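/- The abelian groups H₃(PSL(2,ℂ);ℤ) and êêB(ℂ) are isomorphic. -/

import Mathlib

open Complex
open scoped Classical

noncomputable section

namespace ExtendedBloch

/-- `π` as a complex number. -/
def Cpi : ℂ := (Real.pi : ℂ)

/-- Membership in `ℂ ∖ {0,1}`. -/
def Reg (z : ℂ) : Prop := z ≠ 0 ∧ z ≠ 1

/-- The open upper half plane. -/
def UHP : Set ℂ := {z : ℂ | 0 < z.im}

/-- The 5-tuple occurring in the five term relation. -/
def ftTuple (x y : ℂ) : Fin 5 → ℂ :=
  ![x, y, y / x, (1 - x⁻¹) / (1 - y⁻¹), (1 - x) / (1 - y)]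

/-- The set `FT` of five term tuples. -/
def FT : Set (Fin 5 → ℂ) :=
  {v | ∃ x y : ℂ, Reg x ∧ Reg y ∧ x ≠ y ∧ v = ftTuple x y}

/-- The subset `FT⁺` of tuples with all coordinates in the upper half plane. -/
def FTplus : Set (Fin 5 → ℂ) := {v | v ∈ FT ∧ ∀ i, v i ∈ UHP}

/-- The point `(z; p, q)` of the cover `𝓒` of `ℂ ∖ {0,1}`, realized concretely as the pair of
branch values `(log z + pπi, -log(1-z) + qπi)` (Riemann surface model of `𝓒`). -/
def pt (z : ℂ) (p q : ℤ) : ℂ × ℂ :=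
  (Complex.log z + p * (Cpi * I), -Complex.log (1 - z) + q * (Cpi * I))

/-- The cover `𝓒`, realized as the Riemann surface of all branches of
`(log z + pπi, -log(1-z) + qπi)` on `ℂ ∖ {0,1}`. -/
def Cover : Set (ℂ × ℂ) := {w | ∃ z : ℂ, Reg z ∧ ∃ p q : ℤ, w = pt z p q}

lemma pt_mem_Cover {z : ℂ} (h : Reg z) (p q : ℤ) : pt z p q ∈ Cover :=
  ⟨z, h, p, q, rfl⟩

/-- `w ∈ 𝓒` lies over `z ∈ ℂ ∖ {0,1}`. -/
def LiesOver (w : ℂ × ℂ) (z : ℂ) : Prop := Reg z ∧ ∃ p q : ℤ, w = pt z p q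

/-- The covering action of `ℤ × ℤ` on `𝓒`. -/
def covAct (v : ℤ × ℤ) (w : ℂ × ℂ) : ℂ × ℂ :=
  (w.1 + v.1 * (Cpi * I), w.2 + v.2 * (Cpi * I))

/-- The subset `V ⊂ (ℤ × ℤ)⁵`. -/
def Vset : Set (Fin 5 → ℤ × ℤ) :=
  {v | ∃ p₀ p₁ q₀ q₁ q₂ : ℤ,
    v = ![(p₀, q₀), (p₁, q₁), (p₁ - p₀, q₂), (p₁ - p₀ + q₁ - q₀, q₂ - q₁),
          (q₁ - q₀, q₂ - q₁ - p₀)]}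

/-- The preimage of `FT` in `𝓒⁵`. -/
def FTpre : Set (Fin 5 → ℂ × ℂ) := {w | ∃ v ∈ FT, ∀ i, LiesOver (w i) (v i)}

/-- A base point `((x₀;0,0),…,(x₄;0,0))` with `(x₀,…,x₄) ∈ FT⁺`. -/
def basePt : Fin 5 → ℂ × ℂ := fun i => pt (ftTuple ((1 + I) / 4) I i) 0 0

/-- `𝓕𝓣̂₀`: the connected component of the preimage of `FT` in `𝓒⁵` containing the points
`((x₀;0,0),…,(x₄;0,0))` with `(x₀,…,x₄) ∈ FT⁺`. -/
def FThat₀ : Set (Fin 5 → ℂ × ℂ) := connectedComponentIn FTpre basePt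

/-- `𝓕𝓣̂ = 𝓕𝓣̂₀ + V`. -/
def FThat : Set (Fin 5 → ℂ × ℂ) :=
  {u | ∃ w ∈ FThat₀, ∃ v ∈ Vset, u = fun i => covAct (v i) (w i)}

abbrev CoverT : Type := ↥Cover

/-- The generator `(z; p, q)` of the free abelian group on `𝓒`. -/
def genOf (z : ℂ) (h : Reg z) (p q : ℤ) : FreeAbelianGroup CoverT :=
  FreeAbelianGroup.of ⟨pt z p q, pt_mem_Cover h p q⟩

/-- The lifted five term relators. -/
def FiveTermRels : Set (FreeAbelianGroup CoverT) :=
  {a | ∃ w : Fin 5 → ℂ × ℂ, w ∈ FThat ∧ ∃ hc : ∀ i, w i ∈ Cover,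
    a = ∑ i : Fin 5, (-1 : ℤ) ^ (i : ℕ) • FreeAbelianGroup.of (⟨w i, hc i⟩ : CoverT)}

/-- The transfer relators. -/
def TransferRels : Set (FreeAbelianGroup CoverT) :=
  {a | ∃ z : ℂ, ∃ h : Reg z, ∃ p q p' q' : ℤ,
    a = genOf z h p q + genOf z h p' q' - genOf z h p q' - genOf z h p' q}

def relSub : AddSubgroup (FreeAbelianGroup CoverT) :=
  AddSubgroup.closure (FiveTermRels ∪ TransferRels)

def relSub' : AddSubgroup (FreeAbelianGroup CoverT) :=
  AddSubgroup.closure FiveTermRels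

/-- The extended pre-Bloch group `êP(ℂ)`. -/
abbrev EPreBloch : Type := FreeAbelianGroup CoverT ⧸ relSub

/-- The variant `êP'(ℂ)` without the transfer relations. -/
abbrev EPreBloch' : Type := FreeAbelianGroup CoverT ⧸ relSub'

/-- The class `[z, p, q] ∈ êP(ℂ)` (junk value `0` if `z ∈ {0,1}`). -/
def cls (z : ℂ) (p q : ℤ) : EPreBloch :=
  if h : Reg z then QuotientAddGroup.mk (genOf z h p q) else 0

/-- The class `[z, p, q] ∈ êP'(ℂ)` (junk value `0` if `z ∈ {0,1}`). -/
def cls' (z : ℂ) (p q : ℤ) : EPreBloch' :=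
  if h : Reg z then QuotientAddGroup.mk (genOf z h p q) else 0

/-- `ℂ ∧_ℤ ℂ`, the second exterior power of `ℂ` as a `ℤ`-module. -/
abbrev L2C : Type := ↥(⋀[ℤ]^2 ℂ)

/-- The wedge `a ∧ b ∈ ℂ ∧_ℤ ℂ`. -/
def wedge (a b : ℂ) : L2C :=
  ⟨ExteriorAlgebra.ιMulti ℤ 2 ![a, b],
   ExteriorAlgebra.ιMulti_range ℤ 2 (Set.mem_range_self _)⟩

def nuFree : FreeAbelianGroup CoverT →+ L2C :=
  FreeAbelianGroup.lift fun w : CoverT => wedge w.1.1 w.1.2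

/-- The homomorphism `ν : êP(ℂ) → ℂ ∧_ℤ ℂ`. -/
def nuHom : EPreBloch →+ L2C :=
  if h : ∀ a ∈ relSub, nuFree a = 0 then QuotientAddGroup.lift relSub nuFree h else 0

/-- The homomorphism `ν : êP'(ℂ) → ℂ ∧_ℤ ℂ`. -/
def nuHom' : EPreBloch' →+ L2C :=
  if h : ∀ a ∈ relSub', nuFree a = 0 then QuotientAddGroup.lift relSub' nuFree h else 0

/-- The extended Bloch group `êB(ℂ) = ker ν`. -/
def EBloch : AddSubgroup EPreBloch := nuHom.ker

/-- `êB'(ℂ) = ker ν` on `êP'(ℂ)`. -/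
def EBloch' : AddSubgroup EPreBloch' := nuHom'.ker

/-- The component `X₀₀` of `𝓒` (both fiber coordinates even). -/
def X00 : Set (ℂ × ℂ) := {w | ∃ z : ℂ, Reg z ∧ ∃ p q : ℤ, w = pt z (2 * p) (2 * q)}

abbrev X00T : Type := ↥X00

lemma pt_mem_X00 {z : ℂ} (h : Reg z) (p q : ℤ) : pt z (2 * p) (2 * q) ∈ X00 :=
  ⟨z, h, p, q, rfl⟩

/-- The generator `(z; 2p, 2q)` of the free abelian group on `X₀₀`. -/
def genOf₀ (z : ℂ) (h : Reg z) (p q : ℤ) : FreeAbelianGroup X00T :=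
  FreeAbelianGroup.of ⟨pt z (2 * p) (2 * q), pt_mem_X00 h p q⟩

/-- The five term relators coming from `𝓕𝓣̂ ∩ (X₀₀)⁵`. -/
def FiveTermRels₀ : Set (FreeAbelianGroup X00T) :=
  {a | ∃ w : Fin 5 → ℂ × ℂ, w ∈ FThat ∧ ∃ hc : ∀ i, w i ∈ X00,
    a = ∑ i : Fin 5, (-1 : ℤ) ^ (i : ℕ) • FreeAbelianGroup.of (⟨w i, hc i⟩ : X00T)}

def relSub₀ : AddSubgroup (FreeAbelianGroup X00T) := AddSubgroup.closure FiveTermRels₀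

/-- The true extended pre-Bloch group `êêP(ℂ)`. -/
abbrev EEPreBloch : Type := FreeAbelianGroup X00T ⧸ relSub₀

/-- The class `[z, 2p, 2q] ∈ êêP(ℂ)` (junk value `0` if `z ∈ {0,1}`). -/
def cls₀ (z : ℂ) (p q : ℤ) : EEPreBloch :=
  if h : Reg z then QuotientAddGroup.mk (genOf₀ z h p q) else 0

def nuFree₀ : FreeAbelianGroup X00T →+ L2C :=
  FreeAbelianGroup.lift fun w : X00T => wedge w.1.1 w.1.2

/-- The homomorphism `ν̂ : êêP(ℂ) → ℂ ∧_ℤ ℂ`. -/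
def nuHom₀ : EEPreBloch →+ L2C :=
  if h : ∀ a ∈ relSub₀, nuFree₀ a = 0 then QuotientAddGroup.lift relSub₀ nuFree₀ h else 0

/-- The true extended Bloch group `êêB(ℂ) = ker ν̂`. -/
def EEBloch : AddSubgroup EEPreBloch := nuHom₀.ker

/-- The Rogers dilogarithm `𝓡(z) = ½ log z log(1-z) - ∫₀ᶻ log(1-t)/t dt` (straight segment,
parametrized by `t = s z`). -/
def rogers (z : ℂ) : ℂ :=
  (1 / 2) * Complex.log z * Complex.log (1 - z) -
    ∫ s in (0:ℝ)..(1:ℝ), Complex.log (1 - (s : ℂ) * z) / (s : ℂ)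

/-- `R(z; p, q) = 𝓡(z) + (πi/2)(p log(1-z) + q log z) - π²/6`. -/
def Rfun (z : ℂ) (p q : ℤ) : ℂ :=
  rogers z + (Cpi * I / 2) * (p * Complex.log (1 - z) + q * Complex.log z) - Cpi ^ 2 / 6

/-- `R̂(z; 2p, 2q) = 𝓡(z) + πi(p log(1-z) + q log z) - π²/6`. -/
def Rhat (z : ℂ) (p q : ℤ) : ℂ :=
  rogers z + Cpi * I * (p * Complex.log (1 - z) + q * Complex.log z) - Cpi ^ 2 / 6

/-- `ℂ / π²ℤ`. -/
abbrev ModPiSq : Type := ℂ ⧸ AddSubgroup.zmultiples (Cpi ^ 2)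

/-- `ℂ / 2π²ℤ`. -/
abbrev Mod2PiSq : Type := ℂ ⧸ AddSubgroup.zmultiples (2 * Cpi ^ 2)

abbrev RegT : Type := {z : ℂ // Reg z}

def pbGen (z : ℂ) (h : Reg z) : FreeAbelianGroup RegT := FreeAbelianGroup.of ⟨z, h⟩

/-- The five term relators for the classical pre-Bloch group. -/
def pbRels : Set (FreeAbelianGroup RegT) :=
  {a | ∃ x y : ℂ, ∃ hx : Reg x, ∃ hy : Reg y, x ≠ y ∧
    ∃ h2 : Reg (y / x), ∃ h3 : Reg ((1 - x⁻¹) / (1 - y⁻¹)), ∃ h4 : Reg ((1 - x) / (1 - y)),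
    a = pbGen x hx - pbGen y hy + pbGen (y / x) h2 -
        pbGen ((1 - x⁻¹) / (1 - y⁻¹)) h3 + pbGen ((1 - x) / (1 - y)) h4}

def pbSub : AddSubgroup (FreeAbelianGroup RegT) := AddSubgroup.closure pbRels

/-- The classical pre-Bloch group `P(ℂ)`. -/
abbrev PreBloch : Type := FreeAbelianGroup RegT ⧸ pbSub

/-- The class `[z] ∈ P(ℂ)` (junk value `0` if `z ∈ {0,1}`). -/
def pbCls (z : ℂ) : PreBloch :=
  if h : Reg z then QuotientAddGroup.mk (pbGen z h) else 0

/-- `ℂ* ∧_ℤ ℂ*`, the second exterior power of the multiplicative group `ℂ*` as `ℤ`-module. -/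
abbrev L2CU : Type := ↥(⋀[ℤ]^2 (Additive ℂˣ))

/-- The wedge `a ∧ b ∈ ℂ* ∧_ℤ ℂ*`. -/
def wedgeU (a b : ℂˣ) : L2CU :=
  ⟨ExteriorAlgebra.ιMulti ℤ 2 ![Additive.ofMul a, Additive.ofMul b],
   ExteriorAlgebra.ιMulti_range ℤ 2 (Set.mem_range_self _)⟩

def nuPBFree : FreeAbelianGroup RegT →+ L2CU :=
  FreeAbelianGroup.lift fun z : RegT =>
    2 • wedgeU (Units.mk0 z.1 z.2.1) (Units.mk0 (1 - z.1) (sub_ne_zero_of_ne (Ne.symm z.2.2)))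

/-- The homomorphism `P(ℂ) → ℂ* ∧_ℤ ℂ*`, `[z] ↦ 2 (z ∧ (1-z))`. -/
def nuPB : PreBloch →+ L2CU :=
  if h : ∀ a ∈ pbSub, nuPBFree a = 0 then QuotientAddGroup.lift pbSub nuPBFree h else 0

/-- The classical Bloch group `B(ℂ)`. -/
def Bloch : AddSubgroup PreBloch := nuPB.ker

/-- The roots of unity in `ℂ*`. -/
def muStar : Set ℂˣ := {ζ | ∃ n : ℕ, 0 < n ∧ ζ ^ n = 1}

abbrev SL2C := Matrix.SpecialLinearGroup (Fin 2) ℂ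

/-- `PSL(2,ℂ) = SL(2,ℂ)/{±1}` as a discrete group. -/
abbrev PSL2C := SL2C ⧸ Subgroup.center SL2C

/-- The boundary map `C₃ → C₂` of the inhomogeneous bar complex computing `H₃(PSL(2,ℂ);ℤ)`. -/
def d3 : FreeAbelianGroup (Fin 3 → PSL2C) →+ FreeAbelianGroup (Fin 2 → PSL2C) :=
  FreeAbelianGroup.lift fun g =>
    FreeAbelianGroup.of ![g 1, g 2] - FreeAbelianGroup.of ![g 0 * g 1, g 2] +
      FreeAbelianGroup.of ![g 0, g 1 * g 2] - FreeAbelianGroup.of ![g 0, g 1]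

/-- The boundary map `C₄ → C₃` of the inhomogeneous bar complex computing `H₃(PSL(2,ℂ);ℤ)`. -/
def d4 : FreeAbelianGroup (Fin 4 → PSL2C) →+ FreeAbelianGroup (Fin 3 → PSL2C) :=
  FreeAbelianGroup.lift fun g =>
    FreeAbelianGroup.of ![g 1, g 2, g 3] - FreeAbelianGroup.of ![g 0 * g 1, g 2, g 3] +
      FreeAbelianGroup.of ![g 0, g 1 * g 2, g 3] - FreeAbelianGroup.of ![g 0, g 1, g 2 * g 3] +
      FreeAbelianGroup.of ![g 0, g 1, g 2]

/-- `H₃(PSL(2,ℂ);ℤ)`, defined as homology of the inhomogeneous bar complex. -/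
abbrev H3PSL2C : Type := ↥d3.ker ⧸ ((d4.range).addSubgroupOf d3.ker)

/-- The set of combinatorial flattenings. -/
def Flattenings : Set (ℂ × ℂ × ℂ) :=
  {w | w.1 + w.2.1 + w.2.2 = 0 ∧ ∃ z : ℂ, Reg z ∧ ∃ p q r : ℤ,
    w.1 = Complex.log z + p * (Cpi * I) ∧
    w.2.1 = -Complex.log (1 - z) + q * (Cpi * I) ∧
    w.2.2 = Complex.log (1 - z) - Complex.log z + r * (Cpi * I)}

/-- The map `ℓ : 𝓒 → ℂ³`. -/
def ellMap (w : ℂ × ℂ) : ℂ × ℂ × ℂ := (w.1, w.2, -w.1 - w.2)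

/-- The element `κ = [x,1,1] + [x,0,0] - [x,1,0] - [x,0,1] ∈ êP'(ℂ)`. -/
def kap (x : ℂ) : EPreBloch' := cls' x 1 1 + cls' x 0 0 - cls' x 1 0 - cls' x 0 1

/-- The natural projection `êP'(ℂ) → êP(ℂ)`. -/
def projP : EPreBloch' →+ EPreBloch :=
  QuotientAddGroup.map relSub' relSub (AddMonoidHom.id _)
    (by
      rw [AddSubgroup.comap_id]
      exact AddSubgroup.closure_mono Set.subset_union_left)

section

open FreeAbelianGroup (of)

/-- The free abelian group on a type. -/
abbrev FA (X : Type) : Type := FreeAbelianGroup X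

lemma fa_ext {X A : Type} [AddCommGroup A] {f g : FA X →+ A} (h : ∀ x, f (of x) = g (of x)) :
    f = g := FreeAbelianGroup.lift_ext _ _ h

section Bar

variable (Γ S : Type) [Group Γ] [MulAction Γ S]

/-- The bar differential `C₁ → C₀` with coefficients in a permutation module. -/
def bd1 : FA (Γ × S) →+ FA (Unit × S) :=
  FreeAbelianGroup.lift fun x => of ((), x.2) - of ((), x.1 • x.2)

/-- The bar differential `C₂ → C₁` with coefficients in a permutation module. -/
def bd2 : FA ((Γ × Γ) × S) →+ FA (Γ × S) :=
  FreeAbelianGroup.lift fun x =>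
    of (x.1.2, x.2) - of (x.1.1 * x.1.2, x.2) + of (x.1.1, x.1.2 • x.2)

/-- The bar differential `C₃ → C₂` with coefficients in a permutation module. -/
def bd3 : FA ((Γ × Γ × Γ) × S) →+ FA ((Γ × Γ) × S) :=
  FreeAbelianGroup.lift fun x =>
    of ((x.1.2.1, x.1.2.2), x.2) - of ((x.1.1 * x.1.2.1, x.1.2.2), x.2) +
      of ((x.1.1, x.1.2.1 * x.1.2.2), x.2) - of ((x.1.1, x.1.2.1), x.1.2.2 • x.2)

/-- The bar differential `C₄ → C₃` with coefficients in a permutation module. -/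
def bd4 : FA ((Γ × Γ × Γ × Γ) × S) →+ FA ((Γ × Γ × Γ) × S) :=
  FreeAbelianGroup.lift fun x =>
    of ((x.1.2.1, x.1.2.2.1, x.1.2.2.2), x.2) -
      of ((x.1.1 * x.1.2.1, x.1.2.2.1, x.1.2.2.2), x.2) +
      of ((x.1.1, x.1.2.1 * x.1.2.2.1, x.1.2.2.2), x.2) -
      of ((x.1.1, x.1.2.1, x.1.2.2.1 * x.1.2.2.2), x.2) +
      of ((x.1.1, x.1.2.1, x.1.2.2.1), x.1.2.2.2 • x.2)

variable {Γ S}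

@[simp] lemma bd1_of (g : Γ) (s : S) : bd1 Γ S (of (g, s)) = of ((), s) - of ((), g • s) := by
  simp [bd1]

@[simp] lemma bd2_of (g h : Γ) (s : S) :
    bd2 Γ S (of ((g, h), s)) = of (h, s) - of (g * h, s) + of (g, h • s) := by
  simp [bd2]

@[simp] lemma bd3_of (g h k : Γ) (s : S) :
    bd3 Γ S (of ((g, h, k), s)) =
      of ((h, k), s) - of ((g * h, k), s) + of ((g, h * k), s) - of ((g, h), k • s) := by
  simp [bd3]

@[simp] lemma bd4_of (g h k l : Γ) (s : S) :
    bd4 Γ S (of ((g, h, k, l), s)) =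
      of ((h, k, l), s) - of ((g * h, k, l), s) + of ((g, h * k, l), s) -
        of ((g, h, k * l), s) + of ((g, h, k), l • s) := by
  simp [bd4]

lemma bd1_bd2 (x : FA ((Γ × Γ) × S)) : bd1 Γ S (bd2 Γ S x) = 0 := by
  have : (bd1 Γ S).comp (bd2 Γ S) = 0 := fa_ext fun ⟨⟨g, h⟩, s⟩ => by
    simp [mul_smul]
  exact DFunLike.congr_fun this x

lemma bd2_bd3 (x : FA ((Γ × Γ × Γ) × S)) : bd2 Γ S (bd3 Γ S x) = 0 := by
  have : (bd2 Γ S).comp (bd3 Γ S) = 0 := fa_ext fun ⟨⟨g, h, k⟩, s⟩ => by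
    simp only [AddMonoidHom.comp_apply, bd3_of, bd2_of, map_add, map_sub, mul_smul, mul_assoc,
      AddMonoidHom.zero_apply]
    abel
  exact DFunLike.congr_fun this x

lemma bd3_bd4 (x : FA ((Γ × Γ × Γ × Γ) × S)) : bd3 Γ S (bd4 Γ S x) = 0 := by
  have : (bd3 Γ S).comp (bd4 Γ S) = 0 := fa_ext fun ⟨⟨g, h, k, l⟩, s⟩ => by
    simp only [AddMonoidHom.comp_apply, bd3_of, bd4_of, map_add, map_sub, mul_smul, mul_assoc,
      AddMonoidHom.zero_apply]
    abel
  exact DFunLike.congr_fun this x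

end Bar

/-- A functor between action groupoids. -/
structure GFun (Γ S Δ R : Type) [Group Γ] [MulAction Γ S] [Group Δ] [MulAction Δ R] where
  obj : S → R
  co : Γ → S → Δ
  co_mul : ∀ g h s, co (g * h) s = co g (h • s) * co h s
  obj_smul : ∀ g s, obj (g • s) = co g s • obj s

namespace GFun

variable {Γ S Δ R Λ Q : Type} [Group Γ] [MulAction Γ S] [Group Δ] [MulAction Δ R]
  [Group Λ] [MulAction Λ Q]

/-- The functor attached to a group homomorphism and an equivariant map. -/
def mk' (φ : Γ →* Δ) (f : S → R) (h : ∀ g s, f (g • s) = φ g • f s) : GFun Γ S Δ R where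
  obj := f
  co g _ := φ g
  co_mul g h _ := φ.map_mul g h
  obj_smul := h

/-- Composition of functors. -/
def comp (G : GFun Δ R Λ Q) (F : GFun Γ S Δ R) : GFun Γ S Λ Q where
  obj s := G.obj (F.obj s)
  co g s := G.co (F.co g s) (F.obj s)
  co_mul g h s := by rw [F.co_mul, G.co_mul, F.obj_smul]
  obj_smul g s := by rw [F.obj_smul, G.obj_smul]

variable (Γ S) in
/-- The identity functor. -/
def id : GFun Γ S Γ S where
  obj s := s
  co g _ := g
  co_mul _ _ _ := rfl
  obj_smul _ _ := rfl

variable (F F₂ : GFun Γ S Δ R)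

/-- The induced map on `C₀`. -/
def m0 : FA (Unit × S) →+ FA (Unit × R) :=
  FreeAbelianGroup.lift fun x => of ((), F.obj x.2)

/-- The induced map on `C₁`. -/
def m1 : FA (Γ × S) →+ FA (Δ × R) :=
  FreeAbelianGroup.lift fun x => of (F.co x.1 x.2, F.obj x.2)

/-- The induced map on `C₂`. -/
def m2 : FA ((Γ × Γ) × S) →+ FA ((Δ × Δ) × R) :=
  FreeAbelianGroup.lift fun x =>
    of ((F.co x.1.1 (x.1.2 • x.2), F.co x.1.2 x.2), F.obj x.2)

/-- The induced map on `C₃`. -/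
def m3 : FA ((Γ × Γ × Γ) × S) →+ FA ((Δ × Δ × Δ) × R) :=
  FreeAbelianGroup.lift fun x =>
    of ((F.co x.1.1 (x.1.2.1 • x.1.2.2 • x.2), F.co x.1.2.1 (x.1.2.2 • x.2),
      F.co x.1.2.2 x.2), F.obj x.2)

/-- The induced map on `C₄`. -/
def m4 : FA ((Γ × Γ × Γ × Γ) × S) →+ FA ((Δ × Δ × Δ × Δ) × R) :=
  FreeAbelianGroup.lift fun x =>
    of ((F.co x.1.1 (x.1.2.1 • x.1.2.2.1 • x.1.2.2.2 • x.2),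
      F.co x.1.2.1 (x.1.2.2.1 • x.1.2.2.2 • x.2), F.co x.1.2.2.1 (x.1.2.2.2 • x.2),
      F.co x.1.2.2.2 x.2), F.obj x.2)

@[simp] lemma m0_of (u : Unit) (s : S) : F.m0 (of (u, s)) = of ((), F.obj s) := by simp [m0]

@[simp] lemma m1_of (g : Γ) (s : S) : F.m1 (of (g, s)) = of (F.co g s, F.obj s) := by simp [m1]

@[simp] lemma m2_of (g h : Γ) (s : S) :
    F.m2 (of ((g, h), s)) = of ((F.co g (h • s), F.co h s), F.obj s) := by simp [m2]

@[simp] lemma m3_of (g h k : Γ) (s : S) :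
    F.m3 (of ((g, h, k), s)) =
      of ((F.co g (h • k • s), F.co h (k • s), F.co k s), F.obj s) := by simp [m3]

@[simp] lemma m4_of (g h k l : Γ) (s : S) :
    F.m4 (of ((g, h, k, l), s)) =
      of ((F.co g (h • k • l • s), F.co h (k • l • s), F.co k (l • s), F.co l s), F.obj s) := by
  simp [m4]

lemma bd1_m1 (x : FA (Γ × S)) : bd1 Δ R (F.m1 x) = F.m0 (bd1 Γ S x) := by
  have : (bd1 Δ R).comp F.m1 = F.m0.comp (bd1 Γ S) := fa_ext fun ⟨g, s⟩ => by
    simp [F.obj_smul]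
  exact DFunLike.congr_fun this x

lemma bd2_m2 (x : FA ((Γ × Γ) × S)) : bd2 Δ R (F.m2 x) = F.m1 (bd2 Γ S x) := by
  have : (bd2 Δ R).comp F.m2 = F.m1.comp (bd2 Γ S) := fa_ext fun ⟨⟨g, h⟩, s⟩ => by
    simp [F.obj_smul, F.co_mul]
  exact DFunLike.congr_fun this x

lemma bd3_m3 (x : FA ((Γ × Γ × Γ) × S)) : bd3 Δ R (F.m3 x) = F.m2 (bd3 Γ S x) := by
  have : (bd3 Δ R).comp F.m3 = F.m2.comp (bd3 Γ S) := fa_ext fun ⟨⟨g, h, k⟩, s⟩ => by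
    simp [F.obj_smul, F.co_mul, mul_smul]
  exact DFunLike.congr_fun this x

lemma bd4_m4 (x : FA ((Γ × Γ × Γ × Γ) × S)) : bd4 Δ R (F.m4 x) = F.m3 (bd4 Γ S x) := by
  have : (bd4 Δ R).comp F.m4 = F.m3.comp (bd4 Γ S) := fa_ext fun ⟨⟨g, h, k, l⟩, s⟩ => by
    simp [F.obj_smul, F.co_mul, mul_smul]
  exact DFunLike.congr_fun this x

lemma m1_comp (G : GFun Δ R Λ Q) (x : FA (Γ × S)) : (G.comp F).m1 x = G.m1 (F.m1 x) := by
  have : (G.comp F).m1 = G.m1.comp F.m1 := fa_ext fun ⟨g, s⟩ => by simp [comp]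
  exact DFunLike.congr_fun this x

lemma m2_comp (G : GFun Δ R Λ Q) (x : FA ((Γ × Γ) × S)) :
    (G.comp F).m2 x = G.m2 (F.m2 x) := by
  have : (G.comp F).m2 = G.m2.comp F.m2 := fa_ext fun ⟨⟨g, h⟩, s⟩ => by
    simp [comp, F.obj_smul]
  exact DFunLike.congr_fun this x

lemma m3_comp (G : GFun Δ R Λ Q) (x : FA ((Γ × Γ × Γ) × S)) :
    (G.comp F).m3 x = G.m3 (F.m3 x) := by
  have : (G.comp F).m3 = G.m3.comp F.m3 := fa_ext fun ⟨⟨g, h, k⟩, s⟩ => by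
    simp [comp, F.obj_smul]
  exact DFunLike.congr_fun this x

lemma m1_id (x : FA (Γ × S)) : (GFun.id Γ S).m1 x = x := by
  have : (GFun.id Γ S).m1 = AddMonoidHom.id _ := fa_ext fun ⟨g, s⟩ => by simp [id]
  exact DFunLike.congr_fun this x

lemma m2_id (x : FA ((Γ × Γ) × S)) : (GFun.id Γ S).m2 x = x := by
  have : (GFun.id Γ S).m2 = AddMonoidHom.id _ := fa_ext fun ⟨⟨g, h⟩, s⟩ => by simp [id]
  exact DFunLike.congr_fun this x

lemma m3_id (x : FA ((Γ × Γ × Γ) × S)) : (GFun.id Γ S).m3 x = x := by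
  have : (GFun.id Γ S).m3 = AddMonoidHom.id _ := fa_ext fun ⟨⟨g, h, k⟩, s⟩ => by simp [id]
  exact DFunLike.congr_fun this x

variable {F F₂}

/-- The function `η` is a natural transformation from `F` to `F₂`. -/
structure IsNat (F F₂ : GFun Γ S Δ R) (η : S → Δ) : Prop where
  obj : ∀ s, F₂.obj s = η s • F.obj s
  co : ∀ g s, F₂.co g s * η s = η (g • s) * F.co g s

/-- The prism operator `C₀ → C₁`. -/
def pr0 (F : GFun Γ S Δ R) (η : S → Δ) : FA (Unit × S) →+ FA (Δ × R) :=
  FreeAbelianGroup.lift fun x => of (η x.2, F.obj x.2)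

/-- The prism operator `C₁ → C₂`. -/
def pr1 (F F₂ : GFun Γ S Δ R) (η : S → Δ) : FA (Γ × S) →+ FA ((Δ × Δ) × R) :=
  FreeAbelianGroup.lift fun x =>
    of ((η (x.1 • x.2), F.co x.1 x.2), F.obj x.2) - of ((F₂.co x.1 x.2, η x.2), F.obj x.2)

/-- The prism operator `C₂ → C₃`. -/
def pr2 (F F₂ : GFun Γ S Δ R) (η : S → Δ) : FA ((Γ × Γ) × S) →+ FA ((Δ × Δ × Δ) × R) :=
  FreeAbelianGroup.lift fun x =>
    of ((η (x.1.1 • x.1.2 • x.2), F.co x.1.1 (x.1.2 • x.2), F.co x.1.2 x.2), F.obj x.2) -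
    of ((F₂.co x.1.1 (x.1.2 • x.2), η (x.1.2 • x.2), F.co x.1.2 x.2), F.obj x.2) +
    of ((F₂.co x.1.1 (x.1.2 • x.2), F₂.co x.1.2 x.2, η x.2), F.obj x.2)

/-- The prism operator `C₃ → C₄`. -/
def pr3 (F F₂ : GFun Γ S Δ R) (η : S → Δ) : FA ((Γ × Γ × Γ) × S) →+ FA ((Δ × Δ × Δ × Δ) × R) :=
  FreeAbelianGroup.lift fun x =>
    of ((η (x.1.1 • x.1.2.1 • x.1.2.2 • x.2), F.co x.1.1 (x.1.2.1 • x.1.2.2 • x.2),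
      F.co x.1.2.1 (x.1.2.2 • x.2), F.co x.1.2.2 x.2), F.obj x.2) -
    of ((F₂.co x.1.1 (x.1.2.1 • x.1.2.2 • x.2), η (x.1.2.1 • x.1.2.2 • x.2),
      F.co x.1.2.1 (x.1.2.2 • x.2), F.co x.1.2.2 x.2), F.obj x.2) +
    of ((F₂.co x.1.1 (x.1.2.1 • x.1.2.2 • x.2), F₂.co x.1.2.1 (x.1.2.2 • x.2),
      η (x.1.2.2 • x.2), F.co x.1.2.2 x.2), F.obj x.2) -
    of ((F₂.co x.1.1 (x.1.2.1 • x.1.2.2 • x.2), F₂.co x.1.2.1 (x.1.2.2 • x.2),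
      F₂.co x.1.2.2 x.2, η x.2), F.obj x.2)

lemma IsNat.hom0 {η : S → Δ} (h : IsNat F F₂ η) (x : FA (Unit × S)) :
    bd1 Δ R (pr0 F η x) = F.m0 x - F₂.m0 x := by
  have : (bd1 Δ R).comp (pr0 F η) = F.m0 - F₂.m0 := fa_ext fun ⟨_, s⟩ => by
    simp [pr0, h.obj]
  exact DFunLike.congr_fun this x

lemma IsNat.hom1 {η : S → Δ} (h : IsNat F F₂ η) (x : FA (Γ × S)) :
    bd2 Δ R (pr1 F F₂ η x) + pr0 F η (bd1 Γ S x) = F.m1 x - F₂.m1 x := by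
  have : (bd2 Δ R).comp (pr1 F F₂ η) + (pr0 F η).comp (bd1 Γ S) = F.m1 - F₂.m1 :=
    fa_ext fun ⟨g, s⟩ => by
      simp only [pr0, pr1, AddMonoidHom.add_apply, AddMonoidHom.comp_apply,
        AddMonoidHom.sub_apply, FreeAbelianGroup.lift_apply_of, map_sub, bd2_of, bd1_of, m1_of,
        h.obj, F.obj_smul, ← h.co]
      abel
  exact DFunLike.congr_fun this x

lemma IsNat.hom2 {η : S → Δ} (h : IsNat F F₂ η) (x : FA ((Γ × Γ) × S)) :
    bd3 Δ R (pr2 F F₂ η x) + pr1 F F₂ η (bd2 Γ S x) = F.m2 x - F₂.m2 x := by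
  have : (bd3 Δ R).comp (pr2 F F₂ η) + (pr1 F F₂ η).comp (bd2 Γ S) = F.m2 - F₂.m2 :=
    fa_ext fun ⟨⟨g, k⟩, s⟩ => by
      simp only [pr2, pr1, AddMonoidHom.add_apply, AddMonoidHom.comp_apply,
        AddMonoidHom.sub_apply, FreeAbelianGroup.lift_apply_of, map_add, map_sub, bd2_of, bd3_of,
            m2_of,
        h.obj, F.obj_smul, ← h.co, F.co_mul, F₂.co_mul, mul_smul]
      abel
  exact DFunLike.congr_fun this x

lemma IsNat.hom3 {η : S → Δ} (h : IsNat F F₂ η) (x : FA ((Γ × Γ × Γ) × S)) :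
    bd4 Δ R (pr3 F F₂ η x) + pr2 F F₂ η (bd3 Γ S x) = F.m3 x - F₂.m3 x := by
  have : (bd4 Δ R).comp (pr3 F F₂ η) + (pr2 F F₂ η).comp (bd3 Γ S) = F.m3 - F₂.m3 :=
    fa_ext fun ⟨⟨g, k, l⟩, s⟩ => by
      simp only [pr2, pr3, AddMonoidHom.add_apply, AddMonoidHom.comp_apply,
        AddMonoidHom.sub_apply, FreeAbelianGroup.lift_apply_of, map_add, map_sub, bd4_of, bd3_of,
            m3_of,
        h.obj, F.obj_smul, ← h.co, F.co_mul, F₂.co_mul, mul_smul]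
      abel
  exact DFunLike.congr_fun this x

end GFun

section Classes

variable (Γ S : Type) [Group Γ] [MulAction Γ S]

/-- One-chains modulo boundaries. -/
abbrev Q1 : Type := FA (Γ × S) ⧸ (bd2 Γ S).range

/-- Two-chains modulo boundaries. -/
abbrev Q2 : Type := FA ((Γ × Γ) × S) ⧸ (bd3 Γ S).range

/-- Three-chains modulo boundaries. -/
abbrev Q3 : Type := FA ((Γ × Γ × Γ) × S) ⧸ (bd4 Γ S).range

variable {Γ S}

/-- The class of a one-chain modulo boundaries. -/
def q1 : FA (Γ × S) →+ Q1 Γ S := QuotientAddGroup.mk' _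

/-- The class of a two-chain modulo boundaries. -/
def q2 : FA ((Γ × Γ) × S) →+ Q2 Γ S := QuotientAddGroup.mk' _

/-- The class of a three-chain modulo boundaries. -/
def q3 : FA ((Γ × Γ × Γ) × S) →+ Q3 Γ S := QuotientAddGroup.mk' _

lemma q1_eq_zero {x : FA (Γ × S)} : q1 x = 0 ↔ ∃ b, bd2 Γ S b = x :=
  (QuotientAddGroup.eq_zero_iff x).trans AddMonoidHom.mem_range

lemma q2_eq_zero {x : FA ((Γ × Γ) × S)} : q2 x = 0 ↔ ∃ b, bd3 Γ S b = x :=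
  (QuotientAddGroup.eq_zero_iff x).trans AddMonoidHom.mem_range

lemma q3_eq_zero {x : FA ((Γ × Γ × Γ) × S)} : q3 x = 0 ↔ ∃ b, bd4 Γ S b = x :=
  (QuotientAddGroup.eq_zero_iff x).trans AddMonoidHom.mem_range

@[simp] lemma q1_bd2 (b : FA ((Γ × Γ) × S)) : q1 (bd2 Γ S b) = 0 := q1_eq_zero.2 ⟨b, rfl⟩

@[simp] lemma q2_bd3 (b : FA ((Γ × Γ × Γ) × S)) : q2 (bd3 Γ S b) = 0 := q2_eq_zero.2 ⟨b, rfl⟩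

@[simp] lemma q3_bd4 (b : FA ((Γ × Γ × Γ × Γ) × S)) : q3 (bd4 Γ S b) = 0 :=
  q3_eq_zero.2 ⟨b, rfl⟩

variable {Δ R : Type} [Group Δ] [MulAction Δ R]

/-- The map induced by a functor on one-chains modulo boundaries. -/
def GFun.M1 (F : GFun Γ S Δ R) : Q1 Γ S →+ Q1 Δ R :=
  QuotientAddGroup.map _ _ F.m1 (by
    rintro _ ⟨b, rfl⟩
    exact ⟨F.m2 b, F.bd2_m2 b⟩)

/-- The map induced by a functor on two-chains modulo boundaries. -/
def GFun.M2 (F : GFun Γ S Δ R) : Q2 Γ S →+ Q2 Δ R :=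
  QuotientAddGroup.map _ _ F.m2 (by
    rintro _ ⟨b, rfl⟩
    exact ⟨F.m3 b, F.bd3_m3 b⟩)

/-- The map induced by a functor on three-chains modulo boundaries. -/
def GFun.M3 (F : GFun Γ S Δ R) : Q3 Γ S →+ Q3 Δ R :=
  QuotientAddGroup.map _ _ F.m3 (by
    rintro _ ⟨b, rfl⟩
    exact ⟨F.m4 b, F.bd4_m4 b⟩)

lemma GFun.q1_m1 (F : GFun Γ S Δ R) (x : FA (Γ × S)) : q1 (F.m1 x) = F.M1 (q1 x) := rfl

lemma GFun.q2_m2 (F : GFun Γ S Δ R) (x : FA ((Γ × Γ) × S)) : q2 (F.m2 x) = F.M2 (q2 x) := rfl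

lemma GFun.q3_m3 (F : GFun Γ S Δ R) (x : FA ((Γ × Γ × Γ) × S)) : q3 (F.m3 x) = F.M3 (q3 x) :=
  rfl

lemma GFun.IsNat.q1 {F F₂ : GFun Γ S Δ R} {η : S → Δ} (h : GFun.IsNat F F₂ η) {x : FA (Γ × S)}
    (hx : bd1 Γ S x = 0) : q1 (F.m1 x) = q1 (F₂.m1 x) := by
  rw [← sub_eq_zero, ← map_sub, ← h.hom1, hx, map_zero, add_zero, q1_bd2]

lemma GFun.IsNat.q2 {F F₂ : GFun Γ S Δ R} {η : S → Δ} (h : GFun.IsNat F F₂ η)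
    {x : FA ((Γ × Γ) × S)} (hx : bd2 Γ S x = 0) : q2 (F.m2 x) = q2 (F₂.m2 x) := by
  rw [← sub_eq_zero, ← map_sub, ← h.hom2, hx, map_zero, add_zero, q2_bd3]

lemma GFun.IsNat.q3 {F F₂ : GFun Γ S Δ R} {η : S → Δ} (h : GFun.IsNat F F₂ η)
    {x : FA ((Γ × Γ × Γ) × S)} (hx : bd3 Γ S x = 0) : q3 (F.m3 x) = q3 (F₂.m3 x) := by
  rw [← sub_eq_zero, ← map_sub, ← h.hom3, hx, map_zero, add_zero, q3_bd4]

end Classes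

/-- A relation preserved by a group action. -/
class RInv (Γ : Type) {Y : Type} [Group Γ] [MulAction Γ Y] (r : Y → Y → Prop) : Prop where
  inv : ∀ (g : Γ) {x y : Y}, r x y → r (g • x) (g • y)

/-- A relation such that every finite set admits an element related to all of its members. -/
class RExt {Y : Type} (r : Y → Y → Prop) : Prop where
  ext : ∀ F : Finset Y, ∃ y, ∀ x ∈ F, r y x

/-- Configurations of `n` points in general position. -/
def Conf {Y : Type} (r : Y → Y → Prop) (n : ℕ) : Type :=
  {c : Fin n → Y // ∀ i j, i < j → r (c i) (c j)}

namespace Conf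

variable {Y : Type} {r : Y → Y → Prop} {n : ℕ}

@[ext] lemma ext {c c' : Conf r n} (h : ∀ i, c.1 i = c'.1 i) : c = c' :=
  Subtype.ext (funext h)

/-- Omit the `i`-th point. -/
def face (i : Fin (n + 1)) (c : Conf r (n + 1)) : Conf r n :=
  ⟨fun j => c.1 (i.succAbove j), fun _ _ h => c.2 _ _ (Fin.succAbove_lt_succAbove_iff.2 h)⟩

/-- Add a point in front. -/
def cons (y : Y) (c : Conf r n) (h : ∀ i, r y (c.1 i)) : Conf r (n + 1) :=
  ⟨Fin.cons y c.1, fun i j hij => by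
    cases j using Fin.cases with
    | zero => exact absurd hij (Fin.not_lt_zero i)
    | succ _ =>
      cases i using Fin.cases with
      | zero => simpa using h _
      | succ i => simpa using c.2 i _ (Fin.succ_lt_succ_iff.1 hij)⟩

lemma face_zero_cons (y : Y) (c : Conf r n) (h : ∀ i, r y (c.1 i)) : face 0 (cons y c h) = c := by
  ext i; simp [face, cons]

lemma face_succ_cons (y : Y) (c : Conf r (n + 1)) (h : ∀ i, r y (c.1 i)) (i : Fin (n + 1)) :
    face i.succ (cons y c h) = cons y (face i c) (fun _ => h _) := by
  ext j
  cases j using Fin.cases with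
  | zero => simp [face, cons]
  | succ j => simp [face, cons, Fin.succ_succAbove_succ]

lemma eq_cons (c : Conf r (n + 1)) :
    c = cons (c.1 0) (face 0 c) (fun j => c.2 _ _ (by simp)) := by
  ext j
  cases j using Fin.cases with
  | zero => simp [cons]
  | succ j => simp [face, cons]

instance : Subsingleton (Conf r 0) := ⟨fun _ _ => ext fun i => i.elim0⟩

/-- The empty configuration. -/
def nil : Conf r 0 := ⟨Fin.elim0, fun i => i.elim0⟩

instance {Γ : Type} [Group Γ] [MulAction Γ Y] [RInv Γ r] : MulAction Γ (Conf r n) where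
  smul g c := ⟨fun i => g • c.1 i, fun i j h => RInv.inv g (c.2 i j h)⟩
  one_smul c := ext fun i => one_smul Γ (c.1 i)
  mul_smul g h c := ext fun i => mul_smul g h (c.1 i)

@[simp] lemma smul_val {Γ : Type} [Group Γ] [MulAction Γ Y] [RInv Γ r] (g : Γ) (c : Conf r n)
    (i : Fin n) : (g • c).1 i = g • c.1 i := rfl

lemma face_smul {Γ : Type} [Group Γ] [MulAction Γ Y] [RInv Γ r] (g : Γ) (i : Fin (n + 1))
    (c : Conf r (n + 1)) : face i (g • c) = g • face i c := rfl

end Conf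

section FaceBoundary

variable {Y : Type} {r : Y → Y → Prop} {n : ℕ} {P : Type}

/-- The alternating sum of faces. -/
def fb (r : Y → Y → Prop) (n : ℕ) (P : Type) : FA (P × Conf r (n + 1)) →+ FA (P × Conf r n) :=
  FreeAbelianGroup.lift fun x =>
    ∑ i : Fin (n + 1), (-1 : ℤ) ^ (i : ℕ) • of (x.1, Conf.face i x.2)

lemma fb_of (p : P) (c : Conf r (n + 1)) :
    fb r n P (of (p, c)) = ∑ i : Fin (n + 1), (-1 : ℤ) ^ (i : ℕ) • of (p, Conf.face i c) := by
  simp [fb]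

/-- The cone with apex `y`. -/
def cone (r : Y → Y → Prop) (n : ℕ) (P : Type) (y : Y) :
    FA (P × Conf r n) →+ FA (P × Conf r (n + 1)) :=
  FreeAbelianGroup.lift fun x =>
    if h : ∀ i, r y (x.2.1 i) then of (x.1, Conf.cons y x.2 h) else 0

lemma cone_of (y : Y) (p : P) (c : Conf r n) (h : ∀ i, r y (c.1 i)) :
    cone r n P y (of (p, c)) = of (p, Conf.cons y c h) := by
  simp [cone, h]

lemma fb_cone_zero (y : Y) (x : FA (P × Conf r 0)) : fb r 0 P (cone r 0 P y x) = x := by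
  have : (fb r 0 P).comp (cone r 0 P y) = AddMonoidHom.id _ := fa_ext fun ⟨p, c⟩ => by
    simp [cone_of y p c (fun i => i.elim0), fb_of, Conf.face_zero_cons]
  exact DFunLike.congr_fun this x

lemma fb_cone_of (y : Y) (p : P) (c : Conf r (n + 1)) (h : ∀ i, r y (c.1 i)) :
    fb r (n + 1) P (cone r (n + 1) P y (of (p, c))) =
      of (p, c) - cone r n P y (fb r n P (of (p, c))) := by
  rw [cone_of y p c h, fb_of, Fin.sum_univ_succ, Conf.face_zero_cons, fb_of, map_sum,
    sub_eq_add_neg, ← Finset.sum_neg_distrib]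
  simp only [Fin.val_zero, pow_zero, one_smul, add_right_inj]
  refine Finset.sum_congr rfl fun i _ => ?_
  rw [Conf.face_succ_cons, map_zsmul, cone_of y p (Conf.face i c) (fun j => h _), Fin.val_succ,
      pow_succ,
    mul_neg_one, neg_smul]

lemma exists_fb_cone [RExt r] (x : FA (P × Conf r (n + 1))) :
    ∃ y, fb r (n + 1) P (cone r (n + 1) P y x) = x - cone r n P y (fb r n P x) := by
  suffices H : ∃ F : Finset Y, ∀ y, (∀ z ∈ F, r y z) →
      fb r (n + 1) P (cone r (n + 1) P y x) = x - cone r n P y (fb r n P x) by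
    obtain ⟨F, hF⟩ := H
    obtain ⟨y, hy⟩ := RExt.ext (r := r) F
    exact ⟨y, hF y hy⟩
  induction x using FreeAbelianGroup.induction_on with
  | zero => exact ⟨∅, fun y _ => by simp⟩
  | of x =>
    exact ⟨Finset.univ.image x.2.1, fun y hy => fb_cone_of y x.1 x.2 fun i => hy _ (by simp)⟩
  | neg x h =>
    obtain ⟨F, hF⟩ := h
    exact ⟨F, fun y hy => by simp only [map_neg, hF y hy]; abel⟩
  | add x x' h h' =>
    obtain ⟨F, hF⟩ := h
    obtain ⟨F', hF'⟩ := h'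
    refine ⟨F ∪ F', fun y hy => ?_⟩
    simp only [map_add, hF y fun z hz => hy z (Finset.mem_union_left _ hz),
      hF' y fun z hz => hy z (Finset.mem_union_right _ hz)]
    abel

lemma fb_exact [RExt r] {x : FA (P × Conf r (n + 1))} (hx : fb r n P x = 0) :
    ∃ z, fb r (n + 1) P z = x := by
  obtain ⟨y, hy⟩ := exists_fb_cone x
  exact ⟨_, by rw [hy, hx, map_zero, sub_zero]⟩

lemma fb_surj [RExt r] (x : FA (P × Conf r 0)) : ∃ z, fb r 0 P z = x := by
  obtain ⟨y, -⟩ := RExt.ext (r := r) ∅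
  exact ⟨_, fb_cone_zero y x⟩

lemma fb_fb (x : FA (P × Conf r (n + 2))) : fb r n P (fb r (n + 1) P x) = 0 := by
  have : (fb r n P).comp (fb r (n + 1) P) = 0 := by
    induction n with
    | zero =>
      refine fa_ext fun ⟨p, c⟩ => ?_
      have e : Conf.face 0 (Conf.face 0 c) = Conf.face 0 (Conf.face 1 c) := Subsingleton.elim _ _
      simp [fb_of, Fin.sum_univ_succ, e]
    | succ n ih =>
      refine fa_ext fun ⟨p, c⟩ => ?_
      have h : ∀ j, r (c.1 0) ((Conf.face 0 c).1 j) := fun j => c.2 _ _ (by simp)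
      have e : (of (p, c) : FA (P × Conf r (n + 3))) =
          cone r (n + 2) P (c.1 0) (of (p, Conf.face 0 c)) := by
        rw [cone_of _ _ _ h, ← Conf.eq_cons]
      have h' (i) : fb r (n + 1) P (cone r (n + 1) P (c.1 0)
          (of (p, Conf.face i (Conf.face 0 c)))) =
          of (p, Conf.face i (Conf.face 0 c)) - cone r n P (c.1 0)
            (fb r n P (of (p, Conf.face i (Conf.face 0 c)))) :=
        fb_cone_of _ _ _ fun j => h _
      have h'' : fb r (n + 1) P (cone r (n + 1) P (c.1 0)
          (fb r (n + 1) P (of (p, Conf.face 0 c)))) =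
          fb r (n + 1) P (of (p, Conf.face 0 c)) - cone r n P (c.1 0)
            (fb r n P (fb r (n + 1) P (of (p, Conf.face 0 c)))) := by
        rw [fb_of]
        simp only [map_sum, map_zsmul, h', smul_sub, Finset.sum_sub_distrib]
      have ih' := DFunLike.congr_fun (ih 0) (of (p, Conf.face 0 c))
      simp only [AddMonoidHom.comp_apply, AddMonoidHom.zero_apply] at ih'
      rw [AddMonoidHom.comp_apply, e, fb_cone_of _ _ _ h, map_sub, h'', ih', map_zero]
      simp
  exact DFunLike.congr_fun this x

variable {Γ : Type} [Group Γ] [MulAction Γ Y] [RInv Γ r]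

lemma bd1_fb (x : FA (Γ × Conf r (n + 1))) :
    bd1 Γ _ (fb r n _ x) = fb r n _ (bd1 Γ _ x) := by
  have : (bd1 Γ _).comp (fb r n _) = (fb r n _).comp (bd1 Γ _) := fa_ext fun ⟨g, c⟩ => by
    simp only [AddMonoidHom.comp_apply, fb_of, map_sum, map_zsmul, bd1_of, map_sub, smul_sub,
      Finset.sum_sub_distrib, Conf.face_smul]
  exact DFunLike.congr_fun this x

lemma bd2_fb (x : FA ((Γ × Γ) × Conf r (n + 1))) :
    bd2 Γ _ (fb r n _ x) = fb r n _ (bd2 Γ _ x) := by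
  have : (bd2 Γ _).comp (fb r n _) = (fb r n _).comp (bd2 Γ _) := fa_ext fun ⟨⟨g, h⟩, c⟩ => by
    simp only [AddMonoidHom.comp_apply, fb_of, map_sum, map_zsmul, bd2_of, map_sub, map_add,
      smul_sub, smul_add, Finset.sum_sub_distrib, Finset.sum_add_distrib, Conf.face_smul]
  exact DFunLike.congr_fun this x

lemma bd3_fb (x : FA ((Γ × Γ × Γ) × Conf r (n + 1))) :
    bd3 Γ _ (fb r n _ x) = fb r n _ (bd3 Γ _ x) := by
  have : (bd3 Γ _).comp (fb r n _) = (fb r n _).comp (bd3 Γ _) :=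
    fa_ext fun ⟨⟨g, h, k⟩, c⟩ => by
      simp only [AddMonoidHom.comp_apply, fb_of, map_sum, map_zsmul, bd3_of, map_sub, map_add,
        smul_sub, smul_add, Finset.sum_sub_distrib, Finset.sum_add_distrib, Conf.face_smul]
  exact DFunLike.congr_fun this x

lemma bd4_fb (x : FA ((Γ × Γ × Γ × Γ) × Conf r (n + 1))) :
    bd4 Γ _ (fb r n _ x) = fb r n _ (bd4 Γ _ x) := by
  have : (bd4 Γ _).comp (fb r n _) = (fb r n _).comp (bd4 Γ _) :=
    fa_ext fun ⟨⟨g, h, k, l⟩, c⟩ => by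
      simp only [AddMonoidHom.comp_apply, fb_of, map_sum, map_zsmul, bd4_of, map_sub, map_add,
        smul_sub, smul_add, Finset.sum_sub_distrib, Finset.sum_add_distrib, Conf.face_smul]
  exact DFunLike.congr_fun this x

end FaceBoundary

/-- A type carrying the trivial action of every group. -/
def Triv (S : Type) : Type := S

instance {Γ S : Type} [Group Γ] : MulAction Γ (Triv S) where
  smul _ s := s
  one_smul _ := rfl
  mul_smul _ _ _ := rfl

@[simp] lemma triv_smul {Γ S : Type} [Group Γ] (g : Γ) (s : Triv S) : g • s = s := rfl

/-- The one-point set with trivial action. -/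
abbrev Pt : Type := Triv Unit

/-- The point. -/
def pnt : Pt := ()

lemma pt_eq (s : Pt) : s = pnt := rfl

@[simp] lemma pt_smul {Γ : Type} [Group Γ] (g : Γ) (s : Pt) : g • s = s := rfl

section Abelian

variable {A : Type} [CommGroup A]

/-- The two-cycle `[a|b] - [b|a]`. -/
def comm2 (a b : A) : FA ((A × A) × Pt) := of ((a, b), pnt) - of ((b, a), pnt)

lemma bd2_comm2 (a b : A) : bd2 A Pt (comm2 a b) = 0 := by
  simp only [comm2, map_sub, bd2_of, pt_smul, mul_comm b]
  abel

lemma comm2_mul_left (a a' b : A) :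
    q2 (comm2 (a * a') b) = q2 (comm2 a b) + q2 (comm2 a' b) := by
  rw [← map_add, ← sub_eq_zero, ← map_sub, q2_eq_zero]
  refine ⟨-of ((a, a', b), pnt) + of ((a, b, a'), pnt) - of ((b, a, a'), pnt), ?_⟩
  simp only [map_add, map_sub, map_neg, bd3_of, comm2, pt_smul, mul_comm b]
  abel

omit [CommGroup A] in
lemma comm2_swap (a b : A) : comm2 b a = -comm2 a b := by simp [comm2]

lemma comm2_mul_right (a b b' : A) :
    q2 (comm2 a (b * b')) = q2 (comm2 a b) + q2 (comm2 a b') := by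
  rw [← neg_inj, ← map_neg, ← comm2_swap, comm2_mul_left, comm2_swap b, comm2_swap b']
  simp [add_comm]

/-- The biadditive pairing `A × A → Q₂(A)` given by `comm2`. -/
def commHom : Additive A →+ Additive A →+ Q2 A Pt :=
  AddMonoidHom.mk' (fun a => AddMonoidHom.mk' (fun b => q2 (comm2 a.toMul b.toMul))
    fun b b' => comm2_mul_right _ _ _) fun a a' => by
      ext b; exact comm2_mul_left _ _ _

lemma commHom_apply (a b : A) :
    commHom (Additive.ofMul a) (Additive.ofMul b) = q2 (comm2 a b) := rfl

lemma q2_comm2_pow (a b : A) (n : ℕ) :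
    q2 (comm2 (a ^ n) (b ^ n)) = (n ^ 2 : ℤ) • q2 (comm2 a b) := by
  simp only [← commHom_apply, ofMul_pow, map_nsmul, AddMonoidHom.nsmul_apply]
  rw [← mul_nsmul, ← natCast_zsmul]
  congr 1
  push_cast; ring

/-- A symmetric two-cocycle. -/
structure SymCocycle (A W : Type) [CommGroup A] [AddCommGroup W] where
  f : A → A → W
  symm : ∀ a b, f a b = f b a
  coc : ∀ a b c, f b c - f (a * b) c + f a (b * c) - f a b = 0

/-- The abelian extension attached to a symmetric two-cocycle. -/
structure SymCocycle.Ext {W : Type} [AddCommGroup W] (f : SymCocycle A W) : Type where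
  fst : W
  snd : A

namespace SymCocycle

variable {W : Type} [AddCommGroup W] (f : SymCocycle A W)

lemma f_one (a : A) : f.f 1 a = f.f 1 1 := by
  have := f.coc 1 1 a
  simp only [one_mul, sub_self, zero_add] at this
  exact sub_eq_zero.1 this

variable {f} in
lemma Ext.ext' {x y : f.Ext} (h : x.fst = y.fst) (h' : x.snd = y.snd) : x = y := by
  cases x; cases y; simp_all

instance : Add f.Ext := ⟨fun x y => ⟨x.fst + y.fst + f.f x.snd y.snd, x.snd * y.snd⟩⟩

instance : Zero f.Ext := ⟨⟨-f.f 1 1, 1⟩⟩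

instance : Neg f.Ext := ⟨fun x => ⟨-x.fst - f.f 1 1 - f.f x.snd x.snd⁻¹, x.snd⁻¹⟩⟩

instance : AddCommGroup f.Ext where
  nsmul := nsmulRec
  zsmul := zsmulRec
  add_assoc x y z := Ext.ext' (by
    change x.fst + y.fst + f.f x.snd y.snd + z.fst + f.f (x.snd * y.snd) z.snd =
      x.fst + (y.fst + z.fst + f.f y.snd z.snd) + f.f x.snd (y.snd * z.snd)
    have := f.coc x.snd y.snd z.snd
    rw [← sub_eq_zero, ← neg_eq_zero, ← this]
    abel) (mul_assoc _ _ _)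
  zero_add x := Ext.ext' (by
    change -f.f 1 1 + x.fst + f.f 1 x.snd = x.fst
    rw [f.f_one x.snd]; abel) (one_mul _)
  add_zero x := Ext.ext' (by
    change x.fst + -f.f 1 1 + f.f x.snd 1 = x.fst
    rw [f.symm x.snd, f.f_one x.snd]; abel) (mul_one _)
  neg_add_cancel x := Ext.ext' (by
    change -x.fst - f.f 1 1 - f.f x.snd x.snd⁻¹ + x.fst + f.f x.snd⁻¹ x.snd = -f.f 1 1
    rw [f.symm x.snd⁻¹]; abel) (inv_mul_cancel _)
  add_comm x y := Ext.ext' (by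
    change x.fst + y.fst + f.f x.snd y.snd = y.fst + x.fst + f.f y.snd x.snd
    rw [f.symm, add_comm x.fst]) (mul_comm _ _)

/-- The inclusion of the kernel. -/
def incl : W →+ f.Ext :=
  AddMonoidHom.mk' (fun w => ⟨w - f.f 1 1, 1⟩) fun w w' => Ext.ext' (by
    change w + w' - f.f 1 1 = w - f.f 1 1 + (w' - f.f 1 1) + f.f 1 1
    abel) (one_mul _).symm

lemma incl_eq_zero {w : W} (h : f.incl w = 0) : w = 0 := by
  have : w - f.f 1 1 = -f.f 1 1 := congrArg Ext.fst h
  simpa [sub_eq_add_neg] using this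

lemma sec_rel (a b : A) : (⟨0, b⟩ : f.Ext) - ⟨0, a * b⟩ + ⟨0, a⟩ = f.incl (f.f a b) := by
  rw [sub_add_eq_add_sub, sub_eq_iff_eq_add]
  refine Ext.ext' ?_ ?_
  · change 0 + 0 + f.f b a = f.f a b - f.f 1 1 + 0 + f.f 1 (a * b)
    rw [f.f_one (a * b), f.symm b]; abel
  · change b * a = 1 * (a * b)
    rw [one_mul, mul_comm]

end SymCocycle

variable (A) in
/-- The subgroup generated by the classes of commutator cycles. -/
def commSub : AddSubgroup (Q2 A Pt) :=
  AddSubgroup.closure (Set.range fun p : A × A => q2 (comm2 p.1 p.2))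

variable (A) in
/-- The tautological symmetric cocycle. -/
def tautCocycle : SymCocycle A (Q2 A Pt ⧸ commSub A) where
  f a b := QuotientAddGroup.mk' (commSub A) (q2 (of ((a, b), pnt)))
  symm a b := by
    rw [← sub_eq_zero, ← map_sub, ← map_sub]
    exact (QuotientAddGroup.eq_zero_iff _).2 (AddSubgroup.subset_closure ⟨(a, b), rfl⟩)
  coc a b c := by
    simp only [← map_sub, ← map_add]
    have := bd3_of a b c pnt
    rw [pt_smul] at this
    rw [← this, q2_bd3, map_zero]

lemma mem_commSub {x : FA ((A × A) × Pt)} (hx : bd2 A Pt x = 0) : q2 x ∈ commSub A := by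
  let f := tautCocycle A
  let σ : FA (A × Pt) →+ f.Ext := FreeAbelianGroup.lift fun a => ⟨0, a.1⟩
  have h : σ.comp (bd2 A Pt) = (f.incl.comp (QuotientAddGroup.mk' (commSub A))).comp q2 :=
    fa_ext fun ⟨⟨a, b⟩, s⟩ => by
      simp only [AddMonoidHom.comp_apply, bd2_of, map_add, map_sub, σ,
        FreeAbelianGroup.lift_apply_of, f.sec_rel]
      rfl
  have h' := DFunLike.congr_fun h x
  simp only [AddMonoidHom.comp_apply, hx, map_zero] at h'
  exact (QuotientAddGroup.eq_zero_iff _).1 (f.incl_eq_zero h'.symm)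

/-! ### The prism operator of a central element -/

lemma isNat_const (t : A) : GFun.IsNat (GFun.id A Pt) (GFun.id A Pt) fun _ => t :=
  ⟨fun _ => rfl, fun g _ => mul_comm g t⟩

/-- The prism operator of an element of an abelian group, on two-chains. -/
def hT (t : A) : FA ((A × A) × Pt) →+ FA ((A × A × A) × Pt) :=
  GFun.pr2 (GFun.id A Pt) (GFun.id A Pt) fun _ => t

lemma hT_of (t a b : A) : hT t (of ((a, b), pnt)) =
    of ((t, a, b), pnt) - of ((a, t, b), pnt) + of ((a, b, t), pnt) := by
  simp [hT, GFun.pr2, GFun.id]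

lemma q3_hT_bd3 (t : A) (b : FA ((A × A × A) × Pt)) : q3 (hT t (bd3 A Pt b)) = 0 := by
  have := (isNat_const t).hom3 b
  rw [sub_self, add_comm, add_eq_zero_iff_eq_neg, ← map_neg] at this
  change q3 (GFun.pr2 (GFun.id A Pt) (GFun.id A Pt) (fun _ => t) (bd3 A Pt b)) = 0
  rw [this, q3_bd4]

lemma bd3_hT (t : A) {x : FA ((A × A) × Pt)} (hx : bd2 A Pt x = 0) : bd3 A Pt (hT t x) = 0 := by
  have := (isNat_const t).hom2 x
  rwa [sub_self, hx, map_zero, add_zero] at this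

/-- The product with the class of `t`. -/
def hTQ (t : A) : Q2 A Pt →+ Q3 A Pt :=
  QuotientAddGroup.lift _ (q3.comp (hT t)) (by
    rintro _ ⟨b, rfl⟩
    exact q3_hT_bd3 t b)

lemma hTQ_q2 (t : A) (x : FA ((A × A) × Pt)) : hTQ t (q2 x) = q3 (hT t x) := rfl

/-- The alternating three-cycle of three elements of an abelian group. -/
def alt3 (t a b : A) : FA ((A × A × A) × Pt) := hT t (comm2 a b)

lemma bd3_alt3 (t a b : A) : bd3 A Pt (alt3 t a b) = 0 := bd3_hT t (bd2_comm2 a b)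

lemma alt3_cyc (t a b : A) : alt3 t a b = alt3 a b t := by
  simp only [alt3, comm2, map_sub, hT_of]
  abel

lemma q3_alt3 (t a b : A) :
    q3 (alt3 t a b) = hTQ t (commHom (Additive.ofMul a) (Additive.ofMul b)) := rfl

lemma alt3_mul₂ (t a a' b : A) :
    q3 (alt3 t (a * a') b) = q3 (alt3 t a b) + q3 (alt3 t a' b) := by
  simp [q3_alt3]

lemma alt3_mul₃ (t a b b' : A) :
    q3 (alt3 t a (b * b')) = q3 (alt3 t a b) + q3 (alt3 t a b') := by
  simp [q3_alt3]

lemma alt3_mul₁ (t t' a b : A) :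
    q3 (alt3 (t * t') a b) = q3 (alt3 t a b) + q3 (alt3 t' a b) := by
  rw [alt3_cyc, alt3_cyc t, alt3_cyc t', alt3_mul₃]

/-- The triadditive form of `alt3`. -/
def altHom : Additive A →+ Additive A →+ Additive A →+ Q3 A Pt :=
  AddMonoidHom.mk' (fun t => AddMonoidHom.mk' (fun a => AddMonoidHom.mk'
    (fun b => q3 (alt3 t.toMul a.toMul b.toMul)) fun b b' => alt3_mul₃ _ _ _ _)
      fun a a' => by ext b; exact alt3_mul₂ _ _ _ _)
      fun t t' => by ext a b; exact alt3_mul₁ _ _ _ _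

lemma altHom_apply (t a b : A) :
    altHom (Additive.ofMul t) (Additive.ofMul a) (Additive.ofMul b) = q3 (alt3 t a b) := rfl

lemma q3_alt3_pow (t a b : A) (n : ℕ) :
    q3 (alt3 (t ^ n) (a ^ n) (b ^ n)) = (n ^ 3 : ℤ) • q3 (alt3 t a b) := by
  simp only [← altHom_apply, ofMul_pow, map_nsmul, AddMonoidHom.nsmul_apply]
  rw [← mul_nsmul, ← mul_nsmul, ← natCast_zsmul]
  congr 1
  push_cast; ring

end Abelian

lemma fa_map_inj {X : Type} {f : FA X →+ (X → ℤ)} (hf : ∀ x, f (of x) = Pi.single x 1)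
    {y : FA X} (hy : f y = 0) : y = 0 := by
  have : f = (Finsupp.coeFnAddHom (M := ℤ)).comp FreeAbelianGroup.toFinsupp := fa_ext fun x => by
    rw [hf]
    ext z
    simp [Pi.single_apply, Finsupp.single_apply, eq_comm]
  rw [this] at hy
  have h2 : FreeAbelianGroup.toFinsupp y = 0 := DFunLike.coe_injective hy
  exact (FreeAbelianGroup.equivFinsupp X).injective (by simpa using h2)

/-- The group `C`, with the action of `A × C` through the second factor. -/
def Crc (_ C : Type) : Type := C

section Circle

variable {A C : Type} [CommGroup A] [CommGroup C]

instance : CommGroup (Crc A C) := inferInstanceAs (CommGroup C)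

variable (A C) in
/-- The identification of `C` with `Crc A C`. -/
def crcOf : C ≃* Crc A C := MulEquiv.refl C

instance : MulAction (A × C) (Crc A C) where
  smul g s := crcOf A C g.2 * s
  one_smul s := one_mul s
  mul_smul g h s := mul_assoc (crcOf A C g.2) (crcOf A C h.2) s

lemma crc_smul (g : A × C) (s : Crc A C) : g • s = crcOf A C g.2 * s := rfl

variable (A C) in
/-- The functor from the group `A` to the action groupoid of `A × C` on `C`. -/
def crcJ : GFun A Pt (A × C) (Crc A C) :=
  GFun.mk' (MonoidHom.inl A C) (fun _ => 1) fun _ _ => by simp [crc_smul]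

variable (A C) in
/-- The projection of the action groupoid of `A × C` on `C` to `A`. -/
def crcR : GFun (A × C) (Crc A C) A Pt :=
  GFun.mk' (MonoidHom.fst A C) (fun _ => pnt) fun _ _ => rfl

variable (A C) in
/-- The natural transformation witnessing that `crcJ` is a retract. -/
def crcη (s : Crc A C) : A × C := (1, ((crcOf A C).symm s)⁻¹)

lemma crc_isNat : GFun.IsNat (GFun.id (A × C) (Crc A C)) ((crcJ A C).comp (crcR A C))
    (crcη A C) where
  obj s := by simp [crcη, crc_smul, GFun.id, GFun.comp, crcJ, GFun.mk']
  co g s := by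
    refine Prod.ext ?_ ?_ <;> simp [crcη, crc_smul, GFun.id, GFun.comp, crcJ, crcR, GFun.mk']

instance : Inhabited (Crc A C) := ⟨1⟩

end Circle

section Shift

variable {C : Type} [CommGroup C] {P : Type}

/-- The augmentation. -/
def eps (P C : Type) : FA (P × C) →+ FA (P × Pt) :=
  FreeAbelianGroup.lift fun x => of (x.1, pnt)

/-- Translation by `t`. -/
def trn (P : Type) (t : C) : FA (P × C) →+ FA (P × C) :=
  FreeAbelianGroup.lift fun x => of (x.1, x.2 * t)

omit [CommGroup C] in
@[simp] lemma eps_of (p : P) (s : C) : eps P C (of (p, s)) = of (p, pnt) := by simp [eps]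

@[simp] lemma trn_of (p : P) (s t : C) : trn P t (of (p, s)) = of (p, s * t) := by simp [trn]

lemma trn_mul (s t : C) (x : FA (P × C)) : trn P (s * t) x = trn P t (trn P s x) := by
  have : trn P (s * t) = (trn P t).comp (trn P s) := fa_ext fun ⟨p, u⟩ => by simp [mul_assoc]
  exact DFunLike.congr_fun this x

lemma trn_one (x : FA (P × C)) : trn P (1 : C) x = x := by
  have : trn P (1 : C) = AddMonoidHom.id _ := fa_ext fun ⟨p, u⟩ => by simp
  exact DFunLike.congr_fun this x

lemma eps_trn (t : C) (x : FA (P × C)) : eps P C (trn P t x) = eps P C x := by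
  have : (eps P C).comp (trn P t) = eps P C := fa_ext fun ⟨p, u⟩ => by simp
  exact DFunLike.congr_fun this x

omit [CommGroup C] in
lemma eps_surj [Inhabited C] (x : FA (P × Pt)) : ∃ y, eps P C y = x := by
  refine ⟨FreeAbelianGroup.lift (fun p : P × Pt => of (p.1, (default : C))) x, ?_⟩
  have : (eps P C).comp (FreeAbelianGroup.lift (fun p : P × Pt => of (p.1, (default : C)))) =
      AddMonoidHom.id _ := fa_ext fun ⟨p, u⟩ => by simp [pt_eq]
  exact DFunLike.congr_fun this x

lemma eps_exact {t : C} (ht : ∀ s : C, ∃ k : ℤ, s = t ^ k) {x : FA (P × C)}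
    (hx : eps P C x = 0) : ∃ y, trn P t y - y = x := by
  let D : FA (P × C) →+ FA (P × C) := trn P t - AddMonoidHom.id _
  have h1 (p : P) (s : C) : of (p, s * t) - of (p, s) ∈ D.range := ⟨of (p, s), by simp [D]⟩
  have h2 (p : P) (k : ℤ) : of (p, t ^ k) - of (p, 1) ∈ D.range := by
    induction k with
    | zero => simp
    | succ k ih =>
      have := add_mem (h1 p (t ^ (k : ℤ))) ih
      rwa [sub_add_sub_cancel, ← zpow_add_one] at this
    | pred k ih =>
      have := sub_mem ih (h1 p (t ^ (-(k : ℤ) - 1)))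
      rw [← zpow_add_one, sub_add_cancel] at this
      simpa using this
  have h3 (x : FA (P × C)) :
      x - FreeAbelianGroup.lift (fun p : P × Pt => of (p.1, (1 : C))) (eps P C x) ∈ D.range := by
    induction x using FreeAbelianGroup.induction_on with
    | zero => simp
    | of x =>
      obtain ⟨k, hk⟩ := ht x.2
      simpa [eps, ← hk] using h2 x.1 k
    | neg x h =>
      have := neg_mem h
      simp only [map_neg]
      convert this using 1; abel
    | add x y hx hy =>
      have := add_mem hx hy
      simp only [map_add]
      convert this using 1; abel
  have := h3 x
  rw [hx, map_zero, sub_zero] at this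
  obtain ⟨y, hy⟩ := this
  exact ⟨y, hy⟩

lemma trn_sub_inj {x : FA (P × Multiplicative ℤ)}
    (hx : trn P (Multiplicative.ofAdd (1 : ℤ)) x = x) : x = 0 := by
  let L : FA (P × Multiplicative ℤ) →+ (P × Multiplicative ℤ → ℤ) :=
    FreeAbelianGroup.lift fun x y => if y.1 = x.1 ∧ x.2.toAdd ≤ y.2.toAdd then 1 else 0
  refine fa_map_inj
    (f := L - L.comp (trn P (Multiplicative.ofAdd (1 : ℤ)))) ?_ (by simp [hx])
  rintro ⟨p, s⟩
  ext ⟨q, u⟩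
  have hs : s = u ↔ s.toAdd = u.toAdd := Multiplicative.toAdd.injective.eq_iff.symm
  simp only [L, AddMonoidHom.sub_apply, AddMonoidHom.comp_apply, trn_of,
    FreeAbelianGroup.lift_apply_of, Pi.sub_apply, Pi.single_apply, toAdd_mul, toAdd_ofAdd,
    Prod.mk.injEq]
  by_cases hq : q = p
  · have h' : u = s ↔ u.toAdd = s.toAdd := Multiplicative.toAdd.injective.eq_iff.symm
    simp only [hq, true_and, h']
    split_ifs <;> omega
  · simp [hq]

/-- The norm map. -/
def nrm (P C : Type) [Fintype C] : FA (P × Pt) →+ FA (P × C) :=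
  FreeAbelianGroup.lift fun x => ∑ s : C, of (x.1, s)

/-- The restriction to the fibre over `u`. -/
def rst (P : Type) (u : C) : FA (P × C) →+ FA (P × C) :=
  FreeAbelianGroup.lift fun x => if x.2 = u then of x else 0

lemma rst_trn (u : C) (x : FA (P × C)) : rst P u (trn P u x) = trn P u (rst P 1 x) := by
  have : (rst P u).comp (trn P u) = (trn P u).comp (rst P 1) := fa_ext fun ⟨p, s⟩ => by
    simp only [AddMonoidHom.comp_apply, trn_of, rst, FreeAbelianGroup.lift_apply_of, mul_eq_right]
    split_ifs <;> simp
  exact DFunLike.congr_fun this x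

omit [CommGroup C] in
lemma sum_rst [Fintype C] (x : FA (P × C)) : ∑ u, rst P u x = x := by
  have : ∑ u : C, rst P u = AddMonoidHom.id (FA (P × C)) := fa_ext fun ⟨p, s⟩ => by
    simp [rst]
  simpa [AddMonoidHom.finsetSum_apply] using DFunLike.congr_fun this x

lemma exists_nrm [Fintype C] {t : C} (ht : ∀ s : C, ∃ k : ℤ, s = t ^ k) {x : FA (P × C)}
    (hx : trn P t x = x) : ∃ b, nrm P C b = x := by
  have h1 (k : ℤ) : trn P (t ^ k) x = x := by
    induction k with
    | zero => simp [trn_one]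
    | succ k ih => rw [zpow_add_one, trn_mul, ih, hx]
    | pred k ih =>
      have h := congrArg (trn P (t ^ (-(k : ℤ) - 1))) hx
      rwa [← trn_mul, ← zpow_one_add, add_sub_cancel, ih, eq_comm] at h
  refine ⟨eps P C (rst P 1 x), ?_⟩
  have h2 : ((nrm P C).comp (eps P C)).comp (rst P 1) = (∑ u : C, trn P u).comp (rst P 1) :=
    fa_ext fun ⟨p, s⟩ => by
      by_cases h : s = 1 <;>
        simp [rst, h, nrm]
  have h3 := DFunLike.congr_fun h2 x
  simp only [AddMonoidHom.comp_apply, AddMonoidHom.finsetSum_apply, ← rst_trn] at h3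
  rw [h3]
  conv_rhs => rw [← sum_rst x]
  refine Finset.sum_congr rfl fun u _ => ?_
  obtain ⟨k, rfl⟩ := ht u
  rw [h1]

end Shift

section Good

/-- The functor between one-point groupoids attached to a group homomorphism. -/
def gh {Γ Δ : Type} [Group Γ] [Group Δ] (φ : Γ →* Δ) : GFun Γ Pt Δ Pt :=
  GFun.mk' φ (fun _ => pnt) fun _ _ => rfl

section gh

variable {Γ Δ : Type} [Group Γ] [Group Δ] (φ : Γ →* Δ)

@[simp] lemma gh_co (a : Γ) (s : Pt) : (gh φ).co a s = φ a := rfl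

@[simp] lemma gh_obj (s : Pt) : (gh φ).obj s = pnt := rfl

end gh

variable (A : Type) [CommGroup A] {B : Type} [CommGroup B]

variable {A} in
/-- The three-cycle attached to an element of finite order. -/
def lens (g : A) (n : ℕ) : FA ((A × A × A) × Pt) :=
  ∑ j ∈ Finset.range n, of ((g, g ^ j, g), pnt)

/-- The subgroup generated by the classes of alternating cycles and cyclic cycles. -/
def cycSub : AddSubgroup (Q3 A Pt) :=
  AddSubgroup.closure ({q | ∃ t a b : A, q = q3 (alt3 t a b)} ∪
    {q | ∃ (g : A) (n : ℕ), 0 < n ∧ g ^ n = 1 ∧ q = q3 (lens g n)})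

/-- Every three-cycle is homologous to a combination of alternating and cyclic cycles. -/
def Good : Prop := ∀ x, bd3 A Pt x = 0 → q3 x ∈ cycSub A

variable {A}

lemma alt3_mem (t a b : A) : q3 (alt3 t a b) ∈ cycSub A :=
  AddSubgroup.subset_closure (Or.inl ⟨t, a, b, rfl⟩)

lemma lens_mem {g : A} {n : ℕ} (hn : 0 < n) (h : g ^ n = 1) : q3 (lens g n) ∈ cycSub A :=
  AddSubgroup.subset_closure (Or.inr ⟨g, n, hn, h, rfl⟩)

lemma gh_alt3 (φ : A →* B) (t a b : A) :
    (gh φ).m3 (alt3 t a b) = alt3 (φ t) (φ a) (φ b) := by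
  simp [alt3, comm2, hT_of]

lemma gh_lens (φ : A →* B) (g : A) (n : ℕ) : (gh φ).m3 (lens g n) = lens (φ g) n := by
  simp [lens]

lemma gh_mem (φ : A →* B) {q : Q3 A Pt} (hq : q ∈ cycSub A) : (gh φ).M3 q ∈ cycSub B := by
  suffices cycSub A ≤ (cycSub B).comap (gh φ).M3 from this hq
  rw [cycSub, AddSubgroup.closure_le]
  rintro q (⟨t, a, b, hq⟩ | ⟨g, n, hn, h, hq⟩) <;> rw [hq]
  · change (gh φ).M3 (q3 (alt3 t a b)) ∈ cycSub B
    rw [← GFun.q3_m3, gh_alt3]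
    exact alt3_mem _ _ _
  · change (gh φ).M3 (q3 (lens g n)) ∈ cycSub B
    rw [← GFun.q3_m3, gh_lens]
    exact lens_mem hn (by rw [← map_pow, h, map_one])

lemma Good.equiv (h : Good A) (e : A ≃* B) : Good B := by
  intro x hx
  have h1 := h ((gh e.symm.toMonoidHom).m3 x) (by rw [GFun.bd3_m3, hx, map_zero])
  have h2 := gh_mem e.toMonoidHom h1
  rw [← GFun.q3_m3] at h2
  convert h2 using 2
  have : (gh e.toMonoidHom).m3.comp (gh e.symm.toMonoidHom).m3 = AddMonoidHom.id _ :=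
    fa_ext fun ⟨⟨a, b, c⟩, s⟩ => by simp [pt_eq]
  exact (DFunLike.congr_fun this x).symm

lemma hTQ_mem (t : A) {q : Q2 A Pt} (hq : q ∈ commSub A) : hTQ t q ∈ cycSub A := by
  suffices commSub A ≤ (cycSub A).comap (hTQ t) from this hq
  rw [commSub, AddSubgroup.closure_le]
  rintro _ ⟨p, rfl⟩
  exact alt3_mem t p.1 p.2

end Good

section Crc

variable (A C : Type) [CommGroup A] [CommGroup C]

/-- The augmentation functor of the action groupoid of `A × C` on `C`. -/
def crcE : GFun (A × C) (Crc A C) (A × C) Pt :=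
  GFun.mk' (MonoidHom.id _) (fun _ => pnt) fun _ _ => rfl

variable {A C} in
/-- The translation functor of the action groupoid of `A × C` on `C`. -/
def crcT (t : Crc A C) : GFun (A × C) (Crc A C) (A × C) (Crc A C) :=
  GFun.mk' (MonoidHom.id _) (fun s => s * t) fun g s => mul_assoc (crcOf A C g.2) s t

variable {A C}

lemma crcE_m3 (x : FA (((A × C) × (A × C) × A × C) × Crc A C)) :
    (crcE A C).m3 x = eps _ _ x := rfl
lemma crcT_m1 (t : Crc A C) (x : FA ((A × C) × Crc A C)) : (crcT t).m1 x = trn _ t x := rfl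
lemma crcT_m2 (t : Crc A C) (x : FA (((A × C) × A × C) × Crc A C)) : (crcT t).m2 x = trn _ t x :=
  rfl
lemma crcT_m3 (t : Crc A C) (x : FA (((A × C) × (A × C) × A × C) × Crc A C)) :
    (crcT t).m3 x = trn _ t x := rfl

/-- The element of `A × C` attached to an element of `Crc A C`. -/
def crcG (t : Crc A C) : A × C := (1, (crcOf A C).symm t)

lemma crc_isNat_trn (t : Crc A C) : GFun.IsNat (crcJ A C) ((crcT t).comp (crcJ A C))
    fun _ => crcG t where
  obj s := by simp [crcG, crc_smul, GFun.comp, crcJ, crcT, GFun.mk']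
  co g s := by simp [crcG, GFun.comp, crcJ, crcT, GFun.mk']

lemma eps_crcJ_m3 (y : FA ((A × A × A) × Pt)) :
    eps _ _ ((crcJ A C).m3 y) = (gh (MonoidHom.inl A C)).m3 y := by
  have : (eps _ _).comp (crcJ A C).m3 = (gh (MonoidHom.inl A C)).m3 :=
    fa_ext fun ⟨⟨a, b, c⟩, s⟩ => by simp [crcJ, GFun.mk']
  exact DFunLike.congr_fun this y

lemma eps_pr2 (t : Crc A C) (y : FA ((A × A) × Pt)) :
    eps _ _ (GFun.pr2 (crcJ A C) ((crcT t).comp (crcJ A C)) (fun _ => crcG t) y) =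
      hT (crcG t) ((gh (MonoidHom.inl A C)).m2 y) := by
  have : (eps _ _).comp (GFun.pr2 (crcJ A C) ((crcT t).comp (crcJ A C)) fun _ => crcG t) =
      (hT (crcG t)).comp (gh (MonoidHom.inl A C)).m2 :=
    fa_ext fun ⟨⟨a, b⟩, s⟩ => by
      simp [crcJ, crcT, GFun.mk', GFun.pr2, hT_of, GFun.comp]
  exact DFunLike.congr_fun this y

lemma q3_eps {w : FA (((A × C) × (A × C) × A × C) × Crc A C)}
    (hw : bd3 _ _ w = 0) :
    q3 (eps _ _ w) = (gh (MonoidHom.inl A C)).M3 (q3 ((crcR A C).m3 w)) := by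
  have h := crc_isNat.q3 hw
  rw [GFun.m3_id, GFun.m3_comp] at h
  have h2 := congrArg (crcE A C).M3 h
  rwa [← GFun.q3_m3, ← GFun.q3_m3, crcE_m3, crcE_m3, eps_crcJ_m3, GFun.q3_m3] at h2

end Crc

section Wang

variable {A : Type} [CommGroup A]

omit [CommGroup A] in
variable (A) in
lemma ofAdd_gen (s : Crc A (Multiplicative ℤ)) :
    ∃ k : ℤ, s = crcOf A _ (Multiplicative.ofAdd (1 : ℤ)) ^ k := by
  obtain ⟨s, rfl⟩ := (crcOf A _).surjective s
  refine ⟨s.toAdd, ?_⟩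
  rw [← map_zpow, ← ofAdd_zsmul, smul_eq_mul, mul_one, ofAdd_toAdd]

omit [CommGroup A] in
lemma trn_sub_inj' {P : Type} {x : FA (P × Crc A (Multiplicative ℤ))}
    (hx : trn P (crcOf A _ (Multiplicative.ofAdd (1 : ℤ))) x = x) : x = 0 :=
  trn_sub_inj hx

lemma Good.prod_int (hA : Good A) : Good (A × Multiplicative ℤ) := by
  intro x hx
  let t : Crc A (Multiplicative ℤ) := crcOf A _ (Multiplicative.ofAdd (1 : ℤ))
  obtain ⟨a30, h30⟩ := eps_surj (C := Crc A (Multiplicative ℤ)) x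
  have h1 : eps _ _ (bd3 (A × Multiplicative ℤ) (Crc A (Multiplicative ℤ)) a30) = 0 := by
    exact ((crcE A _).bd3_m3 a30).symm.trans ((congrArg _ h30).trans hx)
  obtain ⟨a21, h21⟩ := eps_exact (t := t) (ofAdd_gen A) h1
  have h2 : bd2 (A × Multiplicative ℤ) (Crc A (Multiplicative ℤ)) a21 = 0 := by
    refine trn_sub_inj' (sub_eq_zero.1 ?_)
    have h := congrArg (bd2 (A × Multiplicative ℤ) (Crc A (Multiplicative ℤ))) h21
    rw [map_sub, bd2_bd3] at h
    have := (crcT t).bd2_m2 a21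
    rw [crcT_m1, crcT_m2] at this
    rwa [this] at h
  let y := (crcR A (Multiplicative ℤ)).m2 a21
  have hy : bd2 A Pt y = 0 := by
    rw [← map_zero (crcR A (Multiplicative ℤ)).m1, ← h2]
    exact GFun.bd2_m2 _ _
  let b31 := GFun.pr2 (GFun.id (A × Multiplicative ℤ) (Crc A (Multiplicative ℤ)))
      ((crcJ A (Multiplicative ℤ)).comp (crcR A (Multiplicative ℤ)))
    (crcη A (Multiplicative ℤ)) a21
  have h3 : bd3 _ _ b31 = a21 - (crcJ A (Multiplicative ℤ)).m2 y := by
    have := crc_isNat.hom2 a21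
    rwa [h2, map_zero, add_zero, GFun.m2_id, GFun.m2_comp] at this
  let c := GFun.pr2 (crcJ A (Multiplicative ℤ)) ((crcT t).comp (crcJ A (Multiplicative ℤ)))
      (fun _ => crcG t) y
  have h4 : bd3 _ _ c = (crcJ A _).m2 y - trn _ t ((crcJ A _).m2 y) := by
    have := (crc_isNat_trn t).hom2 y
    rwa [hy, map_zero, add_zero, GFun.m2_comp, crcT_m2] at this
  have h5 : bd3 _ _ (trn _ t b31) = trn _ t (bd3 _ _ b31) := by
    have := (crcT t).bd3_m3 b31
    rwa [crcT_m3, crcT_m2] at this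
  let w := a30 + c - (trn _ t b31 - b31)
  have hw : bd3 (A × Multiplicative ℤ) (Crc A (Multiplicative ℤ)) w = 0 := by
    simp only [w, map_add, map_sub, h5, h4, h3]
    rw [← h21]
    abel
  have h6 := q3_eps hw
  have h7 : eps _ _ w = x + hT (crcG t) ((gh (MonoidHom.inl A (Multiplicative ℤ))).m2 y) := by
    have e1 : eps _ _ a30 = x := h30
    have e2 : eps _ _ (trn _ t b31) = eps _ _ b31 := eps_trn t b31
    simp only [w, map_add, map_sub, c, eps_pr2, e1, e2]
    abel
  rw [h7, map_add, ← hTQ_q2, GFun.q2_m2] at h6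
  rw [eq_sub_of_add_eq h6]
  refine sub_mem (gh_mem _ (hA _ (by rw [GFun.bd3_m3, hw, map_zero]))) (hTQ_mem _ ?_)
  rw [← GFun.q2_m2]
  exact mem_commSub (by rw [GFun.bd2_m2, hy, map_zero])

end Wang

section Cyclic

variable {F : Type} [CommGroup F]

lemma q3_unit (x : FA ((Unit × Unit × Unit) × Pt)) : q3 x = 0 := by
  have : (q3 : FA ((Unit × Unit × Unit) × Pt) →+ Q3 Unit Pt) = 0 := fa_ext fun ⟨⟨a, b, c⟩, s⟩ => by
    have h := bd4_of a a b c s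
    simp only [Subsingleton.elim a 1, Subsingleton.elim b 1, Subsingleton.elim c 1, mul_one,
      pt_smul, sub_self, zero_add] at h ⊢
    rw [← h, q3_bd4, AddMonoidHom.zero_apply]
  exact DFunLike.congr_fun this x

lemma q2_unit {x : FA ((Unit × Unit) × Pt)} (hx : bd2 Unit Pt x = 0) : q2 x = 0 := by
  have h := mem_commSub hx
  suffices commSub Unit ≤ ⊥ from (AddSubgroup.mem_bot).1 (this h)
  rw [commSub, AddSubgroup.closure_le]
  rintro _ ⟨p, rfl⟩
  change q2 (comm2 p.1 p.2) = 0
  rw [Subsingleton.elim p.1 p.2]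
  simp [comm2]

lemma q3_free {x : FA (((Unit × F) × (Unit × F) × Unit × F) × Crc Unit F)}
    (hx : bd3 _ _ x = 0) : q3 x = 0 := by
  have h := crc_isNat.q3 hx
  rw [GFun.m3_id, GFun.m3_comp, GFun.q3_m3, q3_unit, map_zero] at h
  exact h

lemma q2_free {x : FA (((Unit × F) × Unit × F) × Crc Unit F)}
    (hx : bd2 _ _ x = 0) : q2 x = 0 := by
  have h := crc_isNat.q2 hx
  rw [GFun.m2_id, GFun.m2_comp, GFun.q2_m2, q2_unit, map_zero] at h
  · exact h
  · rw [GFun.bd2_m2, hx, map_zero]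

lemma q1_of_pow {Γ : Type} [Group Γ] (g : Γ) (k : ℤ) :
    q1 (of (g ^ k, pnt) : FA (Γ × Pt)) = k • q1 (of (g, pnt)) := by
  have key (a b : Γ) :
      q1 (of (a * b, pnt) : FA (Γ × Pt)) = q1 (of (a, pnt)) + q1 (of (b, pnt)) := by
    have h := q1_bd2 (of ((a, b), pnt) : FA ((Γ × Γ) × Pt))
    rw [bd2_of, pt_smul] at h
    simp only [map_add, map_sub] at h
    rw [eq_comm, ← sub_eq_zero, ← h]; abel
  let f : Γ →* Multiplicative (Q1 Γ Pt) :=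
    MonoidHom.mk' (fun a => Multiplicative.ofAdd (q1 (of (a, pnt)))) key
  exact congrArg Multiplicative.toAdd (map_zpow f g k)

variable [Fintype F]

instance : Fintype (Crc Unit F) := inferInstanceAs (Fintype F)

lemma trn_nrm {C P : Type} [CommGroup C] [Fintype C] (t : C) (b : FA (P × Pt)) :
    trn P t (nrm P C b) = nrm P C b := by
  have : (trn P t).comp (nrm P C) = nrm P C := fa_ext fun ⟨p, s⟩ => by
    simp only [AddMonoidHom.comp_apply, nrm, FreeAbelianGroup.lift_apply_of, map_sum, trn_of]
    exact Fintype.sum_equiv (Equiv.mulRight t) _ _ fun _ => rfl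
  exact DFunLike.congr_fun this b

lemma bd2_nrm (b : FA (((Unit × F) × Unit × F) × Pt)) :
    bd2 (Unit × F) (Crc Unit F) (nrm _ (Crc Unit F) b) = nrm _ (Crc Unit F) (bd2 _ _ b) := by
  have : (bd2 (Unit × F) (Crc Unit F)).comp (nrm _ (Crc Unit F)) =
      (nrm _ (Crc Unit F)).comp (bd2 _ _) :=
    fa_ext fun ⟨⟨p, q⟩, s⟩ => by
      have hs (h : Unit × F) : ∑ u : Crc Unit F, (of (p, h • u) :
          FA ((Unit × F) × Crc Unit F)) = ∑ u : Crc Unit F, of (p, u) :=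
        Fintype.sum_equiv (Equiv.mulLeft h.2) _ _ fun _ => rfl
      have e : nrm ((Unit × F) × Unit × F) (Crc Unit F) (of ((p, q), s)) =
        ∑ u : Crc Unit F, of ((p, q), u) := FreeAbelianGroup.lift_apply_of _ _
      have e' (p : Unit × F) : nrm (Unit × F) (Crc Unit F) (of (p, s)) =
        ∑ u : Crc Unit F, of (p, u) := FreeAbelianGroup.lift_apply_of _ _
      rw [AddMonoidHom.comp_apply, AddMonoidHom.comp_apply, e, bd2_of]
      simp only [map_add, map_sub, map_sum, bd2_of, pt_smul, e', Finset.sum_add_distrib,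
        Finset.sum_sub_distrib]
      rw [hs]
  exact DFunLike.congr_fun this b

lemma q3_eps_eq_zero {t : Crc Unit F} {z : FA (((Unit × F) × (Unit × F) × Unit × F) × Crc Unit F)}
    {a : FA (((Unit × F) × Unit × F) × Crc Unit F)} {b : FA (((Unit × F) × Unit × F) × Pt)}
    (h : bd3 _ _ z = trn _ t a - a) (hb : bd2 _ _ a = nrm _ (Crc Unit F) (bd2 _ _ b)) :
    q3 (eps _ (Crc Unit F) z) = 0 := by
  have h1 : bd2 _ _ (a - nrm _ (Crc Unit F) b) = 0 := by rw [map_sub, hb, ← bd2_nrm, sub_self]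
  obtain ⟨c, hc⟩ := q2_eq_zero.1 (q2_free h1)
  have h5 : bd3 _ _ (trn _ t c) = trn _ t (bd3 _ _ c) := by
    have := (crcT t).bd3_m3 c
    rwa [crcT_m3, crcT_m2] at this
  have h6 : trn _ t (nrm ((Unit × F) × Unit × F) (Crc Unit F) b) =
      nrm ((Unit × F) × Unit × F) (Crc Unit F) b :=
    trn_nrm t b
  have h2 : bd3 _ _ (z - (trn _ t c - c)) = 0 := by
    rw [map_sub, map_sub, h5, hc, map_sub, h6, h]
    abel
  have h3 := q3_eps h2
  rw [q3_free h2 |> fun h => (q3_unit _), map_zero] at h3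
  have h4 : eps _ _ (trn _ t c) = eps _ _ c := eps_trn t c
  rwa [map_sub (eps _ _), map_sub (eps _ _), h4, sub_self, sub_zero] at h3

variable (t : Crc Unit F)

/-- The lift of `lens` to the free orbit. -/
def lensUp : FA (((Unit × F) × (Unit × F) × Unit × F) × Crc Unit F) :=
  ∑ j ∈ Finset.range (orderOf t), of ((crcG t, crcG t ^ j, crcG t), (1 : Crc Unit F))

/-- An auxiliary chain bounding the norm of `t`. -/
def lensAux : FA (((Unit × F) × Unit × F) × Crc Unit F) :=
  -∑ j ∈ Finset.range (orderOf t), of ((crcG t, crcG t ^ j), (1 : Crc Unit F))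

omit [Fintype F] in
lemma crcG_pow (j : ℕ) : crcG t ^ j = crcG (t ^ j) := by
  refine Prod.ext (by simp [crcG]) ?_
  rw [Prod.pow_snd, crcG, crcG, map_pow]

omit [Fintype F] in
lemma crcG_smul : crcG t • (1 : Crc Unit F) = t := by simp [crc_smul, crcG]

omit [Fintype F] in
lemma unit_pow_order : (crcG t) ^ orderOf t = 1 := by
  rw [crcG_pow, pow_orderOf_eq_one]
  refine Prod.ext rfl ?_
  simp [crcG]

omit [Fintype F] in
lemma bd3_lensUp : bd3 _ _ (lensUp t) = trn _ t (lensAux t) - lensAux t := by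
  have e (f : ℕ → FA (((Unit × F) × Unit × F) × Crc Unit F))
      (h : f (orderOf t) = f 0) :
      ∑ j ∈ Finset.range (orderOf t), f (j + 1) = ∑ j ∈ Finset.range (orderOf t), f j := by
    have := Finset.sum_range_sub f (orderOf t)
    rw [Finset.sum_sub_distrib, h, sub_self] at this
    exact sub_eq_zero.1 this
  have e1 (j : ℕ) : bd3 (Unit × F) (Crc Unit F)
      (of ((crcG t, crcG t ^ j, crcG t), (1 : Crc Unit F))) =
      of ((crcG t ^ j, crcG t), (1 : Crc Unit F)) -
      of ((crcG t ^ (j + 1), crcG t), (1 : Crc Unit F)) +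
      of ((crcG t, crcG t ^ (j + 1)), (1 : Crc Unit F)) - of ((crcG t, crcG t ^ j), t) := by
    refine (bd3_of _ _ _ _).trans ?_
    rw [← pow_succ', ← pow_succ, crcG_smul]
  have e2 : trn _ t (lensAux t) =
      -∑ j ∈ Finset.range (orderOf t), of ((crcG t, crcG t ^ j), t) := by
    have : ∀ p : (Unit × F) × Unit × F, trn _ t (of (p, (1 : Crc Unit F))) = of (p, t) :=
      fun p => (trn_of p 1 t).trans (by rw [one_mul])
    simp only [lensAux, map_neg, map_sum, this]
  rw [lensUp, map_sum, Finset.sum_congr rfl fun j _ => e1 j, Finset.sum_sub_distrib,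
    Finset.sum_add_distrib, Finset.sum_sub_distrib, e2, lensAux,
    e (fun j => of ((crcG t ^ j, crcG t), (1 : Crc Unit F))) (by rw [unit_pow_order, pow_zero]),
    e (fun j => of ((crcG t, crcG t ^ j), (1 : Crc Unit F))) (by rw [unit_pow_order, pow_zero])]
  abel

variable {t} (ht : ∀ s : Crc Unit F, ∃ k : ℤ, s = t ^ k)

include ht in
lemma bd2_lensAux : bd2 _ _ (lensAux t) = -nrm _ (Crc Unit F) (of (crcG t, pnt)) := by
  have e1 (j : ℕ) : bd2 (Unit × F) (Crc Unit F)
      (of ((crcG t, crcG t ^ j), (1 : Crc Unit F))) =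
      of (crcG t ^ j, (1 : Crc Unit F)) - of (crcG t ^ (j + 1), (1 : Crc Unit F)) +
      of (crcG t, t ^ j) := by
    refine (bd2_of _ _ _).trans ?_
    rw [← pow_succ', crcG_pow t j, crcG_smul]
  have e2 := Finset.sum_range_sub'
    (fun j => (of (crcG t ^ j, (1 : Crc Unit F)) : FA ((Unit × F) × Crc Unit F))) (orderOf t)
  have e3 : nrm _ (Crc Unit F) (of (crcG t, pnt)) =
      ∑ j ∈ Finset.range (orderOf t), (of (crcG t, t ^ j) : FA ((Unit × F) × Crc Unit F)) := by
    refine (FreeAbelianGroup.lift_apply_of _ _).trans ?_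
    symm
    refine Finset.sum_bij (fun j _ => t ^ j) (fun _ _ => Finset.mem_univ _) ?_ ?_ fun _ _ => rfl
    · intro a ha b hb hab
      exact pow_injOn_Iio_orderOf (by simpa using ha) (by simpa using hb) hab
    · intro s _
      obtain ⟨k, rfl⟩ := ht s
      obtain ⟨n, hn, h⟩ := (mem_zpowers_iff_mem_range_orderOf (x := t) (y := t ^ k)).1
        (Subgroup.zpow_mem_zpowers t k) |> Finset.mem_image.1
      exact ⟨n, hn, h⟩
  rw [lensAux, map_neg, map_sum, Finset.sum_congr rfl fun j _ => e1 j, Finset.sum_add_distrib, e2,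
    unit_pow_order, pow_zero, sub_self, zero_add, e3]

omit [Fintype F] in
lemma eps_lensUp : eps _ (Crc Unit F) (lensUp t) = lens (crcG t) (orderOf t) := by
  have (p : (Unit × F) × (Unit × F) × Unit × F) : eps _ (Crc Unit F) (of (p, (1 : Crc Unit F))) =
      of (p, pnt) := by simp
  rw [lensUp, map_sum, lens]
  rfl

omit [Fintype F] in
include ht in
lemma q1_mem_zmultiples (b : FA ((Unit × F) × Pt)) :
    q1 b ∈ AddSubgroup.zmultiples (q1 (of (crcG t, pnt) : FA ((Unit × F) × Pt))) := by
  induction b using FreeAbelianGroup.induction_on with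
  | zero => rw [map_zero]; exact zero_mem _
  | of x =>
    obtain ⟨⟨u, f⟩, s⟩ := x
    obtain ⟨k, hk⟩ := ht (crcOf Unit F f)
    have : ((u, f) : Unit × F) = crcG t ^ k := by
      refine Prod.ext rfl ?_
      refine Eq.trans ?_ (map_zpow (MonoidHom.snd Unit F) (crcG t) k).symm
      rw [MonoidHom.coe_snd, crcG, ← map_zpow, ← hk, MulEquiv.symm_apply_apply]
    rw [pt_eq s, this, q1_of_pow]
    exact zsmul_mem (AddSubgroup.mem_zmultiples _) k
  | neg x h => rw [map_neg]; exact neg_mem h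
  | add x y h h' => rw [map_add]; exact add_mem h h'

include ht in
lemma exists_lens {x : FA (((Unit × F) × (Unit × F) × Unit × F) × Pt)} (hx : bd3 _ _ x = 0) :
    ∃ k : ℤ, q3 x = k • q3 (lens (crcG t) (orderOf t)) := by
  obtain ⟨a30, h30⟩ := eps_surj (C := Crc Unit F) x
  have h1 : eps _ (Crc Unit F) (bd3 (Unit × F) (Crc Unit F) a30) = 0 := by
    exact ((crcE Unit F).bd3_m3 a30).symm.trans ((congrArg _ h30).trans hx)
  obtain ⟨a21, h21⟩ := eps_exact (t := t) ht h1
  have h2 : trn _ t (bd2 (Unit × F) (Crc Unit F) a21) = bd2 (Unit × F) (Crc Unit F) a21 := by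
    have h := congrArg (bd2 (Unit × F) (Crc Unit F)) h21
    rw [map_sub, bd2_bd3] at h
    have := (crcT t).bd2_m2 a21
    rw [crcT_m1, crcT_m2] at this
    rw [← this]
    exact sub_eq_zero.1 h
  obtain ⟨b, hb⟩ := exists_nrm ht h2
  obtain ⟨k, hk⟩ : ∃ k : ℤ, q1 b = k • q1 (of (crcG t, pnt)) := by
    obtain ⟨k, hk⟩ := q1_mem_zmultiples ht b
    exact ⟨k, hk.symm⟩
  rw [← sub_eq_zero, ← map_zsmul, ← map_sub, q1_eq_zero] at hk
  obtain ⟨b', hb'⟩ := hk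
  have h3 : q3 (eps _ (Crc Unit F) (a30 + k • lensUp t)) = 0 := by
    refine q3_eps_eq_zero (t := t) (a := a21 + k • lensAux t) (b := b') ?_ ?_
    · rw [map_add, map_zsmul, bd3_lensUp, map_add, map_zsmul, ← h21, smul_sub]
      simp only [trn]
      abel
    · rw [map_add, map_zsmul, bd2_lensAux ht, hb', map_sub, map_zsmul, smul_neg, ← sub_eq_add_neg]
      exact congrArg (· - _) hb.symm
  refine ⟨-k, ?_⟩
  rw [map_add, map_zsmul, eps_lensUp, map_add, map_zsmul] at h3
  have h4 : q3 (eps _ (Crc Unit F) a30) = q3 x := congrArg q3 h30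
  rw [h4] at h3
  rw [neg_smul]
  exact eq_neg_of_add_eq_zero_left h3

include ht in
lemma order_smul_lens :
    (orderOf t : ℤ) • q3 (lens (crcG t) (orderOf t)) = 0 := by
  have h1 : q1 ((orderOf t : ℤ) • of (crcG t, pnt) : FA ((Unit × F) × Pt)) = 0 := by
    rw [map_zsmul, ← q1_of_pow, zpow_natCast, unit_pow_order]
    have := q1_of_pow (1 : Unit × F) 0
    rwa [zpow_zero, zero_smul] at this
  obtain ⟨b, hb⟩ := q1_eq_zero.1 h1
  have := q3_eps_eq_zero (t := t) (z := (orderOf t : ℤ) • lensUp t)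
    (a := (orderOf t : ℤ) • lensAux t) (b := -b)
    (by rw [map_zsmul, bd3_lensUp, map_zsmul, smul_sub])
    (by rw [map_zsmul, bd2_lensAux ht, map_neg, map_neg, hb, map_zsmul, smul_neg])
  rwa [map_zsmul, eps_lensUp, map_zsmul] at this

end Cyclic

section General

lemma good_cyclic {F : Type} [CommGroup F] [Finite F] [IsCyclic F] : Good F := by
  cases nonempty_fintype F
  suffices Good (Unit × F) from this.equiv (MulEquiv.uniqueProd (M := F) (N := Unit))
  intro x hx
  obtain ⟨g, hg⟩ := IsCyclic.exists_generator (α := F)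
  let t := crcOf Unit F g
  have ht : ∀ s : Crc Unit F, ∃ k : ℤ, s = t ^ k := fun s => by
    obtain ⟨k, hk⟩ := hg ((crcOf Unit F).symm s)
    refine ⟨k, (crcOf Unit F).symm.injective ?_⟩
    rw [map_zpow, MulEquiv.symm_apply_apply]
    exact hk.symm
  obtain ⟨k, hk⟩ := exists_lens ht hx
  rw [hk]
  exact zsmul_mem (lens_mem (orderOf_pos t) (unit_pow_order t)) k

/-- A type synonym-free model of powers of an infinite cyclic group. -/
lemma Good.pi_int {A : Type} [CommGroup A] (hA : Good A) (n : ℕ) :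
    Good (A × (Fin n → Multiplicative ℤ)) := by
  induction n with
  | zero => exact hA.equiv (MulEquiv.prodUnique (M := A) (N := Fin 0 → Multiplicative ℤ)).symm
  | succ n ih =>
    refine ih.prod_int.equiv (MulEquiv.prodAssoc.trans (MulEquiv.prodCongr (MulEquiv.refl A) ?_))
    exact MulEquiv.prodComm.trans
      { Fin.consEquiv (fun _ : Fin (n + 1) => Multiplicative ℤ) with
        map_mul' := fun a b => by
          ext j
          cases j using Fin.cases <;> simp [Fin.consEquiv] }

lemma good_fg {A : Type} [CommGroup A] [Group.FG A]
    (hcyc : ∀ (F : Type) [CommGroup F] [Finite F] (φ : F →* A), Function.Injective φ → IsCyclic F) :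
    Good A := by
  obtain ⟨ι, j, _, _, p, hp, e, ⟨f⟩⟩ := CommGroup.equiv_free_prod_prod_multiplicative_zmod A
  have (i : ι) : NeZero (p i ^ e i) := ⟨(pow_pos (hp i).pos _).ne'⟩
  let F := (i : ι) → Multiplicative (ZMod (p i ^ e i))
  have : Finite F := Pi.finite
  have : IsCyclic F := hcyc F (f.symm.toMonoidHom.comp (MonoidHom.inr _ F)) fun a b h => by
    simpa using h
  refine (good_cyclic (F := F)).pi_int (Fintype.card j) |>.equiv ?_
  refine (MulEquiv.prodComm.trans (MulEquiv.prodCongr ?_ (MulEquiv.refl F))).trans f.symm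
  exact MulEquiv.arrowCongr (Fintype.equivFin j).symm (MulEquiv.refl (Multiplicative ℤ))

variable {A : Type} [CommGroup A]

lemma exists_fg_support (x : FA ((A × A × A) × Pt)) :
    ∃ S : Finset A, ∀ H : Subgroup A, Subgroup.closure (S : Set A) ≤ H →
      x ∈ ((gh H.subtype).m3).range := by
  induction x using FreeAbelianGroup.induction_on with
  | zero => exact ⟨∅, fun _ _ => zero_mem _⟩
  | of x =>
    obtain ⟨⟨a, b, c⟩, s⟩ := x
    refine ⟨{a, b, c}, fun H hH => ?_⟩
    have h : ∀ d ∈ ({a, b, c} : Finset A), d ∈ H := fun d hd => hH (Subgroup.subset_closure hd)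
    exact ⟨of ((⟨a, h a (by simp)⟩, ⟨b, h b (by simp)⟩, ⟨c, h c (by simp)⟩), pnt), by
      simp [pt_eq s]⟩
  | neg x h =>
    obtain ⟨S, hS⟩ := h
    exact ⟨S, fun H hH => neg_mem (hS H hH)⟩
  | add x y hx hy =>
    obtain ⟨S, hS⟩ := hx
    obtain ⟨S', hS'⟩ := hy
    refine ⟨S ∪ S', fun H hH => add_mem (hS H (le_trans ?_ hH)) (hS' H (le_trans ?_ hH))⟩ <;>
      exact Subgroup.closure_mono (by simp)

lemma gh_m2_injective {Γ Δ : Type} [Group Γ] [Group Δ] {φ : Γ →* Δ} (hφ : Function.Injective φ) :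
    Function.Injective (gh φ).m2 := by
  have : ((FreeAbelianGroup.lift fun x : (Δ × Δ) × Pt =>
      of ((Function.invFun φ x.1.1, Function.invFun φ x.1.2), pnt)).comp (gh φ).m2 :
        FA ((Γ × Γ) × Pt) →+ FA ((Γ × Γ) × Pt)) = AddMonoidHom.id _ := fa_ext fun ⟨⟨a, b⟩, s⟩ => by
    simp [pt_eq, Function.leftInverse_invFun hφ _]
  exact Function.LeftInverse.injective fun x => DFunLike.congr_fun this x

lemma good_of_isCyclic
    (hcyc : ∀ (F : Type) [CommGroup F] [Finite F] (φ : F →* A), Function.Injective φ → IsCyclic F) :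
    Good A := by
  intro x hx
  obtain ⟨S, hS⟩ := exists_fg_support x
  let H := Subgroup.closure (S : Set A)
  obtain ⟨y, hy⟩ := hS H le_rfl
  have : Group.FG H := Group.closure_finset_fg S
  have hH : Good H := good_fg fun F _ _ φ hφ =>
    hcyc F (H.subtype.comp φ) (H.subtype_injective.comp hφ)
  have h1 : bd3 H Pt y = 0 := by
    refine gh_m2_injective H.subtype_injective ?_
    rw [map_zero, ← GFun.bd3_m3, hy, hx]
  rw [← hy, GFun.q3_m3]
  exact gh_mem _ (hH y h1)

end General

lemma good_units : Good ℂˣ :=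
  good_of_isCyclic fun _ _ _ φ hφ =>
    isCyclic_of_injective_ringHom ((Units.coeHom ℂ).comp φ) (Units.val_injective.comp hφ)

lemma good_add : Good (Multiplicative ℂ) := by
  refine good_of_isCyclic fun F _ _ φ hφ => ?_
  suffices Subsingleton F from isCyclic_of_subsingleton
  refine ⟨fun a b => hφ ?_⟩
  suffices h : ∀ a, φ a = 1 by rw [h, h]
  intro a
  have h1 : φ a ^ Nat.card F = 1 := by rw [← map_pow, pow_card_eq_one', map_one]
  have h2 : (Nat.card F : ℂ) * (φ a).toAdd = 0 := by
    simpa using congrArg Multiplicative.toAdd h1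
  have h3 : (φ a).toAdd = 0 := by
    rcases mul_eq_zero.1 h2 with h | h
    · exact absurd h (by exact_mod_cast Nat.card_pos.ne')
    · exact h
  exact h3

section Lens

variable {A : Type} [CommGroup A]

lemma bd3_lens {g : A} {n : ℕ} (h : g ^ n = 1) : bd3 A Pt (lens g n) = 0 := by
  have e1 (j : ℕ) : bd3 A Pt (of ((g, g ^ j, g), pnt)) =
      (of ((g ^ j, g), pnt) - of ((g ^ (j + 1), g), pnt)) -
        (of ((g, g ^ j), pnt) - of ((g, g ^ (j + 1)), pnt)) := by
    rw [bd3_of, pt_smul, ← pow_succ', ← pow_succ]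
    abel
  rw [lens, map_sum, Finset.sum_congr rfl fun j _ => e1 j, Finset.sum_sub_distrib,
    Finset.sum_range_sub' (fun j => (of ((g ^ j, g), pnt) : FA ((A × A) × Pt))),
    Finset.sum_range_sub' (fun j => (of ((g, g ^ j), pnt) : FA ((A × A) × Pt))), h, pow_zero,
    sub_self, sub_self, sub_self]

section

variable (h : A)

/-- The cyclic subgroup generated by `h`, with a trivial factor. -/
def cycIncl : Unit × Subgroup.zpowers h →* A :=
  (Subgroup.zpowers h).subtype.comp (MonoidHom.snd _ _)

/-- The generator of the cyclic subgroup. -/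
def cycGen : Crc Unit (Subgroup.zpowers h) :=
  crcOf Unit _ ⟨h, Subgroup.mem_zpowers h⟩

lemma cycGen_gen (s : Crc Unit (Subgroup.zpowers h)) : ∃ k : ℤ, s = cycGen h ^ k := by
  obtain ⟨⟨_, k, rfl⟩, rfl⟩ := (crcOf Unit _).surjective s
  refine ⟨k, ?_⟩
  rw [cycGen, ← map_zpow]
  exact congrArg _ (Subtype.ext (by simp))

lemma orderOf_cycGen : orderOf (cycGen h) = orderOf h := by
  rw [cycGen, MulEquiv.orderOf_eq, Subgroup.orderOf_mk]

lemma cycIncl_crcG : cycIncl h (crcG (cycGen h)) = h := rfl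

variable {h} (hh : 0 < orderOf h)

include hh in
lemma finite_zpowers' : Finite (Subgroup.zpowers h) :=
  finite_zpowers.2 (orderOf_pos_iff.1 hh)

include hh in
lemma lens_zpowers {g : A} (hg : g ∈ Subgroup.zpowers h) {m : ℕ} (hm : g ^ m = 1) :
    q3 (lens g m) ∈ AddSubgroup.zmultiples (q3 (lens h (orderOf h))) := by
  have := finite_zpowers' hh
  cases nonempty_fintype (Subgroup.zpowers h)
  let g' : Unit × Subgroup.zpowers h := ((), ⟨g, hg⟩)
  have hg' : g' ^ m = 1 := Prod.ext rfl (Subtype.ext hm)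
  obtain ⟨k, hk⟩ := exists_lens (cycGen_gen h) (bd3_lens hg')
  have := congrArg (gh (cycIncl h)).M3 hk
  rw [map_zsmul, ← GFun.q3_m3, ← GFun.q3_m3, gh_lens, gh_lens, cycIncl_crcG, orderOf_cycGen] at this
  exact ⟨k, this.symm⟩

include hh in
lemma orderOf_smul_lens : (orderOf h : ℤ) • q3 (lens h (orderOf h)) = 0 := by
  have := finite_zpowers' hh
  cases nonempty_fintype (Subgroup.zpowers h)
  have := congrArg (gh (cycIncl h)).M3 (order_smul_lens (cycGen_gen h))
  rwa [map_zsmul, ← GFun.q3_m3, gh_lens, cycIncl_crcG, orderOf_cycGen, map_zero] at this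

end

end Lens

/-- The standard primitive root of unity of order `n`. -/
def zet (n : ℕ) : ℂˣ := Units.mk0 (exp (2 * Real.pi * I / n)) (exp_ne_zero _)

lemma zet_prim {n : ℕ} (hn : n ≠ 0) : IsPrimitiveRoot (zet n) n :=
  IsPrimitiveRoot.coe_units_iff.1 (Complex.isPrimitiveRoot_exp n hn)

lemma zet_pow {n : ℕ} (hn : n ≠ 0) : zet n ^ n = 1 := (zet_prim hn).pow_eq_one

lemma orderOf_zet {n : ℕ} (hn : n ≠ 0) : orderOf (zet n) = n := (zet_prim hn).eq_orderOf.symm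

/-- The class of the standard cyclic cycle of order `n`. -/
def ell (n : ℕ) : Q3 ℂˣ Pt := q3 (lens (zet n) n)

lemma smul_ell {n : ℕ} (hn : n ≠ 0) : (n : ℤ) • ell n = 0 := by
  have := orderOf_smul_lens (h := zet n) (by rw [orderOf_zet hn]; omega)
  rwa [orderOf_zet hn] at this

lemma lens_mem_ell {g : ℂˣ} {n m : ℕ} (hn : n ≠ 0) (hg : g ^ n = 1) (hm : g ^ m = 1) :
    q3 (lens g m) ∈ AddSubgroup.zmultiples (ell n) := by
  have := lens_zpowers (h := zet n) (by rw [orderOf_zet hn]; omega) (g := g) (m := m) ?_ hm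
  · rwa [orderOf_zet hn] at this
  · have : NeZero n := ⟨hn⟩
    rw [(zet_prim hn).zpowers_eq]
    exact (_root_.mem_rootsOfUnity n g).2 hg

lemma ell_mem_left {n m : ℕ} (hn : n ≠ 0) (hm : m ≠ 0) :
    ell n ∈ AddSubgroup.zmultiples (ell (n * m)) :=
  lens_mem_ell (mul_ne_zero hn hm) (by rw [pow_mul, zet_pow hn, one_pow]) (zet_pow hn)

lemma ell_mem_right {n m : ℕ} (hn : n ≠ 0) (hm : m ≠ 0) :
    ell m ∈ AddSubgroup.zmultiples (ell (n * m)) := by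
  rw [mul_comm]; exact ell_mem_left hm hn

/-- A three-cycle of the torus is a combination of alternating cycles up to a multiple of a
cyclic cycle. -/
lemma exists_ell {x : FA ((ℂˣ × ℂˣ × ℂˣ) × Pt)} (hx : bd3 ℂˣ Pt x = 0) :
    ∃ (n : ℕ) (k : ℤ), n ≠ 0 ∧
      q3 x - k • ell n ∈ AddSubgroup.closure {q | ∃ t a b : ℂˣ, q = q3 (alt3 t a b)} := by
  have h := good_units x hx
  rw [cycSub, AddSubgroup.closure_union, AddSubgroup.mem_sup] at h
  obtain ⟨y, hy, z, hz, h⟩ := h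
  suffices ∃ (n : ℕ) (k : ℤ), n ≠ 0 ∧ z = k • ell n by
    obtain ⟨n, k, hn, rfl⟩ := this
    exact ⟨n, k, hn, by rwa [← h, add_sub_cancel_right]⟩
  clear h
  induction hz using AddSubgroup.closure_induction with
  | mem z hz =>
    obtain ⟨g, n, hn, hg, rfl⟩ := hz
    obtain ⟨k, hk⟩ := lens_mem_ell hn.ne' hg hg
    exact ⟨n, k, hn.ne', hk.symm⟩
  | zero => exact ⟨1, 0, one_ne_zero, (zero_smul _ _).symm⟩
  | add z z' _ _ h1 h2 =>
    obtain ⟨n, k, hn, rfl⟩ := h1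
    obtain ⟨m, l, hm, rfl⟩ := h2
    obtain ⟨i, hi⟩ := ell_mem_left hn hm
    obtain ⟨j, hj⟩ := ell_mem_right hn hm
    refine ⟨n * m, k * i + l * j, mul_ne_zero hn hm, ?_⟩
    rw [← hi, ← hj, add_smul, mul_smul, mul_smul]
  | neg z _ h1 =>
    obtain ⟨n, k, hn, rfl⟩ := h1
    exact ⟨n, -k, hn, (neg_smul _ _).symm⟩

/-- Three-cycles of the additive group are combinations of alternating cycles. -/
lemma exists_alt_add {x : FA ((Multiplicative ℂ × Multiplicative ℂ × Multiplicative ℂ) × Pt)}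
    (hx : bd3 _ Pt x = 0) :
    q3 x ∈ AddSubgroup.closure {q | ∃ t a b : Multiplicative ℂ, q = q3 (alt3 t a b)} := by
  have h := good_add x hx
  refine (AddSubgroup.closure_le _).2 ?_ h
  rintro q (hq | ⟨g, n, hn, hg, rfl⟩)
  · exact AddSubgroup.subset_closure hq
  · have h1 : g = 1 := by
      have h2 : (n : ℂ) * g.toAdd = 0 := by simpa using congrArg Multiplicative.toAdd hg
      rcases mul_eq_zero.1 h2 with h | h
      · exact absurd h (by exact_mod_cast hn.ne')
      · exact h
    have h3 := bd4_of (1 : Multiplicative ℂ) 1 1 1 pnt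
    simp only [mul_one, pt_smul, sub_self, zero_add] at h3
    have h4 : q3 (lens g n) = 0 := by
      simp only [lens, h1, one_pow, ← h3, map_sum, q3_bd4, Finset.sum_const_zero]
    rw [h4]
    exact zero_mem _

section Pow

/-- The additive group of complex numbers, written multiplicatively. -/
abbrev MC : Type := Multiplicative ℂ

/-- The functor induced by the `c`-th power map. -/
def powG (c : ℕ) (S : Type) : GFun MC (Triv S) MC (Triv S) :=
  GFun.mk' (powMonoidHom c) (fun s => s) fun _ _ => rfl

variable (c : ℕ)

lemma powG_pt1 (y : FA (MC × Pt)) : q1 ((powG c Unit).m1 y) = (c : ℤ) • q1 y := by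
  have : q1.comp (powG c Unit).m1 = (c : ℤ) • q1 := fa_ext fun ⟨g, s⟩ => by
    have := q1_of_pow g c
    rw [zpow_natCast] at this
    rw [AddMonoidHom.comp_apply, AddMonoidHom.smul_apply, pt_eq s, ← this]
    simp [powG, GFun.mk', pt_eq]
  exact DFunLike.congr_fun this y

lemma powG_pt2 {y : FA ((MC × MC) × Pt)} (hy : bd2 MC Pt y = 0) :
    q2 ((powG c Unit).m2 y) = (c ^ 2 : ℤ) • q2 y := by
  rw [GFun.q2_m2]
  have h := mem_commSub hy
  generalize q2 y = q at h ⊢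
  induction h using AddSubgroup.closure_induction with
  | mem z hz =>
    obtain ⟨p, rfl⟩ := hz
    change (powG c Unit).M2 (q2 (comm2 p.1 p.2)) = _ • q2 (comm2 p.1 p.2)
    rw [← q2_comm2_pow, ← GFun.q2_m2]
    have h' (x : (MC × MC) × Pt) : (powG c Unit).m2 (of x) =
        of ((x.1.1 ^ c, x.1.2 ^ c), x.2) := GFun.m2_of _ _ _ _
    simp only [comm2, map_sub, h']
  | zero => simp
  | add x y _ _ hx hy => rw [map_add, hx, hy, smul_add]
  | neg x _ hx => rw [map_neg, hx, smul_neg]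

lemma powG_pt3 {y : FA ((MC × MC × MC) × Pt)} (hy : bd3 MC Pt y = 0) :
    q3 ((powG c Unit).m3 y) = (c ^ 3 : ℤ) • q3 y := by
  rw [GFun.q3_m3]
  have h := exists_alt_add hy
  generalize q3 y = q at h ⊢
  induction h using AddSubgroup.closure_induction with
  | mem z hz =>
    obtain ⟨t, a, b, rfl⟩ := hz
    rw [← q3_alt3_pow, ← GFun.q3_m3]
    have := gh_alt3 (powMonoidHom c) t a b
    simp only [powMonoidHom_apply] at this
    rw [← this]
    rfl
  | zero => simp
  | add x y _ _ hx hy => rw [map_add, hx, hy, smul_add]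
  | neg x _ hx => rw [map_neg, hx, smul_neg]

variable {S : Type} {Γ : Type} [Group Γ]

/-- The inclusion of a point. -/
def incG (Γ : Type) [Group Γ] (s : Triv S) : GFun Γ Pt Γ (Triv S) :=
  GFun.mk' (MonoidHom.id Γ) (fun _ => s) fun _ _ => rfl

/-- The component of a chain at a point. -/
def cmpAt (P : Type) (s : Triv S) : FA (P × Triv S) →+ FA (P × Pt) :=
  FreeAbelianGroup.lift fun x => if x.2 = s then of (x.1, pnt) else 0

/-- The chain supported at a point. -/
def incAt (P : Type) (s : Triv S) : FA (P × Pt) →+ FA (P × Triv S) :=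
  FreeAbelianGroup.lift fun x => of (x.1, s)

lemma cmpAt_of (P : Type) (s s' : Triv S) (p : P) :
    cmpAt P s (of (p, s')) = if s' = s then of (p, pnt) else 0 := by
  simp [cmpAt]

lemma exists_sum_cmpAt {P : Type} (y : FA (P × Triv S)) :
    ∃ F : Finset (Triv S), y = ∑ s ∈ F, incAt P s (cmpAt P s y) := by
  suffices H : ∃ F : Finset (Triv S), ∀ F', F ⊆ F' → y = ∑ s ∈ F', incAt P s (cmpAt P s y) by
    obtain ⟨F, hF⟩ := H
    exact ⟨F, hF F le_rfl⟩
  induction y using FreeAbelianGroup.induction_on with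
  | zero => exact ⟨∅, fun _ _ => by simp⟩
  | of x =>
    obtain ⟨p, s⟩ := x
    refine ⟨{s}, fun F' h => ?_⟩
    rw [Finset.sum_eq_single_of_mem s (h (by simp))]
    · simp [cmpAt_of, incAt]
    · intro b _ hb
      rw [cmpAt_of, if_neg (Ne.symm hb), map_zero]
  | neg x h =>
    obtain ⟨F, hF⟩ := h
    refine ⟨F, fun F' h => ?_⟩
    conv_lhs => rw [hF F' h]
    simp
  | add x y hx hy =>
    obtain ⟨F, hF⟩ := hx
    obtain ⟨F₁, hF₁⟩ := hy
    refine ⟨F ∪ F₁, fun F' h => ?_⟩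
    conv_lhs => rw [hF F' (Finset.union_subset_left h), hF₁ F' (Finset.union_subset_right h)]
    simp [Finset.sum_add_distrib]

lemma bd2_cmpAt (s : Triv S) (y : FA ((Γ × Γ) × Triv S)) :
    bd2 Γ Pt (cmpAt _ s y) = cmpAt _ s (bd2 Γ (Triv S) y) := by
  have : (bd2 Γ Pt).comp (cmpAt _ s) = (cmpAt _ s).comp (bd2 Γ (Triv S)) :=
    fa_ext fun ⟨⟨a, b⟩, s'⟩ => by
      by_cases h : s' = s <;> simp [cmpAt_of, h, pt_eq]
  exact DFunLike.congr_fun this y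

lemma bd3_cmpAt (s : Triv S) (y : FA ((Γ × Γ × Γ) × Triv S)) :
    bd3 Γ Pt (cmpAt _ s y) = cmpAt _ s (bd3 Γ (Triv S) y) := by
  have : (bd3 Γ Pt).comp (cmpAt _ s) = (cmpAt _ s).comp (bd3 Γ (Triv S)) :=
    fa_ext fun ⟨⟨a, b, d⟩, s'⟩ => by
      by_cases h : s' = s <;> simp [cmpAt_of, h, pt_eq]
  exact DFunLike.congr_fun this y

lemma powG_incG (s : Triv S) :
    (powG c S).comp (incG MC s) = (incG MC s).comp (powG c Unit) := rfl

lemma powG_q1 (y : FA (MC × Triv S)) : q1 ((powG c S).m1 y) = (c : ℤ) • q1 y := by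
  obtain ⟨F, hF⟩ := exists_sum_cmpAt y
  rw [hF, map_sum, map_sum, map_sum, Finset.smul_sum]
  refine Finset.sum_congr rfl fun s _ => ?_
  change q1 ((powG c S).m1 ((incG MC s).m1 _)) = _ • q1 ((incG MC s).m1 _)
  rw [← GFun.m1_comp, powG_incG, GFun.m1_comp, GFun.q1_m1, powG_pt1, map_zsmul, ← GFun.q1_m1]

lemma powG_q2 {y : FA ((MC × MC) × Triv S)} (hy : bd2 MC _ y = 0) :
    q2 ((powG c S).m2 y) = (c ^ 2 : ℤ) • q2 y := by
  obtain ⟨F, hF⟩ := exists_sum_cmpAt y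
  rw [hF, map_sum, map_sum, map_sum, Finset.smul_sum]
  refine Finset.sum_congr rfl fun s _ => ?_
  change q2 ((powG c S).m2 ((incG MC s).m2 _)) = _ • q2 ((incG MC s).m2 _)
  rw [← GFun.m2_comp, powG_incG, GFun.m2_comp, GFun.q2_m2, powG_pt2, map_zsmul, ← GFun.q2_m2]
  rw [bd2_cmpAt, hy, map_zero]

lemma powG_q3 {y : FA ((MC × MC × MC) × Triv S)} (hy : bd3 MC _ y = 0) :
    q3 ((powG c S).m3 y) = (c ^ 3 : ℤ) • q3 y := by
  obtain ⟨F, hF⟩ := exists_sum_cmpAt y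
  rw [hF, map_sum, map_sum, map_sum, Finset.smul_sum]
  refine Finset.sum_congr rfl fun s _ => ?_
  change q3 ((powG c S).m3 ((incG MC s).m3 _)) = _ • q3 ((incG MC s).m3 _)
  rw [← GFun.m3_comp, powG_incG, GFun.m3_comp, GFun.q3_m3, powG_pt3, map_zsmul, ← GFun.q3_m3]
  rw [bd3_cmpAt, hy, map_zero]

end Pow

/-- The group of affine transformations `z ↦ t z + u` of the complex line. -/
@[ext] structure Aff where
  /-- The translation part. -/
  u : ℂ
  /-- The linear part. -/
  t : ℂˣ

namespace Aff

instance : Mul Aff := ⟨fun a b => ⟨a.u + a.t * b.u, a.t * b.t⟩⟩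

instance : One Aff := ⟨⟨0, 1⟩⟩

instance : Inv Aff := ⟨fun a => ⟨-(↑a.t⁻¹ * a.u), a.t⁻¹⟩⟩

@[simp] lemma mul_u (a b : Aff) : (a * b).u = a.u + a.t * b.u := rfl

@[simp] lemma mul_t (a b : Aff) : (a * b).t = a.t * b.t := rfl

@[simp] lemma one_u : (1 : Aff).u = 0 := rfl

@[simp] lemma one_t : (1 : Aff).t = 1 := rfl

@[simp] lemma inv_u (a : Aff) : a⁻¹.u = -(↑a.t⁻¹ * a.u) := rfl

@[simp] lemma inv_t (a : Aff) : a⁻¹.t = a.t⁻¹ := rfl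

instance : Group Aff :=
  Group.ofLeftAxioms (fun a b c => by ext <;> simp [mul_add, mul_assoc, add_assoc])
    (fun a => by ext <;> simp) (fun a => by ext <;> simp)

instance : MulAction Aff ℂˣ where
  smul b t := b.t * t
  one_smul t := one_mul t
  mul_smul a b t := mul_assoc a.t b.t t

lemma smul_def (b : Aff) (t : ℂˣ) : b • t = b.t * t := rfl

/-- The linear part, as a homomorphism. -/
def lin : Aff →* ℂˣ where
  toFun := t
  map_one' := rfl
  map_mul' _ _ := rfl

/-- The inclusion of the linear transformations. -/
def dil : ℂˣ →* Aff where
  toFun t := ⟨0, t⟩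
  map_one' := rfl
  map_mul' a b := by ext <;> simp

@[simp] lemma dil_u (a : ℂˣ) : (dil a).u = 0 := rfl

@[simp] lemma dil_t (a : ℂˣ) : (dil a).t = a := rfl

@[simp] lemma lin_apply (a : Aff) : lin a = a.t := rfl

/-- Conjugation by a linear transformation. -/
def conj (c : ℂ) : Aff →* Aff where
  toFun b := ⟨c * b.u, b.t⟩
  map_one' := by ext <;> simp
  map_mul' a b := by ext <;> simp; ring

@[simp] lemma conj_u (c : ℂ) (a : Aff) : (conj c a).u = c * a.u := rfl

@[simp] lemma conj_t (c : ℂ) (a : Aff) : (conj c a).t = a.t := rfl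

/-- The relation imposing no condition. -/
def rT : ℂˣ → ℂˣ → Prop := fun _ _ => True

instance : RInv Aff rT := ⟨fun _ _ _ _ => trivial⟩

instance : RExt rT := ⟨fun _ => ⟨1, fun _ _ => trivial⟩⟩

/-- A configuration space of `Aff`, on which it acts through its linear part. -/
abbrev Cf (n : ℕ) : Type := Conf rT n

lemma smul_congr {n : ℕ} {a b : Aff} (h : a.t = b.t) (s : Cf n) : a • s = b • s :=
  Conf.ext fun i => by simp [smul_def, h]

/-- The functor induced by an endomorphism preserving linear parts. -/
def tw (n : ℕ) (φ : Aff →* Aff) (h : ∀ b, (φ b).t = b.t) : GFun Aff (Cf n) Aff (Cf n) :=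
  GFun.mk' φ (fun s => s) fun _ _ => smul_congr (h _).symm _

section
variable (n : ℕ) (φ : Aff →* Aff) (h : ∀ b, (φ b).t = b.t)

lemma tw_m1_of (g : Aff) (s : Cf n) : (tw n φ h).m1 (of (g, s)) = of (φ g, s) := GFun.m1_of _ _ _

lemma tw_m2_of (g k : Aff) (s : Cf n) : (tw n φ h).m2 (of ((g, k), s)) = of ((φ g, φ k), s) :=
  GFun.m2_of _ _ _ _

lemma tw_m3_of (g k l : Aff) (s : Cf n) :
    (tw n φ h).m3 (of ((g, k, l), s)) = of ((φ g, φ k, φ l), s) :=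
  GFun.m3_of _ _ _ _ _

lemma tw_m0 (x : FA (Unit × Cf n)) : (tw n φ h).m0 x = x := by
  have : (tw n φ h).m0 = AddMonoidHom.id _ := fa_ext fun x => GFun.m0_of _ _ _
  exact DFunLike.congr_fun this x

lemma fb_tw1 (x : FA (Aff × Cf (n + 1))) :
    fb rT n _ ((tw (n + 1) φ h).m1 x) = (tw n φ h).m1 (fb rT n _ x) := by
  have : (fb rT n _).comp (tw (n + 1) φ h).m1 = (tw n φ h).m1.comp (fb rT n _) :=
    fa_ext fun ⟨g, s⟩ => by
      simp only [AddMonoidHom.comp_apply, tw_m1_of, fb_of, map_sum, map_zsmul]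
  exact DFunLike.congr_fun this x

lemma fb_tw2 (x : FA ((Aff × Aff) × Cf (n + 1))) :
    fb rT n _ ((tw (n + 1) φ h).m2 x) = (tw n φ h).m2 (fb rT n _ x) := by
  have : (fb rT n _).comp (tw (n + 1) φ h).m2 = (tw n φ h).m2.comp (fb rT n _) :=
    fa_ext fun ⟨⟨g, k⟩, s⟩ => by
      simp only [AddMonoidHom.comp_apply, tw_m2_of, fb_of, map_sum, map_zsmul]
  exact DFunLike.congr_fun this x

lemma fb_tw3 (x : FA ((Aff × Aff × Aff) × Cf (n + 1))) :
    fb rT n _ ((tw (n + 1) φ h).m3 x) = (tw n φ h).m3 (fb rT n _ x) := by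
  have : (fb rT n _).comp (tw (n + 1) φ h).m3 = (tw n φ h).m3.comp (fb rT n _) :=
    fa_ext fun ⟨⟨g, k, l⟩, s⟩ => by
      simp only [AddMonoidHom.comp_apply, tw_m3_of, fb_of, map_sum, map_zsmul]
  exact DFunLike.congr_fun this x

end

/-- Scaling of translations on chains. -/
def scl (n : ℕ) (c : ℕ) : GFun Aff (Cf n) Aff (Cf n) := tw n (conj c) fun _ => rfl

/-- Projection to the linear part on chains. -/
def prj (n : ℕ) : GFun Aff (Cf n) Aff (Cf n) := tw n (dil.comp lin) fun _ => rfl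

section
variable (n c : ℕ)

lemma fb_scl1 (x : FA (Aff × Cf (n + 1))) :
    fb rT n _ ((scl (n + 1) c).m1 x) = (scl n c).m1 (fb rT n _ x) := fb_tw1 ..

lemma fb_prj1 (x : FA (Aff × Cf (n + 1))) :
    fb rT n _ ((prj (n + 1)).m1 x) = (prj n).m1 (fb rT n _ x) := fb_tw1 ..

lemma fb_scl2 (x : FA ((Aff × Aff) × Cf (n + 1))) :
    fb rT n _ ((scl (n + 1) c).m2 x) = (scl n c).m2 (fb rT n _ x) := fb_tw2 ..

lemma fb_prj2 (x : FA ((Aff × Aff) × Cf (n + 1))) :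
    fb rT n _ ((prj (n + 1)).m2 x) = (prj n).m2 (fb rT n _ x) := fb_tw2 ..

lemma fb_scl3 (x : FA ((Aff × Aff × Aff) × Cf (n + 1))) :
    fb rT n _ ((scl (n + 1) c).m3 x) = (scl n c).m3 (fb rT n _ x) := fb_tw3 ..

lemma fb_prj3 (x : FA ((Aff × Aff × Aff) × Cf (n + 1))) :
    fb rT n _ ((prj (n + 1)).m3 x) = (prj n).m3 (fb rT n _ x) := fb_tw3 ..

lemma prj_m0 (x : FA (Unit × Cf n)) : (prj n).m0 x = x := tw_m0 ..

end

/-- Restriction to the stabilizer of a nonempty configuration. -/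
def toN (n : ℕ) : GFun Aff (Cf (n + 1)) MC (Triv (Cf (n + 1))) where
  obj s := dil (s.1 0)⁻¹ • s
  co b s := Multiplicative.ofAdd (b.u / (b.t * s.1 0))
  co_mul g h s := by
    rw [← ofAdd_add]
    congr 1
    simp only [mul_u, mul_t, Conf.smul_val, smul_def, Units.val_mul]
    have := g.t.ne_zero
    have := h.t.ne_zero
    have := (s.1 0).ne_zero
    field_simp
  obj_smul g s := by
    change dil _ • g • s = dil _ • s
    rw [← mul_smul]
    exact smul_congr (by simp [smul_def]) s

/-- Induction from the group of translations. -/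
def ofN (n : ℕ) : GFun MC (Triv (Cf (n + 1))) Aff (Cf (n + 1)) where
  obj s := s
  co b _ := ⟨b.toAdd, 1⟩
  co_mul g h s := by ext <;> simp
  obj_smul g s := by
    have h (s : Cf (n + 1)) : s = (⟨g.toAdd, 1⟩ : Aff) • s :=
      (one_smul Aff s).symm.trans (smul_congr rfl s)
    exact h s

lemma ofN_toN (n : ℕ) : GFun.IsNat (GFun.id _ _) ((ofN n).comp (toN n))
    fun s => dil (s.1 0)⁻¹ where
  obj s := rfl
  co g s := by
    ext
    · simp [GFun.comp, ofN, toN, GFun.id, Conf.smul_val, smul_def]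
      have := g.t.ne_zero
      have := (s.1 0).ne_zero
      field_simp
    · simp [GFun.comp, ofN, toN, GFun.id, Conf.smul_val, smul_def]

lemma scl_ofN (n c : ℕ) : (scl (n + 1) c).comp (ofN n) = (ofN n).comp (powG c _) := by
  refine GFun.mk.injEq .. |>.mpr ⟨rfl, ?_⟩
  ext g s
  · simp [ofN, scl, tw, GFun.mk', powG]
  · rfl

lemma q1_scl {n : ℕ} (c : ℕ) {x : FA (Aff × Cf (n + 1))} (hx : bd1 Aff _ x = 0) :
    q1 ((scl _ c).m1 x) = (c : ℤ) • q1 x := by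
  have h := (ofN_toN n).q1 hx
  rw [GFun.m1_id, GFun.m1_comp] at h
  rw [GFun.q1_m1, h, ← GFun.q1_m1, ← GFun.m1_comp, scl_ofN, GFun.m1_comp, GFun.q1_m1, powG_q1,
    map_zsmul, ← GFun.q1_m1]

lemma q2_scl {n : ℕ} (c : ℕ) {x : FA ((Aff × Aff) × Cf (n + 1))} (hx : bd2 Aff _ x = 0) :
    q2 ((scl _ c).m2 x) = (c ^ 2 : ℤ) • q2 x := by
  have h := (ofN_toN n).q2 hx
  rw [GFun.m2_id, GFun.m2_comp] at h
  rw [GFun.q2_m2, h, ← GFun.q2_m2, ← GFun.m2_comp, scl_ofN, GFun.m2_comp, GFun.q2_m2, powG_q2,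
    map_zsmul, ← GFun.q2_m2]
  rw [GFun.bd2_m2, hx, map_zero]

lemma q3_scl {n : ℕ} (c : ℕ) {x : FA ((Aff × Aff × Aff) × Cf (n + 1))} (hx : bd3 Aff _ x = 0) :
    q3 ((scl _ c).m3 x) = (c ^ 3 : ℤ) • q3 x := by
  have h := (ofN_toN n).q3 hx
  rw [GFun.m3_id, GFun.m3_comp] at h
  rw [GFun.q3_m3, h, ← GFun.q3_m3, ← GFun.m3_comp, scl_ofN, GFun.m3_comp, GFun.q3_m3, powG_q3,
    map_zsmul, ← GFun.q3_m3]
  rw [GFun.bd3_m3, hx, map_zero]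

lemma scl_zero {c : ℕ} (hc : c ≠ 0) : GFun.IsNat (GFun.id _ _) (scl 0 c)
    fun _ => dil (Units.mk0 c (Nat.cast_ne_zero.2 hc)) where
  obj s := Subsingleton.elim _ _
  co g s := by ext <;> simp [GFun.id, scl, tw, GFun.mk', mul_comm]

/-- The operator `x ↦ Θ x - m x` on one-chains. -/
def dl1 (n : ℕ) (c : ℕ) (m : ℤ) : FA (Aff × Cf n) →+ FA (Aff × Cf n) :=
  (scl n c).m1 - m • AddMonoidHom.id _

/-- The operator `x ↦ Θ x - m x` on two-chains. -/
def dl2 (n : ℕ) (c : ℕ) (m : ℤ) : FA ((Aff × Aff) × Cf n) →+ FA ((Aff × Aff) × Cf n) :=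
  (scl n c).m2 - m • AddMonoidHom.id _

/-- The operator `x ↦ Θ x - m x` on three-chains. -/
def dl3 (n : ℕ) (c : ℕ) (m : ℤ) :
    FA ((Aff × Aff × Aff) × Cf n) →+ FA ((Aff × Aff × Aff) × Cf n) :=
  (scl n c).m3 - m • AddMonoidHom.id _

section
variable (n c : ℕ) (m : ℤ)

lemma bd2_dl2 (x : FA ((Aff × Aff) × Cf n)) : bd2 _ _ (dl2 n c m x) = dl1 n c m (bd2 _ _ x) := by
  simp [dl1, dl2, GFun.bd2_m2]

lemma bd3_dl3 (x : FA ((Aff × Aff × Aff) × Cf n)) :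
    bd3 _ _ (dl3 n c m x) = dl2 n c m (bd3 _ _ x) := by
  simp [dl3, dl2, GFun.bd3_m3]

lemma fb_dl1 (x : FA (Aff × Cf (n + 1))) :
    fb rT n _ (dl1 (n + 1) c m x) = dl1 n c m (fb rT n _ x) := by
  simp [dl1, fb_scl1]

lemma fb_dl2 (x : FA ((Aff × Aff) × Cf (n + 1))) :
    fb rT n _ (dl2 (n + 1) c m x) = dl2 n c m (fb rT n _ x) := by
  simp [dl2, fb_scl2]

lemma fb_dl3 (x : FA ((Aff × Aff × Aff) × Cf (n + 1))) :
    fb rT n _ (dl3 (n + 1) c m x) = dl3 n c m (fb rT n _ x) := by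
  simp [dl3, fb_scl3]

end

section
variable {n : ℕ} (c : ℕ)

lemma exists_dl1 {x : FA (Aff × Cf (n + 1))} (hx : bd1 Aff _ x = 0) :
    ∃ b, bd2 Aff _ b = dl1 _ c c x :=
  q1_eq_zero.1 (by simp [dl1, q1_scl c hx])

lemma exists_dl2 {x : FA ((Aff × Aff) × Cf (n + 1))} (hx : bd2 Aff _ x = 0) :
    ∃ b, bd3 Aff _ b = dl2 _ c (c ^ 2) x :=
  q2_eq_zero.1 (by simp [dl2, q2_scl c hx])

lemma exists_dl3 {x : FA ((Aff × Aff × Aff) × Cf (n + 1))} (hx : bd3 Aff _ x = 0) :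
    ∃ b, bd4 Aff _ b = dl3 _ c (c ^ 3) x :=
  q3_eq_zero.1 (by simp [dl3, q3_scl c hx])

lemma q2_dl2 {c : ℕ} (hc : c ≠ 0) (m : ℤ) {x : FA ((Aff × Aff) × Cf 0)} (hx : bd2 Aff _ x = 0) :
    q2 (dl2 0 c m x) = (1 - m) • q2 x := by
  have := (scl_zero hc).q2 hx
  rw [GFun.m2_id] at this
  simp [dl2, ← this, sub_smul]

lemma q3_dl3 {c : ℕ} (hc : c ≠ 0) (m : ℤ) {x : FA ((Aff × Aff × Aff) × Cf 0)}
    (hx : bd3 Aff _ x = 0) : q3 (dl3 0 c m x) = (1 - m) • q3 x := by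
  have := (scl_zero hc).q3 hx
  rw [GFun.m3_id] at this
  simp [dl3, ← this, sub_smul]

end

lemma smul_q2_sub_prj {c : ℕ} (hc : c ≠ 0) {x : FA ((Aff × Aff) × Cf 0)} (hx : bd2 Aff _ x = 0) :
    ((1 - (c : ℤ) ^ 2) * (1 - (c : ℤ))) • (q2 x - q2 ((prj 0).m2 x)) = 0 := by
  obtain ⟨b20, h20⟩ := fb_surj (r := rT) x
  obtain ⟨b11, h11⟩ := fb_exact (r := rT) (x := bd2 Aff _ b20) (by rw [← bd2_fb, h20, hx])
  obtain ⟨a20, e20⟩ : ∃ a, a = b20 - (prj 1).m2 b20 := ⟨_, rfl⟩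
  obtain ⟨a11, e11⟩ : ∃ a, a = b11 - (prj 2).m1 b11 := ⟨_, rfl⟩
  have f20 : fb rT 0 _ a20 = x - (prj 0).m2 x := by
    rw [e20, map_sub, fb_prj2, h20]
  have f11 : fb rT 1 _ a11 = bd2 _ _ a20 := by
    rw [e11, map_sub, fb_prj1, h11, e20, map_sub, GFun.bd2_m2]
  have d11 : bd1 _ _ a11 = 0 := by
    rw [e11, map_sub, GFun.bd1_m1, prj_m0, sub_self]
  obtain ⟨b21, h21⟩ := exists_dl1 c d11
  obtain ⟨b30, h30⟩ := exists_dl2 c (x := dl2 _ c c a20 - fb rT _ _ b21) (by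
    rw [map_sub, bd2_dl2, bd2_fb, h21, fb_dl1, f11, sub_self])
  have key : bd3 _ _ (fb rT _ _ b30) = dl2 _ c (c ^ 2) (dl2 _ c c (x - (prj 0).m2 x)) := by
    rw [bd3_fb, h30, fb_dl2, map_sub, fb_fb, sub_zero, fb_dl2, f20]
  have hy : bd2 _ _ (x - (prj 0).m2 x) = 0 := by rw [map_sub, GFun.bd2_m2, hx, map_zero, sub_zero]
  have := congrArg q2 key
  rw [q2_bd3, q2_dl2 hc _ (by rw [bd2_dl2, hy, map_zero]), q2_dl2 hc _ hy, map_sub,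
    smul_smul] at this
  exact this.symm

lemma q2_prj {x : FA ((Aff × Aff) × Cf 0)} (hx : bd2 Aff _ x = 0) : q2 ((prj 0).m2 x) = q2 x := by
  have h2 := smul_q2_sub_prj (c := 2) (by simp) hx
  have h3 := smul_q2_sub_prj (c := 3) (by simp) hx
  norm_num at h2 h3
  have : (1 : ℤ) • (q2 x - q2 ((prj 0).m2 x)) = 0 := by
    rw [show (1 : ℤ) = 16 - 5 * 3 by norm_num, sub_smul, mul_smul, h2, h3]
    simp
  rw [one_smul, sub_eq_zero] at this
  exact this.symm

lemma smul_q3_sub_prj {c : ℕ} (hc : c ≠ 0) {x : FA ((Aff × Aff × Aff) × Cf 0)}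
    (hx : bd3 Aff _ x = 0) :
    ((1 - (c : ℤ) ^ 3) * ((1 - (c : ℤ) ^ 2) * (1 - (c : ℤ)))) • (q3 x - q3 ((prj 0).m3 x)) = 0 := by
  obtain ⟨b30, h30⟩ := fb_surj (r := rT) x
  obtain ⟨b21, h21⟩ := fb_exact (r := rT) (x := bd3 Aff _ b30) (by rw [← bd3_fb, h30, hx])
  obtain ⟨b12, h12⟩ := fb_exact (r := rT) (x := bd2 Aff _ b21) (by
    rw [← bd2_fb, h21, bd2_bd3])
  obtain ⟨a30, e30⟩ : ∃ a, a = b30 - (prj 1).m3 b30 := ⟨_, rfl⟩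
  obtain ⟨a21, e21⟩ : ∃ a, a = b21 - (prj 2).m2 b21 := ⟨_, rfl⟩
  obtain ⟨a12, e12⟩ : ∃ a, a = b12 - (prj 3).m1 b12 := ⟨_, rfl⟩
  have f30 : fb rT 0 _ a30 = x - (prj 0).m3 x := by
    rw [e30, map_sub, fb_prj3, h30]
  have f21 : fb rT 1 _ a21 = bd3 _ _ a30 := by
    rw [e21, map_sub, fb_prj2, h21, e30, map_sub, GFun.bd3_m3]
  have f12 : fb rT 2 _ a12 = bd2 _ _ a21 := by
    rw [e12, map_sub, fb_prj1, h12, e21, map_sub, GFun.bd2_m2]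
  have d12 : bd1 _ _ a12 = 0 := by
    rw [e12, map_sub, GFun.bd1_m1, prj_m0, sub_self]
  obtain ⟨b22, h22⟩ := exists_dl1 c d12
  obtain ⟨b31, h31⟩ := exists_dl2 c (x := dl2 _ c c a21 - fb rT _ _ b22) (by
    rw [map_sub, bd2_dl2, bd2_fb, h22, fb_dl1, f12, sub_self])
  obtain ⟨b40, h40⟩ := exists_dl3 c
    (x := dl3 _ c (c ^ 2) (dl3 _ c c a30) - fb rT _ _ b31) (by
      rw [map_sub, bd3_dl3, bd3_dl3, bd3_fb, h31, fb_dl2, map_sub, fb_fb, sub_zero, fb_dl2, f21,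
        sub_self])
  have key : bd4 _ _ (fb rT _ _ b40) =
      dl3 _ c (c ^ 3) (dl3 _ c (c ^ 2) (dl3 _ c c (x - (prj 0).m3 x))) := by
    rw [bd4_fb, h40, fb_dl3, map_sub, fb_fb, sub_zero, fb_dl3, fb_dl3, f30]
  have hy : bd3 _ _ (x - (prj 0).m3 x) = 0 := by rw [map_sub, GFun.bd3_m3, hx, map_zero, sub_zero]
  have := congrArg q3 key
  rw [q3_bd4, q3_dl3 hc _ (by rw [bd3_dl3, bd3_dl3, hy, map_zero, map_zero]),
    q3_dl3 hc _ (by rw [bd3_dl3, hy, map_zero]), q3_dl3 hc _ hy, map_sub, smul_smul, smul_smul,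
    mul_assoc] at this
  exact this.symm

lemma q3_prj {x : FA ((Aff × Aff × Aff) × Cf 0)} (hx : bd3 Aff _ x = 0) :
    q3 ((prj 0).m3 x) = q3 x := by
  have h2 := smul_q3_sub_prj (c := 2) (by simp) hx
  have h3 := smul_q3_sub_prj (c := 3) (by simp) hx
  norm_num at h2 h3
  have : (1 : ℤ) • (q3 x - q3 ((prj 0).m3 x)) = 0 := by
    rw [show (1 : ℤ) = 416 * 5 - 99 * 21 by norm_num, sub_smul, mul_comm (416 : ℤ), mul_smul,
      mul_smul]
    rw [h2, h3]; simp
  rw [one_smul, sub_eq_zero] at this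
  exact this.symm

end Aff

/-- The complex projective line. -/
inductive P1 : Type
  | inf : P1
  | fin (z : ℂ) : P1

namespace P1

/-- The first homogeneous coordinate. -/
def top : P1 → ℂ
  | inf => 1
  | fin z => z

/-- The second homogeneous coordinate. -/
def bot : P1 → ℂ
  | inf => 0
  | fin _ => 1

@[simp] lemma top_inf : top inf = 1 := rfl

@[simp] lemma bot_inf : bot inf = 0 := rfl

@[simp] lemma top_fin (z : ℂ) : top (fin z) = z := rfl

@[simp] lemma bot_fin (z : ℂ) : bot (fin z) = 1 := rfl

lemma bot_or_top (x : P1) : x.bot ≠ 0 ∨ x.top ≠ 0 := by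
  cases x <;> simp

/-- The point with given homogeneous coordinates. -/
def mkP (a b : ℂ) : P1 := if b = 0 then inf else fin (a / b)

/-- The factor between homogeneous coordinates and the normalized ones. -/
def sc (a b : ℂ) : ℂ := if b = 0 then a else b

lemma sc_mul_top {a b : ℂ} : sc a b * (mkP a b).top = a := by
  unfold sc mkP
  split_ifs with h
  · simp
  · simp [mul_div_cancel₀ _ h]

lemma sc_mul_bot {a b : ℂ} : sc a b * (mkP a b).bot = b := by
  unfold sc mkP
  split_ifs with h
  · simp [h]
  · simp

lemma mkP_smul {k : ℂ} (hk : k ≠ 0) (x : P1) : mkP (k * x.top) (k * x.bot) = x := by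
  cases x <;> simp [mkP, hk]

lemma sc_smul (k : ℂ) (x : P1) : sc (k * x.top) (k * x.bot) = k := by
  cases x <;> simp [sc]
  intro h; simp [h]

/-- The determinant of two points in normalized homogeneous coordinates. -/
def det (x y : P1) : ℂ := x.top * y.bot - y.top * x.bot

lemma det_ne_zero {x y : P1} (h : x ≠ y) : det x y ≠ 0 := by
  cases x <;> cases y <;> simp_all [det, sub_eq_zero]

/-- The Plücker relation. -/
lemma pluecker (a b c d : P1) : det a b * det c d - det a c * det b d + det a d * det b c = 0 := by
  simp only [det]; ring

end P1

section

open P1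

/-- The action of a matrix on the projective line. -/
def act (M : SL2C) (x : P1) : P1 :=
  mkP (M 0 0 * x.top + M 0 1 * x.bot) (M 1 0 * x.top + M 1 1 * x.bot)

/-- The automorphy factor of the action on the projective line. -/
def fac (M : SL2C) (x : P1) : ℂ :=
  sc (M 0 0 * x.top + M 0 1 * x.bot) (M 1 0 * x.top + M 1 1 * x.bot)

lemma fac_top (M : SL2C) (x : P1) :
    fac M x * (act M x).top = M 0 0 * x.top + M 0 1 * x.bot := sc_mul_top

lemma fac_bot (M : SL2C) (x : P1) :
    fac M x * (act M x).bot = M 1 0 * x.top + M 1 1 * x.bot := sc_mul_bot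

lemma sl_det (M : SL2C) : M 0 0 * M 1 1 - M 0 1 * M 1 0 = 1 := by
  rw [← Matrix.det_fin_two]; exact M.2

lemma fac_ne_zero (M : SL2C) (x : P1) : fac M x ≠ 0 := by
  intro h
  have h1 := fac_top M x
  have h2 := fac_bot M x
  rw [h, zero_mul] at h1 h2
  have hd := sl_det M
  rcases bot_or_top x with hx | hx
  · exact hx (by linear_combination M 0 0 * -h2 + M 1 0 * h1 - x.bot * hd)
  · exact hx (by linear_combination M 1 1 * -h1 + M 0 1 * h2 - x.top * hd)

lemma act_eq {M : SL2C} {x y : P1} {k : ℂ} (hk : k ≠ 0)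
    (h1 : M 0 0 * x.top + M 0 1 * x.bot = k * y.top)
    (h2 : M 1 0 * x.top + M 1 1 * x.bot = k * y.bot) : act M x = y ∧ fac M x = k := by
  unfold act fac
  rw [h1, h2]
  exact ⟨mkP_smul hk y, sc_smul k y⟩

lemma act_fac_mul (M N : SL2C) (x : P1) :
    act (M * N) x = act M (act N x) ∧ fac (M * N) x = fac M (act N x) * fac N x := by
  have a1 := fac_top N x
  have a2 := fac_bot N x
  have b1 := fac_top M (act N x)
  have b2 := fac_bot M (act N x)
  apply act_eq (mul_ne_zero (fac_ne_zero _ _) (fac_ne_zero _ _))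
  · simp only [Matrix.SpecialLinearGroup.coe_mul, Matrix.mul_apply, Fin.sum_univ_two]
    linear_combination -M 0 0 * a1 - M 0 1 * a2 - fac N x * b1
  · simp only [Matrix.SpecialLinearGroup.coe_mul, Matrix.mul_apply, Fin.sum_univ_two]
    linear_combination -M 1 0 * a1 - M 1 1 * a2 - fac N x * b2

lemma act_fac_center {M : SL2C} (h : M ∈ Subgroup.center SL2C) (x : P1) :
    act M x = x ∧ fac M x ^ 2 = 1 := by
  rw [Matrix.SpecialLinearGroup.mem_center_iff] at h
  obtain ⟨r, hr, h⟩ := h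
  rw [Fintype.card_fin] at hr
  have e (i j) : M i j = if i = j then r else 0 := by
    rw [← h, Matrix.scalar_apply, Matrix.diagonal_apply]
  have hr0 : r ≠ 0 := by rintro rfl; simp at hr
  obtain ⟨h1, h2⟩ := act_eq (M := M) (x := x) (y := x) hr0 (by simp [e]) (by simp [e])
  exact ⟨h1, by rw [h2, hr]⟩

lemma det_act (M : SL2C) (x y : P1) : fac M x * fac M y * det (act M x) (act M y) = det x y := by
  have a1 := fac_top M x
  have a2 := fac_bot M x
  have b1 := fac_top M y
  have b2 := fac_bot M y
  have hd := sl_det M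
  calc _ = (fac M x * (act M x).top) * (fac M y * (act M y).bot) -
      (fac M y * (act M y).top) * (fac M x * (act M x).bot) := by simp only [det]; ring
    _ = det x y := by
      rw [a1, a2, b1, b2]; simp only [det]
      linear_combination (x.top * y.bot - y.top * x.bot) * hd

/-- The action of `PSL(2,ℂ)` on the projective line. -/
def pact (g : PSL2C) (x : P1) : P1 :=
  Quotient.liftOn' g (fun M => act M x) fun M N h => by
    rw [QuotientGroup.leftRel_apply] at h
    have := (act_fac_mul M (M⁻¹ * N) x).1
    rw [mul_inv_cancel_left, (act_fac_center h x).1] at this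
    exact this.symm

/-- The square of the automorphy factor. -/
def pfac (g : PSL2C) (x : P1) : ℂˣ :=
  Quotient.liftOn' g (fun M => Units.mk0 (fac M x ^ 2) (pow_ne_zero 2 (fac_ne_zero M x)))
    fun M N h => by
      rw [QuotientGroup.leftRel_apply] at h
      have := (act_fac_mul M (M⁻¹ * N) x).2
      rw [mul_inv_cancel_left, (act_fac_center h x).1] at this
      ext
      simp only [Units.val_mk0]
      rw [this, mul_pow, (act_fac_center h x).2, mul_one]

instance : MulAction PSL2C P1 where
  smul := pact
  one_smul x := (act_eq (M := 1) one_ne_zero (by simp) (by simp)).1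
  mul_smul g h x := by
    induction g using QuotientGroup.induction_on
    induction h using QuotientGroup.induction_on
    exact (act_fac_mul _ _ x).1

lemma mk_smul (M : SL2C) (x : P1) : (M : PSL2C) • x = act M x := rfl

lemma pfac_mk (M : SL2C) (x : P1) : (pfac (M : PSL2C) x : ℂ) = fac M x ^ 2 := rfl

lemma pfac_mul (g h : PSL2C) (x : P1) : pfac (g * h) x = pfac g (h • x) * pfac h x := by
  induction g using QuotientGroup.induction_on
  induction h using QuotientGroup.induction_on
  ext
  rw [← QuotientGroup.mk_mul, pfac_mk, (act_fac_mul _ _ x).2, mul_pow]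
  rfl

lemma pfac_one (x : P1) : pfac 1 x = 1 := by
  have := pfac_mul 1 1 x
  rw [one_smul, mul_one] at this
  exact mul_eq_left.1 this.symm

/-- The squared determinant of two distinct points. -/
def sdet (x y : P1) : ℂˣ := if h : x = y then 1 else Units.mk0 (det x y ^ 2)
  (pow_ne_zero 2 (det_ne_zero h))

lemma sdet_val {x y : P1} (h : x ≠ y) : (sdet x y : ℂ) = det x y ^ 2 := by simp [sdet, h]

lemma sdet_smul (g : PSL2C) {x y : P1} (h : x ≠ y) :
    pfac g x * pfac g y * sdet (g • x) (g • y) = sdet x y := by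
  have h' : g • x ≠ g • y := fun e => h (MulAction.injective g e)
  induction g using QuotientGroup.induction_on
  ext
  rw [Units.val_mul, Units.val_mul, sdet_val h, sdet_val h', pfac_mk, pfac_mk, mk_smul, mk_smul,
    ← det_act _ x y]
  ring

/-- Pairs of a point of the projective line and a scalar. -/
@[ext] structure VP : Type where
  /-- The underlying point. -/
  pt : P1
  /-- The scalar. -/
  sc : ℂˣ

instance : MulAction PSL2C VP where
  smul g v := ⟨g • v.pt, pfac g v.pt * v.sc⟩
  one_smul v := by
    ext1
    · exact one_smul _ _
    · exact (congrArg (· * v.sc) (pfac_one _)).trans (one_mul _)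
  mul_smul g h v := by
    ext1
    · exact mul_smul _ _ _
    · exact (congrArg (· * v.sc) (pfac_mul _ _ _)).trans (mul_assoc _ _ _)

@[simp] lemma vp_smul_pt (g : PSL2C) (v : VP) : (g • v).pt = g • v.pt := rfl

@[simp] lemma vp_smul_sc (g : PSL2C) (v : VP) : (g • v).sc = pfac g v.pt * v.sc := rfl

/-- Points in general position in the projective line. -/
def rP : P1 → P1 → Prop := fun x y => x ≠ y

/-- Pairs with distinct underlying points. -/
def rV : VP → VP → Prop := fun x y => x.pt ≠ y.pt

instance : RInv PSL2C rP := ⟨fun g _ _ h e => h (MulAction.injective g e)⟩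

instance : RInv PSL2C rV := ⟨fun g _ _ h e => h (MulAction.injective g e)⟩

instance : Infinite P1 := Infinite.of_injective P1.fin fun _ _ h => by cases h; rfl

instance : RExt rP := ⟨fun F => by
  obtain ⟨y, hy⟩ := Infinite.exists_notMem_finset F
  exact ⟨y, fun x hx e => hy (e ▸ hx)⟩⟩

instance : RExt rV := ⟨fun F => by
  obtain ⟨y, hy⟩ := Infinite.exists_notMem_finset (F.image VP.pt)
  exact ⟨⟨y, 1⟩, fun x hx e => hy (Finset.mem_image.2 ⟨x, hx, e.symm⟩)⟩⟩

end

/-- A set of orbit representatives with a common stabilizer. -/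
structure Slice {Γ H S O : Type} [Group Γ] [MulAction Γ S] [Group H] (j : H →* Γ) (s : O → S) :
    Prop where
  inj : Function.Injective j
  fix : ∀ h o, j h • s o = s o
  surj : ∀ x, ∃ p : Γ × O, x = p.1 • s p.2
  stab : ∀ g o o', g • s o = s o' → o = o' ∧ ∃ h, j h = g

namespace Slice

variable {Γ H S O : Type} [Group Γ] [MulAction Γ S] [Group H] {j : H →* Γ} {s : O → S}
  (h : Slice j s)

/-- The induction functor from the stabilizer. -/
def ind : GFun H (Triv O) Γ S where
  obj := s
  co g _ := j g
  co_mul a b _ := j.map_mul a b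
  obj_smul g o := (h.fix g o).symm

/-- The group element moving a representative to a given point. -/
def mv (x : S) : Γ := (h.surj x).choose.1

/-- The representative of the orbit of a given point. -/
def rep (x : S) : O := (h.surj x).choose.2

lemma eq_mv (x : S) : x = h.mv x • s (h.rep x) := (h.surj x).choose_spec

lemma exists_co (g : Γ) (x : S) :
    h.rep x = h.rep (g • x) ∧ ∃ k, j k = (h.mv (g • x))⁻¹ * g * h.mv x := by
  apply h.stab
  rw [mul_smul, mul_smul, ← h.eq_mv, inv_smul_eq_iff, ← h.eq_mv]

/-- The restriction functor to the stabilizer. -/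
def res : GFun Γ S H (Triv O) where
  obj := h.rep
  co g x := (h.exists_co g x).2.choose
  co_mul a b x := by
    apply h.inj
    rw [map_mul, (h.exists_co _ _).2.choose_spec, (h.exists_co _ _).2.choose_spec,
      (h.exists_co _ _).2.choose_spec, mul_smul]
    group
  obj_smul g x := (h.exists_co g x).1.symm

lemma j_co (g : Γ) (x : S) : j (h.res.co g x) = (h.mv (g • x))⁻¹ * g * h.mv x :=
  (h.exists_co g x).2.choose_spec

lemma nat : GFun.IsNat (h.ind.comp h.res) (GFun.id Γ S) h.mv where
  obj x := h.eq_mv x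
  co g x := by
    change g * h.mv x = h.mv (g • x) * j (h.res.co g x)
    rw [j_co]
    group

lemma q1_ind {x : FA (Γ × S)} (hx : bd1 Γ S x = 0) : q1 (h.ind.m1 (h.res.m1 x)) = q1 x := by
  rw [← GFun.m1_comp, h.nat.q1 hx, GFun.m1_id]

lemma q2_ind {x : FA ((Γ × Γ) × S)} (hx : bd2 Γ S x = 0) :
    q2 (h.ind.m2 (h.res.m2 x)) = q2 x := by
  rw [← GFun.m2_comp, h.nat.q2 hx, GFun.m2_id]

lemma q3_ind {x : FA ((Γ × Γ × Γ) × S)} (hx : bd3 Γ S x = 0) :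
    q3 (h.ind.m3 (h.res.m3 x)) = q3 x := by
  rw [← GFun.m3_comp, h.nat.q3 hx, GFun.m3_id]

lemma exists_bd1 (x : FA (Unit × S)) :
    ∃ b, bd1 Γ S b = h.ind.m0 (h.res.m0 x) - x := by
  have e : (h.ind.comp h.res).m0 x - (GFun.id Γ S).m0 x = h.ind.m0 (h.res.m0 x) - x := by
    have h1 : (h.ind.comp h.res).m0 = h.ind.m0.comp h.res.m0 := fa_ext fun x => by
      rw [AddMonoidHom.comp_apply, GFun.m0_of, GFun.m0_of, GFun.m0_of]; rfl
    have h2 : (GFun.id Γ S).m0 = AddMonoidHom.id _ := fa_ext fun x => GFun.m0_of _ _ _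
    rw [h1, h2]; rfl
  exact ⟨_, (h.nat.hom0 x).trans e⟩

end Slice

lemma exists_bd2_trivial {x : FA (Unit × Pt)} : ∃ b, bd2 Unit Pt b = x := by
  induction x using FreeAbelianGroup.induction_on with
  | zero => exact ⟨0, map_zero _⟩
  | of x =>
    obtain ⟨⟨⟩, s⟩ := x
    exact ⟨of (((), ()), s), by simp [pt_eq]⟩
  | neg x h => obtain ⟨b, hb⟩ := h; exact ⟨-b, by rw [map_neg, hb]⟩
  | add x y hx hy =>
    obtain ⟨b, hb⟩ := hx
    obtain ⟨b', hb'⟩ := hy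
    exact ⟨b + b', by rw [map_add, hb, hb']⟩

/-- An upper triangular matrix. -/
def bor (s : ℂˣ) (u : ℂ) : SL2C := ⟨!![(s : ℂ), u * (s⁻¹ : ℂˣ); 0, (s⁻¹ : ℂˣ)], by simp⟩

lemma bor_mul (s s' : ℂˣ) (u u' : ℂ) :
    bor s u * bor s' u' = bor (s * s') (u + (s ^ 2 : ℂˣ) * u') := by
  have := s.ne_zero
  have := s'.ne_zero
  ext i j
  change ((bor s u).1 * (bor s' u').1) i j = _
  rw [Matrix.mul_apply, Fin.sum_univ_two]
  fin_cases i <;> fin_cases j <;> simp [bor]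
  · field_simp
    ring
  · ring

lemma bor_congr {s s' : ℂˣ} (h : s ^ 2 = s' ^ 2) (u : ℂ) :
    (bor s u : PSL2C) = (bor s' u : PSL2C) := by
  rcases sq_eq_sq_iff_eq_or_eq_neg.1 (congrArg Units.val h) with h | h
  · rw [Units.ext h]
  · rw [QuotientGroup.eq, Matrix.SpecialLinearGroup.mem_center_iff]
    refine ⟨-1, by simp, ?_⟩
    have h2 : bor s' u = bor s u * -1 := by
      ext i j
      rw [mul_neg, mul_one]
      change _ = (-(bor s u).1) i j
      rw [Matrix.neg_apply]
      fin_cases i <;> fin_cases j <;> simp [bor, h, inv_neg]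
    rw [h2, inv_mul_cancel_left]
    ext i j
    fin_cases i <;> fin_cases j <;> simp

lemma exists_sq (t : ℂˣ) : ∃ s : ℂˣ, s ^ 2 = t := by
  obtain ⟨s, hs⟩ := IsAlgClosed.exists_pow_nat_eq (t : ℂ) (n := 2) (by simp)
  have : s ≠ 0 := by rintro rfl; exact t.ne_zero (by simpa using hs.symm)
  exact ⟨Units.mk0 s this, Units.ext hs⟩

/-- The inclusion of the affine group as the stabilizer of the point at infinity. -/
def jB : Aff →* PSL2C where
  toFun b := (bor (exists_sq b.t).choose b.u : PSL2C)
  map_one' := by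
    have h := bor_congr (s := (exists_sq 1).choose) (s' := 1)
      ((exists_sq 1).choose_spec.trans (one_pow 2).symm) 0
    refine h.trans ?_
    have : bor 1 0 = 1 := by ext i j; fin_cases i <;> fin_cases j <;> simp [bor]
    rw [this]; rfl
  map_mul' a b := by
    rw [← QuotientGroup.mk_mul, bor_mul, (exists_sq a.t).choose_spec]
    apply bor_congr
    rw [mul_pow, (exists_sq _).choose_spec, (exists_sq _).choose_spec, (exists_sq _).choose_spec]
    rfl

lemma jB_eq (b : Aff) {s : ℂˣ} (h : s ^ 2 = b.t) : jB b = (bor s b.u : PSL2C) :=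
  bor_congr ((exists_sq b.t).choose_spec.trans h.symm) _

lemma jB_inf (b : Aff) : jB b • P1.inf = P1.inf ∧ pfac (jB b) P1.inf = b.t := by
  obtain ⟨s, hs⟩ := exists_sq b.t
  obtain ⟨h1, h2⟩ := act_eq (M := bor s b.u) (x := P1.inf) (y := P1.inf) (k := s) s.ne_zero
    (by simp [bor]) (by simp [bor])
  rw [jB_eq b hs]
  exact ⟨h1, by ext; rw [pfac_mk, h2, ← hs]; simp⟩

lemma jB_fin (b : Aff) (z : ℂ) :
    jB b • P1.fin z = P1.fin (b.t * z + b.u) ∧ pfac (jB b) (P1.fin z) = b.t⁻¹ := by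
  obtain ⟨s, hs⟩ := exists_sq b.t
  have := s.ne_zero
  obtain ⟨h1, h2⟩ := act_eq (M := bor s b.u) (x := P1.fin z) (y := P1.fin (b.t * z + b.u))
    (k := (s⁻¹ : ℂˣ)) (s⁻¹).ne_zero
    (by simp [bor, ← hs]; field_simp) (by simp [bor])
  rw [jB_eq b hs]
  exact ⟨h1, by ext; rw [pfac_mk, h2, ← hs]; simp⟩

lemma jB_injective : Function.Injective jB := by
  rw [injective_iff_map_eq_one]
  intro b hb
  have h0 := (jB_fin b 0).1
  have h1 := (jB_fin b 1).1
  rw [hb, one_smul] at h0 h1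
  injection h0 with h0
  injection h1 with h1
  ext
  · simpa using h0.symm
  · have : b.u = 0 := by simpa using h0.symm
    simpa [this] using h1.symm

lemma exists_jB {g : PSL2C} (h : g • P1.inf = P1.inf) : ∃ b, jB b = g := by
  induction g using QuotientGroup.induction_on with
  | H M =>
  have h2 := fac_bot M P1.inf
  rw [mk_smul] at h
  rw [h] at h2
  have h10 : M 1 0 = 0 := by simpa using h2.symm
  have hd := sl_det M
  rw [h10, mul_zero, sub_zero] at hd
  have h0 : M 0 0 ≠ 0 := left_ne_zero_of_mul_eq_one hd
  refine ⟨⟨M 0 1 * M 0 0, Units.mk0 (M 0 0) h0 ^ 2⟩, ?_⟩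
  rw [jB_eq _ rfl]
  congr 1
  ext i j
  fin_cases i <;> fin_cases j <;> simp [bor, h0, h10]
  exact (eq_inv_of_mul_eq_one_right hd).symm

lemma exists_smul_inf (x : P1) : ∃ g : PSL2C, g • P1.inf = x := by
  cases x with
  | inf => exact ⟨1, one_smul _ _⟩
  | fin z =>
    let M : SL2C := ⟨!![z, -1; 1, 0], by simp⟩
    exact ⟨(M : PSL2C), (act_eq (M := M) one_ne_zero (by simp [M]) (by simp [M])).1⟩

lemma exists_smul_pair {x y : P1} (h : x ≠ y) :
    ∃ g : PSL2C, g • P1.inf = x ∧ g • P1.fin 0 = y := by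
  obtain ⟨g, rfl⟩ := exists_smul_inf x
  cases hy : g⁻¹ • y with
  | inf => rw [inv_smul_eq_iff] at hy; exact absurd hy.symm h
  | fin z =>
    rw [inv_smul_eq_iff] at hy
    refine ⟨g * jB ⟨z, 1⟩, ?_, ?_⟩
    · rw [mul_smul, (jB_inf _).1]
    · rw [mul_smul, (jB_fin _ _).1, hy]; simp

lemma exists_smul_triple {x y z : P1} (h : x ≠ y) (h' : x ≠ z) (h'' : y ≠ z) :
    ∃ g : PSL2C, g • P1.inf = x ∧ g • P1.fin 0 = y ∧ g • P1.fin 1 = z := by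
  obtain ⟨g, rfl, rfl⟩ := exists_smul_pair h
  cases hz : g⁻¹ • z with
  | inf => rw [inv_smul_eq_iff] at hz; exact absurd hz.symm h'
  | fin w =>
    rw [inv_smul_eq_iff] at hz
    have hw : w ≠ 0 := by rintro rfl; exact h'' hz.symm
    refine ⟨g * jB ⟨0, Units.mk0 w hw⟩, ?_, ?_, ?_⟩
    · rw [mul_smul, (jB_inf _).1]
    · rw [mul_smul, (jB_fin _ _).1]; simp
    · rw [mul_smul, (jB_fin _ _).1, hz]; simp

/-- The inclusion of the diagonal torus. -/
def jT : ℂˣ →* PSL2C := jB.comp Aff.dil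

lemma jT_inf (t : ℂˣ) : jT t • P1.inf = P1.inf ∧ pfac (jT t) P1.inf = t := jB_inf _

lemma jT_fin (t : ℂˣ) (z : ℂ) :
    jT t • P1.fin z = P1.fin (t * z) ∧ pfac (jT t) (P1.fin z) = t⁻¹ := by
  have := jB_fin (Aff.dil t) z
  rw [Aff.dil_t, Aff.dil_u, add_zero] at this
  exact this

lemma jT_injective : Function.Injective jT :=
  jB_injective.comp fun a b h => by simpa using congrArg Aff.t h

lemma exists_jT {g : PSL2C} (h : g • P1.inf = P1.inf) (h' : g • P1.fin 0 = P1.fin 0) :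
    ∃ b, jT b = g := by
  obtain ⟨b, rfl⟩ := exists_jB h
  rw [(jB_fin _ _).1] at h'
  injection h' with h'
  refine ⟨b.t, congrArg jB ?_⟩
  ext
  · simpa using h'.symm
  · rfl

lemma eq_one_of_triple {g : PSL2C} (h : g • P1.inf = P1.inf) (h' : g • P1.fin 0 = P1.fin 0)
    (h'' : g • P1.fin 1 = P1.fin 1) : g = 1 := by
  obtain ⟨b, rfl⟩ := exists_jT h h'
  rw [(jT_fin _ _).1] at h''
  injection h'' with h''
  rw [mul_one] at h''
  rw [show b = 1 from Units.ext h'', map_one]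

section Stair

variable {Γ Y : Type} [Group Γ] [MulAction Γ Y] {r : Y → Y → Prop} [RInv Γ r]

variable (Γ) in
/-- A zigzag in the double complex from a three-cycle to a chain of four-point configurations. -/
structure Stair (z : FA ((Γ × Γ × Γ) × Conf r 0)) (a30 : FA ((Γ × Γ × Γ) × Conf r 1))
    (a21 : FA ((Γ × Γ) × Conf r 2)) (a12 : FA (Γ × Conf r 3)) (a03 : FA (Unit × Conf r 4)) :
    Prop where
  h30 : fb r 0 _ a30 = z
  h21 : fb r 1 _ a21 = bd3 Γ _ a30
  h12 : fb r 2 _ a12 = bd2 Γ _ a21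
  h03 : fb r 3 _ a03 = bd1 Γ _ a12

variable (Γ) in
/-- The relation between a three-cycle and the final chains of its zigzags. -/
def StairRel (z : FA ((Γ × Γ × Γ) × Conf r 0)) (a : FA (Unit × Conf r 4)) : Prop :=
  ∃ a30 a21 a12, Stair Γ z a30 a21 a12 a

variable [RExt r]

lemma StairRel.exists {z : FA ((Γ × Γ × Γ) × Conf r 0)} (hz : bd3 Γ _ z = 0) :
    ∃ a, StairRel Γ z a := by
  obtain ⟨a30, h30⟩ := fb_surj z
  obtain ⟨a21, h21⟩ := fb_exact (x := bd3 Γ _ a30) (by rw [← bd3_fb, h30, hz])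
  obtain ⟨a12, h12⟩ := fb_exact (x := bd2 Γ _ a21) (by rw [← bd2_fb, h21, bd2_bd3])
  obtain ⟨a03, h03⟩ := fb_exact (x := bd1 Γ _ a12) (by rw [← bd1_fb, h12, bd1_bd2])
  exact ⟨a03, a30, a21, a12, h30, h21, h12, h03⟩

omit [RExt r] in
lemma StairRel.sub {z z' : FA ((Γ × Γ × Γ) × Conf r 0)} {a a' : FA (Unit × Conf r 4)} :
    StairRel Γ z a → StairRel Γ z' a' → StairRel Γ (z - z') (a - a') := by
  rintro ⟨b, c, d, h⟩ ⟨b', c', d', h'⟩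
  refine ⟨b - b', c - c', d - d', ?_, ?_, ?_, ?_⟩
  · rw [map_sub, h.h30, h'.h30]
  · rw [map_sub, map_sub, h.h21, h'.h21]
  · rw [map_sub, map_sub, h.h12, h'.h12]
  · rw [map_sub, map_sub, h.h03, h'.h03]

omit [RExt r] in
lemma StairRel.zero : StairRel Γ (r := r) 0 0 :=
  ⟨0, 0, 0, by simp only [map_zero], by simp only [map_zero], by simp only [map_zero],
    by simp only [map_zero]⟩

omit [RExt r] in
lemma StairRel.add {z z' : FA ((Γ × Γ × Γ) × Conf r 0)} {a a' : FA (Unit × Conf r 4)}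
    (h : StairRel Γ z a) (h' : StairRel Γ z' a') : StairRel Γ (z + z') (a + a') := by
  simpa using h.sub (StairRel.zero.sub h')

lemma StairRel.uniq {z : FA ((Γ × Γ × Γ) × Conf r 0)} {a : FA (Unit × Conf r 4)}
    (h : StairRel Γ z a) (hz : q3 z = 0) : ∃ b c, a = bd1 Γ _ b + fb r 4 _ c := by
  obtain ⟨a30, a21, a12, h⟩ := h
  obtain ⟨y, hy⟩ := q3_eq_zero.1 hz
  obtain ⟨y', rfl⟩ := fb_surj y
  obtain ⟨c, hc⟩ := fb_exact (x := a30 - bd4 Γ _ y')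
    (by rw [map_sub, h.h30, ← bd4_fb, hy, sub_self])
  obtain ⟨d, hd⟩ := fb_exact (x := a21 - bd3 Γ _ c)
    (by rw [map_sub, h.h21, ← bd3_fb, hc, map_sub, bd3_bd4, sub_zero, sub_self])
  obtain ⟨e, he⟩ := fb_exact (x := a12 - bd2 Γ _ d)
    (by rw [map_sub, h.h12, ← bd2_fb, hd, map_sub, bd2_bd3, sub_zero, sub_self])
  obtain ⟨f, hf⟩ := fb_exact (x := a - bd1 Γ _ e)
    (by rw [map_sub, h.h03, ← bd1_fb, he, map_sub, bd1_bd2, sub_zero, sub_self])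
  exact ⟨e, f, by rw [hf]; abel⟩

/-- The homomorphism on three-cycles induced by an invariant of four-point configurations. -/
def stairHom {Q : Type*} [AddCommGroup Q] (ψ : FA (Unit × Conf r 4) →+ Q)
    (h1 : ∀ b, ψ (bd1 Γ _ b) = 0) (h2 : ∀ c, ψ (fb r 4 _ c) = 0) :
    (bd3 Γ (Conf r 0)).ker →+ Q :=
  AddMonoidHom.mk' (fun z => ψ (StairRel.exists z.2).choose) fun z z' => by
    have h := ((StairRel.exists (z + z').2).choose_spec.sub
      ((StairRel.exists z.2).choose_spec.add (StairRel.exists z'.2).choose_spec))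
    obtain ⟨b, c, e⟩ := h.uniq (by rw [AddSubgroup.coe_add, sub_self, map_zero])
    rw [← map_add, ← sub_eq_zero, ← map_sub, e, map_add, h1, h2, add_zero]

lemma stairHom_eq {Q : Type*} [AddCommGroup Q] {ψ : FA (Unit × Conf r 4) →+ Q}
    (h1 : ∀ b, ψ (bd1 Γ _ b) = 0) (h2 : ∀ c, ψ (fb r 4 _ c) = 0)
    (z : (bd3 Γ (Conf r 0)).ker) {a z'} (h : StairRel Γ z' a) (hq : q3 (z : FA _) = q3 z') :
    stairHom ψ h1 h2 z = ψ a := by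
  obtain ⟨b, c, e⟩ := ((StairRel.exists z.2).choose_spec.sub h).uniq
    (by rw [map_sub, hq, sub_self])
  change ψ (StairRel.exists z.2).choose = _
  rw [← sub_eq_zero, ← map_sub, e, map_add, h1, h2, add_zero]

end Stair

section Map

variable {Y Y' : Type} {r : Y → Y → Prop} {r' : Y' → Y' → Prop}

/-- The map of configurations induced by a map of points. -/
def Conf.map (f : Y → Y') (hf : ∀ x y, r x y → r' (f x) (f y)) {n : ℕ} (c : Conf r n) :
    Conf r' n := ⟨fun i => f (c.1 i), fun i j h => hf _ _ (c.2 i j h)⟩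

end Map

/-- The standard flag of one point. -/
def flag1 : Conf rP 1 := ⟨![P1.inf], fun i j h => by omega⟩

/-- The standard flag of two points. -/
def flag2 : Conf rP 2 :=
  ⟨![P1.inf, P1.fin 0], fun i j h => by fin_cases i <;> fin_cases j <;> simp_all [rP]⟩

/-- The standard flag of three points. -/
def flag3 : Conf rP 3 :=
  ⟨![P1.inf, P1.fin 0, P1.fin 1], fun i j h => by
    fin_cases i <;> fin_cases j <;> simp_all [rP]⟩

/-- The standard configuration with a given cross ratio. -/
def flag4 (z : RegT) : Conf rP 4 :=
  ⟨![P1.inf, P1.fin 0, P1.fin z.1, P1.fin 1], fun i j h => by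
    have h0 := z.2.1
    have h1 := z.2.2
    fin_cases i <;> fin_cases j <;> simp_all [rP, Ne.symm h0]⟩

lemma slice1 : Slice jB (fun _ : Unit => flag1) where
  inj := jB_injective
  fix h _ := by
    ext i
    fin_cases i
    exact (jB_inf h).1
  surj x := by
    obtain ⟨g, hg⟩ := exists_smul_inf (x.1 0)
    refine ⟨(g, ()), ?_⟩
    ext i
    fin_cases i
    exact hg.symm
  stab g _ _ h := ⟨rfl, exists_jB (congrArg (fun c : Conf rP 1 => c.1 0) h)⟩

lemma slice2 : Slice jT (fun _ : Unit => flag2) where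
  inj := jT_injective
  fix h _ := by
    ext i
    fin_cases i
    · exact (jT_inf h).1
    · exact ((jT_fin h 0).1).trans (by rw [mul_zero]; rfl)
  surj x := by
    obtain ⟨g, hg, hg'⟩ := exists_smul_pair (x.2 0 1 (by decide))
    refine ⟨(g, ()), ?_⟩
    ext i
    fin_cases i
    exacts [hg.symm, hg'.symm]
  stab g _ _ h := ⟨rfl, exists_jT (congrArg (fun c : Conf rP 2 => c.1 0) h)
    (congrArg (fun c : Conf rP 2 => c.1 1) h)⟩

lemma slice3 : Slice (1 : Unit →* PSL2C) (fun _ : Unit => flag3) where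
  inj := Function.injective_of_subsingleton _
  fix h _ := one_smul _ _
  surj x := by
    obtain ⟨g, hg, hg', hg''⟩ := exists_smul_triple (x.2 0 1 (by decide)) (x.2 0 2 (by decide))
      (x.2 1 2 (by decide))
    refine ⟨(g, ()), ?_⟩
    ext i
    fin_cases i
    exacts [hg.symm, hg'.symm, hg''.symm]
  stab g _ _ h := ⟨rfl, (), (eq_one_of_triple (congrArg (fun c : Conf rP 3 => c.1 0) h)
    (congrArg (fun c : Conf rP 3 => c.1 1) h) (congrArg (fun c : Conf rP 3 => c.1 2) h)).symm⟩

lemma slice4 : Slice (1 : Unit →* PSL2C) (fun z : RegT => flag4 z) where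
  inj := Function.injective_of_subsingleton _
  fix h _ := one_smul _ _
  surj x := by
    obtain ⟨g, hg, hg', hg''⟩ := exists_smul_triple (x.2 0 1 (by decide)) (x.2 0 3 (by decide))
      (x.2 1 3 (by decide))
    cases hz : g⁻¹ • x.1 2 with
    | inf =>
      rw [inv_smul_eq_iff] at hz
      exact absurd (hg.symm.trans hz.symm) (x.2 0 2 (by decide))
    | fin z =>
      rw [inv_smul_eq_iff] at hz
      refine ⟨(g, ⟨z, ?_, ?_⟩), ?_⟩
      · rintro rfl
        exact x.2 1 2 (by decide) (hg'.symm.trans hz.symm)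
      · rintro rfl
        exact x.2 2 3 (by decide) (hz.trans hg'')
      · ext i
        fin_cases i
        exacts [hg.symm, hg'.symm, hz, hg''.symm]
  stab g z z' h := by
    have h2 : g • P1.fin z.1 = P1.fin z'.1 := congrArg (fun c : Conf rP 4 => c.1 2) h
    have h1 := eq_one_of_triple (congrArg (fun c : Conf rP 4 => c.1 0) h)
      (congrArg (fun c : Conf rP 4 => c.1 1) h) (congrArg (fun c : Conf rP 4 => c.1 3) h)
    rw [h1, one_smul] at h2
    injection h2 with h2
    exact ⟨Subtype.ext h2, (), h1.symm⟩

/-- The cross ratio of four distinct points. -/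
def crs (c : Conf rP 4) : RegT := slice4.rep c

lemma crs_flag4 (z : RegT) : crs (flag4 z) = z :=
  ((slice4.stab _ _ _ (slice4.eq_mv (flag4 z)).symm).1)

lemma crs_smul (g : PSL2C) (c : Conf rP 4) : crs (g • c) = crs c := (slice4.exists_co g c).1.symm

lemma Conf.det_ne {n : ℕ} (c : Conf rP n) {i j : Fin n} (h : i < j) :
    P1.det (c.1 i) (c.1 j) ≠ 0 := P1.det_ne_zero (c.2 i j h)

lemma crs_eq (c : Conf rP 4) : (crs c).1 =
    P1.det (c.1 1) (c.1 2) * P1.det (c.1 0) (c.1 3) /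
      (P1.det (c.1 0) (c.1 2) * P1.det (c.1 1) (c.1 3)) := by
  have e : c = slice4.mv c • flag4 (crs c) := slice4.eq_mv c
  rw [eq_div_iff (mul_ne_zero (c.det_ne (by decide)) (c.det_ne (by decide)))]
  generalize crs c = z at e
  generalize slice4.mv c = g at e
  induction g using QuotientGroup.induction_on with
  | H M =>
  have e' : ∀ i, c.1 i = act M ((flag4 z).1 i) := fun i => congrArg (fun c : Conf rP 4 => c.1 i) e
  have h (i j) : fac M ((flag4 z).1 i) * fac M ((flag4 z).1 j) * P1.det (c.1 i) (c.1 j) =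
      P1.det ((flag4 z).1 i) ((flag4 z).1 j) := by rw [e', e', det_act]
  have hf (i) := fac_ne_zero M ((flag4 z).1 i)
  rw [← mul_right_inj' (mul_ne_zero (mul_ne_zero (hf 0) (hf 1)) (mul_ne_zero (hf 2) (hf 3)))]
  have e1 : ∀ a b c d p q r s : ℂ, (a * b) * (c * d) * (p * (q * r)) =
      p * ((a * c * q) * (b * d * r)) :=
    fun a b c d p q r s => by ring
  have e2 : ∀ a b c d q r : ℂ, (a * b) * (c * d) * (q * r) = ((b * c * q) * (a * d * r)) :=
    fun a b c d q r => by ring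
  rw [e1 _ _ _ _ _ _ _ 0, e2, h, h, h, h]
  simp [flag4, P1.det]

lemma one_sub_crs (c : Conf rP 4) : 1 - (crs c).1 =
    P1.det (c.1 0) (c.1 1) * P1.det (c.1 2) (c.1 3) /
      (P1.det (c.1 0) (c.1 2) * P1.det (c.1 1) (c.1 3)) := by
  have h := mul_ne_zero (c.det_ne (i := 0) (j := 2) (by decide))
    (c.det_ne (i := 1) (j := 3) (by decide))
  rw [crs_eq, eq_div_iff h, sub_mul, div_mul_cancel₀ _ h]
  linear_combination - P1.pluecker (c.1 0) (c.1 1) (c.1 2) (c.1 3)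

/-- The class in the pre-Bloch group of a chain of four-point configurations. -/
def kcr : FA (Unit × Conf rP 4) →+ PreBloch :=
  FreeAbelianGroup.lift fun x => QuotientAddGroup.mk (of (crs x.2))

@[simp] lemma kcr_of (x : Unit × Conf rP 4) :
    kcr (of x) = (QuotientAddGroup.mk (of (crs x.2)) : PreBloch) :=
  FreeAbelianGroup.lift_apply_of _ _

lemma kcr_bd1 (b : FA (PSL2C × Conf rP 4)) : kcr (bd1 PSL2C _ b) = 0 := by
  refine DFunLike.congr_fun (f := kcr.comp (bd1 PSL2C _)) (g := 0) (fa_ext fun ⟨g, c⟩ => ?_) b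
  simp [crs_smul]

lemma crs_face {c : Conf rP 5} {x y : ℂ} (hx : (crs (c.face 0)).1 = x)
    (hy : (crs (c.face 1)).1 = y) :
    x ≠ y ∧ (crs (c.face 2)).1 = y / x ∧ (crs (c.face 3)).1 = (1 - x⁻¹) / (1 - y⁻¹) ∧
      (crs (c.face 4)).1 = (1 - x) / (1 - y) := by
  have h (i j : Fin 5) (hij : i < j) := c.det_ne hij
  have h01 := h 0 1 (by decide)
  have h02 := h 0 2 (by decide)
  have h03 := h 0 3 (by decide)
  have h04 := h 0 4 (by decide)
  have h12 := h 1 2 (by decide)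
  have h13 := h 1 3 (by decide)
  have h14 := h 1 4 (by decide)
  have h23 := h 2 3 (by decide)
  have h24 := h 2 4 (by decide)
  have h34 := h 3 4 (by decide)
  have hx' := one_sub_crs (c.face 0)
  have hy' := one_sub_crs (c.face 1)
  have hx0 := (crs (c.face 0)).2
  have hy0 := (crs (c.face 1)).2
  have h2 : (crs (c.face 2)).1 = y / x := by
    rw [← hx, ← hy, crs_eq, crs_eq, crs_eq]
    simp only [Conf.face]
    simp [Fin.succAbove, Fin.lt_def]
    field_simp
  have hx1 : 1 - x⁻¹ = -(1 - x) / x := by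
    field_simp [hx ▸ hx0.1]; ring
  have hy1 : 1 - y⁻¹ = -(1 - y) / y := by
    field_simp [hy ▸ hy0.1]; ring
  refine ⟨?_, h2, ?_, ?_⟩
  · rintro rfl
    rw [div_self (hx ▸ hx0.1)] at h2
    exact (crs (c.face 2)).2.2 h2
  · rw [hx1, hy1, ← hx, ← hy, hx', hy', crs_eq, crs_eq, crs_eq]
    simp only [Conf.face]
    simp [Fin.succAbove, Fin.lt_def]
    field_simp
  · rw [← hx, ← hy, hx', hy', crs_eq]
    simp only [Conf.face]
    simp [Fin.succAbove, Fin.lt_def]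
    field_simp

lemma kcr_fb (b : FA (Unit × Conf rP 5)) : kcr (fb rP 4 _ b) = 0 := by
  refine DFunLike.congr_fun (f := kcr.comp (fb rP 4 _)) (g := 0) (fa_ext fun ⟨g, c⟩ => ?_) b
  obtain ⟨h1, h2, h3, h4⟩ := crs_face (c := c) rfl rfl
  rw [AddMonoidHom.comp_apply, fb_of, map_sum]
  simp only [map_zsmul, kcr_of]
  simp only [← QuotientAddGroup.mk_zsmul]
  rw [← QuotientAddGroup.mk_sum, AddMonoidHom.zero_apply, QuotientAddGroup.eq_zero_iff]
  refine AddSubgroup.subset_closure ⟨_, _, (crs (c.face 0)).2, (crs (c.face 1)).2, h1,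
    h2 ▸ (crs (c.face 2)).2, h3 ▸ (crs (c.face 3)).2, h4 ▸ (crs (c.face 4)).2, ?_⟩
  simp only [pbGen, Fin.sum_univ_succ, ← h2, ← h3, ← h4]
  simp
  abel

/-- The subgroup generated by boundaries. -/
def confSub : AddSubgroup (FA (Unit × Conf rP 4)) := (fb rP 4 Unit).range ⊔ (bd1 PSL2C _).range

lemma sub_mem_confSub {c c' : Conf rP 4} (h : crs c = crs c') :
    of ((), c) - of ((), c') ∈ confSub := by
  refine AddSubgroup.mem_sup_right ?_
  have e : (slice4.mv c)⁻¹ • c = flag4 (crs c) := inv_smul_eq_iff.2 (slice4.eq_mv c)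
  have e' : c' = slice4.mv c' • flag4 (crs c') := slice4.eq_mv c'
  refine ⟨of (slice4.mv c' * (slice4.mv c)⁻¹, c), ?_⟩
  rw [bd1_of, mul_smul, e, h, ← e']

lemma crs_mk (c : Conf rP 4) {z : ℂ} (h : P1.det (c.1 1) (c.1 2) * P1.det (c.1 0) (c.1 3) =
    z * (P1.det (c.1 0) (c.1 2) * P1.det (c.1 1) (c.1 3))) : (crs c).1 = z := by
  rw [crs_eq, div_eq_iff (mul_ne_zero (c.det_ne (by decide)) (c.det_ne (by decide))), h]

lemma exists_conf5 {x y : ℂ} (hx : Reg x) (hy : Reg y) (h : x ≠ y) :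
    ∃ c : Conf rP 5, (crs (c.face 0)).1 = x ∧ (crs (c.face 1)).1 = y := by
  have x0 := hx.1
  have x1 := sub_ne_zero.2 hx.2
  have y0 := hy.1
  have y1 := sub_ne_zero.2 hy.2
  have xy := sub_ne_zero.2 h
  have e1 : y / x - 0 ≠ 0 := by simp [x0, y0]
  have e2 : y / x - 1 ≠ 0 := by
    intro h'; apply xy; field_simp at h'; linear_combination -h'
  have e3 : y * (x - 1) / (x * (y - 1)) - 0 ≠ 0 := by simp [x0, y0, x1, y1]
  have e4 : y * (x - 1) / (x * (y - 1)) - 1 ≠ 0 := by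
    intro h'; apply xy; field_simp at h'; linear_combination h'
  have e5 : y * (x - 1) / (x * (y - 1)) - y / x ≠ 0 := by
    intro h'
    field_simp at h'
    rw [mul_zero, mul_eq_zero, or_iff_right y0] at h'
    exact xy (by linear_combination h')
  let c : Conf rP 5 := ⟨![P1.inf, P1.fin 0, P1.fin (y * (x - 1) / (x * (y - 1))), P1.fin (y / x),
      P1.fin 1], fun i j hij => by
    have e1 := sub_ne_zero.1 e1
    have e2 := sub_ne_zero.1 e2
    have e3 := sub_ne_zero.1 e3
    have e4 := sub_ne_zero.1 e4
    have e5 := sub_ne_zero.1 e5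
    fin_cases i <;> fin_cases j <;> simp_all [rP, -div_eq_zero_iff, Ne.symm e1, Ne.symm e3]⟩
  refine ⟨c, crs_mk _ ?_, crs_mk _ ?_⟩
  · simp only [Conf.face, c]
    simp [Fin.succAbove, P1.det]
    field_simp
    ring
  · simp only [Conf.face, c]
    simp [Fin.succAbove, Fin.lt_def, P1.det]
    field_simp
    ring

lemma mem_confSub {a : FA (Unit × Conf rP 4)} (h : kcr a = 0) :
    ∃ b c, a = bd1 PSL2C _ b + fb rP 4 _ c := by
  let s : FA RegT →+ FA (Unit × Conf rP 4) ⧸ confSub :=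
    FreeAbelianGroup.lift fun z => QuotientAddGroup.mk (of ((), flag4 z))
  have hs (z) : s (of z) = QuotientAddGroup.mk (of ((), flag4 z)) :=
    FreeAbelianGroup.lift_apply_of _ _
  have hc (c : Conf rP 4) : s (of (crs c)) = QuotientAddGroup.mk (of ((), c)) := by
    rw [hs, QuotientAddGroup.eq, neg_add_eq_sub]
    exact sub_mem_confSub (crs_flag4 _).symm
  have hs0 : pbSub ≤ s.ker := by
    refine (AddSubgroup.closure_le _).2 ?_
    rintro _ ⟨x, y, hx, hy, hxy, h2, h3, h4, rfl⟩
    obtain ⟨c, hx', hy'⟩ := exists_conf5 hx hy hxy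
    obtain ⟨-, h2', h3', h4'⟩ := crs_face hx' hy'
    rw [SetLike.mem_coe, AddMonoidHom.mem_ker]
    have e {z : ℂ} (h : Reg z) (c : Conf rP 4) (hz : (crs c).1 = z) :
        s (pbGen z h) = QuotientAddGroup.mk (of ((), c)) := by
      rw [← hc, pbGen]; congr 2; exact Subtype.ext hz.symm
    simp only [map_add, map_sub]
    rw [e _ _ hx', e _ _ hy', e _ _ h2', e _ _ h3', e _ _ h4']
    have : (QuotientAddGroup.mk (fb rP 4 Unit (of ((), c))) :
        FA (Unit × Conf rP 4) ⧸ confSub) = 0 :=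
      (QuotientAddGroup.eq_zero_iff _).2 (AddSubgroup.mem_sup_left ⟨_, rfl⟩)
    rw [← this, fb_of]
    simp only [Fin.sum_univ_succ]
    simp
    abel
  have key : ((QuotientAddGroup.lift pbSub s hs0).comp kcr) = QuotientAddGroup.mk' confSub :=
    fa_ext fun ⟨⟨⟩, c⟩ => by
      rw [AddMonoidHom.comp_apply, kcr_of]
      exact hc c
  have h' : (QuotientAddGroup.mk a : FA (Unit × Conf rP 4) ⧸ confSub) = 0 := by
    have := DFunLike.congr_fun key a
    rw [AddMonoidHom.comp_apply, h, map_zero] at this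
    exact this.symm
  obtain ⟨_, ⟨c, rfl⟩, _, ⟨b, rfl⟩, e⟩ :=
    AddSubgroup.mem_sup.1 ((QuotientAddGroup.eq_zero_iff _).1 h')
  exact ⟨b, c, by rw [← e, add_comm]⟩

lemma q1_flag3 {x : FA (PSL2C × Conf rP 3)} (hx : bd1 PSL2C _ x = 0) : q1 x = 0 := by
  rw [← slice3.q1_ind hx]
  obtain ⟨b, hb⟩ := exists_bd2_trivial (x := slice3.res.m1 x)
  rw [← hb, ← GFun.bd2_m2, q1_bd2]

/-- A representative of the inversion of the projective line. -/
def winvM : SL2C := ⟨!![0, -1; 1, 0], by simp⟩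

/-- The inversion of the projective line. -/
def winv : PSL2C := (winvM : PSL2C)

lemma winv_inf : winv • P1.inf = P1.fin 0 :=
  (act_eq (M := winvM) (x := P1.inf) (y := P1.fin 0) (k := 1) one_ne_zero
    (by simp [winvM, P1.top, P1.bot]) (by simp [winvM, P1.top, P1.bot])).1

lemma winv_fin (t : ℂˣ) : winv • P1.fin t = P1.fin (-(t⁻¹ : ℂˣ)) :=
  (act_eq (M := winvM) (x := P1.fin t) (y := P1.fin (-(t⁻¹ : ℂˣ))) (k := t) t.ne_zero
    (by simp [winvM, P1.top, P1.bot]) (by simp [winvM, P1.top, P1.bot])).1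

lemma winv_zero : winv • P1.fin 0 = P1.inf :=
  (act_eq (M := winvM) (x := P1.fin 0) (y := P1.inf) (k := -1) (by simp)
    (by simp [winvM, P1.top, P1.bot]) (by simp [winvM, P1.top, P1.bot])).1

lemma winv_one : winv • P1.fin 1 = P1.fin (-1) := by simpa using winv_fin 1

lemma jT_winv (t : ℂˣ) : jT t⁻¹ * winv = winv * jT t := by
  have h : (winv * jT t)⁻¹ * (jT t⁻¹ * winv) = 1 := by
    refine eq_one_of_triple ?_ ?_ ?_ <;>
      rw [mul_smul, inv_smul_eq_iff, mul_smul, mul_smul]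
    · rw [winv_inf, (jT_inf _).1, winv_inf, (jT_fin _ _).1, mul_zero]
    · rw [winv_zero, (jT_inf _).1, (jT_fin _ _).1, mul_zero, winv_zero]
    · rw [winv_one, (jT_fin _ _).1, (jT_fin _ _).1, mul_one, winv_fin, mul_neg_one]
  rw [inv_mul_eq_one] at h
  exact h.symm

/-- The exchange of two points. -/
def swp : GFun PSL2C (Conf rP 2) PSL2C (Conf rP 2) :=
  GFun.mk' (MonoidHom.id _) (fun c => ⟨![c.1 1, c.1 0], fun i j h => by
    have := c.2 0 1 (by decide)
    fin_cases i <;> fin_cases j <;> simp_all [rP, Ne.symm]⟩)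
    fun g c => by ext i; fin_cases i <;> rfl

lemma fb_swp {P : Type} (p : P) (c : Conf rP 2) :
    fb rP 1 P (of (p, swp.obj c)) = -fb rP 1 P (of (p, c)) := by
  have e0 : (swp.obj c).face 0 = c.face 1 := by ext i; fin_cases i; rfl
  have e1 : (swp.obj c).face 1 = c.face 0 := by ext i; fin_cases i; rfl
  simp [fb_of, Fin.sum_univ_succ, e0, e1]

lemma fb_swp_m2 (x : FA ((PSL2C × PSL2C) × Conf rP 2)) :
    fb rP 1 _ (x + swp.m2 x) = 0 := by
  refine DFunLike.congr_fun (f := (fb rP 1 _).comp (AddMonoidHom.id _ + swp.m2)) (g := 0)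
    (fa_ext fun ⟨⟨g, h⟩, c⟩ => ?_) x
  have := fb_swp (g, h) c
  simp only [AddMonoidHom.comp_apply, AddMonoidHom.add_apply, AddMonoidHom.id_apply, map_add]
  rw [GFun.m2_of]
  exact (congrArg _ this).trans (add_neg_cancel _)

/-- The inversion of an abelian group. -/
def invH (A : Type) [CommGroup A] : A →* A where
  toFun a := a⁻¹
  map_one' := inv_one
  map_mul' := mul_inv

lemma swp_isNat : GFun.IsNat slice2.ind ((swp.comp slice2.ind).comp (gh (invH ℂˣ)))
    fun _ => winv where
  obj _ := by
    ext i
    fin_cases i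
    exacts [winv_inf.symm, winv_zero.symm]
  co g _ := jT_winv g

lemma q2_swp (a b : ℂˣ) : q2 (swp.m2 (slice2.ind.m2 (comm2 a b))) =
    q2 (slice2.ind.m2 (comm2 a b)) := by
  have h := swp_isNat.q2 (bd2_comm2 a⁻¹ b⁻¹)
  have e : (gh (invH ℂˣ)).m2 (comm2 a⁻¹ b⁻¹) = comm2 a b := by simp [comm2, invH]
  rw [GFun.m2_comp, GFun.m2_comp, e] at h
  rw [← h, GFun.q2_m2, GFun.q2_m2, ← commHom_apply, ← commHom_apply, ofMul_inv, ofMul_inv,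
    map_neg, map_neg, (commHom (A := ℂˣ)).map_neg, AddMonoidHom.neg_apply, map_neg, neg_neg]

/-- The classes of two-chains with vanishing face boundary. -/
def fbKer : AddSubgroup (Q2 PSL2C (Conf rP 2)) :=
  (fb rP 1 (PSL2C × PSL2C)).ker.map q2

lemma comm2_mem_fbKer (a b : ℂˣ) : q2 (slice2.ind.m2 (comm2 a b)) ∈ fbKer := by
  obtain ⟨s, rfl⟩ := exists_sq a
  refine ⟨slice2.ind.m2 (comm2 s b) + swp.m2 (slice2.ind.m2 (comm2 s b)), fb_swp_m2 _, ?_⟩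
  rw [map_add, q2_swp, GFun.q2_m2, GFun.q2_m2, ← commHom_apply, ← commHom_apply, pow_two,
    ofMul_mul, map_add, AddMonoidHom.add_apply, map_add]

lemma q2_mem_fbKer {x : FA ((PSL2C × PSL2C) × Conf rP 2)} (hx : bd2 PSL2C _ x = 0) :
    q2 x ∈ fbKer := by
  rw [← slice2.q2_ind hx, GFun.q2_m2]
  have h := mem_commSub (x := slice2.res.m2 x) (by rw [GFun.bd2_m2, hx, map_zero])
  suffices commSub ℂˣ ≤ fbKer.comap slice2.ind.M2 from this h
  rw [commSub, AddSubgroup.closure_le]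
  rintro _ ⟨⟨a, b⟩, rfl⟩
  exact comm2_mem_fbKer a b

/-- The inclusion of the torus. -/
def torF : GFun ℂˣ Pt PSL2C (Conf rP 0) :=
  GFun.mk' jT (fun _ => Conf.nil) fun _ _ => Subsingleton.elim _ _

lemma torF_isNat : GFun.IsNat torF (torF.comp (gh (invH ℂˣ))) fun _ => winv where
  obj _ := Subsingleton.elim _ _
  co g _ := jT_winv g

lemma torF_alt3 (t a b : ℂˣ) : torF.M3 (q3 (alt3 t a b)) = 0 := by
  have key (t : ℂˣ) : (2 : ℤ) • torF.M3 (q3 (alt3 t a b)) = 0 := by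
    have h := torF_isNat.q3 (bd3_alt3 t a b)
    rw [GFun.m3_comp, gh_alt3] at h
    have e : q3 (alt3 t⁻¹ a⁻¹ b⁻¹) = -q3 (alt3 t a b) := by
      simp only [← altHom_apply, ofMul_inv, map_neg, AddMonoidHom.neg_apply, neg_neg]
    rw [GFun.q3_m3, GFun.q3_m3] at h
    change _ = torF.M3 (q3 (alt3 t⁻¹ a⁻¹ b⁻¹)) at h
    rw [e, map_neg] at h
    rw [two_smul]
    nth_rewrite 1 [h]
    exact neg_add_cancel _
  obtain ⟨s, rfl⟩ := exists_sq t
  rw [← altHom_apply, pow_two, ofMul_mul, map_add, AddMonoidHom.add_apply, AddMonoidHom.add_apply,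
    altHom_apply, map_add, ← two_smul ℤ, key]

/-- The functor forgetting a configuration. -/
def forgF (n : ℕ) : GFun PSL2C (Conf rP n) PSL2C (Conf rP 0) :=
  GFun.mk' (MonoidHom.id _) (fun _ => Conf.nil) fun _ _ => Subsingleton.elim _ _

lemma fb_zero_eq (x : FA ((PSL2C × PSL2C × PSL2C) × Conf rP 1)) :
    fb rP 0 _ x = (forgF 1).m3 x := by
  refine DFunLike.congr_fun (fa_ext fun ⟨⟨g, h, k⟩, c⟩ => ?_) x
  rw [fb_of, GFun.m3_of]
  simp only [Fin.sum_univ_succ, Finset.univ_eq_empty, Finset.sum_empty, add_zero, Fin.val_zero,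
    pow_zero, one_smul]
  congr 2
  exact Subsingleton.elim _ _

/-- The functor between one-point sets. -/
def affP : GFun Aff (Triv Unit) Aff (Aff.Cf 0) :=
  GFun.mk' (MonoidHom.id _) (fun _ => Conf.nil) fun _ _ => Subsingleton.elim _ _

/-- The inclusion of the affine group. -/
def affF : GFun Aff (Aff.Cf 0) PSL2C (Conf rP 0) :=
  GFun.mk' jB (fun _ => Conf.nil) fun _ _ => Subsingleton.elim _ _

/-- The projection of the affine group to the torus. -/
def affL : GFun Aff (Aff.Cf 0) ℂˣ Pt := GFun.mk' Aff.lin (fun _ => pnt) fun _ _ => rfl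

lemma exists_torus {x : FA ((PSL2C × PSL2C × PSL2C) × Conf rP 1)} (hx : bd3 PSL2C _ x = 0) :
    ∃ y, bd3 ℂˣ Pt y = 0 ∧ q3 (fb rP 0 _ x) = torF.M3 (q3 y) := by
  have h1 : bd3 Aff _ (slice1.res.m3 x) = 0 := by rw [GFun.bd3_m3, hx, map_zero]
  have h2 : bd3 Aff _ (affP.m3 (slice1.res.m3 x)) = 0 := by rw [GFun.bd3_m3, h1, map_zero]
  refine ⟨affL.m3 (affP.m3 (slice1.res.m3 x)), by rw [GFun.bd3_m3, h2, map_zero], ?_⟩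
  rw [fb_zero_eq, GFun.q3_m3, ← slice1.q3_ind hx, ← GFun.q3_m3, ← GFun.m3_comp]
  have e : (forgF 1).comp slice1.ind = affF.comp affP := rfl
  rw [e, GFun.m3_comp, GFun.q3_m3, ← Aff.q3_prj h2, ← GFun.q3_m3, ← GFun.q3_m3, ← GFun.m3_comp,
    ← GFun.m3_comp (F := affL)]
  rfl

lemma exists_smul_ell {z : FA ((PSL2C × PSL2C × PSL2C) × Conf rP 0)} {a : FA (Unit × Conf rP 4)}
    (h : StairRel PSL2C z a) (ha : kcr a = 0) :
    ∃ (n : ℕ) (k : ℤ), n ≠ 0 ∧ q3 z = k • torF.M3 (ell n) := by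
  obtain ⟨a30, a21, a12, h⟩ := h
  obtain ⟨b13, b04, rfl⟩ := mem_confSub ha
  obtain ⟨b22, h22⟩ := q1_eq_zero.1 (q1_flag3 (x := a12 - fb rP 3 _ b13)
    (by rw [map_sub, ← h.h03, bd1_fb, map_add, fb_fb, add_zero, sub_self]))
  obtain ⟨k, hk, hk'⟩ := q2_mem_fbKer (x := a21 - fb rP 2 _ b22)
    (by rw [map_sub, bd2_fb, h22, map_sub, fb_fb, sub_zero, h.h12, sub_self])
  rw [← sub_eq_zero, ← map_sub, q2_eq_zero] at hk'
  obtain ⟨e, he⟩ := hk'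
  rw [SetLike.mem_coe, AddMonoidHom.mem_ker] at hk
  obtain ⟨y, hy, hy'⟩ := exists_torus (x := a30 + fb rP 1 _ e) (by
    rw [map_add, bd3_fb, he, map_sub, map_sub, hk, fb_fb, h.h21]; abel)
  rw [map_add, fb_fb, add_zero, h.h30] at hy'
  obtain ⟨n, m, hn, hm⟩ := exists_ell hy
  refine ⟨n, m, hn, ?_⟩
  rw [hy', ← map_zsmul, ← sub_eq_zero, ← map_sub]
  suffices AddSubgroup.closure {q | ∃ t a b : ℂˣ, q = q3 (alt3 t a b)} ≤ torF.M3.ker from this hm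
  rw [AddSubgroup.closure_le]
  rintro _ ⟨t, a, b, rfl⟩
  exact torF_alt3 t a b

section Lens

variable {Γ Y : Type} [Group Γ] [MulAction Γ Y] {r : Y → Y → Prop}

/-- A configuration of one point. -/
def Conf.mk1 (a : Y) : Conf r 1 := ⟨![a], fun i j h => by omega⟩

/-- A configuration of two points. -/
def Conf.mk2 (a b : Y) (h : r a b) : Conf r 2 :=
  ⟨![a, b], fun i j h => by fin_cases i <;> fin_cases j <;> simp_all⟩

/-- A configuration of three points. -/
def Conf.mk3 (a b c : Y) (h₁ : r a b) (h₂ : r a c) (h₃ : r b c) : Conf r 3 :=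
  ⟨![a, b, c], fun i j h => by fin_cases i <;> fin_cases j <;> simp_all⟩

/-- A configuration of four points. -/
def Conf.mk4 (a b c d : Y) (h₁ : r a b) (h₂ : r a c) (h₃ : r a d) (h₄ : r b c) (h₅ : r b d)
    (h₆ : r c d) : Conf r 4 :=
  ⟨![a, b, c, d], fun i j h => by fin_cases i <;> fin_cases j <;> simp_all⟩

lemma fb_mk1 {P : Type} (p : P) (a : Y) :
    fb r 0 P (of (p, Conf.mk1 a)) = of (p, Conf.nil) := by
  have e : (Conf.mk1 a : Conf r 1).face 0 = Conf.nil := Subsingleton.elim _ _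
  simp [fb_of, e]

lemma fb_mk2 {P : Type} (p : P) (a b : Y) (h : r a b) :
    fb r 1 P (of (p, Conf.mk2 a b h)) = of (p, Conf.mk1 b) - of (p, Conf.mk1 a) := by
  have e0 : (Conf.mk2 a b h).face 0 = Conf.mk1 b := by ext i; fin_cases i; rfl
  have e1 : (Conf.mk2 a b h).face 1 = Conf.mk1 a := by ext i; fin_cases i; rfl
  simp [fb_of, Fin.sum_univ_succ, e0, e1]
  abel

lemma fb_mk3 {P : Type} (p : P) (a b c : Y) (h₁ : r a b) (h₂ : r a c) (h₃ : r b c) :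
    fb r 2 P (of (p, Conf.mk3 a b c h₁ h₂ h₃)) =
      of (p, Conf.mk2 b c h₃) - of (p, Conf.mk2 a c h₂) + of (p, Conf.mk2 a b h₁) := by
  have e0 : (Conf.mk3 a b c h₁ h₂ h₃).face 0 = Conf.mk2 b c h₃ := by
    ext i; fin_cases i <;> rfl
  have e1 : (Conf.mk3 a b c h₁ h₂ h₃).face 1 = Conf.mk2 a c h₂ := by
    ext i; fin_cases i <;> rfl
  have e2 : (Conf.mk3 a b c h₁ h₂ h₃).face 2 = Conf.mk2 a b h₁ := by
    ext i; fin_cases i <;> rfl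
  simp [fb_of, Fin.sum_univ_succ, e0, e1, e2]
  abel

lemma fb_mk4 {P : Type} (p : P) (a b c d : Y) (h₁ : r a b) (h₂ : r a c) (h₃ : r a d)
    (h₄ : r b c) (h₅ : r b d) (h₆ : r c d) :
    fb r 3 P (of (p, Conf.mk4 a b c d h₁ h₂ h₃ h₄ h₅ h₆)) =
      of (p, Conf.mk3 b c d h₄ h₅ h₆) - of (p, Conf.mk3 a c d h₂ h₃ h₆) +
        of (p, Conf.mk3 a b d h₁ h₃ h₅) - of (p, Conf.mk3 a b c h₁ h₂ h₄) := by
  have e0 : (Conf.mk4 a b c d h₁ h₂ h₃ h₄ h₅ h₆).face 0 = Conf.mk3 b c d h₄ h₅ h₆ := by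
    ext i; fin_cases i <;> rfl
  have e1 : (Conf.mk4 a b c d h₁ h₂ h₃ h₄ h₅ h₆).face 1 = Conf.mk3 a c d h₂ h₃ h₆ := by
    ext i; fin_cases i <;> rfl
  have e2 : (Conf.mk4 a b c d h₁ h₂ h₃ h₄ h₅ h₆).face 2 = Conf.mk3 a b d h₁ h₃ h₅ := by
    ext i; fin_cases i <;> rfl
  have e3 : (Conf.mk4 a b c d h₁ h₂ h₃ h₄ h₅ h₆).face 3 = Conf.mk3 a b c h₁ h₂ h₄ := by
    ext i; fin_cases i <;> rfl
  simp [fb_of, Fin.sum_univ_succ, e0, e1, e2, e3]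
  abel

lemma sum_range_shift {M : Type*} [AddCommGroup M] (f : ℕ → M) {n : ℕ} (h : f n = f 0) :
    ∑ j ∈ Finset.range n, f (j + 1) = ∑ j ∈ Finset.range n, f j := by
  rw [← sub_eq_zero, ← Finset.sum_sub_distrib, Finset.sum_range_sub, h, sub_self]

variable [RInv Γ r]

lemma lens_stairRel {g : Γ} {n : ℕ} (hg : g ^ n = 1) {y e e' w : Y} (he : g • e = e')
    (w' : ℕ → Y) (hw' : ∀ j, g ^ j • w = w' j)
    (h₁ : r y e) (h₁' : r y e') (h₂ : ∀ j, r y (w' j)) (h₃ : ∀ j, r e (w' j))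
    (h₃' : ∀ j, r e' (w' j)) (h₄ : ∀ j, r (w' (j + 1)) (w' j)) :
    StairRel Γ (r := r) (∑ j ∈ Finset.range n, of ((g, g ^ j, g), Conf.nil))
      (∑ j ∈ Finset.range n,
        (of ((), Conf.mk4 y e (w' (j + 1)) (w' j) h₁ (h₂ _) (h₂ _) (h₃ _) (h₃ _) (h₄ _)) -
          of ((), Conf.mk4 y e' (w' (j + 1)) (w' j) h₁' (h₂ _) (h₂ _) (h₃' _) (h₃' _)
            (h₄ _)))) := by
  have w0 : w' 0 = w := by rw [← hw', pow_zero, one_smul]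
  have wn : w' n = w' 0 := by rw [← hw', hg, one_smul, w0]
  have ws (j) : g • w' j = w' (j + 1) := by rw [← hw', ← hw', smul_smul, pow_succ']
  have wn1 : w' (n + 1) = w' (0 + 1) := by rw [← ws, wn, ws]
  have m1 (a : ℕ) : g • (Conf.mk1 (w' a) : Conf r 1) = Conf.mk1 (w' (a + 1)) := by
    ext i; fin_cases i; exact ws a
  have m2 (h : Γ) (a : ℕ) (ha) (hh : ∀ i, h • w' i = w' (i + a)) :
      h • (Conf.mk2 (w' 1) (w' 0) ha : Conf r 2) = Conf.mk2 (w' (a + 1)) (w' a) (h₄ a) := by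
    ext i
    fin_cases i
    · exact (hh 1).trans (congrArg w' (Nat.add_comm 1 a))
    · exact (hh 0).trans (congrArg w' (Nat.zero_add a))
  have pw (j i : ℕ) : g ^ j • w' i = w' (i + j) := by
    rw [← hw', ← hw', smul_smul, ← pow_add, add_comm]
  have m3 (a : ℕ) : g • (Conf.mk3 e (w' (a + 1)) (w' a) (h₃ _) (h₃ _) (h₄ _) : Conf r 3) =
      Conf.mk3 e' (w' (a + 1 + 1)) (w' (a + 1)) (h₃' _) (h₃' _) (h₄ _) := by
    ext i
    fin_cases i
    exacts [he, ws _, ws _]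
  refine ⟨∑ j ∈ Finset.range n, of ((g, g ^ j, g), Conf.mk1 (w' 0)),
    ∑ j ∈ Finset.range n, of ((g, g ^ j), Conf.mk2 (w' (0 + 1)) (w' 0) (h₄ 0)),
    ∑ j ∈ Finset.range n, of (g, Conf.mk3 e (w' (j + 1)) (w' j) (h₃ _) (h₃ _) (h₄ _)),
    ?_, ?_, ?_, ?_⟩
  · simp only [map_sum, fb_mk1]
  · simp only [map_sum, fb_mk2, bd3_of, m1]
    have e1 := sum_range_shift (n := n) (fun j => of ((g, g ^ j), (Conf.mk1 (w' 0) : Conf r 1)))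
      (by simp [hg])
    have e2 := sum_range_shift (n := n) (fun j => of ((g ^ j, g), (Conf.mk1 (w' 0) : Conf r 1)))
      (by simp [hg])
    simp only [← pow_succ, ← pow_succ', Finset.sum_sub_distrib, Finset.sum_add_distrib, e1, e2]
    abel
  · simp only [map_sum, fb_mk3, bd2_of, m2 _ _ _ (pw _)]
    have e1 := sum_range_shift (n := n)
      (fun j => of (g ^ j, (Conf.mk2 (w' (0 + 1)) (w' 0) (h₄ 0) : Conf r 2))) (by simp [hg])
    have e2 := sum_range_shift (n := n)
      (fun j => of (g, (Conf.mk2 e (w' j) (h₃ _) : Conf r 2))) (by simp only [wn])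
    simp only [← pow_succ', Finset.sum_sub_distrib, Finset.sum_add_distrib, e1, e2]
    abel
  · simp only [map_sum, map_sub, fb_mk4, bd1_of, m3]
    have e1 := sum_range_shift (n := n)
      (fun j => of ((), (Conf.mk3 e' (w' (j + 1)) (w' j) (h₃' _) (h₃' _) (h₄ _) : Conf r 3)))
      (by simp only [wn, wn1])
    have e2 := sum_range_shift (n := n)
      (fun j => of ((), (Conf.mk3 y e (w' j) h₁ (h₂ _) (h₃ _) : Conf r 3))) (by simp only [wn])
    have e3 := sum_range_shift (n := n)
      (fun j => of ((), (Conf.mk3 y e' (w' j) h₁' (h₂ _) (h₃' _) : Conf r 3))) (by simp only [wn])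
    simp only [Finset.sum_sub_distrib, Finset.sum_add_distrib, e1, e2, e3]
    abel

end Lens

lemma torF_m3_lens (t : ℂˣ) (n : ℕ) : torF.m3 (lens t n) =
    ∑ j ∈ Finset.range n, of ((jT t, jT t ^ j, jT t), Conf.nil) := by
  rw [lens, map_sum]
  refine Finset.sum_congr rfl fun j _ => ?_
  rw [GFun.m3_of, ← map_pow]
  rfl

lemma exists_stairRel_lens {n : ℕ} (hn : 2 ≤ n) :
    ∃ a, StairRel PSL2C (torF.m3 (lens (zet n) n)) a ∧ kcr a = 0 := by
  have h1 : zet n ^ n = 1 := zet_pow (by omega)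
  have h2 : zet n ≠ 1 := (zet_prim (by omega)).ne_one (by omega)
  rw [torF_m3_lens]
  refine ⟨_, lens_stairRel (r := rP) (g := jT (zet n)) (by rw [← map_pow, h1, map_one])
    (jT_inf _).1 (fun j => P1.fin ((zet n ^ j : ℂˣ) : ℂ)) (w := P1.fin 1) (y := P1.fin 0)
    (fun j => ?_) ?_ ?_ ?_ ?_ ?_ ?_, ?_⟩
  · rw [← map_pow, (jT_fin _ _).1, mul_one]
  · exact fun h => nomatch h
  · exact fun h => nomatch h
  · exact fun j h => Units.ne_zero _ (P1.fin.inj h).symm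
  · exact fun j h => nomatch h
  · exact fun j h => nomatch h
  · intro j h
    have h := Units.ext (P1.fin.inj h)
    rw [pow_succ, mul_eq_left] at h
    exact h2 h
  · simp only [sub_self, Finset.sum_const_zero, map_zero]

section Alternating

variable {A M : Type*} [AddCommGroup A] [AddCommGroup M]

/-- The alternating map attached to a biadditive alternating pairing. -/
def altOf (B : A →+ A →+ M) (hB : ∀ a, B a a = 0) : A [⋀^Fin 2]→ₗ[ℤ] M where
  toFun v := B (v 0) (v 1)
  map_update_add' := by
    intro inst v i x y
    rw [Subsingleton.elim inst (instDecidableEqFin 2)]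
    fin_cases i <;> simp [Function.update]
  map_update_smul' := by
    intro inst v i c x
    rw [Subsingleton.elim inst (instDecidableEqFin 2)]
    fin_cases i <;> simp [Function.update]
  map_eq_zero_of_eq' v i j h hij := by
    have h01 : v 0 = v 1 := by
      fin_cases i <;> fin_cases j <;> simp_all
    rw [h01, hB]

lemma alt_swap {B : A →+ A →+ M} (hB : ∀ a, B a a = 0) (a b : A) : B a b = -B b a := by
  have h := hB (a + b)
  simp only [map_add, AddMonoidHom.add_apply, hB, zero_add, add_zero] at h
  exact eq_neg_of_add_eq_zero_right h

end Alternating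

lemma wedge_eq (a b : ℂ) : wedge a b = exteriorPower.ιMulti ℤ 2 ![a, b] := rfl

/-- The wedge as a biadditive map. -/
def wedgeB : ℂ →+ ℂ →+ L2C :=
  AddMonoidHom.mk' (fun a => AddMonoidHom.mk' (wedge a) fun b b' => by
    have h := (exteriorPower.ιMulti ℤ 2 (M := ℂ)).map_update_add ![a, 0] 1 b b'
    have e (c : ℂ) : Function.update ![a, 0] 1 c = ![a, c] := by
      ext i; fin_cases i <;> simp
    rwa [e, e, e] at h) fun a a' => by
    ext1 b
    have h := (exteriorPower.ιMulti ℤ 2 (M := ℂ)).map_update_add ![0, b] 0 a a'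
    have e (c : ℂ) : Function.update ![0, b] 0 c = ![c, b] := by
      ext i; fin_cases i <;> simp
    rwa [e, e, e] at h

@[simp] lemma wedgeB_apply (a b : ℂ) : wedgeB a b = wedge a b := rfl

lemma wedgeB_self (a : ℂ) : wedgeB a a = 0 :=
  (exteriorPower.ιMulti ℤ 2).map_eq_zero_of_eq ![a, a] (i := 0) (j := 1) rfl (by decide)

section Lift

variable {M : Type} [AddCommGroup M]

/-- The homomorphism attached to an alternating pairing. -/
def wedgeLift (B : ℂ →+ ℂ →+ M) (hB : ∀ a, B a a = 0) : L2C →+ M :=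
  (exteriorPower.alternatingMapLinearEquiv (altOf B hB)).toAddMonoidHom

@[simp] lemma wedgeLift_wedge (B : ℂ →+ ℂ →+ M) (hB : ∀ a, B a a = 0) (a b : ℂ) :
    wedgeLift B hB (wedge a b) = B a b := by
  rw [wedge_eq]
  exact exteriorPower.alternatingMapLinearEquiv_apply_ιMulti _ _

lemma l2c_ext {f g : L2C →+ M} (h : ∀ a b, f (wedge a b) = g (wedge a b)) : f = g := by
  have : f.toIntLinearMap = g.toIntLinearMap := by
    refine exteriorPower.linearMap_ext ?_
    ext v
    have e : v = ![v 0, v 1] := by ext i; fin_cases i <;> rfl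
    rw [e]
    exact h _ _
  ext x
  exact LinearMap.congr_fun this x

end Lift

/-- Halving on the exterior square. -/
def halfL2 : L2C →+ L2C :=
  wedgeLift (wedgeB.comp (AddMonoidHom.mulLeft (1 / 2))) fun a => by
    have h : a = 1 / 2 * a + 1 / 2 * a := by ring
    change wedgeB (1 / 2 * a) a = 0
    nth_rewrite 2 [h]
    rw [map_add, wedgeB_self, add_zero]

lemma halfL2_wedge (a b : ℂ) : halfL2 (wedge a b) = wedge (1 / 2 * a) b := wedgeLift_wedge _ _ _ _

lemma halfL2_add (x : L2C) : halfL2 (x + x) = x := by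
  have h : halfL2.comp (AddMonoidHom.id _ + AddMonoidHom.id _) = AddMonoidHom.id _ :=
    l2c_ext fun a b => by
      simp only [AddMonoidHom.comp_apply, AddMonoidHom.add_apply, AddMonoidHom.id_apply, map_add,
        halfL2_wedge]
      rw [← wedgeB_apply, ← wedgeB_apply, ← AddMonoidHom.add_apply, ← map_add]
      congr 2
      ring
  exact DFunLike.congr_fun h x

/-- The period `2πi`. -/
def tau : ℂ := 2 * Real.pi * I

lemma tau_ne : tau ≠ 0 := two_pi_I_ne_zero

/-- The subgroup `τ ∧ ℂ`. -/
def tauSub : AddSubgroup L2C := (wedgeB tau).range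

/-- The quotient of the exterior square of `ℂ` by `τ ∧ ℂ`. -/
abbrev M2 : Type := L2C ⧸ tauSub

/-- The projection to the quotient. -/
def m2q : L2C →+ M2 := QuotientAddGroup.mk' tauSub

lemma m2q_eq_zero {x : L2C} : m2q x = 0 ↔ ∃ c, wedge tau c = x := QuotientAddGroup.eq_zero_iff x

lemma m2q_surj : Function.Surjective m2q := QuotientAddGroup.mk'_surjective _

lemma m2_double {x : M2} (h : x + x = 0) : x = 0 := by
  obtain ⟨x, rfl⟩ := m2q_surj x
  rw [← map_add, m2q_eq_zero] at h
  obtain ⟨c, hc⟩ := h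
  refine m2q_eq_zero.2 ⟨1 / 2 * c, ?_⟩
  rw [← halfL2_add x, ← hc, halfL2_wedge, ← wedgeB_apply, ← wedgeB_apply]
  have h1 : c = 1 / 2 * c + 1 / 2 * c := by ring
  have h2 : tau = 1 / 2 * tau + 1 / 2 * tau := by ring
  calc wedgeB tau (1 / 2 * c) = wedgeB (1 / 2 * tau + 1 / 2 * tau) (1 / 2 * c) := by rw [← h2]
    _ = wedgeB (1 / 2 * tau) (1 / 2 * c + 1 / 2 * c) := by
      rw [map_add, map_add, AddMonoidHom.add_apply]
    _ = wedgeB (1 / 2 * tau) c := by rw [← h1]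

lemma m2_quad {x : M2} (h : (4 : ℤ) • x = 0) : x = 0 := by
  refine m2_double (m2_double ?_)
  rw [← h]
  abel

/-- The class in `M2` of `log a ∧ log b`. -/
def omg (a b : ℂˣ) : M2 := m2q (wedge (log a) (log b))

lemma exp_eq_iff_tau {x y : ℂ} : exp x = exp y ↔ ∃ n : ℤ, x = y + n * tau :=
  exp_eq_exp_iff_exists_int

lemma omg_eq {a b : ℂˣ} {x y : ℂ} (hx : exp x = a) (hy : exp y = b) :
    omg a b = m2q (wedge x y) := by
  obtain ⟨n, hn⟩ := exp_eq_iff_tau.1 ((exp_log a.ne_zero).trans hx.symm)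
  obtain ⟨m, hm⟩ := exp_eq_iff_tau.1 ((exp_log b.ne_zero).trans hy.symm)
  have h0 (c) : m2q (wedge tau c) = 0 := m2q_eq_zero.2 ⟨c, rfl⟩
  have h1 (c) : m2q (wedge c tau) = 0 := by
    rw [← wedgeB_apply, alt_swap wedgeB_self, map_neg, wedgeB_apply, h0, neg_zero]
  rw [omg, hn, hm, ← zsmul_eq_mul, ← zsmul_eq_mul, ← wedgeB_apply, ← wedgeB_apply]
  simp only [map_add, map_zsmul, AddMonoidHom.add_apply, AddMonoidHom.zsmul_apply, wedgeB_apply,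
    h0, h1, smul_zero, add_zero]

/-- The alternating pairing `(a, b) ↦ log a ∧ log b`. -/
def omB : Additive ℂˣ →+ Additive ℂˣ →+ M2 :=
  AddMonoidHom.mk' (fun a => AddMonoidHom.mk' (fun b => omg a.toMul b.toMul) fun b b' => by
    rw [omg_eq (exp_log (Units.ne_zero _)) (y := log b.toMul + log b'.toMul)
      (by rw [exp_add, exp_log (Units.ne_zero _), exp_log (Units.ne_zero _)]; rfl)]
    rw [← wedgeB_apply, map_add, map_add]
    rfl) fun a a' => by
    refine DFunLike.ext _ _ fun b => ?_
    refine (omg_eq (x := log a.toMul + log a'.toMul)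
      (by rw [exp_add, exp_log (Units.ne_zero _), exp_log (Units.ne_zero _)]; rfl)
      (exp_log (Units.ne_zero _))).trans ?_
    rw [← wedgeB_apply, map_add, AddMonoidHom.add_apply, map_add]
    rfl

lemma omB_apply (a b : ℂˣ) : omB (Additive.ofMul a) (Additive.ofMul b) = omg a b := rfl

lemma omB_self (a : Additive ℂˣ) : omB a a = 0 :=
  (congrArg m2q (wedgeB_self _)).trans (map_zero _)

lemma exists_tau_rat {u : ℂ} (h : wedge u tau = 0) : ∃ q : ℚ, u = q * tau := by
  by_contra hu
  have hu' : u ∉ Submodule.span ℚ {tau} := fun h => by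
    obtain ⟨q, hq⟩ := Submodule.mem_span_singleton.1 h
    exact hu ⟨q, by rw [← hq, Rat.smul_def]⟩
  obtain ⟨f, hf, hf'⟩ := Submodule.exists_le_ker_of_notMem hu'
  obtain ⟨g, hg, -⟩ := Submodule.exists_le_ker_of_notMem (p := (⊥ : Submodule ℚ ℂ))
    (v := tau) (by simpa using tau_ne)
  have hft : f tau = 0 := hf' (Submodule.mem_span_singleton_self _)
  let B : ℂ →+ ℂ →+ ℚ := AddMonoidHom.mk' (fun a => AddMonoidHom.mk'
    (fun b => f a * g b - f b * g a) fun b b' => by rw [map_add, map_add]; ring) fun a a' => by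
      ext b
      simp only [AddMonoidHom.mk'_apply, AddMonoidHom.add_apply, map_add]
      ring
  have h2 := wedgeLift_wedge B (fun a => sub_self _) u tau
  rw [h, map_zero] at h2
  have h3 : B u tau = f u * g tau := by
    change f u * g tau - f tau * g u = _
    rw [hft, zero_mul, sub_zero]
  exact mul_ne_zero hf hg (h3.symm.trans h2.symm)

section Identities

variable {A M : Type*} [AddCommGroup A] [AddCommGroup M] {B : A →+ A →+ M}

lemma alt_five (hB : ∀ a, B a a = 0) (x y a b d : A) :
    B x a - B y b + B (y - x) (d - x) - B (a + y - x - b) (d - x - b) + B (a - b) (d - b) = 0 := by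
  simp only [map_add, map_sub, AddMonoidHom.add_apply, AddMonoidHom.sub_apply, hB]
  simp only [alt_swap hB a x, alt_swap hB y x, alt_swap hB b x]
  abel

lemma alt_prism (hB : ∀ a, B a a = 0) (g₀ g₁ h₀ h₁ c : A) :
    B (h₀ - h₁) c - B h₀ h₁ - (B (g₀ + h₀ - (g₁ + h₁)) c - B (g₀ + h₀) (g₁ + h₁)) +
      (B (g₀ - g₁) (c - h₀ - h₁) - B g₀ g₁) = B g₁ h₁ - B g₀ h₀ := by
  simp only [map_add, map_sub, AddMonoidHom.add_apply, AddMonoidHom.sub_apply]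
  simp only [alt_swap hB h₀ g₁]
  abel

lemma alt_triangle (hB : ∀ a, B a a = 0) (a₀ a₁ a₂ c d e : A) :
    B (a₁ - a₂) d - B a₁ a₂ - (B (a₀ - a₂) e - B a₀ a₂) + (B (a₀ - a₁) c - B a₀ a₁) =
      B c d + B d e + B e c - (B (c - a₀ - a₁) (d - a₁ - a₂) + B (d - a₁ - a₂) (e - a₀ - a₂) +
        B (e - a₀ - a₂) (c - a₀ - a₁)) := by
  simp only [map_sub, AddMonoidHom.sub_apply, hB]
  simp only [alt_swap hB c a₁, alt_swap hB c a₂, alt_swap hB d a₀, alt_swap hB d a₂,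
      alt_swap hB e a₀, alt_swap hB e a₁, alt_swap hB a₁ a₀,
    alt_swap hB a₂ a₀, alt_swap hB a₂ a₁]
  abel

lemma alt_tetra (hB : ∀ a, B a a = 0) (c₀₁ c₀₂ c₀₃ c₁₂ c₁₃ c₂₃ : A) :
    B c₁₂ c₂₃ + B c₂₃ c₁₃ + B c₁₃ c₁₂ - (B c₀₂ c₂₃ + B c₂₃ c₀₃ + B c₀₃ c₀₂) +
      (B c₀₁ c₁₃ + B c₁₃ c₀₃ + B c₀₃ c₀₁) - (B c₀₁ c₁₂ + B c₁₂ c₀₂ + B c₀₂ c₀₁) =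
      B (c₁₂ + c₀₃ - c₀₂ - c₁₃) (c₀₁ + c₂₃ - c₀₂ - c₁₃) := by
  simp only [map_add, map_sub, AddMonoidHom.add_apply, AddMonoidHom.sub_apply, hB]
  simp only [alt_swap hB c₀₂ c₀₁, alt_swap hB c₀₃ c₀₁, alt_swap hB c₁₂ c₀₁, alt_swap hB c₁₃ c₀₁,
    alt_swap hB c₀₃ c₀₂, alt_swap hB c₁₂ c₀₂, alt_swap hB c₁₃ c₀₂, alt_swap hB c₁₃ c₀₃,
        alt_swap hB c₂₃ c₀₃, alt_swap hB c₁₃ c₁₂, alt_swap hB c₂₃ c₁₃]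
  abel

end Identities

/-- The pairing `log z ∧ log (1 - z)` on generators. -/
def omReg (z : RegT) : M2 :=
  omg (Units.mk0 z.1 z.2.1) (Units.mk0 (1 - z.1) (sub_ne_zero.2 z.2.2.symm))

lemma omReg_eq {z : RegT} {p q r : ℂˣ} (hz : z.1 = p / q) (hz' : 1 - z.1 = r / q) :
    omReg z = omB (.ofMul p - .ofMul q) (.ofMul r - .ofMul q) := by
  rw [← ofMul_div, ← ofMul_div, omB_apply, omReg]
  congr 1
  · ext; simp [hz]
  · ext; simp [← hz']

/-- The homomorphism `[z] ↦ log z ∧ log (1 - z)` on the pre-Bloch group. -/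
def wPB : PreBloch →+ M2 :=
  QuotientAddGroup.lift pbSub (FreeAbelianGroup.lift omReg) <| by
    refine (AddSubgroup.closure_le _).2 ?_
    rintro _ ⟨x, y, hx, hy, hxy, h2, h3, h4, rfl⟩
    rw [SetLike.mem_coe, AddMonoidHom.mem_ker]
    simp only [map_add, map_sub, pbGen, FreeAbelianGroup.lift_apply_of]
    have x1 := sub_ne_zero.2 hx.2.symm
    have y1 := sub_ne_zero.2 hy.2.symm
    have d := sub_ne_zero.2 hxy
    have y1' := sub_ne_zero.2 hy.2
    have x0 := hx.1
    have y0 := hy.1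
    have ex : 1 - x⁻¹ = -(1 - x) / x := by field_simp; ring
    have ey : 1 - y⁻¹ = -(1 - y) / y := by field_simp; ring
    let X := Units.mk0 x hx.1
    let Y := Units.mk0 y hy.1
    let A := Units.mk0 _ x1
    let B := Units.mk0 _ y1
    let D := Units.mk0 _ d
    rw [omReg_eq (p := X) (q := 1) (r := A) (by simp [X]) (by simp [A]),
      omReg_eq (p := Y) (q := 1) (r := B) (by simp [Y]) (by simp [B]),
      omReg_eq (p := Y) (q := X) (r := D) (by simp [X, Y]) (by simp [X, D]; field_simp),
      omReg_eq (p := A * Y) (q := X * B) (r := D)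
        (by change (1 - x⁻¹) / (1 - y⁻¹) = _; rw [ex, ey]; simp [A, X, B, Y]; field_simp; ring)
        (by change 1 - (1 - x⁻¹) / (1 - y⁻¹) = _; rw [ex, ey]; simp [D, X, B]; field_simp; ring),
      omReg_eq (p := A) (q := B) (r := D) (by simp [A, B]) (by simp [B, D]; field_simp; ring)]
    rw [← alt_five omB_self (.ofMul X) (.ofMul Y) (.ofMul A) (.ofMul B) (.ofMul D)]
    simp only [ofMul_one, ofMul_mul, sub_zero, sub_sub]

lemma wPB_of (z : RegT) : wPB (QuotientAddGroup.mk (of z)) = omReg z :=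
  FreeAbelianGroup.lift_apply_of _ _

/-- The kernel of the pairing on the pre-Bloch group. -/
def B0 : AddSubgroup PreBloch := wPB.ker

/-- The additive form of the automorphy factor. -/
def afac (g : PSL2C) (x : P1) : Additive ℂˣ := .ofMul (pfac g x)

/-- The additive form of the squared determinant. -/
def adet (x y : P1) : Additive ℂˣ := .ofMul (sdet x y)

lemma afac_mul (g h : PSL2C) (x : P1) : afac (g * h) x = afac g (h • x) + afac h x :=
  congrArg Additive.ofMul (pfac_mul g h x)

lemma adet_smul (g : PSL2C) {x y : P1} (h : x ≠ y) :
    adet (g • x) (g • y) = adet x y - afac g x - afac g y := by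
  have := congrArg Additive.ofMul (sdet_smul g h)
  simp only [ofMul_mul] at this
  rw [adet, adet, afac, afac, ← this]
  abel

/-- The cochain of bidegree `(2, 0)`. -/
def phi20 : FA ((PSL2C × PSL2C) × Conf rP 1) →+ M2 :=
  FreeAbelianGroup.lift fun x =>
    omB (afac x.1.1 (x.1.2 • x.2.1 0)) (afac x.1.2 (x.2.1 0))

/-- The cochain of bidegree `(1, 1)`. -/
def phi11 : FA (PSL2C × Conf rP 2) →+ M2 :=
  FreeAbelianGroup.lift fun x =>
    omB (afac x.1 (x.2.1 0) - afac x.1 (x.2.1 1)) (adet (x.2.1 0) (x.2.1 1)) -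
      omB (afac x.1 (x.2.1 0)) (afac x.1 (x.2.1 1))

/-- The cochain of bidegree `(0, 2)`. -/
def phi02 : FA (Unit × Conf rP 3) →+ M2 :=
  FreeAbelianGroup.lift fun x =>
    omB (adet (x.2.1 0) (x.2.1 1)) (adet (x.2.1 1) (x.2.1 2)) +
      omB (adet (x.2.1 1) (x.2.1 2)) (adet (x.2.1 0) (x.2.1 2)) +
      omB (adet (x.2.1 0) (x.2.1 2)) (adet (x.2.1 0) (x.2.1 1))

lemma phi20_of (x) : phi20 (of x) =
    omB (afac x.1.1 (x.1.2 • x.2.1 0)) (afac x.1.2 (x.2.1 0)) :=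
  FreeAbelianGroup.lift_apply_of _ _

lemma phi11_of (x) : phi11 (of x) =
    omB (afac x.1 (x.2.1 0) - afac x.1 (x.2.1 1)) (adet (x.2.1 0) (x.2.1 1)) -
      omB (afac x.1 (x.2.1 0)) (afac x.1 (x.2.1 1)) :=
  FreeAbelianGroup.lift_apply_of _ _

lemma phi02_of (x) : phi02 (of x) =
    omB (adet (x.2.1 0) (x.2.1 1)) (adet (x.2.1 1) (x.2.1 2)) +
      omB (adet (x.2.1 1) (x.2.1 2)) (adet (x.2.1 0) (x.2.1 2)) +
      omB (adet (x.2.1 0) (x.2.1 2)) (adet (x.2.1 0) (x.2.1 1)) :=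
  FreeAbelianGroup.lift_apply_of _ _

lemma Conf.face_val {n : ℕ} (c : Conf rP (n + 1)) (i : Fin (n + 1)) (j : Fin n) :
    (c.face i).1 j = c.1 (i.succAbove j) := rfl

lemma fb_one {P : Type} (p : P) (c : Conf rP 2) :
    fb rP 1 P (of (p, c)) = of (p, c.face 0) - of (p, c.face 1) := by
  rw [fb_of, Fin.sum_univ_succ]
  simp [sub_eq_add_neg]

lemma fb_two {P : Type} (p : P) (c : Conf rP 3) :
    fb rP 2 P (of (p, c)) = of (p, c.face 0) - of (p, c.face 1) + of (p, c.face 2) := by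
  simp [fb_of, Fin.sum_univ_succ]
  abel

lemma fb_three {P : Type} (p : P) (c : Conf rP 4) :
    fb rP 3 P (of (p, c)) =
      of (p, c.face 0) - of (p, c.face 1) + of (p, c.face 2) - of (p, c.face 3) := by
  simp [fb_of, Fin.sum_univ_succ]
  abel

lemma phi20_bd3 (x) : phi20 (bd3 _ _ x) = 0 := by
  refine DFunLike.congr_fun (f := phi20.comp (bd3 _ _)) (g := 0) (fa_ext fun ⟨⟨g, h, k⟩, c⟩ => ?_) x
  rw [AddMonoidHom.comp_apply, bd3_of]
  simp only [map_add, map_sub, phi20_of, Conf.smul_val, afac_mul, mul_smul,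
    AddMonoidHom.add_apply, AddMonoidHom.zero_apply]
  abel

lemma phi20_fb_of (g h : PSL2C) (c : Conf rP 2) :
    phi20 (fb rP 1 _ (of ((g, h), c))) = phi11 (bd2 _ _ (of ((g, h), c))) := by
  have h01 := adet_smul h (c.2 0 1 (by decide))
  rw [fb_one, bd2_of]
  simp only [phi20.map_sub, phi11.map_add, phi11.map_sub, phi20_of, phi11_of, Conf.smul_val,
     Conf.face_val, afac_mul, h01]
  rw [alt_prism omB_self]
  simp [Fin.succAbove]

lemma phi20_fb (x) : phi20 (fb rP 1 _ x) = phi11 (bd2 _ _ x) :=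
  DFunLike.congr_fun (f := phi20.comp (fb rP 1 _)) (g := phi11.comp (bd2 _ _))
    (fa_ext fun x => phi20_fb_of x.1.1 x.1.2 x.2) x

lemma phi11_fb_of (g : PSL2C) (c : Conf rP 3) :
    phi11 (fb rP 2 _ (of (g, c))) = phi02 (bd1 _ _ (of (g, c))) := by
  have h01 := adet_smul g (c.2 0 1 (by decide))
  have h12 := adet_smul g (c.2 1 2 (by decide))
  have h02 := adet_smul g (c.2 0 2 (by decide))
  rw [fb_two, bd1_of]
  simp only [phi11.map_sub, phi11.map_add, phi02.map_sub, phi11_of, phi02_of,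
    Conf.smul_val, Conf.face_val, h01, h12, h02]
  rw [← alt_triangle omB_self]
  simp [Fin.succAbove, Fin.lt_def]

lemma phi11_fb (x) : phi11 (fb rP 2 _ x) = phi02 (bd1 _ _ x) :=
  DFunLike.congr_fun (f := phi11.comp (fb rP 2 _)) (g := phi02.comp (bd1 _ _))
    (fa_ext fun x => phi11_fb_of x.1 x.2) x

lemma four_omReg_crs (c : Conf rP 4) : (4 : ℤ) • omReg (crs c) = omB
    (adet (c.1 1) (c.1 2) + adet (c.1 0) (c.1 3) - adet (c.1 0) (c.1 2) - adet (c.1 1) (c.1 3))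
    (adet (c.1 0) (c.1 1) + adet (c.1 2) (c.1 3) - adet (c.1 0) (c.1 2)
      - adet (c.1 1) (c.1 3)) := by
  have hs (i j : Fin 4) (hij : i < j) : (sdet (c.1 i) (c.1 j) : ℂ) = _ := sdet_val (c.2 i j hij)
  have e2 : (4 : ℤ) • omReg (crs c) = omB (.ofMul (Units.mk0 _ (crs c).2.1 ^ 2))
      (.ofMul (Units.mk0 _ (sub_ne_zero.2 (crs c).2.2.symm) ^ 2)) := by
    rw [ofMul_pow, ofMul_pow, map_nsmul, map_nsmul, AddMonoidHom.nsmul_apply, omB_apply, omReg,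
      smul_smul]
    norm_num
    rfl
  rw [e2]
  simp only [adet, ← ofMul_mul, ← ofMul_div]
  refine congrArg₂ (fun x y => omB x y) ?_ ?_
  · refine congrArg Additive.ofMul (Units.ext ?_)
    simp only [Units.val_pow_eq_pow_val, Units.val_mk0, Units.val_div_eq_div_val, Units.val_mul,
      hs 1 2 (by decide), hs 0 3 (by decide), hs 0 2 (by decide), hs 1 3 (by decide), crs_eq]
    ring
  · refine congrArg Additive.ofMul (Units.ext ?_)
    simp only [Units.val_pow_eq_pow_val, Units.val_mk0, Units.val_div_eq_div_val, Units.val_mul,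
      hs 0 1 (by decide), hs 2 3 (by decide), hs 0 2 (by decide), hs 1 3 (by decide), one_sub_crs]
    ring

lemma phi02_fb_of (c : Conf rP 4) :
    phi02 (fb rP 3 _ (of ((), c))) = (4 : ℤ) • wPB (kcr (of ((), c))) := by
  rw [kcr_of, wPB_of, four_omReg_crs, ← alt_tetra omB_self, fb_three]
  simp only [phi02.map_add, phi02.map_sub, phi02_of, Conf.face_val]
  simp [Fin.succAbove, Fin.lt_def]

lemma phi02_fb (x) : phi02 (fb rP 3 _ x) = (4 : ℤ) • wPB (kcr x) :=
  DFunLike.congr_fun (f := phi02.comp (fb rP 3 _)) (g := (4 : ℤ) • wPB.comp kcr)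
    (fa_ext fun x => phi02_fb_of x.2) x

lemma StairRel.wPB_eq {z a} (h : StairRel PSL2C (r := rP) z a) : wPB (kcr a) = 0 := by
  obtain ⟨a30, a21, a12, h⟩ := h
  refine m2_quad ?_
  rw [← phi02_fb, h.h03, ← phi11_fb, h.h12, ← phi20_fb, h.h21, phi20_bd3]

lemma exists_bd1_fb (a : FA (Unit × Conf rP 4)) : ∃ b, bd1 PSL2C _ b = fb rP 3 _ a := by
  obtain ⟨b, hb⟩ := slice3.exists_bd1 (fb rP 3 _ a)
  have h : slice3.res.m0 (fb rP 3 _ a) = 0 :=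
    DFunLike.congr_fun (f := slice3.res.m0.comp (fb rP 3 _)) (g := 0) (fa_ext fun x => by
      rw [AddMonoidHom.comp_apply]
      refine (congrArg _ (fb_three x.1 x.2)).trans ?_
      simp only [map_add, map_sub, GFun.m0_of]
      simp only [pt_eq]
      rw [AddMonoidHom.zero_apply, sub_self, zero_add, sub_self]) a
  exact ⟨-b, by rw [map_neg, hb, h, map_zero, zero_sub, neg_neg]⟩

/-- The determinant as a unit. -/
def udet (x y : P1) : ℂˣ := if h : x = y then 1 else Units.mk0 _ (P1.det_ne_zero h)

lemma udet_val {x y : P1} (h : x ≠ y) : (udet x y : ℂ) = P1.det x y := by simp [udet, h]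

lemma exists_fac (g : PSL2C) : ∃ f : P1 → ℂˣ, (∀ x, pfac g x = f x ^ 2) ∧
    ∀ x y, x ≠ y → f x * f y * udet (g • x) (g • y) = udet x y := by
  induction g using QuotientGroup.induction_on with
  | H M =>
  refine ⟨fun x => Units.mk0 (fac M x) (fac_ne_zero M x), fun x => Units.ext (by simp [pfac_mk]),
    fun x y h => Units.ext ?_⟩
  have h' : act M x ≠ act M y := fun e => h (MulAction.injective (M : PSL2C) e)
  rw [Units.val_mul, Units.val_mul, mk_smul, mk_smul, udet_val h, udet_val h']
  exact det_act M x y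

/-- The multiplicative cocycle on pairs of points extending the torus character. -/
def chi : FA (PSL2C × Conf rP 2) →+ Additive ℂˣ :=
  FreeAbelianGroup.lift fun x => .ofMul (pfac x.1 (x.2.1 0) *
    udet (x.1 • x.2.1 0) (x.1 • x.2.1 1) / udet (x.2.1 0) (x.2.1 1))

lemma chi_of (x) : chi (of x) = .ofMul (pfac x.1 (x.2.1 0) *
    udet (x.1 • x.2.1 0) (x.1 • x.2.1 1) / udet (x.2.1 0) (x.2.1 1)) :=
  FreeAbelianGroup.lift_apply_of _ _

lemma chi_bd2 (x) : chi (bd2 _ _ x) = 0 :=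
  DFunLike.congr_fun (f := chi.comp (bd2 _ _)) (g := 0) (fa_ext fun ⟨⟨g, h⟩, c⟩ => by
    rw [AddMonoidHom.comp_apply, bd2_of]
    simp only [map_add, map_sub, chi_of, Conf.smul_val, pfac_mul, mul_smul, ofMul_mul, ofMul_div,
      AddMonoidHom.zero_apply]
    abel) x

lemma chi_fb_of (g : PSL2C) (c : Conf rP 3) : chi (fb rP 2 _ (of (g, c))) = 0 := by
  obtain ⟨f, hf, hd⟩ := exists_fac g
  have h01 := hd _ _ (c.2 0 1 (by decide))
  have h12 := hd _ _ (c.2 1 2 (by decide))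
  have h02 := hd _ _ (c.2 0 2 (by decide))
  rw [fb_two]
  simp only [map_add, map_sub, chi_of, Conf.face_val]
  simp only [Fin.succAbove, Fin.lt_def]
  simp only [hf]
  simp [← h01, ← h02, ← h12, ofMul_mul, ofMul_pow, ofMul_div]
  abel

lemma chi_fb (x) : chi (fb rP 2 _ x) = 0 :=
  DFunLike.congr_fun (f := chi.comp (fb rP 2 _)) (g := 0)
    (fa_ext fun x => chi_fb_of x.1 x.2) x

/-- The class of a group element in degree one. -/
def oneHom (A : Type) [CommGroup A] : Additive A →+ Q1 A Pt :=
  AddMonoidHom.mk' (fun a => q1 (of (a.toMul, pnt))) fun a b => by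
    rw [← sub_eq_zero, ← map_add, ← map_sub, q1_eq_zero]
    refine ⟨-of ((a.toMul, b.toMul), pnt), ?_⟩
    rw [map_neg, bd2_of, pt_smul]
    change _ = of (a.toMul * b.toMul, pnt) - _
    abel

lemma oneHom_chi (y : FA (ℂˣ × Pt)) : oneHom ℂˣ (chi (slice2.ind.m1 y)) = q1 y := by
  refine DFunLike.congr_fun (f := (oneHom ℂˣ).comp (chi.comp slice2.ind.m1)) (g := q1)
    (fa_ext fun ⟨t, s⟩ => ?_) y
  rw [AddMonoidHom.comp_apply, AddMonoidHom.comp_apply, GFun.m1_of, chi_of]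
  have h : pfac (jT t) P1.inf * udet (jT t • P1.inf) (jT t • P1.fin 0) / udet P1.inf (P1.fin 0) =
      t := by
    rw [(jT_inf t).2, (jT_inf t).1, (jT_fin t 0).1, mul_zero, mul_div_cancel_right]
  refine (congrArg (fun a => oneHom ℂˣ (.ofMul a)) h).trans ?_
  rw [pt_eq s]
  rfl

lemma q1_fb {a : FA (PSL2C × Conf rP 3)} (h : bd1 PSL2C _ (fb rP 2 _ a) = 0) :
    q1 (fb rP 2 _ a) = 0 := by
  have e := slice2.q1_ind h
  rw [← e, GFun.q1_m1, ← oneHom_chi]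
  have h2 : chi (slice2.ind.m1 (slice2.res.m1 (fb rP 2 _ a))) = 0 := by
    rw [← sub_eq_zero, ← map_sub, q1_eq_zero] at e
    obtain ⟨b, hb⟩ := e
    rw [← sub_add_cancel (slice2.ind.m1 _) (fb rP 2 _ a), ← hb, map_add, chi_bd2, chi_fb, add_zero]
  rw [h2, map_zero, map_zero]

/-- The inclusion of the affine group as a stabilizer. -/
def affF1 : GFun Aff (Aff.Cf 0) PSL2C (Conf rP 1) :=
  GFun.mk' jB (fun _ => flag1) fun g _ => (slice1.fix g ()).symm

/-- The inclusion of the torus fixing a point. -/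
def torF1 : GFun ℂˣ Pt PSL2C (Conf rP 1) :=
  GFun.mk' jT (fun _ => flag1) fun g _ => (slice1.fix (Aff.dil g) ()).symm

lemma exists_torus1 {x : FA ((PSL2C × PSL2C) × Conf rP 1)} (hx : bd2 PSL2C _ x = 0) :
    ∃ y, bd2 ℂˣ Pt y = 0 ∧ q2 x = torF1.M2 (q2 y) := by
  have h1 : bd2 Aff _ (slice1.res.m2 x) = 0 := by rw [GFun.bd2_m2, hx, map_zero]
  have h2 : bd2 Aff _ (affP.m2 (slice1.res.m2 x)) = 0 := by rw [GFun.bd2_m2, h1, map_zero]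
  refine ⟨affL.m2 (affP.m2 (slice1.res.m2 x)), by rw [GFun.bd2_m2, h2, map_zero], ?_⟩
  rw [← slice1.q2_ind hx]
  have e : slice1.ind = affF1.comp affP := rfl
  rw [e, GFun.m2_comp, GFun.q2_m2, ← Aff.q2_prj h2, ← GFun.q2_m2, ← GFun.q2_m2, ← GFun.m2_comp,
    ← GFun.m2_comp (F := affL)]
  rfl

/-- The cochain `phi20` on homology classes of the torus. -/
def phiT : Q2 ℂˣ Pt →+ M2 :=
  QuotientAddGroup.lift _ (phi20.comp torF1.m2) <| by
    rintro _ ⟨y, rfl⟩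
    change phi20 (torF1.m2 (bd3 _ _ y)) = 0
    rw [← GFun.bd3_m3, phi20_bd3]

lemma phiT_q2 (y) : phiT (q2 y) = phi20 (torF1.m2 y) := rfl

lemma phiT_comm2 (a b : ℂˣ) : phiT (q2 (comm2 a b)) = (2 : ℤ) • omg a b := by
  have h (a b : ℂˣ) : phi20 (torF1.m2 (of ((a, b), pnt))) = omg a b := by
    rw [GFun.m2_of, phi20_of]
    change omB (.ofMul (pfac (jT a) (jT b • P1.inf))) (.ofMul (pfac (jT b) P1.inf)) = _
    rw [(jT_inf b).1, (jT_inf a).2, (jT_inf b).2, omB_apply]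
  rw [phiT_q2, comm2, map_sub, map_sub, h, h, ← omB_apply, ← omB_apply,
    alt_swap omB_self (.ofMul b), sub_neg_eq_add, two_smul]

/-- The exponential as a homomorphism to the units. -/
def uexp : ℂ →+ Additive ℂˣ :=
  AddMonoidHom.mk' (fun z => .ofMul (Units.mk0 _ (exp_ne_zero z))) fun x y =>
    congrArg Additive.ofMul (Units.ext (exp_add x y))

lemma uexp_log (a : ℂˣ) : uexp (log a) = .ofMul a :=
  congrArg Additive.ofMul (Units.ext (exp_log a.ne_zero))

lemma uexp_tau : uexp tau = 0 := congrArg Additive.ofMul (Units.ext exp_two_pi_mul_I)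

/-- The homomorphism from the exterior square to the second homology of the torus. -/
def commM : M2 →+ Q2 ℂˣ Pt :=
  QuotientAddGroup.lift tauSub (wedgeLift
    (AddMonoidHom.mk' (fun a => (commHom (uexp a)).comp uexp) fun a b => by
      rw [map_add, map_add]; rfl)
    fun a => by
      change q2 (comm2 _ _) = 0
      rw [comm2, sub_self, map_zero]) <| by
    rintro _ ⟨c, rfl⟩
    rw [wedgeB_apply, AddMonoidHom.mem_ker, wedgeLift_wedge]
    change commHom (uexp tau) (uexp c) = 0
    rw [uexp_tau, map_zero, AddMonoidHom.zero_apply]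

lemma commM_wedge (a b : ℂ) : commM (m2q (wedge a b)) = commHom (uexp a) (uexp b) :=
  wedgeLift_wedge _ _ _ _

lemma phiT_commM (m : M2) : phiT (commM m) = (2 : ℤ) • m := by
  obtain ⟨x, rfl⟩ := m2q_surj m
  refine DFunLike.congr_fun (f := phiT.comp (commM.comp m2q)) (g := (2 : ℤ) • m2q)
    (l2c_ext fun a b => ?_) x
  rw [AddMonoidHom.comp_apply, AddMonoidHom.comp_apply, commM_wedge, AddMonoidHom.zsmul_apply]
  refine (phiT_comm2 _ _).trans ?_
  rw [omg_eq rfl rfl]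

lemma q2_eq_zero_of_phi20 {x : FA ((PSL2C × PSL2C) × Conf rP 1)} (hx : bd2 PSL2C _ x = 0)
    (h : phi20 x = 0) : q2 x = 0 := by
  obtain ⟨y, hy, e⟩ := exists_torus1 hx
  have hm : commSub ℂˣ ≤ commM.range := by
    rw [commSub, AddSubgroup.closure_le]
    rintro _ ⟨⟨a, b⟩, rfl⟩
    exact ⟨omg a b, by rw [omg, commM_wedge, uexp_log, uexp_log, commHom_apply]⟩
  obtain ⟨m, hm⟩ := hm (mem_commSub hy)
  have h2 : phi20 (torF1.m2 y) = 0 := by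
    rw [← GFun.q2_m2, ← sub_eq_zero, ← map_sub, q2_eq_zero] at e
    obtain ⟨b, hb⟩ := e
    rw [← sub_sub_cancel x (torF1.m2 y), ← hb, map_sub, h, phi20_bd3, sub_zero]
  rw [← phiT_q2, ← hm, phiT_commM, two_smul] at h2
  rw [e, ← hm, m2_double h2, map_zero, map_zero]

lemma exists_stairRel {β : PreBloch} (hβ : wPB β = 0) :
    ∃ z a, bd3 PSL2C _ z = 0 ∧ StairRel PSL2C (r := rP) z a ∧ kcr a = β := by
  obtain ⟨a, rfl⟩ : ∃ a, kcr a = β := by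
    obtain ⟨b, rfl⟩ := QuotientAddGroup.mk_surjective β
    refine ⟨FreeAbelianGroup.map (fun z => ((), flag4 z)) b, ?_⟩
    refine DFunLike.congr_fun (f := kcr.comp (FreeAbelianGroup.map _))
      (g := QuotientAddGroup.mk' pbSub) (fa_ext fun z => ?_) b
    rw [AddMonoidHom.comp_apply, FreeAbelianGroup.map_of_apply, kcr_of, crs_flag4]
    rfl
  obtain ⟨a12, h12⟩ := exists_bd1_fb a
  obtain ⟨a21, h21⟩ := q1_eq_zero.1 (q1_fb (a := a12) (by rw [bd1_fb, h12, fb_fb]))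
  obtain ⟨a30, h30⟩ := q2_eq_zero.1 (q2_eq_zero_of_phi20 (x := fb rP 1 _ a21)
    (by rw [bd2_fb, h21, fb_fb])
    (by rw [phi20_fb, h21, phi11_fb, h12, phi02_fb, hβ, smul_zero]))
  exact ⟨fb rP 0 _ a30, a, by rw [bd3_fb, h30, fb_fb],
    ⟨a30, a21, a12, rfl, h30.symm, h21.symm, h12.symm⟩, rfl⟩

section

open Set Filter Topology MeasureTheory

/-- A holomorphic function on an open set that is star-shaped around zero has a primitive. -/
lemma exists_primitive_of_star {U : Set ℂ} (hU : IsOpen U)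
    (hs : ∀ z ∈ U, ∀ s ∈ Icc (0 : ℝ) 1, (s : ℂ) * z ∈ U) {h : ℂ → ℂ} (hh : DifferentiableOn ℂ h U) :
    ∃ G : ℂ → ℂ, ∀ z ∈ U, HasDerivAt G (h z) z := by
  have hd := (hh.analyticOnNhd hU).deriv.continuousOn
  let F : ℂ → ℝ → ℂ := fun z s => z * h (s * z)
  let F' : ℂ → ℝ → ℂ := fun z s => h (s * z) + z * (s * deriv h (s * z))
  have hF' : ContinuousOn (fun p : ℂ × ℝ => F' p.1 p.2) (U ×ˢ Icc (0 : ℝ) 1) := by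
    have hm : MapsTo (fun p : ℂ × ℝ => (p.2 : ℂ) * p.1) (U ×ˢ Icc (0 : ℝ) 1) U :=
      fun p hp => hs _ hp.1 _ hp.2
    have hc : ContinuousOn (fun p : ℂ × ℝ => (p.2 : ℂ) * p.1) (U ×ˢ Icc (0 : ℝ) 1) := by fun_prop
    exact (hh.continuousOn.comp hc hm).add (continuousOn_fst.mul
      ((by fun_prop : ContinuousOn (fun p : ℂ × ℝ => (p.2 : ℂ)) _).mul (hd.comp hc hm)))
  have hF : ∀ z ∈ U, ContinuousOn (F z) (Icc 0 1) := fun z hz =>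
    continuousOn_const.mul (hh.continuousOn.comp (by fun_prop) fun s hs' => hs z hz s hs')
  have hF'' : ∀ z ∈ U, ContinuousOn (F' z) (Icc 0 1) := fun z hz =>
    hF'.comp (f := fun s => (z, s)) (by fun_prop) fun s hs' => ⟨hz, hs'⟩
  have hI : ∀ f : ℝ → ℂ, ContinuousOn f (Icc 0 1) → IntervalIntegrable f volume 0 1 :=
    fun f hf => ContinuousOn.intervalIntegrable (by rwa [uIcc_of_le zero_le_one])
  have hsub : uIoc (0 : ℝ) 1 ⊆ Icc 0 1 := by
    rw [uIoc_of_le zero_le_one]; exact Ioc_subset_Icc_self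
  have hM : ∀ f : ℝ → ℂ, ContinuousOn f (Icc 0 1) →
      AEStronglyMeasurable f (volume.restrict (uIoc (0 : ℝ) 1)) := fun f hf =>
    (hf.mono hsub).aestronglyMeasurable measurableSet_uIoc
  refine ⟨fun z => ∫ s in (0 : ℝ)..1, F z s, fun z hz => ?_⟩
  obtain ⟨ε, hε, hb⟩ := Metric.nhds_basis_closedBall.mem_iff.1 (hU.mem_nhds hz)
  obtain ⟨C, hC⟩ := ((isCompact_closedBall z ε).prod 
    (isCompact_Icc (a := (0 : ℝ)) (b := 1))).exists_bound_of_continuousOn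
    (hF'.mono (prod_mono hb subset_rfl))
  have key := intervalIntegral.hasDerivAt_integral_of_dominated_loc_of_deriv_le (F := F) (F' := F')
    (x₀ := z) (s := Metric.closedBall z ε) (a := 0) (b := 1) (μ := volume) (bound := fun _ => C)
    (Metric.closedBall_mem_nhds z hε)
    (by filter_upwards [hU.mem_nhds hz] with w hw using hM _ (hF w hw))
    (hI _ (hF z hz)) (hM _ (hF'' z hz))
    (Eventually.of_forall fun s hs' w hw => hC (w, s) ⟨hw, hsub hs'⟩) intervalIntegrable_const
    (Eventually.of_forall fun s hs' w hw => by
      have h1 : HasDerivAt (fun w : ℂ => (s : ℂ) * w) s w := by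
        simpa using (hasDerivAt_id w).const_mul (s : ℂ)
      have h2 := ((hh.differentiableAt (hU.mem_nhds (hs w (hb hw) s (hsub hs')))).hasDerivAt).comp
        w h1
      refine ((hasDerivAt_id w).mul h2).congr_deriv ?_
      simp only [F', id, one_mul, Function.comp]
      ring)
  refine key.2.congr_deriv ?_
  have hp : ∀ s ∈ uIcc (0 : ℝ) 1, HasDerivAt (fun s : ℝ => (s : ℂ) * h (s * z)) (F' z s) s := by
    intro s hs'
    rw [uIcc_of_le zero_le_one] at hs'
    have h0 : HasDerivAt (fun s : ℝ => (s : ℂ)) 1 s := ofRealCLM.hasDerivAt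
    have h1 : HasDerivAt (fun s : ℝ => (s : ℂ) * z) z s := by simpa using h0.mul_const z
    have h2 := ((hh.differentiableAt (hU.mem_nhds (hs z hz s hs'))).hasDerivAt).comp s h1
    refine (h0.mul h2).congr_deriv ?_
    simp only [F', one_mul, Function.comp]
    ring
  rw [intervalIntegral.integral_eq_sub_of_hasDerivAt hp (hI _ (hF'' z hz))]
  simp

lemma exists_dilog : ∃ L : ℂ → ℂ, ∀ z, z ≠ 0 → 1 - z ∈ slitPlane →
    HasDerivAt L (-log (1 - z) / z) z := by
  have hU : IsOpen {z : ℂ | 1 - z ∈ slitPlane} := isOpen_slitPlane.preimage (by fun_prop)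
  have hd : DifferentiableOn ℂ (fun z => -log (1 - z)) {z : ℂ | 1 - z ∈ slitPlane} := fun z hz =>
    ((DifferentiableAt.clog (by fun_prop) hz).neg).differentiableWithinAt
  obtain ⟨G, hG⟩ := exists_primitive_of_star hU (fun z hz s hs => by
      have := starConvex_one_slitPlane.add_smul_mem (x := 1) (y := -z) (by simpa 
        [sub_eq_add_neg] using hz) hs.1 hs.2
      simpa [sub_eq_add_neg] using this)
    ((differentiableOn_dslope (c := 0) (hU.mem_nhds (by simp))).2 hd)
  refine ⟨G, fun z h0 hz => (hG z hz).congr_deriv ?_⟩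
  rw [dslope_of_ne _ h0, slope_def_field]
  simp

/-- A branch of the dilogarithm. -/
def dil : ℂ → ℂ := exists_dilog.choose

lemma hasDerivAt_dil {z : ℂ} (h0 : z ≠ 0) (hz : 1 - z ∈ slitPlane) :
    HasDerivAt dil (-log (1 - z) / z) z := exists_dilog.choose_spec z h0 hz

lemma exists_dil_reflect : ∃ c : ℂ, ∀ z ∈ slitPlane, 1 - z ∈ slitPlane →
    dil z + dil (1 - z) + log z * log (1 - z) = c := by
  let W : Set ℂ := {z | z ∈ slitPlane ∧ 1 - z ∈ slitPlane}
  have hW : IsOpen W := isOpen_slitPlane.inter (isOpen_slitPlane.preimage (by fun_prop))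
  have hs : StarConvex ℝ (1 / 2 : ℂ) W := by
    refine fun z hz a b ha hb hab => ⟨?_, ?_⟩
    · have := starConvex_ofReal_slitPlane (x := 1 / 2) (by norm_num) hz.1 ha hb hab
      simpa using this
    · have := starConvex_ofReal_slitPlane (x := 1 / 2) (by norm_num) hz.2 ha hb hab
      have e : (b : ℂ) = 1 - a := by rw [← ofReal_one, ← hab]; push_cast; ring
      convert this using 1
      simp only [real_smul, e]
      push_cast
      ring
  have hc : IsPreconnected W := (hs.isPathConnected ⟨by norm_num [slitPlane],
      by norm_num [slitPlane]⟩).isConnected.isPreconnected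
  let f : ℂ → ℂ := fun z => dil z + dil (1 - z) + log z * log (1 - z)
  have hf : ∀ z ∈ W, HasDerivAt f 0 z := by
    rintro z ⟨h1, h2⟩
    have n1 := slitPlane_ne_zero h1
    have n2 := slitPlane_ne_zero h2
    have hs : HasDerivAt (fun z : ℂ => 1 - z) (-1) z := by simpa using (hasDerivAt_id z).const_sub 1
    have d1 := hasDerivAt_dil n1 h2
    have d2 := (hasDerivAt_dil n2 (by simpa using h1)).comp z hs
    have d3 := (hasDerivAt_log h1).mul (hs.clog h2)
    refine ((d1.add d2).add d3).congr_deriv ?_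
    rw [sub_sub_cancel]
    field_simp
    ring
  obtain ⟨c, hc⟩ := hW.exists_is_const_of_deriv_eq_zero hc
    (fun z hz => (hf z hz).differentiableAt.differentiableWithinAt) fun z hz => (hf z hz).deriv
  exact ⟨c, fun z h1 h2 => hc z ⟨h1, h2⟩⟩

/-- The constant in the reflection formula. -/
def dilC : ℂ := exists_dil_reflect.choose

lemma dil_reflect {z : ℂ} (h1 : z ∈ slitPlane) (h2 : 1 - z ∈ slitPlane) :
    dil z + dil (1 - z) + log z * log (1 - z) = dilC := exists_dil_reflect.choose_spec z h1 h2

end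

section

open Set Filter Topology

lemma Cpi_mul_I_ne : Cpi * I ≠ 0 := mul_ne_zero (ofReal_ne_zero.2 Real.pi_ne_zero) I_ne_zero

lemma tau_eq : tau = 2 * (Cpi * I) := by rw [tau, Cpi, mul_assoc]

lemma exp_sq_eq_iff {u a : ℂ} : exp u ^ 2 = exp a ^ 2 ↔ ∃ p : ℤ, u = a + p * (Cpi * I) := by
  rw [← exp_nat_mul, ← exp_nat_mul, exp_eq_iff_tau, tau_eq]
  refine exists_congr fun p => ⟨fun h => ?_, fun h => ?_⟩
  · push_cast at h
    linear_combination h / 2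
  · push_cast
    linear_combination 2 * h

lemma liesOver_iff {u v z : ℂ} :
    LiesOver (u, v) z ↔ Reg z ∧ exp u ^ 2 = z ^ 2 ∧ exp v ^ 2 * (1 - z) ^ 2 = 1 := by
  refine and_congr_right fun h => ?_
  have h1 : 1 - z ≠ 0 := sub_ne_zero.2 h.2.symm
  have e1 : exp u ^ 2 = z ^ 2 ↔ ∃ p : ℤ, u = log z + p * (Cpi * I) := by
    rw [← exp_sq_eq_iff, exp_log h.1]
  have e2 : exp v ^ 2 * (1 - z) ^ 2 = 1 ↔ ∃ p : ℤ, v = -log (1 - z) + p * (Cpi * I) := by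
    rw [← exp_sq_eq_iff, exp_neg, exp_log h1, inv_pow, ← one_div, eq_div_iff (pow_ne_zero 2 h1)]
  rw [e1, e2]
  constructor
  · rintro ⟨p, q, e⟩
    exact ⟨⟨p, (Prod.ext_iff.1 e).1⟩, ⟨q, (Prod.ext_iff.1 e).2⟩⟩
  · rintro ⟨⟨p, e⟩, ⟨q, f⟩⟩
    exact ⟨p, q, Prod.ext e f⟩

lemma Reg.sub_ne {z : ℂ} (h : Reg z) : 1 - z ≠ 0 := sub_ne_zero.2 h.2.symm

/-- Compatible logarithms over the first three entries of a five term tuple. -/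
structure Lft (x y u₀ v₀ u₁ v₁ v₂ : ℂ) : Prop where
  hx : Reg x
  hy : Reg y
  hxy : x ≠ y
  eu₀ : exp u₀ ^ 2 = x ^ 2
  ev₀ : exp v₀ ^ 2 * (1 - x) ^ 2 = 1
  eu₁ : exp u₁ ^ 2 = y ^ 2
  ev₁ : exp v₁ ^ 2 * (1 - y) ^ 2 = 1
  ev₂ : exp v₂ ^ 2 * (1 - y / x) ^ 2 = 1

/-- The tuple of branch values determined by the logarithms over the first three entries. -/
def ftv (u₀ v₀ u₁ v₁ v₂ : ℂ) : Fin 5 → ℂ × ℂ :=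
  ![(u₀, v₀), (u₁, v₁), (u₁ - u₀, v₂), (u₁ - u₀ + v₁ - v₀, v₂ - v₁), (v₁ - v₀, v₂ - v₁ - u₀)]

section

variable {x y u₀ v₀ u₁ v₁ v₂ : ℂ}

lemma reg_three (hx : Reg x) (hy : Reg y) (hxy : x ≠ y) : Reg (y / x) :=
  ⟨div_ne_zero hy.1 hx.1, fun h => hxy ((div_eq_one_iff_eq hx.1).1 h).symm⟩

lemma inv_ne (hx : Reg x) : 1 - x⁻¹ ≠ 0 := sub_ne_zero.2 fun h => hx.2 (inv_eq_one.1 h.symm)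

lemma reg_four (hx : Reg x) (hy : Reg y) (hxy : x ≠ y) : Reg ((1 - x⁻¹) / (1 - y⁻¹)) :=
  ⟨div_ne_zero (inv_ne hx) (inv_ne hy), fun h => hxy <|
    inv_injective (sub_right_injective ((div_eq_one_iff_eq (inv_ne hy)).1 h))⟩

lemma reg_five (hx : Reg x) (hy : Reg y) (hxy : x ≠ y) : Reg ((1 - x) / (1 - y)) :=
  ⟨div_ne_zero hx.sub_ne hy.sub_ne, fun h => hxy <|
    sub_right_injective ((div_eq_one_iff_eq hy.sub_ne).1 h)⟩

lemma Lft.liesOver (h : Lft x y u₀ v₀ u₁ v₁ v₂) (i : Fin 5) :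
    LiesOver (ftv u₀ v₀ u₁ v₁ v₂ i) (ftTuple x y i) := by
  obtain ⟨hx, hy, hxy, eu₀, ev₀, eu₁, ev₁, ev₂⟩ := h
  have x0 := hx.1
  have y0 := hy.1
  have x1 := hx.sub_ne
  have y1 := hy.sub_ne
  have x2 := inv_ne hx
  have y2 := inv_ne hy
  have x3 : x - 1 ≠ 0 := sub_ne_zero.2 hx.2
  have y3 : y - 1 ≠ 0 := sub_ne_zero.2 hy.2
  have xy : x - y ≠ 0 := sub_ne_zero.2 hxy
  have f₀ : exp v₀ ^ 2 = ((1 - x) ^ 2)⁻¹ := eq_inv_of_mul_eq_one_left ev₀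
  have f₁ : exp v₁ ^ 2 = ((1 - y) ^ 2)⁻¹ := eq_inv_of_mul_eq_one_left ev₁
  have f₂ : exp v₂ ^ 2 = ((1 - y / x) ^ 2)⁻¹ := eq_inv_of_mul_eq_one_left ev₂
  have g : 1 - y / x = (x - y) / x := by field_simp
  fin_cases i
  · exact liesOver_iff.2 ⟨hx, eu₀, ev₀⟩
  · exact liesOver_iff.2 ⟨hy, eu₁, ev₁⟩
  · change LiesOver (u₁ - u₀, v₂) (y / x)
    refine liesOver_iff.2 ⟨reg_three hx hy hxy, ?_, ev₂⟩
    rw [exp_sub, div_pow, eu₀, eu₁, div_pow]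
  · change LiesOver (u₁ - u₀ + v₁ - v₀, v₂ - v₁) ((1 - x⁻¹) / (1 - y⁻¹))
    refine liesOver_iff.2 ⟨reg_four hx hy hxy, ?_, ?_⟩
    · rw [exp_sub, exp_add, exp_sub, div_pow, mul_pow, div_pow, eu₀, eu₁, f₀, f₁]
      have e : (1 - x⁻¹) / (1 - y⁻¹) = y * (1 - x) / (x * (1 - y)) := by
        rw [div_eq_div_iff y2 (mul_ne_zero x0 y1)]
        field_simp
        ring
      rw [e]
      field_simp
    · rw [exp_sub, div_pow, f₁, f₂, g]
      have e : 1 - (1 - x⁻¹) / (1 - y⁻¹) = (x - y) / (x * (1 - y)) := by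
        rw [one_sub_div y2, div_eq_div_iff y2 (mul_ne_zero x0 y1)]
        field_simp
        ring
      rw [e]
      field_simp
  · change LiesOver (v₁ - v₀, v₂ - v₁ - u₀) ((1 - x) / (1 - y))
    refine liesOver_iff.2 ⟨reg_five hx hy hxy, ?_, ?_⟩
    · rw [exp_sub, div_pow, f₀, f₁]
      field_simp
    · rw [exp_sub, exp_sub, div_pow, div_pow, eu₀, f₁, f₂, g]
      have e : 1 - (1 - x) / (1 - y) = (x - y) / (1 - y) := by field_simp; ring
      rw [e]
      field_simp

lemma Lft.mem_FTpre (h : Lft x y u₀ v₀ u₁ v₁ v₂) : ftv u₀ v₀ u₁ v₁ v₂ ∈ FTpre :=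
  ⟨_, ⟨x, y, h.hx, h.hy, h.hxy, rfl⟩, h.liesOver⟩

end

/-- The straight segment joins two base points inside the domains of the relevant logarithms. -/
structure Near (x₀ y₀ x₁ y₁ : ℂ) : Prop where
  hx : x₁ / x₀ ∈ slitPlane
  hx' : (1 - x₁) / (1 - x₀) ∈ slitPlane
  hy : y₁ / y₀ ∈ slitPlane
  hy' : (1 - y₁) / (1 - y₀) ∈ slitPlane
  hxy : (x₁ - y₁) / (x₀ - y₀) ∈ slitPlane

lemma near_nhds {f g h k : ℂ → ℂ} {a : ℂ} (hf : ContinuousAt f a) (hg : ContinuousAt g a)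
    (hh : ContinuousAt h a) (hk : ContinuousAt k a) (hfh : f a = h a) (hgk : g a = k a)
    (hx : Reg (f a)) (hy : Reg (g a)) (hxy : f a ≠ g a) :
    ∀ᶠ t in 𝓝 a, Near (f t) (g t) (h t) (k t) := by
  have key {p q : ℂ → ℂ} (hp : ContinuousAt p a) (hq : ContinuousAt q a) (h0 : p a ≠ 0)
      (e : p a = q a) : ∀ᶠ t in 𝓝 a, q t / p t ∈ slitPlane :=
    (hq.div hp h0).eventually_mem (isOpen_slitPlane.mem_nhds (by
      rw [Pi.div_apply, ← e, div_self h0]; exact one_mem_slitPlane))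
  filter_upwards [key hf hh hx.1 hfh, key (hf.const_sub 1) (hh.const_sub 1) hx.sub_ne (by rw [hfh]),
    key hg hk hy.1 hgk, key (hg.const_sub 1) (hk.const_sub 1) hy.sub_ne (by rw [hgk]),
    key (hf.sub hg) (hh.sub hk) (sub_ne_zero.2 hxy) (by rw [Pi.sub_apply, Pi.sub_apply, hfh, hgk])]
    with t h1 h2 h3 h4 h5 using ⟨h1, h2, h3, h4, h5⟩

lemma isPreconnected_compl_finite {s : Set ℂ} (hs : s.Finite) : IsPreconnected sᶜ :=
  (hs.countable.isConnected_compl_of_one_lt_rank (by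
    rw [rank_real_complex]
    norm_num)).isPreconnected

/-- A property of base points that propagates along short segments holds everywhere as soon as it
holds once. -/
lemma base_induction {P : ℂ → ℂ → Prop}
    (hP : ∀ x₀ y₀ x₁ y₁, Reg x₀ → Reg y₀ → x₀ ≠ y₀ → Reg x₁ → Reg y₁ → x₁ ≠ y₁ →
      Near x₁ y₁ x₀ y₀ → P x₀ y₀ → P x₁ y₁) {a b x y : ℂ} (ha : Reg a) (hb : Reg b) (hab : a ≠ b)
    (h0 : P a b) (hx : Reg x) (hy : Reg y) (hxy : x ≠ y) : P x y := by
  have hmem {c z : ℂ} (hz : z ∈ ({0, 1, c} : Set ℂ)ᶜ) : Reg z ∧ z ≠ c := by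
    simp only [mem_compl_iff, mem_insert_iff, mem_singleton_iff, not_or] at hz
    exact ⟨⟨hz.1, hz.2.1⟩, hz.2.2⟩
  have hmem' {c z : ℂ} (hz : Reg z) (hc : z ≠ c) : z ∈ ({0, 1, c} : Set ℂ)ᶜ := by
    simp only [mem_compl_iff, mem_insert_iff, mem_singleton_iff, not_or]
    exact ⟨hz.1, hz.2, hc⟩
  have hpc (c : ℂ) : IsPreconnected ({0, 1, c} : Set ℂ)ᶜ := isPreconnected_compl_finite (by simp)
  have moveX {c s t : ℂ} (hc : Reg c) (hs : Reg s) (hsc : s ≠ c) (ht : Reg t) (htc : t ≠ c)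
      (h : P s c) : P t c := by
    refine ((hpc c).induction₂ (fun s t => P s c ↔ P t c) (fun z hz => ?_)
      (fun _ _ _ _ _ _ h h' => h.trans h') (fun _ _ _ _ h => h.symm) (hmem' hs hsc)
      (hmem' ht htc)).1 h
    obtain ⟨hz, hzc⟩ := hmem hz
    have e1 : ∀ᶠ t in 𝓝[({0, 1, c} : Set ℂ)ᶜ] z, Near z c t c := nhdsWithin_le_nhds <|
      near_nhds continuousAt_const continuousAt_const continuousAt_id continuousAt_const
        rfl rfl hz hc hzc
    have e2 : ∀ᶠ t in 𝓝[({0, 1, c} : Set ℂ)ᶜ] z, Near t c z c := nhdsWithin_le_nhds <|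
      near_nhds continuousAt_id continuousAt_const continuousAt_const continuousAt_const
        rfl rfl hz hc hzc
    filter_upwards [e1, e2, self_mem_nhdsWithin] with t h1 h2 ht
    exact ⟨hP _ _ _ _ hz hc hzc (hmem ht).1 hc (hmem ht).2 h2,
      hP _ _ _ _ (hmem ht).1 hc (hmem ht).2 hz hc hzc h1⟩
  have moveY {c s t : ℂ} (hc : Reg c) (hs : Reg s) (hsc : s ≠ c) (ht : Reg t) (htc : t ≠ c)
      (h : P c s) : P c t := by
    refine ((hpc c).induction₂ (fun s t => P c s ↔ P c t) (fun z hz => ?_)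
      (fun _ _ _ _ _ _ h h' => h.trans h') (fun _ _ _ _ h => h.symm) (hmem' hs hsc)
      (hmem' ht htc)).1 h
    obtain ⟨hz, hzc⟩ := hmem hz
    have e1 : ∀ᶠ t in 𝓝[({0, 1, c} : Set ℂ)ᶜ] z, Near c z c t := nhdsWithin_le_nhds <|
      near_nhds continuousAt_const continuousAt_const continuousAt_const continuousAt_id
        rfl rfl hc hz hzc.symm
    have e2 : ∀ᶠ t in 𝓝[({0, 1, c} : Set ℂ)ᶜ] z, Near c t c z := nhdsWithin_le_nhds <|
      near_nhds continuousAt_const continuousAt_id continuousAt_const continuousAt_const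
        rfl rfl hc hz hzc.symm
    filter_upwards [e1, e2, self_mem_nhdsWithin] with t h1 h2 ht
    exact ⟨hP _ _ _ _ hc hz hzc.symm hc (hmem ht).1 (hmem ht).2.symm h2,
      hP _ _ _ _ hc (hmem ht).1 (hmem ht).2.symm hc hz hzc.symm h1⟩
  obtain ⟨c, hc⟩ := (Set.Finite.infinite_compl (s := ({0, 1, a, x} : Set ℂ)) (by simp)).nonempty
  simp only [mem_compl_iff, mem_insert_iff, mem_singleton_iff, not_or] at hc
  have hcr : Reg c := ⟨hc.1, hc.2.1⟩
  exact moveY hx hcr hc.2.2.2 hy hxy.symm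
    (moveX hcr ha (Ne.symm hc.2.2.1) hx (Ne.symm hc.2.2.2) (moveY ha hb hab.symm hcr hc.2.2.1 h0))

/-- Analytic continuation of compatible logarithms along a short segment. -/
lemma Lft.exists_sheet {x₀ y₀ u₀ v₀ u₁ v₁ v₂ x₁ y₁ : ℂ} (h : Lft x₀ y₀ u₀ v₀ u₁ v₁ v₂)
    (hn : Near x₀ y₀ x₁ y₁) :
    ∃ (D : Set ℂ) (X Y U₀ V₀ U₁ V₁ V₂ : ℂ → ℂ), IsOpen D ∧ IsPreconnected D ∧ 0 ∈ D ∧ 1 ∈ D ∧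
      X 1 = x₁ ∧ Y 1 = y₁ ∧ X 0 = x₀ ∧ Y 0 = y₀ ∧
      ftv (U₀ 0) (V₀ 0) (U₁ 0) (V₁ 0) (V₂ 0) = ftv u₀ v₀ u₁ v₁ v₂ ∧
      (∀ t ∈ D, Lft (X t) (Y t) (U₀ t) (V₀ t) (U₁ t) (V₁ t) (V₂ t)) ∧
      (∀ t ∈ D, DifferentiableAt ℂ X t ∧ DifferentiableAt ℂ Y t ∧ DifferentiableAt ℂ U₀ t ∧
        DifferentiableAt ℂ V₀ t ∧ DifferentiableAt ℂ U₁ t ∧ DifferentiableAt ℂ V₁ t ∧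
        DifferentiableAt ℂ V₂ t) := by
  obtain ⟨hx, hy, hxy, eu₀, ev₀, eu₁, ev₁, ev₂⟩ := h
  let S : ℂ → Set ℂ := fun a => {t | 1 + t * (a - 1) ∈ slitPlane}
  have So (a) : IsOpen (S a) := isOpen_slitPlane.preimage (by fun_prop)
  have Ss (a) : StarConvex ℝ 0 (S a) := fun t ht p q hp hq hpq => by
    have := starConvex_one_slitPlane ht hp hq hpq
    change _ ∈ slitPlane
    convert this using 1
    have e : (p : ℂ) = 1 - q := by rw [← ofReal_one, ← hpq]; push_cast; ring
    simp only [real_smul, e]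
    ring
  have S0 (a) : (0 : ℂ) ∈ S a := by simp [S]
  have S1 {a} (h : a ∈ slitPlane) : (1 : ℂ) ∈ S a := by simpa [S] using h
  let D := S (x₁ / x₀) ∩ (S ((1 - x₁) / (1 - x₀)) ∩ (S (y₁ / y₀) ∩ (S ((1 - y₁) / (1 - y₀)) ∩
    S ((x₁ - y₁) / (x₀ - y₀)))))
  have hxn := hx.1
  have hyn := hy.1
  have hx' := hx.sub_ne
  have hy' := hy.sub_ne
  have hxy' := sub_ne_zero.2 hxy
  let L : ℂ → ℂ → ℂ := fun a t => log (1 + t * (a - 1))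
  have hL (a t) (h : t ∈ S a) : exp (L a t) = 1 + t * (a - 1) := exp_log (slitPlane_ne_zero h)
  have hLd (a t) (h : t ∈ S a) : DifferentiableAt ℂ (L a) t := DifferentiableAt.clog (by fun_prop) h
  have L0 (a) : L a 0 = 0 := by simp [L]
  refine ⟨D, fun t => x₀ + t * (x₁ - x₀), fun t => y₀ + t * (y₁ - y₀), fun t => u₀ + L (x₁ / x₀) t,
    fun t => v₀ - L ((1 - x₁) / (1 - x₀)) t, fun t => u₁ + L (y₁ / y₀) t,
    fun t => v₁ - L ((1 - y₁) / (1 - y₀)) t,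
    fun t => v₂ - L ((x₁ - y₁) / (x₀ - y₀)) t + L (x₁ / x₀) t,
    (So _).inter ((So _).inter ((So _).inter ((So _).inter (So _)))),
    (((Ss _).inter ((Ss _).inter ((Ss _).inter ((Ss _).inter (Ss _))))).isPathConnected
      ⟨S0 _, S0 _, S0 _, S0 _, S0 _⟩).isConnected.isPreconnected,
    ⟨S0 _, S0 _, S0 _, S0 _, S0 _⟩, ⟨S1 hn.hx, S1 hn.hx', S1 hn.hy, S1 hn.hy', S1 hn.hxy⟩,
    by ring, by ring, by ring, by ring, by simp only [L0, add_zero, sub_zero], ?_, ?_⟩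
  · rintro t ⟨h1, h2, h3, h4, h5⟩
    have e1 : x₀ + t * (x₁ - x₀) = x₀ * (1 + t * (x₁ / x₀ - 1)) := by field_simp
    have e2 : 1 - (x₀ + t * (x₁ - x₀)) = (1 - x₀) * (1 + t * ((1 - x₁) / (1 - x₀) - 1)) := by
      field_simp
      ring
    have e3 : y₀ + t * (y₁ - y₀) = y₀ * (1 + t * (y₁ / y₀ - 1)) := by field_simp
    have e4 : 1 - (y₀ + t * (y₁ - y₀)) = (1 - y₀) * (1 + t * ((1 - y₁) / (1 - y₀) - 1)) := by
      field_simp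
      ring
    have e5 : (x₀ + t * (x₁ - x₀)) - (y₀ + t * (y₁ - y₀)) =
        (x₀ - y₀) * (1 + t * ((x₁ - y₁) / (x₀ - y₀) - 1)) := by
      field_simp
      ring
    have n1 := slitPlane_ne_zero h1
    have n2 := slitPlane_ne_zero h2
    have n3 := slitPlane_ne_zero h3
    have n4 := slitPlane_ne_zero h4
    have n5 := slitPlane_ne_zero h5
    have r1 : x₀ + t * (x₁ - x₀) ≠ 0 := by rw [e1]; exact mul_ne_zero hxn n1
    have f : 1 - (y₀ + t * (y₁ - y₀)) / (x₀ + t * (x₁ - x₀)) =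
        (1 - y₀ / x₀) * (1 + t * ((x₁ - y₁) / (x₀ - y₀) - 1)) / (1 + t * (x₁ / x₀ - 1)) := by
      rw [one_sub_div r1, e5, e1]
      field_simp
    have k {a b n : ℂ} (h : n ≠ 0) : (a / n) ^ 2 * (b * n) ^ 2 = a ^ 2 * b ^ 2 := by field_simp
    have k' {a b n m : ℂ} (h : n ≠ 0) (h' : m ≠ 0) :
        (a / m * n) ^ 2 * (b * m / n) ^ 2 = a ^ 2 * b ^ 2 := by field_simp
    beta_reduce
    refine ⟨⟨r1, fun e => mul_ne_zero hx' n2 (e2.symm.trans (by rw [e, sub_self]))⟩,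
      ⟨by rw [e3]; exact mul_ne_zero hyn n3,
        fun e => mul_ne_zero hy' n4 (e4.symm.trans (by rw [e, sub_self]))⟩,
      sub_ne_zero.1 (by rw [e5]; exact mul_ne_zero hxy' n5), ?_, ?_, ?_, ?_, ?_⟩
    · rw [exp_add, hL _ _ h1, mul_pow, eu₀, e1, mul_pow]
    · rw [exp_sub, hL _ _ h2, e2, k n2, ev₀]
    · rw [exp_add, hL _ _ h3, mul_pow, eu₁, e3, mul_pow]
    · rw [exp_sub, hL _ _ h4, e4, k n4, ev₁]
    · rw [exp_add, exp_sub, hL _ _ h5, hL _ _ h1, f, k' n1 n5, ev₂]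
  · rintro t ⟨h1, h2, h3, h4, h5⟩
    exact ⟨by fun_prop, by fun_prop, (hLd _ _ h1).const_add _, (hLd _ _ h2).const_sub _,
      (hLd _ _ h3).const_add _, (hLd _ _ h4).const_sub _, ((hLd _ _ h5).const_sub _).add
          (hLd _ _ h1)⟩

lemma modPiSq_eq {a b : ℂ} (n : ℤ) (h : a - b = n * (Cpi * I) ^ 2) : (a : ModPiSq) = b := by
  rw [QuotientAddGroup.eq, AddSubgroup.mem_zmultiples_iff]
  refine ⟨n, ?_⟩
  rw [zsmul_eq_mul]
  rw [mul_pow, I_sq] at h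
  linear_combination h

/-- The first local expression of the extended Rogers dilogarithm. -/
def dlgL (z u v : ℂ) : ℂ := 1 / 2 * u * v - dil z - (v + log (1 - z)) * u

/-- The second local expression of the extended Rogers dilogarithm. -/
def dlgR (z u v : ℂ) : ℂ := -(1 / 2) * u * v + dil (1 - z) + (u - log z) * v - dilC

/-- The extended Rogers dilogarithm, up to an additive constant. -/
def dlg (z u v : ℂ) : ModPiSq := if 1 - z ∈ slitPlane then (dlgL z u v : ℂ) else (dlgR z u v : ℂ)

lemma dlg_left {z u v : ℂ} (h : 1 - z ∈ slitPlane) : dlg z u v = (dlgL z u v : ℂ) := if_pos h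

lemma dlg_right {z u v : ℂ} (h : z ∈ slitPlane) (hw : LiesOver (u, v) z) :
    dlg z u v = (dlgR z u v : ℂ) := by
  rw [dlg]
  split_ifs with h1
  · obtain ⟨-, p, q, e⟩ := hw
    have eu : u = log z + p * (Cpi * I) := (Prod.ext_iff.1 e).1
    have ev : v = -log (1 - z) + q * (Cpi * I) := (Prod.ext_iff.1 e).2
    refine modPiSq_eq (-(p * q)) ?_
    rw [dlgL, dlgR, ← dil_reflect h h1, eu, ev]
    push_cast
    ring
  · rfl

lemma mem_slitPlane_or (z : ℂ) : z ∈ slitPlane ∨ 1 - z ∈ slitPlane := by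
  simp only [mem_slitPlane_iff, sub_re, one_re, sub_im, one_im, zero_sub, neg_ne_zero]
  by_cases hi : z.im = 0
  · by_cases hr : 0 < z.re
    · exact Or.inl (Or.inl hr)
    · exact Or.inr (Or.inl (by linarith [not_lt.1 hr]))
  · exact Or.inl (Or.inr hi)

lemma liesOver_add {z u v : ℂ} (h : LiesOver (u, v) z) (p q : ℤ) :
    LiesOver (u + p * (Cpi * I), v + q * (Cpi * I)) z := by
  obtain ⟨hz, p', q', e⟩ := h
  have eu : u = log z + p' * (Cpi * I) := (Prod.ext_iff.1 e).1
  have ev : v = -log (1 - z) + q' * (Cpi * I) := (Prod.ext_iff.1 e).2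
  refine ⟨hz, p' + p, q' + q, Prod.ext ?_ ?_⟩
  · rw [pt, eu]
    push_cast
    ring
  · rw [pt, ev]
    push_cast
    ring

lemma dlg_shift {z u v : ℂ} (h : LiesOver (u, v) z) (p q : ℤ) :
    dlg z (u + p * (Cpi * I)) (v + q * (Cpi * I)) = dlg z u v +
      ((1 / 2 * (Cpi * I) * (p * v - q * u) + 1 / 2 * (p * q) * (Cpi * I) ^ 2 : ℂ) : ModPiSq) := by
  obtain ⟨hz, p', q', e⟩ := id h
  have eu : u = log z + p' * (Cpi * I) := (Prod.ext_iff.1 e).1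
  have ev : v = -log (1 - z) + q' * (Cpi * I) := (Prod.ext_iff.1 e).2
  rcases mem_slitPlane_or z with h1 | h1
  · rw [dlg_right h1 h, dlg_right h1 (liesOver_add h p q), ← QuotientAddGroup.mk_add]
    refine modPiSq_eq (p' * q) ?_
    rw [dlgR, dlgR, eu, ev]
    push_cast
    ring
  · rw [dlg_left h1, dlg_left h1, ← QuotientAddGroup.mk_add]
    refine modPiSq_eq (-(p * q' + p * q)) ?_
    rw [dlgL, dlgL, eu, ev]
    push_cast
    ring

/-- Locally along any curve of branch values the dilogarithm lifts to a differentiable function with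
the expected derivative. -/
lemma exists_dlg_lift {D : Set ℂ} (hD : IsOpen D) {Z U V : ℂ → ℂ} (hZ : DifferentiableOn ℂ Z D)
    (hU : DifferentiableOn ℂ U D) (hV : DifferentiableOn ℂ V D)
    (hl : ∀ t ∈ D, LiesOver (U t, V t) (Z t)) {a : ℂ} (ha : a ∈ D) :
    ∃ f : ℂ → ℂ, ∀ᶠ t in 𝓝 a, dlg (Z t) (U t) (V t) = (f t : ℂ) ∧
      HasDerivAt f (1 / 2 * (U t * deriv V t - V t * deriv U t)) t := by
  have hdiff {f : ℂ → ℂ} (hf : DifferentiableOn ℂ f D) {t : ℂ} (ht : t ∈ D) :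
      HasDerivAt f (deriv f t) t := (hf.differentiableAt (hD.mem_nhds ht)).hasDerivAt
  have eU : ∀ t ∈ D, deriv Z t = Z t * deriv U t := fun t ht => by
    have h1 := ((hdiff hU ht).cexp).pow 2
    have h2 := (hdiff hZ ht).pow 2
    have e : (fun t => exp (U t) ^ 2) =ᶠ[𝓝 t] fun t => Z t ^ 2 := by
      filter_upwards [hD.mem_nhds ht] with s hs using (liesOver_iff.1 (hl s hs)).2.1
    have h3 := h1.unique (h2.congr_of_eventuallyEq e)
    have h4 := (liesOver_iff.1 (hl t ht)).2.1
    have h5 := (hl t ht).1.1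
    refine mul_left_cancel₀ (mul_ne_zero two_ne_zero h5) ?_
    norm_num at h3
    linear_combination -h3 + 2 * deriv U t * h4
  have eV : ∀ t ∈ D, deriv Z t = (1 - Z t) * deriv V t := fun t ht => by
    have h1 := (((hdiff hV ht).cexp).pow 2).mul (((hdiff hZ ht).const_sub 1).pow 2)
    have e : (fun t => exp (V t) ^ 2 * (1 - Z t) ^ 2) =ᶠ[𝓝 t] fun t => 1 := by
      filter_upwards [hD.mem_nhds ht] with s hs using (liesOver_iff.1 (hl s hs)).2.2
    have h3 := h1.unique ((hasDerivAt_const t (1 : ℂ)).congr_of_eventuallyEq e)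
    have h5 := (hl t ht).1.sub_ne
    refine mul_left_cancel₀ (mul_ne_zero (mul_ne_zero two_ne_zero
        (pow_ne_zero 2 (exp_ne_zero (V t)))) h5) ?_
    norm_num at h3
    linear_combination -h3
  have hc : ContinuousAt Z a := (hZ.differentiableAt (hD.mem_nhds ha)).continuousAt
  rcases mem_slitPlane_or (Z a) with h1 | h1
  · refine ⟨fun t => dlgR (Z t) (U t) (V t), ?_⟩
    filter_upwards [hD.mem_nhds ha, hc.eventually_mem (isOpen_slitPlane.mem_nhds h1)] with t ht hs
    refine ⟨dlg_right hs (hl t ht), ?_⟩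
    have dz := hdiff hZ ht
    have du := hdiff hU ht
    have dv := hdiff hV ht
    have n0 := (hl t ht).1.1
    have n1 := (hl t ht).1.sub_ne
    have dd := (hasDerivAt_dil n1 (by simpa using hs)).comp t (dz.const_sub 1)
    have dl := dz.clog hs
    have := ((((du.const_mul (-(1 / 2))).mul dv).add dd).add ((du.sub dl).mul dv)).sub_const dilC
    refine this.congr_deriv ?_
    rw [sub_sub_cancel]
    have e1 : deriv Z t / Z t = deriv U t := by rw [eU t ht, mul_div_cancel_left₀ _ n0]
    have e2 : -log (Z t) / (1 - Z t) * -deriv Z t = log (Z t) * deriv V t := by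
      rw [eV t ht]
      field_simp
    rw [e1, e2]
    simp only [Pi.sub_apply]
    ring
  · refine ⟨fun t => dlgL (Z t) (U t) (V t), ?_⟩
    filter_upwards [hD.mem_nhds ha,
      (hc.const_sub 1).eventually_mem (isOpen_slitPlane.mem_nhds h1)] with t ht hs
    refine ⟨dlg_left hs, ?_⟩
    have dz := hdiff hZ ht
    have du := hdiff hU ht
    have dv := hdiff hV ht
    have n0 := (hl t ht).1.1
    have n1 := (hl t ht).1.sub_ne
    have dd := (hasDerivAt_dil n0 hs).comp t dz
    have dl := (dz.const_sub 1).clog hs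
    have := (((du.const_mul (1 / 2)).mul dv).sub dd).sub ((dv.add dl).mul du)
    refine this.congr_deriv ?_
    have e1 : -deriv Z t / (1 - Z t) = -deriv V t := by
      rw [eV t ht]
      field_simp
    have e2 : -log (1 - Z t) / Z t * deriv Z t = -log (1 - Z t) * deriv U t := by
      rw [eU t ht]
      field_simp
    rw [e1, e2]
    simp only [Pi.add_apply]
    ring

/-- The alternating sum of dilogarithms in a five term relation. -/
def dlgSum (x y u₀ v₀ u₁ v₁ v₂ : ℂ) : ModPiSq :=
  ∑ i : Fin 5, (-1 : ℤ) ^ (i : ℕ) •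
    dlg (ftTuple x y i) (ftv u₀ v₀ u₁ v₁ v₂ i).1 (ftv u₀ v₀ u₁ v₁ v₂ i).2

section

variable {x y u₀ v₀ u₁ v₁ v₂ u₀' v₀' u₁' v₁' v₂' : ℂ}

lemma dlgSum_eq : dlgSum x y u₀ v₀ u₁ v₁ v₂ =
    dlg x u₀ v₀ - dlg y u₁ v₁ + dlg (y / x) (u₁ - u₀) v₂ -
      dlg ((1 - x⁻¹) / (1 - y⁻¹)) (u₁ - u₀ + v₁ - v₀) (v₂ - v₁) +
      dlg ((1 - x) / (1 - y)) (v₁ - v₀) (v₂ - v₁ - u₀) := by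
  rw [dlgSum, Fin.sum_univ_five]
  change (1 : ℤ) • dlg x u₀ v₀ + (-1 : ℤ) • dlg y u₁ v₁ + (1 : ℤ) • dlg (y / x) (u₁ - u₀) v₂ +
    (-1 : ℤ) • dlg ((1 - x⁻¹) / (1 - y⁻¹)) (u₁ - u₀ + v₁ - v₀) (v₂ - v₁) +
    (1 : ℤ) • dlg ((1 - x) / (1 - y)) (v₁ - v₀) (v₂ - v₁ - u₀) = _
  simp only [one_smul, neg_smul]
  abel

lemma Lft.exists_shift (h : Lft x y u₀ v₀ u₁ v₁ v₂) (h' : Lft x y u₀' v₀' u₁' v₁' v₂') :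
    ∃ p₀ q₀ p₁ q₁ q₂ : ℤ, u₀' = u₀ + p₀ * (Cpi * I) ∧ v₀' = v₀ + q₀ * (Cpi * I) ∧
      u₁' = u₁ + p₁ * (Cpi * I) ∧ v₁' = v₁ + q₁ * (Cpi * I) ∧ v₂' = v₂ + q₂ * (Cpi * I) := by
  obtain ⟨p₀, e₁⟩ := exp_sq_eq_iff.1 (h'.eu₀.trans h.eu₀.symm)
  obtain ⟨p₁, e₂⟩ := exp_sq_eq_iff.1 (h'.eu₁.trans h.eu₁.symm)
  obtain ⟨q₀, e₃⟩ := exp_sq_eq_iff.1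
    (mul_right_cancel₀ (pow_ne_zero 2 h.hx.sub_ne) (h'.ev₀.trans h.ev₀.symm))
  obtain ⟨q₁, e₄⟩ := exp_sq_eq_iff.1
    (mul_right_cancel₀ (pow_ne_zero 2 h.hy.sub_ne) (h'.ev₁.trans h.ev₁.symm))
  obtain ⟨q₂, e₅⟩ := exp_sq_eq_iff.1
    (mul_right_cancel₀ (pow_ne_zero 2 (reg_three h.hx h.hy h.hxy).sub_ne) (h'.ev₂.trans h.ev₂.symm))
  exact ⟨p₀, q₀, p₁, q₁, q₂, e₁, e₃, e₂, e₄, e₅⟩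

lemma Lft.dlgSum_indep (h : Lft x y u₀ v₀ u₁ v₁ v₂) (h' : Lft x y u₀' v₀' u₁' v₁' v₂') :
    dlgSum x y u₀' v₀' u₁' v₁' v₂' = dlgSum x y u₀ v₀ u₁ v₁ v₂ := by
  obtain ⟨p₀, q₀, p₁, q₁, q₂, rfl, rfl, rfl, rfl, rfl⟩ := h.exists_shift h'
  have e0 := dlg_shift (h.liesOver 0) p₀ q₀
  have e1 := dlg_shift (h.liesOver 1) p₁ q₁
  have e2 := dlg_shift (h.liesOver 2) (p₁ - p₀) q₂
  have e3 := dlg_shift (h.liesOver 3) (p₁ - p₀ + q₁ - q₀) (q₂ - q₁)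
  have e4 := dlg_shift (h.liesOver 4) (q₁ - q₀) (q₂ - q₁ - p₀)
  change dlg x _ _ = dlg x u₀ v₀ + _ at e0
  change dlg y _ _ = dlg y u₁ v₁ + _ at e1
  change dlg (y / x) (u₁ - u₀ + _) _ = dlg (y / x) (u₁ - u₀) v₂ + _ at e2
  change dlg ((1 - x⁻¹) / (1 - y⁻¹)) (u₁ - u₀ + v₁ - v₀ + _) (v₂ - v₁ + _) =
    dlg ((1 - x⁻¹) / (1 - y⁻¹)) (u₁ - u₀ + v₁ - v₀) (v₂ - v₁) + _ at e3
  change dlg ((1 - x) / (1 - y)) (v₁ - v₀ + _) (v₂ - v₁ - u₀ + _) =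
    dlg ((1 - x) / (1 - y)) (v₁ - v₀) (v₂ - v₁ - u₀) + _ at e4
  push_cast at e2 e3 e4
  rw [dlgSum_eq, dlgSum_eq, e0, e1,
    show u₁ + p₁ * (Cpi * I) - (u₀ + p₀ * (Cpi * I)) = u₁ - u₀ + (p₁ - p₀) * (Cpi * I) by ring,
    e2,
    show u₁ - u₀ + (p₁ - p₀) * (Cpi * I) + (v₁ + q₁ * (Cpi * I)) - (v₀ + q₀ * (Cpi * I)) =
      u₁ - u₀ + v₁ - v₀ + (p₁ - p₀ + q₁ - q₀) * (Cpi * I) by ring,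
    show v₂ + q₂ * (Cpi * I) - (v₁ + q₁ * (Cpi * I)) = v₂ - v₁ + (q₂ - q₁) * (Cpi * I) by ring, e3,
    show v₁ + q₁ * (Cpi * I) - (v₀ + q₀ * (Cpi * I)) = v₁ - v₀ + (q₁ - q₀) * (Cpi * I) by ring,
    show v₂ - v₁ + (q₂ - q₁) * (Cpi * I) - (u₀ + p₀ * (Cpi * I)) =
      v₂ - v₁ - u₀ + (q₂ - q₁ - p₀) * (Cpi * I) by ring, e4]
  rw [← sub_eq_zero]
  generalize dlg x u₀ v₀ = d0
  generalize dlg y u₁ v₁ = d1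
  generalize dlg (y / x) _ _ = d2
  generalize dlg ((1 - x⁻¹) / (1 - y⁻¹)) _ _ = d3
  generalize dlg ((1 - x) / (1 - y)) _ _ = d4
  have key (a0 a1 a2 a3 a4 : ℂ) (n : ℤ) (hn : a0 - a1 + a2 - a3 + a4 - 0 = n * (Cpi * I) ^ 2) :
      d0 + (a0 : ModPiSq) - (d1 + a1) + (d2 + a2) - (d3 + a3) + (d4 + a4) -
        (d0 - d1 + d2 - d3 + d4) = 0 := by
    have := modPiSq_eq n hn
    rw [QuotientAddGroup.mk_add, QuotientAddGroup.mk_sub, QuotientAddGroup.mk_add,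
      QuotientAddGroup.mk_sub, QuotientAddGroup.mk_zero] at this
    rw [← this]
    abel
  refine key _ _ _ _ _ (p₀ * q₀ - p₀ * q₁) ?_
  push_cast
  ring

end

/-- The alternating sum of dilogarithms does not change along a sheet. -/
lemma dlgSum_sheet {D : Set ℂ} {X Y U₀ V₀ U₁ V₁ V₂ : ℂ → ℂ} (hD : IsOpen D)
    (hp : IsPreconnected D)
    (hl : ∀ t ∈ D, Lft (X t) (Y t) (U₀ t) (V₀ t) (U₁ t) (V₁ t) (V₂ t))
    (hX : DifferentiableOn ℂ X D) (hY : DifferentiableOn ℂ Y D)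
    (hU₀ : DifferentiableOn ℂ U₀ D) (hV₀ : DifferentiableOn ℂ V₀ D)
    (hU₁ : DifferentiableOn ℂ U₁ D) (hV₁ : DifferentiableOn ℂ V₁ D)
    (hV₂ : DifferentiableOn ℂ V₂ D) {a b : ℂ} (ha : a ∈ D) (hb : b ∈ D) :
    dlgSum (X a) (Y a) (U₀ a) (V₀ a) (U₁ a) (V₁ a) (V₂ a) =
      dlgSum (X b) (Y b) (U₀ b) (V₀ b) (U₁ b) (V₁ b) (V₂ b) := by
  refine hp.induction₂ (fun a b => dlgSum (X a) (Y a) (U₀ a) (V₀ a) (U₁ a) (V₁ a) (V₂ a) =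
      dlgSum (X b) (Y b) (U₀ b) (V₀ b) (U₁ b) (V₁ b) (V₂ b)) ?_
    (fun _ _ _ _ _ _ h h' => h.trans h') (fun _ _ _ _ h => h.symm) ha hb
  intro a ha
  have x0 : ∀ t ∈ D, X t ≠ 0 := fun t ht => (hl t ht).hx.1
  have y0 : ∀ t ∈ D, Y t ≠ 0 := fun t ht => (hl t ht).hy.1
  have y1 : ∀ t ∈ D, 1 - Y t ≠ 0 := fun t ht => (hl t ht).hy.sub_ne
  have y2 : ∀ t ∈ D, 1 - (Y t)⁻¹ ≠ 0 := fun t ht => inv_ne (hl t ht).hy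
  obtain ⟨f0, h0⟩ := exists_dlg_lift hD hX hU₀ hV₀ (fun t ht => (hl t ht).liesOver 0) ha
  obtain ⟨f1, h1⟩ := exists_dlg_lift hD hY hU₁ hV₁ (fun t ht => (hl t ht).liesOver 1) ha
  obtain ⟨f2, h2⟩ := exists_dlg_lift hD (Z := fun t => Y t / X t) (U := fun t => U₁ t - U₀ t)
    (hY.div hX x0) (hU₁.sub hU₀) hV₂ (fun t ht => (hl t ht).liesOver 2) ha
  obtain ⟨f3, h3⟩ := exists_dlg_lift hD (Z := fun t => (1 - (X t)⁻¹) / (1 - (Y t)⁻¹))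
    (U := fun t => U₁ t - U₀ t + V₁ t - V₀ t) (V := fun t => V₂ t - V₁ t)
    (((hX.inv x0).const_sub 1).div ((hY.inv y0).const_sub 1) y2) (((hU₁.sub hU₀).add hV₁).sub hV₀)
    (hV₂.sub hV₁) (fun t ht => (hl t ht).liesOver 3) ha
  obtain ⟨f4, h4⟩ := exists_dlg_lift hD (Z := fun t => (1 - X t) / (1 - Y t))
    (U := fun t => V₁ t - V₀ t) (V := fun t => V₂ t - V₁ t - U₀ t)
    ((hX.const_sub 1).div (hY.const_sub 1) y1) (hV₁.sub hV₀) ((hV₂.sub hV₁).sub hU₀)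
    (fun t ht => (hl t ht).liesOver 4) ha
  obtain ⟨ε, hε, hb⟩ := Metric.eventually_nhds_iff_ball.1
    (((((h0.and h1).and h2).and h3).and h4).and (hD.mem_nhds ha))
  have hder : ∀ t ∈ Metric.ball a ε,
      HasDerivAt (fun t => f0 t - f1 t + f2 t - f3 t + f4 t) 0 t := by
    intro t ht
    obtain ⟨⟨⟨⟨⟨⟨-, k0⟩, ⟨-, k1⟩⟩, ⟨-, k2⟩⟩, ⟨-, k3⟩⟩, ⟨-, k4⟩⟩, hm⟩ := hb t ht
    refine ((((k0.sub k1).add k2).sub k3).add k4).congr_deriv ?_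
    have d {f : ℂ → ℂ} (hf : DifferentiableOn ℂ f D) : HasDerivAt f (deriv f t) t :=
      (hf.differentiableAt (hD.mem_nhds hm)).hasDerivAt
    have e1 : deriv (fun t => U₁ t - U₀ t) t = deriv U₁ t - deriv U₀ t :=
      ((d hU₁).sub (d hU₀)).deriv
    have e2 : deriv (fun t => U₁ t - U₀ t + V₁ t - V₀ t) t =
        deriv U₁ t - deriv U₀ t + deriv V₁ t - deriv V₀ t :=
      ((((d hU₁).sub (d hU₀)).add (d hV₁)).sub (d hV₀)).deriv
    have e3 : deriv (fun t => V₂ t - V₁ t) t = deriv V₂ t - deriv V₁ t :=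
      ((d hV₂).sub (d hV₁)).deriv
    have e4 : deriv (fun t => V₁ t - V₀ t) t = deriv V₁ t - deriv V₀ t :=
      ((d hV₁).sub (d hV₀)).deriv
    have e5 : deriv (fun t => V₂ t - V₁ t - U₀ t) t = deriv V₂ t - deriv V₁ t - deriv U₀ t :=
      (((d hV₂).sub (d hV₁)).sub (d hU₀)).deriv
    rw [e1, e2, e3, e4, e5]
    ring
  have hcst : ∀ t ∈ Metric.ball a ε, f0 t - f1 t + f2 t - f3 t + f4 t =
      f0 a - f1 a + f2 a - f3 a + f4 a := fun t ht =>
    Metric.isOpen_ball.is_const_of_deriv_eq_zero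
      (convex_ball a ε).isPreconnected
      (fun t ht => (hder t ht).differentiableAt.differentiableWithinAt)
      (fun t ht => (hder t ht).deriv) ht (Metric.mem_ball_self hε)
  have hval : ∀ t ∈ Metric.ball a ε,
      dlgSum (X t) (Y t) (U₀ t) (V₀ t) (U₁ t) (V₁ t) (V₂ t) =
        ((f0 t - f1 t + f2 t - f3 t + f4 t : ℂ) : ModPiSq) := by
    intro t ht
    obtain ⟨⟨⟨⟨⟨⟨k0, -⟩, ⟨k1, -⟩⟩, ⟨k2, -⟩⟩, ⟨k3, -⟩⟩, ⟨k4, -⟩⟩, hm⟩ := hb t ht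
    rw [dlgSum_eq, k0, k1, k2, k3, k4]
    rfl
  filter_upwards [mem_nhdsWithin_of_mem_nhds (Metric.ball_mem_nhds a hε)] with t ht
  rw [hval t ht, hval a (Metric.mem_ball_self hε), hcst t ht]

lemma exists_lft {x y : ℂ} (hx : Reg x) (hy : Reg y) (hxy : x ≠ y) :
    ∃ u₀ v₀ u₁ v₁ v₂, Lft x y u₀ v₀ u₁ v₁ v₂ := by
  have h3 := reg_three hx hy hxy
  have key {z : ℂ} (hz : Reg z) :
      exp (log z) ^ 2 = z ^ 2 ∧ exp (-log (1 - z)) ^ 2 * (1 - z) ^ 2 = 1 :=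
    (liesOver_iff.1 ⟨hz, 0, 0, by simp [pt]⟩).2
  exact ⟨log x, -log (1 - x), log y, -log (1 - y), -log (1 - y / x), hx, hy, hxy, (key hx).1,
    (key hx).2, (key hy).1, (key hy).2, (key h3).2⟩

/-- The constant value of the alternating sum of dilogarithms. -/
lemma exists_dlgSum_const : ∃ K : ModPiSq, ∀ x y u₀ v₀ u₁ v₁ v₂ : ℂ,
    Lft x y u₀ v₀ u₁ v₁ v₂ → dlgSum x y u₀ v₀ u₁ v₁ v₂ = K := by
  have h2 : Reg 2 := ⟨by norm_num, by norm_num⟩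
  have h3 : Reg 3 := ⟨by norm_num, by norm_num⟩
  have h23 : (2 : ℂ) ≠ 3 := by norm_num
  obtain ⟨a₀, b₀, a₁, b₁, b₂, hl⟩ := exists_lft h2 h3 h23
  refine ⟨dlgSum 2 3 a₀ b₀ a₁ b₁ b₂, fun x y u₀ v₀ u₁ v₁ v₂ h => ?_⟩
  refine base_induction (P := fun x y => ∀ u₀ v₀ u₁ v₁ v₂ : ℂ,
    Lft x y u₀ v₀ u₁ v₁ v₂ → dlgSum x y u₀ v₀ u₁ v₁ v₂ = dlgSum 2 3 a₀ b₀ a₁ b₁ b₂) ?_ h2 h3 h23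
    (fun u₀ v₀ u₁ v₁ v₂ h => hl.dlgSum_indep h) h.hx h.hy h.hxy u₀ v₀ u₁ v₁ v₂ h
  intro x₀ y₀ x₁ y₁ _ _ _ _ _ _ hn hP u₀ v₀ u₁ v₁ v₂ h
  obtain ⟨D, X, Y, U₀, V₀, U₁, V₁, V₂, hD, hp, h0, h1, rfl, rfl, rfl, rfl, e, hL, hd⟩ :=
    h.exists_sheet hn
  rw [(hL 0 h0).dlgSum_indep h, ← hP _ _ _ _ _ (hL 1 h1)]
  exact dlgSum_sheet hD hp hL (fun t ht => (hd t ht).1.differentiableWithinAt)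
    (fun t ht => (hd t ht).2.1.differentiableWithinAt)
    (fun t ht => (hd t ht).2.2.1.differentiableWithinAt)
    (fun t ht => (hd t ht).2.2.2.1.differentiableWithinAt)
    (fun t ht => (hd t ht).2.2.2.2.1.differentiableWithinAt)
    (fun t ht => (hd t ht).2.2.2.2.2.1.differentiableWithinAt)
    (fun t ht => (hd t ht).2.2.2.2.2.2.differentiableWithinAt) h0 h1

lemma log_eq_of_exp {a : ℂ} {s : ℂ} (ha : a ≠ 0) (h : exp s = a)
    (hs : |(log a).im - s.im| < 2 * Real.pi) : log a = s := by
  obtain ⟨n, hn⟩ := exp_eq_exp_iff_exists_int.1 ((exp_log ha).trans h.symm)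
  have e : (log a).im - s.im = n * (2 * Real.pi) := by
    rw [hn]
    simp
  rw [e, abs_mul, abs_of_pos Real.two_pi_pos] at hs
  have h1 : |(n : ℝ)| < 1 := by
    by_contra h1
    nlinarith [Real.two_pi_pos, not_lt.1 h1]
  have h0 : n = 0 := Int.abs_lt_one_iff.1 (by exact_mod_cast h1)
  simpa [h0] using hn

lemma log_im_pos {a : ℂ} (h : 0 < a.im) : 0 < (log a).im ∧ (log a).im < Real.pi := by
  rw [log_im]
  refine ⟨lt_of_le_of_ne (arg_nonneg_iff.2 h.le) fun h0 => ?_, arg_lt_pi_iff.2 (Or.inr h.ne')⟩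
  exact h.ne' (arg_eq_zero_iff.1 h0.symm).2

lemma log_im_neg {a : ℂ} (h : 0 < a.im) :
    (log (1 - a)).im < 0 ∧ -Real.pi < (log (1 - a)).im := by
  rw [log_im]
  exact ⟨arg_neg_iff.2 (by simpa using h), neg_pi_lt_arg _⟩

/-- Over five term tuples in the upper half plane the principal logarithms are compatible. -/
lemma log_ftv {x y : ℂ} (hx : Reg x) (hy : Reg y) (hxy : x ≠ y)
    (h : ∀ i, 0 < (ftTuple x y i).im) : (fun i => pt (ftTuple x y i) 0 0) =
      ftv (log x) (-log (1 - x)) (log y) (-log (1 - y)) (-log (1 - y / x)) := by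
  have r2 := reg_three hx hy hxy
  have r3 := reg_four hx hy hxy
  have r4 := reg_five hx hy hxy
  have x0 := hx.1
  have y0 := hy.1
  have x1 := hx.sub_ne
  have y1 := hy.sub_ne
  have y2 := inv_ne hy
  have yx : y - x ≠ 0 := sub_ne_zero.2 hxy.symm
  have xy : x - y ≠ 0 := sub_ne_zero.2 hxy
  have y3 : y - 1 ≠ 0 := sub_ne_zero.2 hy.2
  have a0 := log_im_pos (h 0)
  have a1 := log_im_pos (h 1)
  have a2 := log_im_pos (h 2)
  have a3 := log_im_pos (h 3)
  have a4 := log_im_pos (h 4)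
  have b0 := log_im_neg (h 0)
  have b1 := log_im_neg (h 1)
  have b2 := log_im_neg (h 2)
  have b3 := log_im_neg (h 3)
  have b4 := log_im_neg (h 4)
  change 0 < (log x).im ∧ (log x).im < Real.pi at a0
  change 0 < (log y).im ∧ (log y).im < Real.pi at a1
  change 0 < (log (y / x)).im ∧ (log (y / x)).im < Real.pi at a2
  change 0 < (log ((1 - x⁻¹) / (1 - y⁻¹))).im ∧ (log ((1 - x⁻¹) / (1 - y⁻¹))).im < Real.pi at a3
  change 0 < (log ((1 - x) / (1 - y))).im ∧ (log ((1 - x) / (1 - y))).im < Real.pi at a4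
  change (log (1 - x)).im < 0 ∧ -Real.pi < (log (1 - x)).im at b0
  change (log (1 - y)).im < 0 ∧ -Real.pi < (log (1 - y)).im at b1
  change (log (1 - y / x)).im < 0 ∧ -Real.pi < (log (1 - y / x)).im at b2
  change (log (1 - (1 - x⁻¹) / (1 - y⁻¹))).im < 0 ∧ -Real.pi < (log (1 - (1 - x⁻¹) / (1 - y⁻¹))).im
      at b3
  change (log (1 - (1 - x) / (1 - y))).im < 0 ∧ -Real.pi < (log (1 - (1 - x) / (1 - y))).im at b4
  have e2 : log (y / x) = log y - log x := by
    refine log_eq_of_exp r2.1 (by rw [exp_sub, exp_log x0, exp_log y0]) ?_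
    rw [sub_im, abs_lt]
    constructor <;> linarith
  have e4 : log ((1 - x) / (1 - y)) = log (1 - x) - log (1 - y) := by
    refine log_eq_of_exp r4.1 (by rw [exp_sub, exp_log x1, exp_log y1]) ?_
    rw [sub_im, abs_lt]
    constructor <;> linarith
  have e3 : log ((1 - x⁻¹) / (1 - y⁻¹)) = log (y / x) + log ((1 - x) / (1 - y)) := by
    refine log_eq_of_exp r3.1 ?_ ?_
    · rw [exp_add, exp_log r2.1, exp_log r4.1]
      rw [show (1 - x⁻¹) = (x - 1) / x by field_simp, show (1 - y⁻¹) = (y - 1) / y by field_simp]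
      field_simp
      ring
    rw [add_im, abs_lt]
    constructor <;> linarith
  have e3' : log (1 - (1 - x⁻¹) / (1 - y⁻¹)) = log (1 - y / x) - log (1 - y) := by
    refine log_eq_of_exp r3.sub_ne ?_ ?_
    · rw [exp_sub, exp_log r2.sub_ne, exp_log y1]
      rw [show (1 - x⁻¹) = (x - 1) / x by field_simp, show (1 - y⁻¹) = (y - 1) / y by field_simp]
      field_simp
      ring
    rw [sub_im, abs_lt]
    constructor <;> linarith
  have e4' : log (1 - (1 - x) / (1 - y)) = log (1 - (1 - x⁻¹) / (1 - y⁻¹)) + log x := by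
    refine log_eq_of_exp r4.sub_ne ?_ ?_
    · rw [exp_add, exp_log r3.sub_ne, exp_log x0]
      rw [show (1 - x⁻¹) = (x - 1) / x by field_simp, show (1 - y⁻¹) = (y - 1) / y by field_simp]
      field_simp
      ring
    rw [add_im, abs_lt]
    constructor <;> linarith
  funext i
  fin_cases i
  · change pt x 0 0 = (log x, -log (1 - x))
    simp [pt]
  · change pt y 0 0 = (log y, -log (1 - y))
    simp [pt]
  · change pt (y / x) 0 0 = (log y - log x, -log (1 - y / x))
    simp [pt, e2]
  · change pt ((1 - x⁻¹) / (1 - y⁻¹)) 0 0 = (log y - log x + -log (1 - y) - -log (1 - x),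
      -log (1 - y / x) - -log (1 - y))
    simp only [pt, e3, e3', e2, e4, Int.cast_zero, zero_mul, add_zero]
    exact Prod.ext (by ring) (by ring)
  · change pt ((1 - x) / (1 - y)) 0 0 = (-log (1 - y) - -log (1 - x),
      -log (1 - y / x) - -log (1 - y) - log x)
    simp only [pt, e4, e4', e3', Int.cast_zero, zero_mul, add_zero]
    exact Prod.ext (by ring) (by ring)

lemma exists_basePt : ∃ u₀ v₀ u₁ v₁ v₂, Lft ((1 + I) / 4) I u₀ v₀ u₁ v₁ v₂ ∧
    basePt = ftv u₀ v₀ u₁ v₁ v₂ := by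
  have hx : Reg ((1 + I) / 4) := ⟨fun h => by simpa using congrArg im h,
    fun h => by simpa using congrArg im h⟩
  have hy : Reg I := ⟨I_ne_zero, fun h => by simpa using congrArg im h⟩
  have hxy : (1 + I) / 4 ≠ I := fun h => by simpa using congrArg re h
  have i2 := I_sq
  have hxi : (1 + I) ≠ 0 := fun h => hx.1 (by rw [h, zero_div])
  have hyi : 1 - I⁻¹ ≠ 0 := inv_ne hy
  have him : ∀ i, 0 < (ftTuple ((1 + I) / 4) I i).im := by
    intro i
    fin_cases i
    · change 0 < ((1 + I) / 4).im
      simp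
    · change 0 < I.im
      simp
    · change 0 < (I / ((1 + I) / 4)).im
      rw [show I / ((1 + I) / 4) = 2 + 2 * I by
        field_simp
        linear_combination -2 * i2]
      simp
    · change 0 < ((1 - ((1 + I) / 4)⁻¹) / (1 - I⁻¹)).im
      rw [show (1 - ((1 + I) / 4)⁻¹) / (1 - I⁻¹) = (1 + 3 * I) / 2 by
        rw [div_eq_iff hyi, inv_I]
        field_simp
        linear_combination (-(7 + 3 * I)) * i2]
      simp
    · change 0 < ((1 - (1 + I) / 4) / (1 - I)).im
      rw [show (1 - (1 + I) / 4) / (1 - I) = (2 + I) / 4 by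
        rw [div_eq_iff hy.sub_ne]
        linear_combination 1 / 4 * i2]
      simp
  have key {z : ℂ} (hz : Reg z) :
      exp (log z) ^ 2 = z ^ 2 ∧ exp (-log (1 - z)) ^ 2 * (1 - z) ^ 2 = 1 :=
    (liesOver_iff.1 ⟨hz, 0, 0, by simp [pt]⟩).2
  exact ⟨_, _, _, _, _, ⟨hx, hy, hxy, (key hx).1, (key hx).2, (key hy).1, (key hy).2,
    (key (reg_three hx hy hxy)).2⟩, log_ftv hx hy hxy him⟩

lemma lft_iff {x y u₀ v₀ u₁ v₁ v₂ : ℂ} : Lft x y u₀ v₀ u₁ v₁ v₂ ↔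
    x ≠ y ∧ LiesOver (u₀, v₀) x ∧ LiesOver (u₁, v₁) y ∧ exp v₂ ^ 2 * (1 - y / x) ^ 2 = 1 := by
  simp only [liesOver_iff]
  exact ⟨fun h => ⟨h.hxy, ⟨h.hx, h.eu₀, h.ev₀⟩, ⟨h.hy, h.eu₁, h.ev₁⟩, h.ev₂⟩,
    fun ⟨h, ⟨a, b, c⟩, ⟨d, e, f⟩, g⟩ => ⟨a, d, h, b, c, e, f, g⟩⟩

lemma liesOver_sub {u v u' v' z : ℂ} (h : LiesOver (u, v) z) (h' : LiesOver (u', v') z) :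
    u - u' ∈ AddSubgroup.zmultiples (Cpi * I) ∧ v - v' ∈ AddSubgroup.zmultiples (Cpi * I) := by
  obtain ⟨hz, a, b⟩ := liesOver_iff.1 h
  obtain ⟨-, a', b'⟩ := liesOver_iff.1 h'
  obtain ⟨p, hp⟩ := exp_sq_eq_iff.1 (a.trans a'.symm)
  obtain ⟨q, hq⟩ := exp_sq_eq_iff.1
    (mul_right_cancel₀ (pow_ne_zero 2 hz.sub_ne) (b.trans b'.symm))
  refine ⟨⟨p, ?_⟩, ⟨q, ?_⟩⟩
  · rw [hp]
    simp
  · rw [hq]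
    simp

/-- The defects of a tuple of branch values from being compatible. -/
def defect (w : Fin 5 → ℂ × ℂ) : Fin 5 → ℂ :=
  ![(w 2).1 - ((w 1).1 - (w 0).1), (w 3).1 - ((w 1).1 - (w 0).1 + (w 1).2 - (w 0).2),
    (w 3).2 - ((w 2).2 - (w 1).2), (w 4).1 - ((w 1).2 - (w 0).2),
    (w 4).2 - ((w 2).2 - (w 1).2 - (w 0).1)]

lemma eq_ftv_iff {w : Fin 5 → ℂ × ℂ} :
    w = ftv (w 0).1 (w 0).2 (w 1).1 (w 1).2 (w 2).2 ↔ ∀ i, defect w i = 0 := by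
  rw [Fin.forall_fin_succ, Fin.forall_fin_succ, Fin.forall_fin_succ, Fin.forall_fin_succ,
    Fin.forall_fin_one]
  change _ ↔ (w 2).1 - ((w 1).1 - (w 0).1) = 0 ∧
    (w 3).1 - ((w 1).1 - (w 0).1 + (w 1).2 - (w 0).2) = 0 ∧ (w 3).2 - ((w 2).2 - (w 1).2) = 0 ∧
    (w 4).1 - ((w 1).2 - (w 0).2) = 0 ∧ (w 4).2 - ((w 2).2 - (w 1).2 - (w 0).1) = 0
  simp only [sub_eq_zero]
  constructor
  · intro h
    exact ⟨congrArg (fun w => (w 2).1) h, congrArg (fun w => (w 3).1) h,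
      congrArg (fun w => (w 3).2) h, congrArg (fun w => (w 4).1) h, congrArg (fun w => (w 4).2) h⟩
  · rintro ⟨a, b, c, d, e⟩
    funext i
    fin_cases i
    · rfl
    · rfl
    · exact Prod.ext a rfl
    · exact Prod.ext b c
    · exact Prod.ext d e

lemma exists_lft_of_mem_FTpre {w : Fin 5 → ℂ × ℂ} (h : w ∈ FTpre) :
    (∃ x y, Lft x y (w 0).1 (w 0).2 (w 1).1 (w 1).2 (w 2).2) ∧
      ∀ i, defect w i ∈ AddSubgroup.zmultiples (Cpi * I) := by
  obtain ⟨_, ⟨x, y, hx, hy, hxy, rfl⟩, hw⟩ := h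
  have hl : Lft x y (w 0).1 (w 0).2 (w 1).1 (w 1).2 (w 2).2 :=
    lft_iff.2 ⟨hxy, hw 0, hw 1, (liesOver_iff.1 (hw 2)).2.2⟩
  refine ⟨⟨x, y, hl⟩, fun i => ?_⟩
  fin_cases i
  · exact (liesOver_sub (hw 2) (hl.liesOver 2)).1
  · exact (liesOver_sub (hw 3) (hl.liesOver 3)).1
  · exact (liesOver_sub (hw 3) (hl.liesOver 3)).2
  · exact (liesOver_sub (hw 4) (hl.liesOver 4)).1
  · exact (liesOver_sub (hw 4) (hl.liesOver 4)).2

lemma continuous_defect (i : Fin 5) : Continuous fun w => defect w i := by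
  fin_cases i
  · change Continuous fun w : Fin 5 → ℂ × ℂ => (w 2).1 - ((w 1).1 - (w 0).1)
    fun_prop
  · change Continuous fun w : Fin 5 → ℂ × ℂ =>
      (w 3).1 - ((w 1).1 - (w 0).1 + (w 1).2 - (w 0).2)
    fun_prop
  · change Continuous fun w : Fin 5 → ℂ × ℂ => (w 3).2 - ((w 2).2 - (w 1).2)
    fun_prop
  · change Continuous fun w : Fin 5 → ℂ × ℂ => (w 4).1 - ((w 1).2 - (w 0).2)
    fun_prop
  · change Continuous fun w : Fin 5 → ℂ × ℂ => (w 4).2 - ((w 2).2 - (w 1).2 - (w 0).1)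
    fun_prop

lemma ftv_self {u₀ v₀ u₁ v₁ v₂ : ℂ} (i : Fin 5) : defect (ftv u₀ v₀ u₁ v₁ v₂) i = 0 :=
  eq_ftv_iff.1 rfl i

lemma exists_lft_of_mem_FThat₀ {w : Fin 5 → ℂ × ℂ} (h : w ∈ FThat₀) :
    ∃ x y u₀ v₀ u₁ v₁ v₂, Lft x y u₀ v₀ u₁ v₁ v₂ ∧ w = ftv u₀ v₀ u₁ v₁ v₂ := by
  have hs := connectedComponentIn_subset FTpre basePt
  obtain ⟨⟨x, y, hl⟩, -⟩ := exists_lft_of_mem_FTpre (hs h)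
  refine ⟨x, y, _, _, _, _, _, hl, eq_ftv_iff.2 fun i => ?_⟩
  obtain ⟨u₀, v₀, u₁, v₁, v₂, hb, e⟩ := exists_basePt
  have hm : basePt ∈ FThat₀ := mem_connectedComponentIn (e ▸ hb.mem_FTpre)
  rw [(isPreconnected_connectedComponentIn (F := FTpre) (x := basePt)).constant_of_mapsTo
    (T := (AddSubgroup.zmultiples (Cpi * I) : Set ℂ)) (f := fun w => defect w i)
    ⟨inferInstanceAs (DiscreteTopology (AddSubgroup.zmultiples (Cpi * I)))⟩
    (continuous_defect i).continuousOn
    (fun w hw => (exists_lft_of_mem_FTpre (hs hw)).2 i) h hm, e, ftv_self]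

lemma covAct_ftv {u₀ v₀ u₁ v₁ v₂ : ℂ} (p₀ q₀ p₁ q₁ q₂ : ℤ) :
    (fun i => covAct ((![(p₀, q₀), (p₁, q₁), (p₁ - p₀, q₂), (p₁ - p₀ + q₁ - q₀, q₂ - q₁),
          (q₁ - q₀, q₂ - q₁ - p₀)] : Fin 5 → ℤ × ℤ) i) (ftv u₀ v₀ u₁ v₁ v₂ i)) =
      ftv (u₀ + p₀ * (Cpi * I)) (v₀ + q₀ * (Cpi * I)) (u₁ + p₁ * (Cpi * I))
        (v₁ + q₁ * (Cpi * I)) (v₂ + q₂ * (Cpi * I)) := by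
  refine eq_ftv_iff.2 fun i => ?_
  fin_cases i
  · change u₁ - u₀ + ((p₁ - p₀ : ℤ) : ℂ) * (Cpi * I) - (u₁ + p₁ * (Cpi * I) - (u₀ + p₀ * (Cpi * I)))
        = 0
    push_cast
    ring
  · change u₁ - u₀ + v₁ - v₀ + ((p₁ - p₀ + q₁ - q₀ : ℤ) : ℂ) * (Cpi * I) -
      (u₁ + p₁ * (Cpi * I) - (u₀ + p₀ * (Cpi * I)) + (v₁ + q₁ * (Cpi * I)) -
        (v₀ + q₀ * (Cpi * I))) = 0
    push_cast
    ring
  · change v₂ - v₁ + ((q₂ - q₁ : ℤ) : ℂ) * (Cpi * I) -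
      (v₂ + q₂ * (Cpi * I) - (v₁ + q₁ * (Cpi * I))) = 0
    push_cast
    ring
  · change v₁ - v₀ + ((q₁ - q₀ : ℤ) : ℂ) * (Cpi * I) -
      (v₁ + q₁ * (Cpi * I) - (v₀ + q₀ * (Cpi * I))) = 0
    push_cast
    ring
  · change v₂ - v₁ - u₀ + ((q₂ - q₁ - p₀ : ℤ) : ℂ) * (Cpi * I) -
      (v₂ + q₂ * (Cpi * I) - (v₁ + q₁ * (Cpi * I)) - (u₀ + p₀ * (Cpi * I))) = 0
    push_cast
    ring

lemma Lft.shift {x y u₀ v₀ u₁ v₁ v₂ : ℂ} (h : Lft x y u₀ v₀ u₁ v₁ v₂) (p₀ q₀ p₁ q₁ q₂ : ℤ) :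
    Lft x y (u₀ + p₀ * (Cpi * I)) (v₀ + q₀ * (Cpi * I)) (u₁ + p₁ * (Cpi * I))
        (v₁ + q₁ * (Cpi * I)) (v₂ + q₂ * (Cpi * I)) := by
  obtain ⟨a, b, c, -⟩ := lft_iff.1 h
  exact lft_iff.2 ⟨a, liesOver_add b p₀ q₀, liesOver_add c p₁ q₁,
    (liesOver_iff.1 (liesOver_add (h.liesOver 2) 0 q₂)).2.2⟩

/-- The lifted five term tuples are the tuples of compatible logarithms. -/
theorem mem_FThat_iff {w : Fin 5 → ℂ × ℂ} : w ∈ FThat ↔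
    ∃ x y u₀ v₀ u₁ v₁ v₂, Lft x y u₀ v₀ u₁ v₁ v₂ ∧ w = ftv u₀ v₀ u₁ v₁ v₂ := by
  constructor
  · rintro ⟨w, hw, _, ⟨p₀, p₁, q₀, q₁, q₂, rfl⟩, rfl⟩
    obtain ⟨x, y, u₀, v₀, u₁, v₁, v₂, h, rfl⟩ := exists_lft_of_mem_FThat₀ hw
    exact ⟨x, y, _, _, _, _, _, h.shift p₀ q₀ p₁ q₁ q₂, covAct_ftv p₀ q₀ p₁ q₁ q₂⟩
  · rintro ⟨x, y, u₀, v₀, u₁, v₁, v₂, h, rfl⟩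
    obtain ⟨a₀, b₀, a₁, b₁, b₂, hb, e⟩ := exists_basePt
    have hm : basePt ∈ FThat₀ := mem_connectedComponentIn (e ▸ hb.mem_FTpre)
    refine base_induction (P := fun x y => ∀ u₀ v₀ u₁ v₁ v₂ : ℂ,
      Lft x y u₀ v₀ u₁ v₁ v₂ → ftv u₀ v₀ u₁ v₁ v₂ ∈ FThat) ?_ hb.hx hb.hy hb.hxy ?_
      h.hx h.hy h.hxy u₀ v₀ u₁ v₁ v₂ h
    · intro x₀ y₀ x₁ y₁ _ _ _ _ _ _ hn hP u₀ v₀ u₁ v₁ v₂ h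
      obtain ⟨D, X, Y, U₀, V₀, U₁, V₁, V₂, -, hp, h0, h1, rfl, rfl, rfl, rfl, e, hL, hd⟩ :=
        h.exists_sheet hn
      obtain ⟨w, hw, _, ⟨p₀, p₁, q₀, q₁, q₂, rfl⟩, hv⟩ := hP _ _ _ _ _ (hL 1 h1)
      obtain ⟨c, d, r₀, s₀, r₁, s₁, s₂, -, rfl⟩ := exists_lft_of_mem_FThat₀ hw
      rw [covAct_ftv] at hv
      let G : ℂ → Fin 5 → ℂ × ℂ := fun t => ftv (U₀ t + (-p₀ : ℤ) * (Cpi * I))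
        (V₀ t + (-q₀ : ℤ) * (Cpi * I)) (U₁ t + (-p₁ : ℤ) * (Cpi * I))
        (V₁ t + (-q₁ : ℤ) * (Cpi * I)) (V₂ t + (-q₂ : ℤ) * (Cpi * I))
      have hG1 : G 1 = ftv r₀ s₀ r₁ s₁ s₂ := by
        have c0 := congrArg (fun w => (w 0).1) hv
        have c1 := congrArg (fun w => (w 0).2) hv
        have c2 := congrArg (fun w => (w 1).1) hv
        have c3 := congrArg (fun w => (w 1).2) hv
        have c4 := congrArg (fun w => (w 2).2) hv
        change U₀ 1 = _ at c0
        change V₀ 1 = _ at c1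
        change U₁ 1 = _ at c2
        change V₁ 1 = _ at c3
        change V₂ 1 = _ at c4
        have l (a : ℂ) (n : ℤ) : a + n * (Cpi * I) + (-n : ℤ) * (Cpi * I) = a := by
          push_cast
          ring
        simp only [G, c0, c1, c2, c3, c4]
        change ftv (r₀ + p₀ * (Cpi * I) + _) (s₀ + q₀ * (Cpi * I) + _)
          (r₁ + p₁ * (Cpi * I) + _) (s₁ + q₁ * (Cpi * I) + _) (s₂ + q₂ * (Cpi * I) + _) = _
        rw [l, l, l, l, l]
      have hc : ContinuousOn G D := by
        have k0 : ContinuousOn U₀ D := fun t ht => (hd t ht).2.2.1.continuousAt.continuousWithinAt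
        have k1 : ContinuousOn V₀ D := fun t ht =>
          (hd t ht).2.2.2.1.continuousAt.continuousWithinAt
        have k2 : ContinuousOn U₁ D := fun t ht =>
          (hd t ht).2.2.2.2.1.continuousAt.continuousWithinAt
        have k3 : ContinuousOn V₁ D := fun t ht =>
          (hd t ht).2.2.2.2.2.1.continuousAt.continuousWithinAt
        have k4 : ContinuousOn V₂ D := fun t ht =>
          (hd t ht).2.2.2.2.2.2.continuousAt.continuousWithinAt
        refine continuousOn_pi.2 fun i => ?_
        fin_cases i
        · exact ContinuousOn.prodMk (by fun_prop) (by fun_prop)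
        · exact ContinuousOn.prodMk (by fun_prop) (by fun_prop)
        · exact ContinuousOn.prodMk (by fun_prop) (by fun_prop)
        · exact ContinuousOn.prodMk (by fun_prop) (by fun_prop)
        · exact ContinuousOn.prodMk (by fun_prop) (by fun_prop)
      have hsub := (hp.image G hc).subset_connectedComponentIn (F := FTpre)
        (mem_image_of_mem G h1) (by
          rintro _ ⟨t, ht, rfl⟩
          exact ((hL t ht).shift _ _ _ _ _).mem_FTpre)
      rw [hG1, ← connectedComponentIn_eq hw] at hsub
      refine ⟨G 0, hsub (mem_image_of_mem G h0), _, ⟨p₀, p₁, q₀, q₁, q₂, rfl⟩, ?_⟩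
      have l (a : ℂ) (n : ℤ) : a + (-n : ℤ) * (Cpi * I) + n * (Cpi * I) = a := by
        push_cast
        ring
      rw [covAct_ftv, l, l, l, l, l, e]
    · intro u₀ v₀ u₁ v₁ v₂ h
      obtain ⟨p₀, q₀, p₁, q₁, q₂, rfl, rfl, rfl, rfl, rfl⟩ := hb.exists_shift h
      exact ⟨basePt, hm, _, ⟨p₀, p₁, q₀, q₁, q₂, rfl⟩, by rw [e, covAct_ftv]⟩

end

/-- The additive constant of the extended Rogers dilogarithm. -/
def dlgK : ModPiSq := exists_dlgSum_const.choose

/-- The extended Rogers dilogarithm, normalized to satisfy the five term relation. -/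
def rdl (z u v : ℂ) : ModPiSq := dlg z u v - dlgK

lemma Lft.rdl_five {x y u₀ v₀ u₁ v₁ v₂ : ℂ} (h : Lft x y u₀ v₀ u₁ v₁ v₂) :
    rdl x u₀ v₀ - rdl y u₁ v₁ + rdl (y / x) (u₁ - u₀) v₂ -
      rdl ((1 - x⁻¹) / (1 - y⁻¹)) (u₁ - u₀ + v₁ - v₀) (v₂ - v₁) +
      rdl ((1 - x) / (1 - y)) (v₁ - v₀) (v₂ - v₁ - u₀) = 0 := by
  have e := dlgSum_eq.symm.trans (exists_dlgSum_const.choose_spec x y u₀ v₀ u₁ v₁ v₂ h)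
  rw [← sub_eq_zero] at e
  rw [← e]
  simp only [rdl]
  change _ = _ - dlgK
  abel

lemma rdl_shift {z u v : ℂ} (h : LiesOver (u, v) z) (p q : ℤ) :
    rdl z (u + p * (Cpi * I)) (v + q * (Cpi * I)) = rdl z u v +
      ((1 / 2 * (Cpi * I) * (p * v - q * u) + 1 / 2 * (p * q) * (Cpi * I) ^ 2 : ℂ) : ModPiSq) := by
  rw [rdl, dlg_shift h, rdl]
  abel

/-- The equation of the component `X₀₀`. -/
def Ebp (u v : ℂ) : Prop := exp u + exp (-v) = 1

lemma Ebp.reg {u v : ℂ} (h : Ebp u v) : Reg (exp u) :=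
  ⟨exp_ne_zero u, fun e => exp_ne_zero (-v) (by rw [Ebp, e] at h; linear_combination h)⟩

lemma mem_X00_iff {u v : ℂ} : (u, v) ∈ X00 ↔ Ebp u v := by
  constructor
  · rintro ⟨z, hz, p, q, e⟩
    rw [pt, Prod.mk.injEq] at e
    have e1 : exp u = z := by
      rw [← exp_log hz.1, exp_eq_iff_tau]
      exact ⟨p, by rw [e.1, tau_eq]; push_cast; ring⟩
    have e2 : exp (-v) = 1 - z := by
      rw [← exp_log hz.sub_ne, exp_eq_iff_tau]
      exact ⟨-q, by rw [e.2, tau_eq]; push_cast; ring⟩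
    rw [Ebp, e1, e2, add_sub_cancel]
  · intro h
    have hz := h.reg
    refine ⟨exp u, hz, ?_⟩
    obtain ⟨p, hp⟩ := exp_eq_iff_tau.1 (exp_log hz.1).symm
    obtain ⟨q, hq⟩ := exp_eq_iff_tau.1
      ((exp_log hz.sub_ne).trans (sub_eq_of_eq_add' (Eq.symm h)))
    refine ⟨p, q, Prod.ext ?_ ?_⟩
    · change u = log (exp u) + ((2 * p : ℤ) : ℂ) * (Cpi * I)
      push_cast
      linear_combination hp + p * tau_eq
    · change v = -log (1 - exp u) + ((2 * q : ℤ) : ℂ) * (Cpi * I)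
      push_cast
      linear_combination hq + q * tau_eq

lemma ebp_log {z : ℂ} (hz : Reg z) : Ebp (log z) (-log (1 - z)) := by
  rw [Ebp, neg_neg, exp_log hz.1, exp_log hz.sub_ne, add_sub_cancel]

lemma Ebp.liesOver {u v : ℂ} (h : Ebp u v) : LiesOver (u, v) (exp u) := by
  refine liesOver_iff.2 ⟨h.reg, rfl, ?_⟩
  rw [sub_eq_of_eq_add' (Eq.symm h), ← mul_pow, ← exp_add, add_neg_cancel, exp_zero, one_pow]

lemma Ebp.shift {u v : ℂ} (h : Ebp u v) (p q : ℤ) : Ebp (u + p * tau) (v + q * tau) := by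
  rw [Ebp, ← h]
  congr 1
  · exact exp_eq_iff_tau.2 ⟨p, rfl⟩
  · exact exp_eq_iff_tau.2 ⟨-q, by push_cast; ring⟩

lemma Ebp.exists_shift {u v u' v' : ℂ} (h : Ebp u v) (h' : Ebp u' v') (e : exp u' = exp u) :
    ∃ p q : ℤ, u' = u + p * tau ∧ v' = v + q * tau := by
  obtain ⟨p, hp⟩ := exp_eq_iff_tau.1 e
  have e' : exp (-v') = exp (-v) := by
    rw [Ebp] at h h'
    linear_combination h' - h - e
  obtain ⟨q, hq⟩ := exp_eq_iff_tau.1 e'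
  exact ⟨p, -q, hp, by push_cast; linear_combination -hq⟩

/-- The hypotheses of the five term relation on `X₀₀`. -/
structure Five (u₀ v₀ u₁ v₁ v₂ : ℂ) : Prop where
  e₀ : Ebp u₀ v₀
  e₁ : Ebp u₁ v₁
  e₂ : Ebp (u₁ - u₀) v₂

section

variable {u₀ v₀ u₁ v₁ v₂ : ℂ}

lemma Five.lft (h : Five u₀ v₀ u₁ v₁ v₂) : Lft (exp u₀) (exp u₁) u₀ v₀ u₁ v₁ v₂ := by
  refine lft_iff.2 ⟨fun e => h.e₂.reg.2 ?_, h.e₀.liesOver, h.e₁.liesOver, ?_⟩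
  · rw [exp_sub, e, div_self (exp_ne_zero _)]
  · rw [← exp_sub]
    exact (liesOver_iff.1 h.e₂.liesOver).2.2

lemma Five.exp₃ (h : Five u₀ v₀ u₁ v₁ v₂) :
    exp (u₁ - u₀ + v₁ - v₀) = (1 - (exp u₀)⁻¹) / (1 - (exp u₁)⁻¹) := by
  have a : exp (-v₀) = 1 - exp u₀ := by rw [← h.e₀, add_sub_cancel_left]
  have b : exp (-v₁) = 1 - exp u₁ := by rw [← h.e₁, add_sub_cancel_left]
  have e : u₁ - u₀ + v₁ - v₀ = u₁ - u₀ + (-v₀ - -v₁) := by ring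
  rw [e, exp_add, exp_sub, exp_sub, a, b, eq_div_iff (inv_ne h.e₁.reg)]
  have := exp_ne_zero u₀
  have := exp_ne_zero u₁
  have := h.e₁.reg.sub_ne
  field_simp
  ring

lemma Five.exp₄ (h : Five u₀ v₀ u₁ v₁ v₂) : exp (v₁ - v₀) = (1 - exp u₀) / (1 - exp u₁) := by
  have a : exp (-v₀) = 1 - exp u₀ := by rw [← h.e₀, add_sub_cancel_left]
  have b : exp (-v₁) = 1 - exp u₁ := by rw [← h.e₁, add_sub_cancel_left]
  rw [← a, ← b, ← exp_sub]
  ring_nf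

lemma Five.e₃ (h : Five u₀ v₀ u₁ v₁ v₂) : Ebp (u₁ - u₀ + v₁ - v₀) (v₂ - v₁) := by
  have b : exp (-v₁) = 1 - exp u₁ := by rw [← h.e₁, add_sub_cancel_left]
  have c : exp (-v₂) = 1 - exp u₁ / exp u₀ := by rw [← h.e₂, exp_sub, add_sub_cancel_left]
  rw [Ebp, h.exp₃, show -(v₂ - v₁) = -v₂ - -v₁ by ring, exp_sub, b, c]
  have e0 := exp_ne_zero u₀
  have e1 := exp_ne_zero u₁
  have e2 := h.e₁.reg.sub_ne
  have e3 := inv_ne h.e₁.reg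
  rw [show 1 - (exp u₁)⁻¹ = -(1 - exp u₁) / exp u₁ by field_simp; ring]
  field_simp
  ring

lemma Five.e₄ (h : Five u₀ v₀ u₁ v₁ v₂) : Ebp (v₁ - v₀) (v₂ - v₁ - u₀) := by
  have b : exp (-v₁) = 1 - exp u₁ := by rw [← h.e₁, add_sub_cancel_left]
  have c : exp (-v₂) = 1 - exp u₁ / exp u₀ := by rw [← h.e₂, exp_sub, add_sub_cancel_left]
  rw [Ebp, h.exp₄, show -(v₂ - v₁ - u₀) = -v₂ - -v₁ + u₀ by ring, exp_add, exp_sub, b, c]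
  have e0 := exp_ne_zero u₀
  have e2 := h.e₁.reg.sub_ne
  field_simp
  ring

end

/-- The class of a point of `X₀₀`. -/
def ebr (u v : ℂ) : EEPreBloch :=
  if h : Ebp u v then QuotientAddGroup.mk (of ⟨(u, v), mem_X00_iff.2 h⟩) else 0

lemma mk_of_eq_ebr (w : X00T) : (QuotientAddGroup.mk (of w) : EEPreBloch) = ebr w.1.1 w.1.2 := by
  rw [ebr, dif_pos (mem_X00_iff.1 w.2)]

lemma Five.ebr_five {u₀ v₀ u₁ v₁ v₂ : ℂ} (h : Five u₀ v₀ u₁ v₁ v₂) :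
    ebr u₀ v₀ - ebr u₁ v₁ + ebr (u₁ - u₀) v₂ - ebr (u₁ - u₀ + v₁ - v₀) (v₂ - v₁) +
      ebr (v₁ - v₀) (v₂ - v₁ - u₀) = 0 := by
  have hc : ∀ i, ftv u₀ v₀ u₁ v₁ v₂ i ∈ X00 := by
    intro i
    fin_cases i
    exacts [mem_X00_iff.2 h.e₀, mem_X00_iff.2 h.e₁, mem_X00_iff.2 h.e₂, mem_X00_iff.2 h.e₃,
      mem_X00_iff.2 h.e₄]
  have hm : ∑ i : Fin 5, (-1 : ℤ) ^ (i : ℕ) • of (⟨ftv u₀ v₀ u₁ v₁ v₂ i, hc i⟩ : X00T) ∈ relSub₀ :=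
    AddSubgroup.subset_closure ⟨_, mem_FThat_iff.2 ⟨_, _, _, _, _, _, _, h.lft, rfl⟩, hc, rfl⟩
  have e := (QuotientAddGroup.eq_zero_iff _).2 hm
  rw [Fin.sum_univ_five] at e
  rw [← e, ebr, ebr, ebr, ebr, ebr, dif_pos h.e₀, dif_pos h.e₁, dif_pos h.e₂, dif_pos h.e₃,
    dif_pos h.e₄]
  rw [← QuotientAddGroup.mk_sub, ← QuotientAddGroup.mk_add, ← QuotientAddGroup.mk_sub,
    ← QuotientAddGroup.mk_add]
  refine congrArg QuotientAddGroup.mk ?_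
  change _ = (1 : ℤ) • of (⟨(u₀, v₀), _⟩ : X00T) + (-1 : ℤ) • of (⟨(u₁, v₁), _⟩ : X00T) +
    (1 : ℤ) • of (⟨(u₁ - u₀, v₂), _⟩ : X00T) +
    (-1 : ℤ) • of (⟨(u₁ - u₀ + v₁ - v₀, v₂ - v₁), _⟩ : X00T) +
    (1 : ℤ) • of (⟨(v₁ - v₀, v₂ - v₁ - u₀), _⟩ : X00T)
  simp only [one_smul, neg_smul]
  abel

section

variable {M : Type} [AddCommGroup M]

lemma ee_lift_aux (f : ℂ → ℂ → M) (hf : ∀ u₀ v₀ u₁ v₁ v₂, Five u₀ v₀ u₁ v₁ v₂ →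
    f u₀ v₀ - f u₁ v₁ + f (u₁ - u₀) v₂ - f (u₁ - u₀ + v₁ - v₀) (v₂ - v₁) +
      f (v₁ - v₀) (v₂ - v₁ - u₀) = 0) :
    ∀ a ∈ relSub₀, FreeAbelianGroup.lift (fun w : X00T => f w.1.1 w.1.2) a = 0 := by
  intro a ha
  refine (AddSubgroup.closure_le (K := (FreeAbelianGroup.lift
    fun w : X00T => f w.1.1 w.1.2).ker)).2 ?_ ha
  rintro _ ⟨w, hw, hc, rfl⟩
  obtain ⟨x, y, u₀, v₀, u₁, v₁, v₂, -, rfl⟩ := mem_FThat_iff.1 hw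
  have := hf u₀ v₀ u₁ v₁ v₂ ⟨mem_X00_iff.1 (hc 0), mem_X00_iff.1 (hc 1), mem_X00_iff.1 (hc 2)⟩
  rw [SetLike.mem_coe, AddMonoidHom.mem_ker, map_sum, Fin.sum_univ_five]
  simp only [map_zsmul, FreeAbelianGroup.lift_apply_of]
  change (1 : ℤ) • f u₀ v₀ + (-1 : ℤ) • f u₁ v₁ + (1 : ℤ) • f (u₁ - u₀) v₂ +
    (-1 : ℤ) • f (u₁ - u₀ + v₁ - v₀) (v₂ - v₁) + (1 : ℤ) • f (v₁ - v₀) (v₂ - v₁ - u₀) = 0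
  rw [← this]
  simp only [one_smul, neg_smul]
  abel

/-- Homomorphisms out of the extended pre-Bloch group. -/
def eeLift (f : ℂ → ℂ → M) (hf : ∀ u₀ v₀ u₁ v₁ v₂, Five u₀ v₀ u₁ v₁ v₂ →
    f u₀ v₀ - f u₁ v₁ + f (u₁ - u₀) v₂ - f (u₁ - u₀ + v₁ - v₀) (v₂ - v₁) +
      f (v₁ - v₀) (v₂ - v₁ - u₀) = 0) : EEPreBloch →+ M :=
  QuotientAddGroup.lift relSub₀ _ (ee_lift_aux f hf)

lemma eeLift_ebr (f : ℂ → ℂ → M) (hf) {u v : ℂ} (h : Ebp u v) : eeLift f hf (ebr u v) = f u v := by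
  rw [ebr, dif_pos h]
  exact FreeAbelianGroup.lift_apply_of _ _

lemma ee_ext {f g : EEPreBloch →+ M} (h : ∀ u v, Ebp u v → f (ebr u v) = g (ebr u v)) : f = g := by
  refine QuotientAddGroup.addMonoidHom_ext _ (fa_ext fun w => ?_)
  change f (QuotientAddGroup.mk (of w)) = g (QuotientAddGroup.mk (of w))
  rw [mk_of_eq_ebr]
  exact h _ _ (mem_X00_iff.1 w.2)

end

lemma wedge_five (u₀ v₀ u₁ v₁ v₂ : ℂ) : wedge u₀ v₀ - wedge u₁ v₁ + wedge (u₁ - u₀) v₂ -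
    wedge (u₁ - u₀ + v₁ - v₀) (v₂ - v₁) + wedge (v₁ - v₀) (v₂ - v₁ - u₀) = 0 := by
  change wedgeB _ _ - wedgeB _ _ + wedgeB _ _ - wedgeB _ _ + wedgeB _ _ = 0
  simp only [map_add, map_sub, AddMonoidHom.add_apply, AddMonoidHom.sub_apply, wedgeB_self,
    alt_swap wedgeB_self v₁ u₀, alt_swap wedgeB_self v₀ u₀]
  abel

lemma nuHom₀_ebr {u v : ℂ} (h : Ebp u v) : nuHom₀ (ebr u v) = wedge u v := by
  have hn : ∀ a ∈ relSub₀, nuFree₀ a = 0 := ee_lift_aux wedge fun _ _ _ _ _ _ =>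
    wedge_five _ _ _ _ _
  rw [nuHom₀, dif_pos hn, ebr, dif_pos h]
  exact FreeAbelianGroup.lift_apply_of _ _

/-- The dilogarithm on the extended pre-Bloch group. -/
def eeR : EEPreBloch →+ ModPiSq :=
  eeLift (fun u v => rdl (exp u) u v) fun u₀ v₀ u₁ v₁ v₂ h => by
    rw [h.exp₃, h.exp₄, exp_sub]
    exact h.lft.rdl_five

lemma eeR_ebr {u v : ℂ} (h : Ebp u v) : eeR (ebr u v) = rdl (exp u) u v := eeLift_ebr _ _ h

/-- The class of `z` in the pre-Bloch group satisfies the five term relation. -/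
lemma pbCls_five {x y : ℂ} (hx : Reg x) (hy : Reg y) (hxy : x ≠ y) :
    pbCls x - pbCls y + pbCls (y / x) - pbCls ((1 - x⁻¹) / (1 - y⁻¹)) +
      pbCls ((1 - x) / (1 - y)) = 0 := by
  have h2 := reg_three hx hy hxy
  have h3 := reg_four hx hy hxy
  have h4 := reg_five hx hy hxy
  rw [pbCls, pbCls, pbCls, pbCls, pbCls, dif_pos hx, dif_pos hy, dif_pos h2, dif_pos h3,
    dif_pos h4]
  exact (QuotientAddGroup.eq_zero_iff _).2
    (AddSubgroup.subset_closure ⟨x, y, hx, hy, hxy, h2, h3, h4, rfl⟩)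

/-- The projection from the extended to the classical pre-Bloch group. -/
def eeP : EEPreBloch →+ PreBloch :=
  eeLift (fun u _ => pbCls (exp u)) fun u₀ v₀ u₁ v₁ v₂ h => by
    rw [h.exp₃, h.exp₄, exp_sub]
    exact pbCls_five h.e₀.reg h.e₁.reg h.lft.hxy

lemma eeP_ebr {u v : ℂ} (h : Ebp u v) : eeP (ebr u v) = pbCls (exp u) := eeLift_ebr _ _ h

lemma wPB_eeP (e : EEPreBloch) : wPB (eeP e) = -m2q (nuHom₀ e) := by
  refine DFunLike.congr_fun (f := wPB.comp eeP) (g := -(m2q.comp nuHom₀)) (ee_ext fun u v h => ?_) e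
  change wPB (eeP (ebr u v)) = -m2q (nuHom₀ (ebr u v))
  rw [eeP_ebr h, nuHom₀_ebr h, pbCls, dif_pos h.reg, pbGen, wPB_of, omReg,
    omg_eq (x := u) (y := -v) rfl (sub_eq_of_eq_add' (Eq.symm h)).symm, ← map_neg]
  exact congrArg m2q (map_neg (wedgeB u) v)

section

variable {M : Type*} [AddCommGroup M]

/-- A function additive on the right half plane extends to a homomorphism. -/
lemma exists_hom_of_re_pos {A : ℂ → M}
    (hA : ∀ a b : ℂ, 0 < a.re → 0 < b.re → A (a + b) = A a + A b) :
    ∃ F : ℂ →+ M, ∀ u w : ℂ, 0 < w.re → 0 < (u + w).re → F u = A (u + w) - A w := by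
  have hr : ∀ u : ℂ, 0 < ((|u.re| + 1 : ℝ) : ℂ).re ∧ 0 < (u + ((|u.re| + 1 : ℝ) : ℂ)).re := by
    intro u
    rw [add_re, ofReal_re]
    exact ⟨by positivity, by linarith [neg_abs_le u.re]⟩
  have key : ∀ u w w' : ℂ, 0 < w.re → 0 < (u + w).re → 0 < w'.re → 0 < (u + w').re →
      A (u + w) - A w = A (u + w') - A w' := by
    intro u w w' h1 h2 h3 h4
    rw [sub_eq_sub_iff_add_eq_add, ← hA _ _ h2 h3, ← hA _ _ h4 h1]
    congr 1
    ring
  refine ⟨AddMonoidHom.mk' (fun u => A (u + ((|u.re| + 1 : ℝ) : ℂ)) - A ((|u.re| + 1 : ℝ) : ℂ))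
    fun u u' => ?_, fun u w h1 h2 => key _ _ _ (hr u).1 (hr u).2 h1 h2⟩
  obtain ⟨h1, h2⟩ := hr u
  obtain ⟨h3, h4⟩ := hr u'
  have e : u + u' + (((|u.re| + 1 : ℝ) : ℂ) + ((|u'.re| + 1 : ℝ) : ℂ)) =
      u + ((|u.re| + 1 : ℝ) : ℂ) + (u' + ((|u'.re| + 1 : ℝ) : ℂ)) := by ring
  rw [key (u + u') _ (((|u.re| + 1 : ℝ) : ℂ) + ((|u'.re| + 1 : ℝ) : ℂ)) (hr _).1 (hr _).2
    (by rw [add_re]; exact add_pos h1 h3) (by rw [e, add_re]; exact add_pos h2 h4), e,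
    hA _ _ h2 h4, hA _ _ h1 h3]
  abel

lemma hom_eq_of_re_pos {F G : ℂ →+ M} (h : ∀ u : ℂ, 0 < u.re → F u = G u) : F = G := by
  ext u
  have h1 : 0 < ((|u.re| + 1 : ℝ) : ℂ).re := by rw [ofReal_re]; positivity
  have h2 : 0 < (u + ((|u.re| + 1 : ℝ) : ℂ)).re := by
    rw [add_re, ofReal_re]
    linarith [neg_abs_le u.re]
  rw [← add_sub_cancel_right u ((|u.re| + 1 : ℝ) : ℂ), F.map_sub, G.map_sub, h _ h1, h _ h2]

end

lemma exp_ne_one_of_re_pos {u : ℂ} (h : 0 < u.re) : exp u ≠ 1 := by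
  intro e
  have := congrArg norm e
  rw [norm_exp, norm_one, Real.exp_eq_one_iff] at this
  exact h.ne' this

lemma exists_ebp {u : ℂ} (h : exp u ≠ 1) : ∃ v, Ebp u v := by
  refine ⟨-log (1 - exp u), ?_⟩
  rw [Ebp, neg_neg, exp_log (sub_ne_zero.2 (Ne.symm h)), add_sub_cancel]

lemma Ebp.exp_neg {u v : ℂ} (h : Ebp u v) : exp (-v) = 1 - exp u := by
  rw [← h, add_sub_cancel_left]

lemma Ebp.add_tau {u v : ℂ} (h : Ebp u v) : Ebp u (v + tau) := by
  simpa using h.shift 0 1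

lemma Ebp.sub_tau {u v : ℂ} (h : Ebp u v) : Ebp u (v - tau) := by
  simpa [sub_eq_add_neg] using h.shift 0 (-1)

lemma Ebp.shift_right {u v : ℂ} (h : Ebp u v) (q : ℤ) : Ebp u (v + q * tau) := by
  simpa using h.shift 0 q

lemma Ebp.shift_left {u v : ℂ} (h : Ebp u v) (p : ℤ) : Ebp (u + p * tau) v := by
  simpa using h.shift p 0

lemma Ebp.tau_add {u v : ℂ} (h : Ebp u v) : Ebp (u + tau) v := by
  simpa using h.shift 1 0

/-- The change of a class under a shift of the second logarithm. -/
def ebD (u v : ℂ) : EEPreBloch := ebr u (v + tau) - ebr u v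

lemma Five.ebD_five {u₀ v₀ u₁ v₁ v₂ : ℂ} (h : Five u₀ v₀ u₁ v₁ v₂) :
    ebD (u₁ - u₀) v₂ - ebD (u₁ - u₀ + v₁ - v₀) (v₂ - v₁) + ebD (v₁ - v₀) (v₂ - v₁ - u₀) = 0 := by
  have h1 := h.ebr_five
  have h2 := (Five.mk h.e₀ h.e₁ h.e₂.add_tau).ebr_five
  rw [add_sub_right_comm v₂ tau v₁, add_sub_right_comm (v₂ - v₁) tau u₀] at h2
  rw [← sub_eq_zero.2 (h2.trans h1.symm)]
  simp only [ebD]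
  abel

lemma exists_five_last {b w : ℂ} (h : Ebp b w) :
    ∃ u₀ v₀ u₁ v₁ v₂, Five u₀ v₀ u₁ v₁ v₂ ∧ v₁ - v₀ = b ∧ v₂ - v₁ - u₀ = w := by
  obtain ⟨y, hy⟩ := Infinite.exists_notMem_finset ({0, 1, (exp b - 1) / exp b} : Finset ℂ)
  simp only [Finset.mem_insert, Finset.mem_singleton, not_or] at hy
  obtain ⟨hy0, hy1, hyb⟩ := hy
  have ht := exp_ne_zero b
  have hx : 1 - exp b + exp b * y ≠ 0 := fun e => hyb (by
    rw [eq_div_iff ht]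
    linear_combination e)
  have hy1' : 1 - y ≠ 0 := sub_ne_zero.2 (Ne.symm hy1)
  refine ⟨log (1 - exp b + exp b * y), -log (1 - y) - b, log y, -log (1 - y),
    w + -log (1 - y) + log (1 - exp b + exp b * y), ⟨?_, ?_, ?_⟩, by ring, by ring⟩
  · rw [Ebp, exp_log hx, neg_sub, sub_neg_eq_add, exp_add, exp_log hy1']
    ring
  · rw [Ebp, exp_log hy0, neg_neg, exp_log hy1', add_sub_cancel]
  · rw [Ebp, exp_sub, exp_log hx, exp_log hy0, neg_add, neg_add, neg_neg, exp_add, exp_add,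
      exp_log hy1', h.exp_neg, Complex.exp_neg, exp_log hx, ← div_eq_mul_inv, ← add_div,
      div_eq_one_iff_eq hx]
    ring

lemma ebD_sub_tau {b w : ℂ} (h : Ebp b w) : ebD b (w - tau) = ebD b w := by
  obtain ⟨u₀, v₀, u₁, v₁, v₂, hf, rfl, rfl⟩ := exists_five_last h
  have h1 := hf.ebD_five
  have h2 := (Five.mk hf.e₀.tau_add hf.e₁.tau_add (v₂ := v₂) (by
    rw [add_sub_add_right_eq_sub]; exact hf.e₂)).ebD_five
  rw [add_sub_add_right_eq_sub, ← sub_sub] at h2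
  exact add_left_cancel (h2.trans h1.symm)

lemma ebD_congr {u v v' : ℂ} (h : Ebp u v) (h' : Ebp u v') : ebD u v = ebD u v' := by
  obtain ⟨-, q, -, rfl⟩ := h.exists_shift h' rfl
  clear h'
  induction q using Int.induction_on with
  | zero => simp
  | succ n ih =>
    refine ih.trans ?_
    rw [← ebD_sub_tau (h.shift_right (n + 1))]
    congr 1
    push_cast
    ring
  | pred n ih =>
    rw [ih, ← ebD_sub_tau (h.shift_right (-n))]
    congr 1
    push_cast
    ring

lemma exists_five_mid {a b : ℂ} (ha : exp a ≠ 1) (hb : exp b ≠ 1) (hab : exp (a + b) ≠ 1) :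
    ∃ u₀ v₀ u₁ v₁ v₂, Five u₀ v₀ u₁ v₁ v₂ ∧ u₁ - u₀ = a ∧ v₁ - v₀ = b := by
  rw [exp_add] at hab
  have ht := exp_ne_zero b
  have hs := exp_ne_zero a
  have ha' := sub_ne_zero.2 ha
  have hb' := sub_ne_zero.2 hb
  have hab' := sub_ne_zero.2 hab
  have hx : (exp b - 1) / (exp a * exp b - 1) ≠ 0 := div_ne_zero hb' hab'
  have hx1 : 1 - (exp b - 1) / (exp a * exp b - 1) ≠ 0 := by
    rw [one_sub_div hab']
    refine div_ne_zero (fun e => mul_ne_zero ha' ht ?_) hab'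
    linear_combination e
  refine ⟨log ((exp b - 1) / (exp a * exp b - 1)), -log (1 - (exp b - 1) / (exp a * exp b - 1)),
    log ((exp b - 1) / (exp a * exp b - 1)) + a,
    -log (1 - (exp b - 1) / (exp a * exp b - 1)) + b, -log (1 - exp a), ⟨?_, ?_, ?_⟩,
    by ring, by ring⟩
  · rw [Ebp, exp_log hx, neg_neg, exp_log hx1, add_sub_cancel]
  · rw [Ebp, exp_add, exp_log hx, neg_add, neg_neg, exp_add, exp_log hx1, Complex.exp_neg]
    linear_combination (exp b)⁻¹ * div_mul_cancel₀ (exp b - 1) hab' -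
      ((exp b - 1) / (exp a * exp b - 1) * exp a - 1) * mul_inv_cancel₀ ht
  · rw [Ebp, add_sub_cancel_left, neg_neg, exp_log (sub_ne_zero.2 (Ne.symm ha)), add_sub_cancel]

lemma ebD_add {a b v w v' : ℂ} (ha : Ebp a v) (hb : Ebp b w) (hab : Ebp (a + b) v') :
    ebD (a + b) v' = ebD a v + ebD b w := by
  obtain ⟨u₀, v₀, u₁, v₁, v₂, h, rfl, rfl⟩ :=
    exists_five_mid ha.reg.2 hb.reg.2 hab.reg.2
  have e := h.ebD_five
  have e3 := h.e₃
  rw [add_sub_assoc] at e e3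
  rw [ebD_congr ha h.e₂, ebD_congr hb h.e₄, ebD_congr hab e3]
  rw [sub_add_eq_add_sub] at e
  exact (sub_eq_zero.1 e).symm

lemma exists_eA : ∃ F : ℂ →+ EEPreBloch, ∀ u v, Ebp u v → F u = ebD u v := by
  have h := exists_hom_of_re_pos (A := fun u => ebD u (-log (1 - exp u))) fun a b ha hb => by
    have p : ∀ {u : ℂ}, 0 < u.re → Ebp u (-log (1 - exp u)) := fun {u} hu => by
      rw [Ebp, neg_neg, exp_log (sub_ne_zero.2 (exp_ne_one_of_re_pos hu).symm), add_sub_cancel]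
    exact ebD_add (p ha) (p hb) (p (by rw [add_re]; exact add_pos ha hb))
  obtain ⟨F, hF⟩ := h
  refine ⟨F, fun u v huv => ?_⟩
  have p : ∀ {u : ℂ}, 0 < u.re → Ebp u (-log (1 - exp u)) := fun {u} hu => by
    rw [Ebp, neg_neg, exp_log (sub_ne_zero.2 (exp_ne_one_of_re_pos hu).symm), add_sub_cancel]
  have h1 : 0 < ((|u.re| + 1 : ℝ) : ℂ).re := by rw [ofReal_re]; positivity
  have h2 : 0 < (u + ((|u.re| + 1 : ℝ) : ℂ)).re := by
    rw [add_re, ofReal_re]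
    linarith [neg_abs_le u.re]
  rw [hF u _ h1 h2]
  rw [ebD_add huv (p h1) (p h2), add_sub_cancel_right]

/-- The homomorphism describing the shift of the second logarithm. -/
def eA : ℂ →+ EEPreBloch := exists_eA.choose

lemma eA_eq {u v : ℂ} (h : Ebp u v) : eA u = ebD u v := exists_eA.choose_spec u v h

lemma ebr_add_tau {u v : ℂ} (h : Ebp u v) : ebr u (v + tau) = ebr u v + eA u := by
  rw [eA_eq h, ebD, add_sub_cancel]

lemma ebr_sub_tau {u v : ℂ} (h : Ebp u v) : ebr u (v - tau) = ebr u v - eA u := by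
  rw [eq_sub_iff_add_eq, ← ebr_add_tau h.sub_tau, sub_add_cancel]

/-- The change of a class under a shift of the first logarithm, up to its expected value. -/
def ebB (u v : ℂ) : EEPreBloch := ebr (u + tau) v - ebr u v + eA v

lemma ebB_eq_of_ne {u₀ v₀ u₁ v₁ : ℂ} (h₀ : Ebp u₀ v₀) (h₁ : Ebp u₁ v₁) (hne : exp u₁ ≠ exp u₀) :
    ebB u₀ v₀ = ebB u₁ v₁ := by
  obtain ⟨v₂, h₂⟩ := exists_ebp (u := u₁ - u₀) fun e => hne (by
    rwa [exp_sub, div_eq_one_iff_eq (exp_ne_zero _)] at e)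
  have hf := Five.mk h₀ h₁ h₂
  have e1 := hf.ebr_five
  have e2 := (Five.mk h₀.tau_add h₁.tau_add (v₂ := v₂) (by
    rw [add_sub_add_right_eq_sub]; exact h₂)).ebr_five
  rw [add_sub_add_right_eq_sub, ← sub_sub, ebr_sub_tau hf.e₄, eA.map_sub] at e2
  rw [← sub_eq_zero, ← sub_eq_zero.2 (e2.trans e1.symm)]
  simp only [ebB]
  abel

lemma ebB_eq {u₀ v₀ u₁ v₁ : ℂ} (h₀ : Ebp u₀ v₀) (h₁ : Ebp u₁ v₁) : ebB u₀ v₀ = ebB u₁ v₁ := by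
  obtain ⟨z, hz⟩ := Infinite.exists_notMem_finset ({0, 1, exp u₀, exp u₁} : Finset ℂ)
  simp only [Finset.mem_insert, Finset.mem_singleton, not_or] at hz
  have h := ebp_log (z := z) ⟨hz.1, hz.2.1⟩
  have e := exp_log hz.1
  exact (ebB_eq_of_ne h₀ h (by rw [e]; exact hz.2.2.1)).trans
    (ebB_eq_of_ne h₁ h (by rw [e]; exact hz.2.2.2)).symm

lemma ebB_eq_zero {u v : ℂ} (h : Ebp u v) : ebB u v = 0 := by
  obtain ⟨u₀, v₀, u₁, v₁, v₂, hf, -, -⟩ := exists_five_last h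
  have e1 := hf.ebr_five
  have h2' : Ebp (u₁ + tau - u₀) v₂ := by
    rw [add_sub_right_comm]
    exact hf.e₂.tau_add
  have e2 := (Five.mk hf.e₀ hf.e₁.tau_add h2').ebr_five
  have e : -ebB u₁ v₁ + ebB (u₁ - u₀) v₂ - ebB (u₁ - u₀ + v₁ - v₀) (v₂ - v₁) = 0 := by
    rw [← sub_eq_zero.2 (e2.trans e1.symm), add_sub_right_comm u₁ tau u₀,
      show u₁ - u₀ + tau + v₁ - v₀ = u₁ - u₀ + v₁ - v₀ + tau by ring]
    simp only [ebB, map_sub]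
    abel
  rw [ebB_eq hf.e₁ h, ebB_eq hf.e₂ h, ebB_eq hf.e₃ h, neg_add_cancel, zero_sub, neg_eq_zero] at e
  exact e

lemma ebr_tau_add {u v : ℂ} (h : Ebp u v) : ebr (u + tau) v = ebr u v - eA v := by
  have e := ebB_eq_zero h
  rw [ebB] at e
  rw [← sub_eq_zero, ← e]
  abel

lemma two_eA_tau : eA tau + eA tau = 0 := by
  obtain ⟨v, h⟩ := exists_ebp (u := 1) (exp_ne_one_of_re_pos (by simp))
  have e1 := ebr_tau_add h.add_tau
  have e2 := ebr_add_tau h.tau_add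
  rw [ebr_add_tau h, eA.map_add] at e1
  rw [ebr_tau_add h, eA.map_add] at e2
  rw [← sub_eq_zero.2 (e2.symm.trans e1)]
  abel

/-- Two points of `X₀₀` over the same point have classes that differ by the image of `eA`. -/
lemma ebr_sub_mem {u v u' v' : ℂ} (h : Ebp u v) (h' : Ebp u' v') (e : exp u' = exp u) :
    ebr u' v' - ebr u v ∈ eA.range := by
  have hq : ∀ q : ℤ, ebr u (v + q * tau) - ebr u v ∈ eA.range := by
    intro q
    have : ebr u (v + q * tau) - ebr u v = q • eA u := by
      induction q using Int.induction_on with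
      | zero => simp
      | succ n ih =>
        rw [show v + ((n + 1 : ℤ) : ℂ) * tau = v + (n : ℤ) * tau + tau by push_cast; ring,
          ebr_add_tau (h.shift_right n), add_sub_right_comm, ih, add_smul, one_smul]
      | pred n ih =>
        rw [show v + ((-n - 1 : ℤ) : ℂ) * tau = v + (-n : ℤ) * tau - tau by push_cast; ring,
          ebr_sub_tau (h.shift_right (-n)), sub_right_comm, ih, sub_smul, one_smul]
    rw [this]
    exact zsmul_mem (AddMonoidHom.mem_range.2 ⟨u, rfl⟩) q
  have hp : ∀ p : ℤ, ∀ v, Ebp u v → ebr (u + p * tau) v - ebr u v ∈ eA.range := by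
    intro p v h
    have : ebr (u + p * tau) v - ebr u v = -(p • eA v) := by
      induction p using Int.induction_on with
      | zero => simp
      | succ n ih =>
        rw [show u + ((n + 1 : ℤ) : ℂ) * tau = u + (n : ℤ) * tau + tau by push_cast; ring,
          ebr_tau_add (h.shift_left n), sub_right_comm, ih, add_smul, one_smul]
        abel
      | pred n ih =>
        have e := ebr_tau_add (u := u + ((-n - 1 : ℤ) : ℂ) * tau) (v := v)
          (h.shift_left (-n - 1))
        rw [show u + ((-n - 1 : ℤ) : ℂ) * tau + tau = u + (-n : ℤ) * tau by push_cast; ring] at e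
        rw [sub_eq_iff_eq_add.1 e.symm, add_sub_right_comm, ih, sub_smul, one_smul]
        abel
    rw [this]
    exact neg_mem (zsmul_mem (AddMonoidHom.mem_range.2 ⟨v, rfl⟩) p)
  obtain ⟨p, q, rfl, rfl⟩ := h.exists_shift h' e
  rw [← sub_add_sub_cancel _ (ebr u (v + q * tau))]
  exact add_mem (hp p _ (h.shift_right q)) (hq q)

/-- The torsion group `ℚ/ℤ`. -/
abbrev QZ : Type := ℚ ⧸ AddSubgroup.zmultiples (1 : ℚ)

/-- An extension of a group by `ℚ/ℤ` splits. -/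
lemma exists_split {X B : Type} [AddCommGroup X] [AddCommGroup B] (f : X →+ B)
    (hf : Function.Surjective f) (i : QZ →+ X) (hi : Function.Injective i)
    (h : ∀ x, f x = 0 ↔ ∃ d, i d = x) : Nonempty (X ≃+ QZ × B) := by
  obtain ⟨r, hr⟩ := (Module.Baer.of_divisible QZ).extension_property_addMonoidHom i hi
    (AddMonoidHom.id QZ)
  have hr' : ∀ d, r (i d) = d := fun d => DFunLike.congr_fun hr d
  refine ⟨AddEquiv.ofBijective (r.prod f) ⟨?_, ?_⟩⟩
  · rw [injective_iff_map_eq_zero]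
    intro x hx
    rw [AddMonoidHom.prod_apply, Prod.mk_eq_zero] at hx
    obtain ⟨d, rfl⟩ := (h x).1 hx.2
    rw [hr'] at hx
    rw [hx.1, map_zero]
  · rintro ⟨d, b⟩
    obtain ⟨x, rfl⟩ := hf b
    have h0 : ∀ d, f (i d) = 0 := fun d => (h _).2 ⟨d, rfl⟩
    refine ⟨x + i (d - r x), Prod.ext ?_ ?_⟩
    · change r (x + i (d - r x)) = d
      rw [map_add, hr', add_sub_cancel]
    · change f (x + i (d - r x)) = f x
      rw [map_add, h0, add_zero]

/-- A quotient of `ℚ` by a nonzero cyclic subgroup is isomorphic to `ℚ/ℤ`. -/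
lemma exists_qz_hom {X : Type} [AddCommGroup X] (g : ℚ →+ X) {α : ℚ} (hα : α ≠ 0)
    (hg : ∀ q, g q = 0 ↔ ∃ n : ℤ, q = n * α) :
    ∃ i : QZ →+ X, Function.Injective i ∧ ∀ x, (∃ d, i d = x) ↔ ∃ q, g q = x := by
  have hk : AddSubgroup.zmultiples (1 : ℚ) ≤ (g.comp (AddMonoidHom.mulRight α)).ker := by
    rw [AddSubgroup.zmultiples_le, AddMonoidHom.mem_ker]
    exact (hg _).2 ⟨1, by simp⟩
  refine ⟨QuotientAddGroup.lift _ _ hk, ?_, fun x => ⟨?_, ?_⟩⟩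
  · rw [injective_iff_map_eq_zero]
    intro d
    induction d using QuotientAddGroup.induction_on with
    | H q =>
      intro hq
      obtain ⟨n, hn⟩ := (hg _).1 (show g (q * α) = 0 from hq)
      rw [QuotientAddGroup.eq_zero_iff, AddSubgroup.mem_zmultiples_iff]
      exact ⟨n, by rw [zsmul_one]; exact (mul_right_cancel₀ hα hn).symm⟩
  · rintro ⟨d, rfl⟩
    induction d using QuotientAddGroup.induction_on with
    | H q => exact ⟨q * α, rfl⟩
  · rintro ⟨q, rfl⟩
    refine ⟨QuotientAddGroup.mk (q / α), ?_⟩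
    change g (q / α * α) = g q
    rw [div_mul_cancel₀ q hα]

lemma pbLift_aux : ∀ a ∈ pbSub, FreeAbelianGroup.lift (fun z : RegT =>
    (QuotientAddGroup.mk (ebr (log z.1) (-log (1 - z.1))) : EEPreBloch ⧸ eA.range)) a = 0 := by
  intro a ha
  refine (AddSubgroup.closure_le (K := (FreeAbelianGroup.lift fun z : RegT =>
    (QuotientAddGroup.mk (ebr (log z.1) (-log (1 - z.1))) :
      EEPreBloch ⧸ eA.range)).ker)).2 ?_ ha
  rintro _ ⟨x, y, hx, hy, hxy, h2, h3, h4, rfl⟩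
  have h0 := ebp_log hx
  have h1 := ebp_log hy
  obtain ⟨v₂, hv⟩ := exists_ebp (u := log y - log x) (by
    rw [exp_sub, exp_log hx.1, exp_log hy.1]
    exact h2.2)
  have hf := Five.mk h0 h1 hv
  have key : ∀ {z u v : ℂ}, Reg z → Ebp u v → exp u = z →
      (QuotientAddGroup.mk (ebr (log z) (-log (1 - z))) : EEPreBloch ⧸ eA.range) =
        QuotientAddGroup.mk (ebr u v) := fun {z u v} hz hu e => by
    rw [QuotientAddGroup.eq, neg_add_eq_sub]
    exact ebr_sub_mem (ebp_log hz) hu (by rw [e, exp_log hz.1])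
  rw [SetLike.mem_coe, AddMonoidHom.mem_ker]
  simp only [map_add, map_sub, pbGen, FreeAbelianGroup.lift_apply_of]
  rw [key h2 hv (by rw [exp_sub, exp_log hx.1, exp_log hy.1]),
    key h3 hf.e₃ (by rw [hf.exp₃, exp_log hx.1, exp_log hy.1]),
    key h4 hf.e₄ (by rw [hf.exp₄, exp_log hx.1, exp_log hy.1]),
    ← QuotientAddGroup.mk_sub, ← QuotientAddGroup.mk_add, ← QuotientAddGroup.mk_sub,
    ← QuotientAddGroup.mk_add, hf.ebr_five, QuotientAddGroup.mk_zero]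

/-- The class in the extended pre-Bloch group, up to the image of `eA`. -/
def pbLift : PreBloch →+ EEPreBloch ⧸ eA.range := QuotientAddGroup.lift pbSub _ pbLift_aux

lemma pbLift_eeP (e : EEPreBloch) : pbLift (eeP e) = QuotientAddGroup.mk e := by
  refine DFunLike.congr_fun (f := pbLift.comp eeP) (g := QuotientAddGroup.mk' eA.range)
    (ee_ext fun u v h => ?_) e
  change pbLift (eeP (ebr u v)) = QuotientAddGroup.mk (ebr u v)
  rw [eeP_ebr h, pbCls, dif_pos h.reg]
  refine (FreeAbelianGroup.lift_apply_of _ _).trans ?_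
  rw [QuotientAddGroup.eq, neg_add_eq_sub]
  exact ebr_sub_mem (ebp_log h.reg) h (exp_log h.reg.1).symm

lemma eA_hom_eq {M : Type} [AddCommGroup M] {F : EEPreBloch →+ M} {G : ℂ →+ M}
    (h : ∀ u v, Ebp u v → F (ebD u v) = G u) (u : ℂ) : F (eA u) = G u := by
  refine DFunLike.congr_fun (f := F.comp eA) (g := G) (hom_eq_of_re_pos fun u hu => ?_) u
  obtain ⟨v, hv⟩ := exists_ebp (exp_ne_one_of_re_pos hu)
  rw [AddMonoidHom.comp_apply, eA_eq hv, h u v hv]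

lemma nuHom₀_eA (u : ℂ) : nuHom₀ (eA u) = wedge u tau := by
  refine eA_hom_eq (G := wedgeB.flip tau) (fun u v h => ?_) u
  rw [ebD, nuHom₀.map_sub, nuHom₀_ebr h.add_tau, nuHom₀_ebr h, AddMonoidHom.flip_apply]
  change wedgeB u (v + tau) - wedgeB u v = _
  rw [map_add, add_sub_cancel_left]

lemma eeP_eA (u : ℂ) : eeP (eA u) = 0 := by
  refine eA_hom_eq (G := 0) (fun u v h => ?_) u
  rw [ebD, eeP.map_sub, eeP_ebr h.add_tau, eeP_ebr h, sub_self, AddMonoidHom.zero_apply]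

lemma eeP_eq_zero {e : EEPreBloch} : eeP e = 0 ↔ ∃ u, eA u = e := by
  constructor
  · intro h
    have h' := pbLift_eeP e
    rw [h, map_zero] at h'
    exact (QuotientAddGroup.eq_zero_iff e).1 h'.symm
  · rintro ⟨u, rfl⟩
    exact eeP_eA u

lemma eeP_surjective : Function.Surjective eeP := by
  intro b
  induction b using QuotientAddGroup.induction_on with
  | H a =>
    induction a using FreeAbelianGroup.induction_on with
    | zero => exact ⟨0, map_zero _⟩
    | of z =>
      refine ⟨ebr (log z.1) (-log (1 - z.1)), ?_⟩
      rw [eeP_ebr (ebp_log z.2), exp_log z.2.1, pbCls, dif_pos z.2]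
      rfl
    | neg z h =>
      obtain ⟨e, he⟩ := h
      exact ⟨-e, by rw [map_neg, he]; rfl⟩
    | add x y hx hy =>
      obtain ⟨e, he⟩ := hx
      obtain ⟨e', he'⟩ := hy
      exact ⟨e + e', by rw [map_add, he, he']; rfl⟩

lemma eeR_eA (u : ℂ) : eeR (eA u) = ((-(Cpi * I) * u : ℂ) : ModPiSq) := by
  refine eA_hom_eq (G := (QuotientAddGroup.mk' (AddSubgroup.zmultiples (Cpi ^ 2 : ℂ))).comp
    (AddMonoidHom.mulLeft (-(Cpi * I)))) (fun u v h => ?_) u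
  have e := rdl_shift h.liesOver 0 2
  rw [show u + ((0 : ℤ) : ℂ) * (Cpi * I) = u by simp,
    show v + ((2 : ℤ) : ℂ) * (Cpi * I) = v + tau by rw [tau_eq]; push_cast; ring] at e
  rw [ebD, eeR.map_sub, eeR_ebr h.add_tau, eeR_ebr h, e, add_sub_cancel_left]
  change ((_ : ℂ) : ModPiSq) = ((-(Cpi * I) * u : ℂ) : ModPiSq)
  congr 1
  push_cast
  ring

/-- Multiplication by a complex number, on the rationals. -/
def ratMul (c : ℂ) : ℚ →+ ℂ := (AddMonoidHom.mulRight c).comp (algebraMap ℚ ℂ : ℚ →+ ℂ)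

lemma ratMul_apply (c : ℂ) (q : ℚ) : ratMul c q = q * c := rfl

lemma Cpi_sq_ne : (Cpi : ℂ) ^ 2 ≠ 0 := by
  intro h
  exact Cpi_mul_I_ne (by rw [pow_eq_zero_iff two_ne_zero |>.1 h, zero_mul])

lemma modPiSq_rat_eq_zero (q : ℚ) : ((q * Cpi ^ 2 : ℂ) : ModPiSq) = 0 ↔ ∃ n : ℤ, q = n := by
  rw [QuotientAddGroup.eq_zero_iff, AddSubgroup.mem_zmultiples_iff]
  refine exists_congr fun n => ?_
  rw [zsmul_eq_mul, mul_left_inj' Cpi_sq_ne]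
  constructor
  · intro h
    exact_mod_cast h.symm
  · rintro rfl
    push_cast
    rfl

lemma wedge_rat_self (q : ℚ) (c : ℂ) : wedge (q * c) c = 0 := by
  have hd : (q.den : ℂ) ≠ 0 := Nat.cast_ne_zero.2 q.den_nz
  have h1 : q * c = q.num • (c / q.den) := by
    rw [zsmul_eq_mul]
    conv_lhs => rw [Rat.cast_def]
    ring
  have h2 : c = (q.den : ℤ) • (c / q.den) := by
    rw [zsmul_eq_mul, Int.cast_natCast, mul_div_cancel₀ c hd]
  have h : wedgeB (q.num • (c / q.den)) ((q.den : ℤ) • (c / q.den)) = 0 := by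
    rw [map_zsmul, map_zsmul, AddMonoidHom.zsmul_apply, wedgeB_self, smul_zero, smul_zero]
  rwa [← h1, ← h2] at h

lemma eA_rat_zero : ∃ α : ℚ, α ≠ 0 ∧ ∀ q, eA (ratMul tau q) = 0 ↔ ∃ n : ℤ, q = n * α := by
  have hhalf : ∀ q : ℚ, eA (ratMul tau q) = 0 → ∃ n : ℤ, q = n * (1 / 2) := by
    intro q hq
    have h := eeR_eA (ratMul tau q)
    rw [hq, map_zero, ratMul_apply, tau_eq] at h
    have e : -(Cpi * I) * (q * (2 * (Cpi * I))) = ((2 * q : ℚ) : ℂ) * Cpi ^ 2 := by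
      push_cast
      linear_combination (-2 * (q : ℂ) * Cpi ^ 2) * I_sq
    rw [e] at h
    obtain ⟨n, hn⟩ := (modPiSq_rat_eq_zero _).1 h.symm
    exact ⟨n, by linarith⟩
  let K : AddSubgroup ℤ := ((eA.comp (ratMul tau)).comp
    ((AddMonoidHom.mulRight (1 / 2 : ℚ)).comp (Int.castAddHom ℚ))).ker
  have hK : ∀ n : ℤ, n ∈ K ↔ eA (ratMul tau (n * (1 / 2))) = 0 := fun n => Iff.rfl
  obtain ⟨m, hm⟩ := (Int.subgroup_cyclic K)
  have h4 : (4 : ℤ) ∈ K := by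
    rw [hK, ratMul_apply, ← two_eA_tau, ← eA.map_add]
    congr 1
    push_cast
    ring
  have hmem : ∀ n : ℤ, n ∈ K ↔ ∃ k : ℤ, k * m = n := by
    intro n
    rw [hm, AddSubgroup.mem_closure_singleton]
    simp only [smul_eq_mul]
  have hm0 : m ≠ 0 := by
    rintro rfl
    obtain ⟨k, hk⟩ := (hmem 4).1 h4
    simp at hk
  refine ⟨m * (1 / 2), mul_ne_zero (Int.cast_ne_zero.2 hm0) (by norm_num), fun q => ⟨?_, ?_⟩⟩
  · intro hq
    obtain ⟨n, rfl⟩ := hhalf q hq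
    obtain ⟨k, rfl⟩ := (hmem n).1 ((hK n).2 hq)
    exact ⟨k, by push_cast; ring⟩
  · rintro ⟨n, rfl⟩
    have := (hK _).1 ((hmem (n * m)).2 ⟨n, rfl⟩)
    rw [← this]
    push_cast
    rw [mul_assoc]

lemma eeBloch_split : Nonempty (EEBloch ≃+ QZ × B0) := by
  have hP : ∀ e : EEBloch, eeP e.1 ∈ B0 := fun e => by
    have h : nuHom₀ e.1 = 0 := e.2
    change wPB (eeP e.1) = 0
    rw [wPB_eeP, h, map_zero, neg_zero]
  have hA : ∀ q : ℚ, eA (ratMul tau q) ∈ EEBloch := fun q => by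
    change nuHom₀ (eA (ratMul tau q)) = 0
    rw [nuHom₀_eA, ratMul_apply, wedge_rat_self]
  obtain ⟨α, hα, hα'⟩ := eA_rat_zero
  obtain ⟨i, hi, hi'⟩ := exists_qz_hom ((eA.comp (ratMul tau)).codRestrict EEBloch hA) hα
    (fun q => by
      rw [← hα', Subtype.ext_iff]
      rfl)
  refine exists_split ((eeP.comp EEBloch.subtype).codRestrict B0 hP) ?_ i hi fun x => ?_
  · rintro ⟨b, hb⟩
    obtain ⟨e, rfl⟩ := eeP_surjective b
    have h : wPB (eeP e) = 0 := hb
    rw [wPB_eeP, neg_eq_zero, m2q_eq_zero] at h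
    obtain ⟨c, hc⟩ := h
    have hc' : nuHom₀ (eA c) = -nuHom₀ e := by
      rw [nuHom₀_eA, ← hc]
      exact alt_swap wedgeB_self c tau
    refine ⟨⟨e + eA c, ?_⟩, Subtype.ext ?_⟩
    · change nuHom₀ (e + eA c) = 0
      rw [map_add, hc', add_neg_cancel]
    · change eeP (e + eA c) = eeP e
      rw [map_add, eeP_eA, add_zero]
  · rw [hi', Subtype.ext_iff]
    change eeP x.1 = 0 ↔ _
    rw [eeP_eq_zero]
    constructor
    · rintro ⟨u, hu⟩
      have h0 : nuHom₀ x.1 = 0 := x.2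
      rw [← hu, nuHom₀_eA] at h0
      obtain ⟨q, rfl⟩ := exists_tau_rat h0
      exact ⟨q, Subtype.ext hu⟩
    · rintro ⟨q, hq⟩
      exact ⟨_, congrArg Subtype.val hq⟩

/-- The branch of the logarithm with imaginary part in `(0, 2π]`. -/
def lg (x : ℂ) : ℂ := log (-x) + Cpi * I

lemma exp_lg (x : ℂˣ) : exp (lg x) = x := by
  rw [lg, exp_add, exp_log (neg_ne_zero.2 x.ne_zero), show exp (Cpi * I) = -1 from exp_pi_mul_I]
  ring

/-- The squared determinant of two scaled points. -/
def vd (x y : VP) : ℂˣ := sdet x.pt y.pt * (x.sc * y.sc)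

/-- A logarithm of the determinant of two scaled points. -/
def vl (x y : VP) : ℂ := lg (vd x y) / 2

lemma vd_smul (g : PSL2C) {x y : VP} (h : rV x y) : vd (g • x) (g • y) = vd x y := by
  simp only [vd, vp_smul_pt, vp_smul_sc]
  rw [← sdet_smul g h]
  exact (by intros; ac_rfl : ∀ a b c p q : ℂˣ, c * (a * p * (b * q)) = a * b * c * (p * q))
    _ _ _ _ _

lemma vl_smul (g : PSL2C) {x y : VP} (h : rV x y) : vl (g • x) (g • y) = vl x y := by
  rw [vl, vd_smul g h, vl]

lemma exp_vl_sq {x y : VP} (h : rV x y) :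
    exp (vl x y) ^ 2 = P1.det x.pt y.pt ^ 2 * (x.sc * y.sc) := by
  rw [← exp_nat_mul, vl, Nat.cast_ofNat, mul_div_cancel₀ _ two_ne_zero, exp_lg, vd, Units.val_mul,
    sdet_val h, Units.val_mul]

/-- The configuration of underlying points. -/
def vf {n : ℕ} : Conf rV n → Conf rP n := Conf.map VP.pt fun _ _ h => h

lemma vf_val {n : ℕ} (c : Conf rV n) (i : Fin n) : (vf c).1 i = (c.1 i).pt := rfl

lemma vf_face {n : ℕ} (c : Conf rV (n + 1)) (i : Fin (n + 1)) : vf (c.face i) = (vf c).face i := rfl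

lemma vf_smul {n : ℕ} (g : PSL2C) (c : Conf rV n) : vf (g • c) = g • vf c := rfl

/-- A logarithm of the cross ratio. -/
def cru (c : Conf rV 4) : ℂ :=
  vl (c.1 0) (c.1 3) + vl (c.1 1) (c.1 2) - vl (c.1 0) (c.1 2) - vl (c.1 1) (c.1 3)

/-- A logarithm of the inverse of one minus the cross ratio. -/
def crv (c : Conf rV 4) : ℂ :=
  vl (c.1 0) (c.1 2) + vl (c.1 1) (c.1 3) - vl (c.1 0) (c.1 1) - vl (c.1 2) (c.1 3)

lemma cr_liesOver (c : Conf rV 4) : LiesOver (cru c, crv c) (crs (vf c)).1 := by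
  rw [liesOver_iff]
  have h (i j : Fin 4) (hij : i < j) := exp_vl_sq (c.2 i j hij)
  have hd (i j : Fin 4) (hij : i < j) : P1.det (c.1 i).pt (c.1 j).pt ≠ 0 :=
    (vf c).det_ne hij
  have h01 := hd 0 1 (by decide)
  have h02 := hd 0 2 (by decide)
  have h03 := hd 0 3 (by decide)
  have h12 := hd 1 2 (by decide)
  have h13 := hd 1 3 (by decide)
  have h23 := hd 2 3 (by decide)
  have s0 := (c.1 0).sc.ne_zero
  have s1 := (c.1 1).sc.ne_zero
  have s2 := (c.1 2).sc.ne_zero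
  have s3 := (c.1 3).sc.ne_zero
  refine ⟨(crs (vf c)).2, ?_, ?_⟩
  · rw [cru, exp_sub, exp_sub, exp_add, crs_eq, div_pow, div_pow, mul_pow, h 0 3 (by decide),
      h 1 2 (by decide), h 0 2 (by decide), h 1 3 (by decide)]
    simp only [vf_val]
    field_simp
  · rw [crv, exp_sub, exp_sub, exp_add, one_sub_crs, div_pow, div_pow, mul_pow, h 0 1 (by decide),
      h 2 3 (by decide), h 0 2 (by decide), h 1 3 (by decide)]
    simp only [vf_val]
    field_simp

/-- The extended dilogarithm of a chain of four-point configurations of scaled points. -/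
def kdl : FA (Unit × Conf rV 4) →+ ModPiSq :=
  FreeAbelianGroup.lift fun x => rdl (crs (vf x.2)).1 (cru x.2) (crv x.2)

@[simp] lemma kdl_of (x : Unit × Conf rV 4) :
    kdl (of x) = rdl (crs (vf x.2)).1 (cru x.2) (crv x.2) := FreeAbelianGroup.lift_apply_of _ _

lemma kdl_bd1 (b : FA (PSL2C × Conf rV 4)) : kdl (bd1 PSL2C _ b) = 0 := by
  refine DFunLike.congr_fun (f := kdl.comp (bd1 PSL2C _)) (g := 0) (fa_ext fun ⟨g, c⟩ => ?_) b
  have h (i j : Fin 4) (hij : i < j) := vl_smul g (c.2 i j hij)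
  have hu : cru (g • c) = cru c := by
    simp only [cru, Conf.smul_val]
    rw [h 0 3 (by decide), h 1 2 (by decide), h 0 2 (by decide), h 1 3 (by decide)]
  have hv : crv (g • c) = crv c := by
    simp only [crv, Conf.smul_val]
    rw [h 0 1 (by decide), h 2 3 (by decide), h 0 2 (by decide), h 1 3 (by decide)]
  simp [vf_smul, crs_smul, hu, hv]

lemma cr_face (c : Conf rV 5) :
    cru (c.face 2) = cru (c.face 1) - cru (c.face 0) ∧
    cru (c.face 3) = cru (c.face 1) - cru (c.face 0) + crv (c.face 1) - crv (c.face 0) ∧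
    crv (c.face 3) = crv (c.face 2) - crv (c.face 1) ∧
    cru (c.face 4) = crv (c.face 1) - crv (c.face 0) ∧
    crv (c.face 4) = crv (c.face 2) - crv (c.face 1) - cru (c.face 0) := by
  simp only [cru, crv, Conf.face]
  simp [Fin.succAbove, Fin.lt_def]
  refine ⟨?_, ?_, ?_, ?_, ?_⟩ <;> ring

lemma kdl_fb (b : FA (Unit × Conf rV 5)) : kdl (fb rV 4 _ b) = 0 := by
  refine DFunLike.congr_fun (f := kdl.comp (fb rV 4 _)) (g := 0) (fa_ext fun ⟨g, c⟩ => ?_) b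
  obtain ⟨h1, h2, h3, h4⟩ := crs_face (c := vf c) rfl rfl
  obtain ⟨f1, f2, f3, f4, f5⟩ := cr_face c
  have hl (i : Fin 5) := cr_liesOver (c.face i)
  have h : Lft (crs (vf (c.face 0))).1 (crs (vf (c.face 1))).1 (cru (c.face 0)) (crv (c.face 0))
      (cru (c.face 1)) (crv (c.face 1)) (crv (c.face 2)) := by
    refine lft_iff.2 ⟨h1, hl 0, hl 1, ?_⟩
    have := ((liesOver_iff).1 (hl 2)).2.2
    rwa [vf_face, h2] at this
  have h5 := h.rdl_five
  rw [AddMonoidHom.comp_apply, fb_of, map_sum]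
  simp only [map_zsmul, kdl_of, AddMonoidHom.zero_apply, Fin.sum_univ_succ]
  rw [← f2, ← f5, ← f3, ← f4, ← f1] at h5
  simp only [vf_face] at h5 ⊢
  rw [← h2, ← h3, ← h4] at h5
  rw [← h5]
  simp
  abel

lemma kdl_sub {c c' : Conf rV 4} (h : vf c = vf c') (p q : ℤ)
    (hu : cru c' = cru c + p * (Cpi * I)) (hv : crv c' = crv c + q * (Cpi * I)) :
    kdl (of ((), c) - of ((), c')) =
      ((-(1 / 2 * (Cpi * I) * (p * crv c - q * cru c) + 1 / 2 * (p * q) * (Cpi * I) ^ 2) : ℂ) :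
        ModPiSq) := by
  rw [kdl.map_sub, kdl_of, kdl_of, hu, hv, ← h, rdl_shift (cr_liesOver c), QuotientAddGroup.mk_neg]
  exact sub_add_cancel_left _ _

lemma lg_exp {θ : ℂ} (h₀ : 0 < θ.im) (h₁ : θ.im ≤ 2 * Real.pi) : lg (exp θ) = θ := by
  have e : -exp θ = exp (θ - Real.pi * I) := by rw [exp_sub, exp_pi_mul_I, div_neg, div_one]
  rw [lg, e, log_exp]
  · exact sub_add_cancel _ _
  · simp; linarith
  · simp; linarith

lemma lg_zet {n : ℕ} (hn : n ≠ 0) {m k : ℤ} (h₀ : 0 < k) (h₁ : k ≤ n) (h : (n : ℤ) ∣ m - k) :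
    lg ((zet n ^ m : ℂˣ) : ℂ) / 2 = Cpi * I / n * k := by
  obtain ⟨l, hl⟩ := h
  have e : zet n ^ m = zet n ^ k := by
    rw [sub_eq_iff_eq_add.1 hl, zpow_add, zpow_mul, zpow_natCast, zet_pow hn, one_zpow, one_mul]
  have n0 : (0 : ℝ) < n := by exact_mod_cast Nat.pos_of_ne_zero hn
  have e' : ((zet n ^ k : ℂˣ) : ℂ) = exp (((2 * Real.pi * k / n : ℝ) : ℂ) * I) := by
    rw [Units.val_zpow_eq_zpow_val, zet, Units.val_mk0, ← exp_int_mul]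
    congr 1
    push_cast
    ring
  have k0 : (0 : ℝ) < k := by exact_mod_cast h₀
  have k1 : (k : ℝ) ≤ n := by exact_mod_cast h₁
  rw [e, e', lg_exp]
  · push_cast
    simp only [Cpi]
    ring
  · simp only [mul_im, ofReal_re, I_im, ofReal_im, I_re, mul_one, mul_zero, add_zero]
    positivity
  · simp only [mul_im, ofReal_re, I_im, ofReal_im, I_re, mul_one, mul_zero, add_zero]
    rw [div_le_iff₀ n0]
    exact mul_le_mul_of_nonneg_left k1 Real.two_pi_pos.le

/-- The scaled points on the orbit of one. -/
def wpt (t : ℂˣ) (j : ℕ) : VP := ⟨P1.fin ((t ^ j : ℂˣ) : ℂ), (t ^ j)⁻¹⟩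

/-- The scaled points at infinity. -/
def ept (t : ℂˣ) : VP := ⟨P1.inf, t⟩

/-- The scaled point at zero. -/
def zpt : VP := ⟨P1.fin 0, 1⟩

lemma rV_zpt_ept (t : ℂˣ) : rV zpt (ept t) := fun h => nomatch (h : P1.fin _ = P1.inf)

lemma rV_zpt_wpt (t : ℂˣ) (j : ℕ) : rV zpt (wpt t j) :=
  fun h => Units.ne_zero _ (P1.fin.inj h).symm

lemma rV_ept_wpt (s t : ℂˣ) (j : ℕ) : rV (ept s) (wpt t j) :=
  fun h => nomatch (h : P1.inf = P1.fin _)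

lemma rV_wpt {t : ℂˣ} (ht : t ≠ 1) (j : ℕ) : rV (wpt t (j + 1)) (wpt t j) := by
  intro h
  have h := Units.ext (P1.fin.inj h)
  rw [pow_succ, mul_eq_left] at h
  exact ht h

lemma vd_val {x y : VP} (h : rV x y) : (vd x y : ℂ) = P1.det x.pt y.pt ^ 2 * (x.sc * y.sc) := by
  rw [vd, Units.val_mul, sdet_val h, Units.val_mul]

lemma vd_zpt_ept (t : ℂˣ) : vd zpt (ept t) = t := by
  ext
  rw [vd_val (rV_zpt_ept t)]
  simp [P1.det, zpt, ept]

lemma vd_zpt_wpt (t : ℂˣ) (j : ℕ) : vd zpt (wpt t j) = t ^ (j : ℤ) := by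
  ext
  rw [vd_val (rV_zpt_wpt t j)]
  simp [P1.det, zpt, wpt]
  field_simp

lemma vd_ept_wpt (s t : ℂˣ) (j : ℕ) : vd (ept s) (wpt t j) = s * t ^ (-(j : ℤ)) := by
  ext
  rw [vd_val (rV_ept_wpt s t j)]
  simp [P1.det, ept, wpt]

lemma vd_wpt {t : ℂˣ} (ht : t ≠ 1) (j : ℕ) :
    vd (wpt t (j + 1)) (wpt t j) = vd (wpt t 1) (wpt t 0) := by
  ext
  rw [vd_val (rV_wpt ht j), vd_val (rV_wpt ht 0)]
  simp [P1.det, wpt]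
  field_simp
  ring

/-- The lens configurations. -/
def lensC {t : ℂˣ} (ht : t ≠ 1) (s : ℂˣ) (j : ℕ) : Conf rV 4 :=
  Conf.mk4 zpt (ept s) (wpt t (j + 1)) (wpt t j) (rV_zpt_ept _) (rV_zpt_wpt _ _) (rV_zpt_wpt _ _)
    (rV_ept_wpt _ _ _) (rV_ept_wpt _ _ _) (rV_wpt ht j)

lemma cru_lensC {t : ℂˣ} (ht : t ≠ 1) (a : ℤ) (j : ℕ) : cru (lensC ht (t ^ a) j) =
    lg (t ^ (j : ℤ) : ℂˣ) / 2 + lg (t ^ (a - j - 1) : ℂˣ) / 2 - lg (t ^ (j + 1 : ℤ) : ℂˣ) / 2 -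
      lg (t ^ (a - j) : ℂˣ) / 2 := by
  change vl zpt (wpt t j) + vl (ept (t ^ a)) (wpt t (j + 1)) - vl zpt (wpt t (j + 1)) -
    vl (ept (t ^ a)) (wpt t j) = _
  simp only [vl, vd_zpt_wpt, vd_ept_wpt, ← zpow_add]
  push_cast
  simp only [sub_eq_add_neg, neg_add_rev, add_assoc, add_comm (-1 : ℤ)]

lemma crv_lensC {t : ℂˣ} (ht : t ≠ 1) (a : ℤ) (j : ℕ) : crv (lensC ht (t ^ a) j) =
    lg (t ^ (j + 1 : ℤ) : ℂˣ) / 2 + lg (t ^ (a - j) : ℂˣ) / 2 - lg (t ^ a : ℂˣ) / 2 -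
      vl (wpt t 1) (wpt t 0) := by
  change vl zpt (wpt t (j + 1)) + vl (ept (t ^ a)) (wpt t j) - vl zpt (ept (t ^ a)) -
    vl (wpt t (j + 1)) (wpt t j) = _
  simp only [vl, vd_zpt_wpt, vd_ept_wpt, vd_zpt_ept, ← zpow_add, vd_wpt ht j]
  push_cast
  simp only [sub_eq_add_neg]

lemma vf_lensC {t : ℂˣ} (ht : t ≠ 1) (s s' : ℂˣ) (j : ℕ) :
    vf (lensC ht s j) = vf (lensC ht s' j) := by
  ext i; fin_cases i <;> rfl

section Lens

variable {n : ℕ}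

lemma kdl_lensC_zero (hn : 2 ≤ n) (ht : zet n ≠ 1) :
    kdl (of ((), lensC ht (zet n ^ (0 : ℤ)) 0) - of ((), lensC ht (zet n ^ (1 : ℤ)) 0)) =
      ((-(1 / 2 * (Cpi * I) * (Cpi * I / n - vl (wpt (zet n) 1) (wpt (zet n) 0))) : ℂ) :
        ModPiSq) := by
  have n0 : n ≠ 0 := by omega
  have nc : (n : ℂ) ≠ 0 := by exact_mod_cast n0
  have h (m k : ℤ) (h₀ : 0 < k) (h₁ : k ≤ n) (h : (n : ℤ) ∣ m - k) := lg_zet n0 h₀ h₁ h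
  have e0 := h 0 n (by omega) (by omega) ⟨-1, by ring⟩
  have e1 := h 1 1 (by omega) (by omega) ⟨0, by ring⟩
  have e2 := h (-1) (n - 1) (by omega) (by omega) ⟨-1, by ring⟩
  have u := cru_lensC ht 0 0
  have v := crv_lensC ht 0 0
  have u' := cru_lensC ht 1 0
  have v' := crv_lensC ht 1 0
  simp only [Nat.cast_zero, zero_add, sub_zero, zero_sub, sub_self, e0, e1, e2] at u v u' v'
  push_cast at u v u' v'
  rw [kdl_sub (vf_lensC ht _ _ _) 1 0 (by rw [u, u']; push_cast; field_simp; ring)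
    (by rw [v, v']; push_cast; field_simp; ring), v]
  congr 1
  push_cast
  ring

lemma kdl_lensC_last (hn : 2 ≤ n) (ht : zet n ≠ 1) {j : ℕ} (hj : n = j + 1) :
    kdl (of ((), lensC ht (zet n ^ (0 : ℤ)) j) - of ((), lensC ht (zet n ^ (1 : ℤ)) j)) =
      ((1 / 2 * (Cpi * I) * (Cpi * I / n - vl (wpt (zet n) 1) (wpt (zet n) 0) +
        Cpi * I / n * (n - 2)) + 1 / 2 * (Cpi * I) ^ 2 : ℂ) : ModPiSq) := by
  have n0 : n ≠ 0 := by omega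
  have nc : (n : ℂ) ≠ 0 := by exact_mod_cast n0
  have hj' : (n : ℤ) = j + 1 := by exact_mod_cast hj
  have hjc : (n : ℂ) = j + 1 := by exact_mod_cast hj
  have h (m k : ℤ) (h₀ : 0 < k) (h₁ : k ≤ n) (h : (n : ℤ) ∣ m - k) := lg_zet n0 h₀ h₁ h
  have e0 := h 0 n (by omega) (by omega) ⟨-1, by ring⟩
  have e1 := h 1 1 (by omega) (by omega) ⟨0, by ring⟩
  have e2 := h j (n - 1) (by omega) (by omega) ⟨0, by rw [hj']; ring⟩
  have e3 := h (j + 1) n (by omega) (by omega) ⟨0, by rw [hj']; ring⟩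
  have e4 := h (0 - j - 1) n (by omega) (by omega) ⟨-2, by rw [hj']; ring⟩
  have e5 := h (0 - j) 1 (by omega) (by omega) ⟨-1, by rw [hj']; ring⟩
  have e6 := h (1 - j - 1) 1 (by omega) (by omega) ⟨-1, by rw [hj']; ring⟩
  have e7 := h (1 - j) 2 (by omega) (by omega) ⟨-1, by rw [hj']; ring⟩
  have u := cru_lensC ht 0 j
  have v := crv_lensC ht 0 j
  have u' := cru_lensC ht 1 j
  have v' := crv_lensC ht 1 j
  simp only [e0, e1, e2, e3, e4, e5, e6, e7] at u v u' v'
  push_cast at u v u' v'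
  rw [kdl_sub (vf_lensC ht _ _ _) (-1) 1 (by rw [u, u']; push_cast; field_simp; ring)
    (by rw [v, v']; push_cast; field_simp; ring), u, v]
  congr 1
  push_cast
  field_simp
  ring

lemma kdl_lensC_mid (ht : zet n ≠ 1) {j : ℕ} (hj : j + 2 < n) :
    kdl (of ((), lensC ht (zet n ^ (0 : ℤ)) (j + 1)) -
      of ((), lensC ht (zet n ^ (1 : ℤ)) (j + 1))) = ((-(Cpi * I) ^ 2 / n : ℂ) : ModPiSq) := by
  have n0 : n ≠ 0 := by omega
  have nc : (n : ℂ) ≠ 0 := by exact_mod_cast n0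
  have h (m k : ℤ) (h₀ : 0 < k) (h₁ : k ≤ n) (h : (n : ℤ) ∣ m - k) := lg_zet n0 h₀ h₁ h
  have e0 := h 0 n (by omega) (by omega) ⟨-1, by ring⟩
  have e1 := h 1 1 (by omega) (by omega) ⟨0, by ring⟩
  have e2 := h ((j + 1 : ℕ) : ℤ) (j + 1) (by omega) (by omega) ⟨0, by push_cast; ring⟩
  have e3 := h ((j + 1 : ℕ) + 1) (j + 2) (by omega) (by omega) ⟨0, by push_cast; ring⟩
  have e4 := h (0 - (j + 1 : ℕ) - 1) (n - j - 2) (by omega) (by omega) ⟨-1, by push_cast; ring⟩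
  have e5 := h (0 - (j + 1 : ℕ)) (n - j - 1) (by omega) (by omega) ⟨-1, by push_cast; ring⟩
  have e6 := h (1 - (j + 1 : ℕ) - 1) (n - j - 1) (by omega) (by omega) ⟨-1, by push_cast; ring⟩
  have e7 := h (1 - (j + 1 : ℕ)) (n - j) (by omega) (by omega) ⟨-1, by push_cast; ring⟩
  have u := cru_lensC ht 0 (j + 1)
  have v := crv_lensC ht 0 (j + 1)
  have u' := cru_lensC ht 1 (j + 1)
  have v' := crv_lensC ht 1 (j + 1)
  simp only [e0, e1, e2, e3, e4, e5, e6, e7] at u v u' v'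
  push_cast at u v u' v'
  rw [kdl_sub (vf_lensC ht _ _ _) 0 1 (by rw [u, u']; push_cast; field_simp; ring)
    (by rw [v, v']; push_cast; field_simp; ring), u]
  congr 1
  push_cast
  field_simp
  ring

lemma kdl_lens (hn : 2 ≤ n) (ht : zet n ≠ 1) :
    kdl (∑ j ∈ Finset.range n,
      (of ((), lensC ht (zet n ^ (0 : ℤ)) j) - of ((), lensC ht (zet n ^ (1 : ℤ)) j))) =
      ((((-1 / n : ℚ) : ℂ) * Cpi ^ 2 : ℂ) : ModPiSq) := by
  obtain ⟨k, rfl⟩ : ∃ k, n = k + 2 := ⟨n - 2, by omega⟩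
  have nc : ((k + 2 : ℕ) : ℂ) ≠ 0 := by exact_mod_cast (by omega : k + 2 ≠ 0)
  rw [map_sum, Finset.sum_range_succ', Finset.sum_range_succ, kdl_lensC_zero hn,
    kdl_lensC_last hn ht rfl, Finset.sum_congr rfl fun j hj =>
      kdl_lensC_mid ht (by have := Finset.mem_range.1 hj; omega), Finset.sum_const,
    Finset.card_range, ← QuotientAddGroup.mk_nsmul, ← QuotientAddGroup.mk_add,
    ← QuotientAddGroup.mk_add]
  congr 1
  rw [nsmul_eq_mul]
  push_cast at nc ⊢
  field_simp
  ring_nf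
  simp only [I_sq]
  ring

end Lens

/-- A quotient is split by two invariants, one of which identifies the kernel of the other. -/
lemma exists_split_quotient {Z B M : Type} [AddCommGroup Z] [AddCommGroup B] [AddCommGroup M]
    {N : AddSubgroup Z} (f : Z →+ B) (ψ : Z →+ M) (hf : Function.Surjective f)
    (h : ∀ z, z ∈ N ↔ f z = 0 ∧ ψ z = 0) (i : QZ →+ M) (hi : Function.Injective i)
    (hψ : ∀ m, (∃ d, i d = m) ↔ ∃ z, f z = 0 ∧ ψ z = m) : Nonempty (Z ⧸ N ≃+ QZ × B) := by
  choose c hc hc' using fun d => (hψ (i d)).1 ⟨d, rfl⟩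
  have hmk (z z' : Z) (h₁ : f z = 0) (h₁' : f z' = 0) (h₂ : ψ z = ψ z') : (z : Z ⧸ N) = z' := by
    rw [QuotientAddGroup.eq, neg_add_eq_sub, h, map_sub, map_sub, h₁, h₁', h₂, sub_self, sub_self]
    exact ⟨rfl, rfl⟩
  let j : QZ →+ Z ⧸ N := AddMonoidHom.mk' (fun d => (c d : Z ⧸ N)) fun d e => by
    rw [← QuotientAddGroup.mk_add]
    exact hmk _ _ (hc _) (by rw [map_add, hc, hc, add_zero])
      (by rw [map_add, hc', hc', hc', map_add])
  have hj (d : QZ) : j d = (c d : Z ⧸ N) := rfl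
  refine exists_split (QuotientAddGroup.lift N f fun z hz => ((h z).1 hz).1) (fun b => ?_) j
    ((injective_iff_map_eq_zero j).2 fun d hd => ?_) fun x => ?_
  · obtain ⟨z, rfl⟩ := hf b
    exact ⟨z, rfl⟩
  · rw [hj, QuotientAddGroup.eq_zero_iff, h, hc'] at hd
    exact (injective_iff_map_eq_zero i).1 hi _ hd.2
  · induction x using QuotientAddGroup.induction_on with
    | H z =>
    change f z = 0 ↔ _
    constructor
    · intro hz
      obtain ⟨d, hd⟩ := (hψ (ψ z)).2 ⟨z, hz, rfl⟩
      exact ⟨d, hmk _ _ (hc d) hz (by rw [hc', hd])⟩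
    · rintro ⟨d, hd⟩
      rw [hj, QuotientAddGroup.eq, neg_add_eq_sub, h, map_sub, hc, sub_zero] at hd
      exact hd.1

lemma stairHom_congr {Γ Y Q : Type} [Group Γ] [MulAction Γ Y] {r : Y → Y → Prop} [RInv Γ r]
    [RExt r] [AddCommGroup Q] {ψ : FA (Unit × Conf r 4) →+ Q} (h1 : ∀ b, ψ (bd1 Γ _ b) = 0)
    (h2 : ∀ c, ψ (fb r 4 _ c) = 0) {z z' : (bd3 Γ (Conf r 0)).ker}
    (h : q3 z.1 = q3 z'.1) : stairHom ψ h1 h2 z = stairHom ψ h1 h2 z' := by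
  obtain ⟨a, ha⟩ := StairRel.exists z'.2
  rw [stairHom_eq h1 h2 z ha h, stairHom_eq h1 h2 z' ha rfl]

/-- The invariant of three-cycles in the pre-Bloch group. -/
def cycB : (bd3 PSL2C (Conf rP 0)).ker →+ PreBloch := stairHom kcr kcr_bd1 kcr_fb

/-- The comparison of empty configurations. -/
def nilF : GFun PSL2C (Conf rP 0) PSL2C (Conf rV 0) :=
  GFun.mk' (MonoidHom.id _) (fun _ => Conf.nil) fun _ _ => Subsingleton.elim _ _

/-- The comparison of three-cycles. -/
def nilZ : (bd3 PSL2C (Conf rP 0)).ker →+ (bd3 PSL2C (Conf rV 0)).ker :=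
  (nilF.m3.comp (AddSubgroup.subtype _)).codRestrict _ fun z => by
    rw [AddMonoidHom.mem_ker]
    change bd3 _ _ (nilF.m3 z) = 0
    rw [GFun.bd3_m3, z.2, map_zero]

/-- The invariant of three-cycles in the complex numbers modulo the square of `π`. -/
def cycD : (bd3 PSL2C (Conf rP 0)).ker →+ ModPiSq :=
  (stairHom kdl kdl_bd1 kdl_fb).comp nilZ

lemma cycB_congr {z z' : (bd3 PSL2C (Conf rP 0)).ker} (h : q3 z.1 = q3 z'.1) :
    cycB z = cycB z' := stairHom_congr _ _ h

lemma cycD_congr {z z' : (bd3 PSL2C (Conf rP 0)).ker} (h : q3 z.1 = q3 z'.1) :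
    cycD z = cycD z' :=
  stairHom_congr kdl_bd1 kdl_fb (z := nilZ z) (z' := nilZ z') (by
    change q3 (nilF.m3 z) = q3 (nilF.m3 z')
    rw [GFun.q3_m3, GFun.q3_m3, h])

/-- The cyclic three-cycles. -/
def lensZ (n : ℕ) (hn : n ≠ 0) : (bd3 PSL2C (Conf rP 0)).ker :=
  ⟨torF.m3 (lens (zet n) n), by
    rw [AddMonoidHom.mem_ker, GFun.bd3_m3, bd3_lens (zet_pow hn), map_zero]⟩

lemma q3_lensZ (n : ℕ) (hn : n ≠ 0) : q3 (lensZ n hn).1 = torF.M3 (ell n) := torF.q3_m3 _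

lemma cycB_lensZ {n : ℕ} (hn : 2 ≤ n) : cycB (lensZ n (by omega)) = 0 := by
  obtain ⟨a, h, ha⟩ := exists_stairRel_lens hn
  rw [cycB, stairHom_eq kcr_bd1 kcr_fb _ h rfl, ha]

lemma cycD_lensZ {n : ℕ} (hn : 2 ≤ n) :
    cycD (lensZ n (by omega)) = ((((-1 / n : ℚ) : ℂ) * Cpi ^ 2 : ℂ) : ModPiSq) := by
  have h1 : zet n ^ n = 1 := zet_pow (by omega)
  have ht : zet n ≠ 1 := (zet_prim (by omega)).ne_one (by omega)
  have he : jT (zet n) • ept (zet n ^ (0 : ℤ)) = ept (zet n ^ (1 : ℤ)) := by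
    ext1
    · exact (jT_inf _).1
    · rw [vp_smul_sc, zpow_zero, zpow_one]
      exact (mul_one _).trans (jT_inf _).2
  have hw (j : ℕ) : jT (zet n) ^ j • wpt (zet n) 0 = wpt (zet n) j := by
    rw [← map_pow]
    ext1
    · change _ • P1.fin _ = P1.fin _
      rw [(jT_fin _ _).1, pow_zero, Units.val_one, mul_one]
    · change pfac _ (P1.fin _) * _ = _
      rw [(jT_fin _ _).2]
      change (zet n ^ j)⁻¹ * (zet n ^ 0)⁻¹ = (zet n ^ j)⁻¹
      rw [pow_zero, inv_one, mul_one]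
  have h := lens_stairRel (r := rV) (g := jT (zet n)) (n := n) (by rw [← map_pow, h1, map_one]) he
    (wpt (zet n)) hw (rV_zpt_ept _) (rV_zpt_ept _) (rV_zpt_wpt _) (rV_ept_wpt _ _)
    (rV_ept_wpt _ _) (rV_wpt ht)
  rw [← kdl_lens hn ht]
  refine stairHom_eq kdl_bd1 kdl_fb _ h ?_
  congr 1
  change nilF.m3 (torF.m3 (lens (zet n) n)) = _
  rw [torF_m3_lens, map_sum]
  exact Finset.sum_congr rfl fun j _ => GFun.m3_of _ _ _ _ _

lemma wPB_cycB (z : (bd3 PSL2C (Conf rP 0)).ker) : wPB (cycB z) = 0 := by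
  obtain ⟨a, h⟩ := StairRel.exists z.2
  rw [cycB, stairHom_eq kcr_bd1 kcr_fb z h rfl, h.wPB_eq]

lemma exists_cycB {β : PreBloch} (h : wPB β = 0) : ∃ z, cycB z = β := by
  obtain ⟨z, a, hz, ha, rfl⟩ := exists_stairRel h
  exact ⟨⟨z, hz⟩, stairHom_eq kcr_bd1 kcr_fb _ ha rfl⟩

lemma exists_smul_lensZ {z : (bd3 PSL2C (Conf rP 0)).ker} (h : cycB z = 0) :
    ∃ (n : ℕ) (k : ℤ) (hn : 2 ≤ n), q3 z.1 = q3 (k • lensZ n (by omega)).1 := by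
  obtain ⟨a, ha⟩ := StairRel.exists z.2
  rw [cycB, stairHom_eq kcr_bd1 kcr_fb z ha rfl] at h
  obtain ⟨n, k, hn, e⟩ := exists_smul_ell ha h
  obtain ⟨l, hl⟩ := ell_mem_left hn two_ne_zero
  refine ⟨n * 2, k * l, by omega, ?_⟩
  rw [AddSubgroup.coe_zsmul, map_zsmul, q3_lensZ, e, ← hl, map_zsmul, mul_smul]

lemma cycD_smul_lensZ {n : ℕ} (hn : 2 ≤ n) (k : ℤ) : cycD (k • lensZ n (by omega)) =
    ((((-k / n : ℚ) : ℂ) * Cpi ^ 2 : ℂ) : ModPiSq) := by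
  rw [map_zsmul, cycD_lensZ hn, ← QuotientAddGroup.mk_zsmul]
  congr 1
  rw [zsmul_eq_mul]
  push_cast
  ring

lemma q3_eq_zero_iff_cyc (z : (bd3 PSL2C (Conf rP 0)).ker) :
    q3 z.1 = 0 ↔ cycB z = 0 ∧ cycD z = 0 := by
  constructor
  · intro h
    have h' : q3 z.1 = q3 (0 : (bd3 PSL2C (Conf rP 0)).ker).1 := by
      rw [h, ZeroMemClass.coe_zero, map_zero]
    rw [cycB_congr h', cycD_congr h', map_zero, map_zero]
    exact ⟨rfl, rfl⟩
  · rintro ⟨h, h'⟩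
    obtain ⟨n, k, hn, e⟩ := exists_smul_lensZ h
    rw [cycD_congr e, cycD_smul_lensZ hn, modPiSq_rat_eq_zero] at h'
    obtain ⟨m, hm⟩ := h'
    have n0 : (n : ℚ) ≠ 0 := by exact_mod_cast (by omega : n ≠ 0)
    have hk : k = -m * n := by
      rw [div_eq_iff n0] at hm
      exact_mod_cast (by linear_combination -hm : (k : ℚ) = -m * n)
    rw [e, AddSubgroup.coe_zsmul, map_zsmul, q3_lensZ, hk, mul_smul, ← map_zsmul,
      smul_ell (by omega), map_zero, smul_zero]

lemma exists_cycD_iff (m : ModPiSq) :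
    (∃ q : ℚ, ((q * Cpi ^ 2 : ℂ) : ModPiSq) = m) ↔ ∃ z, cycB z = 0 ∧ cycD z = m := by
  constructor
  · rintro ⟨q, rfl⟩
    have hd := q.den_nz
    have hn : 2 ≤ q.den * 2 := by omega
    refine ⟨(-(2 * q.num)) • lensZ (q.den * 2) (by omega), ?_, ?_⟩
    · rw [map_zsmul, cycB_lensZ hn, smul_zero]
    · rw [cycD_smul_lensZ hn]
      have : (-(-(2 * q.num) : ℤ) / (q.den * 2 : ℕ) : ℚ) = q := by
        conv_rhs => rw [← Rat.num_div_den q]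
        push_cast
        field_simp
      rw [this]
  · rintro ⟨z, h, rfl⟩
    obtain ⟨n, k, hn, e⟩ := exists_smul_lensZ h
    exact ⟨_, by rw [cycD_congr e, cycD_smul_lensZ hn]⟩

/-- Bar chains as chains with coefficients in a point. -/
def barE (n : ℕ) {T : Type} (e : (Fin n → PSL2C) ≃ T) :
    FreeAbelianGroup (Fin n → PSL2C) ≃+ FA (T × Conf rP 0) :=
  FreeAbelianGroup.equivOfEquiv
    ⟨fun g => (e g, Conf.nil), fun t => e.symm t.1, fun g => e.symm_apply_apply g,
      fun _ => Prod.ext (e.apply_symm_apply _) (Subsingleton.elim _ _)⟩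

lemma barE_of {n : ℕ} {T : Type} (e : (Fin n → PSL2C) ≃ T) (g : Fin n → PSL2C) :
    barE n e (of g) = of (e g, Conf.nil) := FreeAbelianGroup.map_of_apply _

/-- Pairs. -/
def vec2 : (Fin 2 → PSL2C) ≃ PSL2C × PSL2C :=
  ⟨fun g => (g 0, g 1), fun x => ![x.1, x.2], fun g => by ext i; fin_cases i <;> rfl, fun _ => rfl⟩

/-- Triples. -/
def vec3 : (Fin 3 → PSL2C) ≃ PSL2C × PSL2C × PSL2C :=
  ⟨fun g => (g 0, g 1, g 2), fun x => ![x.1, x.2.1, x.2.2],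
    fun g => by ext i; fin_cases i <;> rfl, fun _ => rfl⟩

/-- Quadruples. -/
def vec4 : (Fin 4 → PSL2C) ≃ PSL2C × PSL2C × PSL2C × PSL2C :=
  ⟨fun g => (g 0, g 1, g 2, g 3), fun x => ![x.1, x.2.1, x.2.2.1, x.2.2.2],
    fun g => by ext i; fin_cases i <;> rfl, fun _ => rfl⟩

lemma bd3_barE (x : FreeAbelianGroup (Fin 3 → PSL2C)) :
    bd3 PSL2C (Conf rP 0) (barE 3 vec3 x) = barE 2 vec2 (d3 x) := by
  refine DFunLike.congr_fun (f := (bd3 PSL2C (Conf rP 0)).comp (barE 3 vec3).toAddMonoidHom)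
    (g := (barE 2 vec2).toAddMonoidHom.comp d3) (fa_ext fun g => ?_) x
  change bd3 PSL2C (Conf rP 0) (barE 3 vec3 (of g)) = barE 2 vec2 (d3 (of g))
  rw [barE_of, d3, FreeAbelianGroup.lift_apply_of, map_sub, map_add, map_sub, barE_of, barE_of,
    barE_of, barE_of]
  have h := bd3_of (g 0) (g 1) (g 2) (Conf.nil : Conf rP 0)
  rwa [Subsingleton.elim (g 2 • Conf.nil : Conf rP 0) Conf.nil] at h

lemma bd4_barE (x : FreeAbelianGroup (Fin 4 → PSL2C)) :
    bd4 PSL2C (Conf rP 0) (barE 4 vec4 x) = barE 3 vec3 (d4 x) := by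
  refine DFunLike.congr_fun (f := (bd4 PSL2C (Conf rP 0)).comp (barE 4 vec4).toAddMonoidHom)
    (g := (barE 3 vec3).toAddMonoidHom.comp d4) (fa_ext fun g => ?_) x
  change bd4 PSL2C (Conf rP 0) (barE 4 vec4 (of g)) = barE 3 vec3 (d4 (of g))
  rw [barE_of, d4, FreeAbelianGroup.lift_apply_of, map_add, map_sub, map_add, map_sub, barE_of,
    barE_of, barE_of, barE_of, barE_of]
  have h := bd4_of (g 0) (g 1) (g 2) (g 3) (Conf.nil : Conf rP 0)
  rwa [Subsingleton.elim (g 3 • Conf.nil : Conf rP 0) Conf.nil] at h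

/-- Bar cycles as cycles with coefficients in a point. -/
def barZ : d3.ker →+ (bd3 PSL2C (Conf rP 0)).ker :=
  ((barE 3 vec3).toAddMonoidHom.comp d3.ker.subtype).codRestrict _ fun z => by
    rw [AddMonoidHom.mem_ker]
    change bd3 PSL2C (Conf rP 0) (barE 3 vec3 z) = 0
    rw [bd3_barE, z.2, map_zero]

lemma barZ_surjective : Function.Surjective barZ := fun z =>
  ⟨⟨(barE 3 vec3).symm z, (barE 2 vec2).injective (by
    rw [← bd3_barE, AddEquiv.apply_symm_apply, z.2, map_zero])⟩,
    Subtype.ext ((barE 3 vec3).apply_symm_apply z)⟩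

lemma mem_d4_range_iff (z : d3.ker) :
    z ∈ d4.range.addSubgroupOf d3.ker ↔ q3 (barZ z).1 = 0 := by
  rw [AddSubgroup.mem_addSubgroupOf, q3_eq_zero, AddMonoidHom.mem_range]
  change _ ↔ ∃ b, _ = barE 3 vec3 z
  constructor
  · rintro ⟨b, hb⟩
    exact ⟨barE 4 vec4 b, by rw [bd4_barE, hb]⟩
  · rintro ⟨b, hb⟩
    refine ⟨(barE 4 vec4).symm b, (barE 3 vec3).injective ?_⟩
    rw [← bd4_barE, AddEquiv.apply_symm_apply, hb]

lemma h3_split : Nonempty (H3PSL2C ≃+ QZ × B0) := by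
  obtain ⟨i, hi, hi'⟩ := exists_qz_hom ((QuotientAddGroup.mk' _).comp (ratMul (Cpi ^ 2)) :
    ℚ →+ ModPiSq) one_ne_zero fun q => by
      rw [← show (∃ n : ℤ, q = n) ↔ ∃ n : ℤ, q = n * 1 by simp only [mul_one],
        ← modPiSq_rat_eq_zero]
      rfl
  refine exists_split_quotient ((cycB.comp barZ).codRestrict B0 fun z => wPB_cycB _)
    (cycD.comp barZ) ?_ (fun z => ?_) i hi fun m => ?_
  · rintro ⟨β, hβ⟩
    obtain ⟨z, rfl⟩ := exists_cycB hβ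
    obtain ⟨w, rfl⟩ := barZ_surjective z
    exact ⟨w, rfl⟩
  · rw [mem_d4_range_iff, q3_eq_zero_iff_cyc, Subtype.ext_iff]
    rfl
  · rw [hi']
    refine (exists_cycD_iff m).trans ?_
    rw [barZ_surjective.exists]
    simp only [Subtype.ext_iff]
    rfl

end

/-- the abelian groups `H₃(PSL(2,ℂ);ℤ)` and `êêB(ℂ)` are isomorphic. -/
theorem stmt7 : Nonempty (H3PSL2C ≃+ ↥EEBloch) := by
  obtain ⟨e⟩ := h3_split
  obtain ⟨f⟩ := eeBloch_split
  exact ⟨e.trans f.symm⟩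

end ExtendedBloch

end
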